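/- Let F|K be an algebraic function field and P a place of F|K such that the value group v_PF is archimedean ordered (rank 1) and P is zero-dimensional, i.e., FP|K is algebraic. Let E|K be a subextension of F|K such that F|E is separable-algebraic, and let ζ₁,…,ζ_m ∈ 𝓞_F. Then there exist a finite extension 𝓕 of F with an extension of P and a finite purely inseparable extension 𝓚 of K inside 𝓕 such that (𝓕|𝓚,P) is uniformizable with respect to ζ₁,…,ζ_m and such that 𝓕|E.𝓚 and 𝓕|F.𝓚 are Galois extensions (where E.𝓚 and F.𝓚 denote the field composita inside 𝓕). -/

import Mathlib

/-! Common valuation-theoretic notions, following F.-V. Kuhlmann,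
"On local uniformization in arbitrary characteristic I".

A valued field `(F, P)` is modelled by a field `F` together with a
`ValuationSubring F` (the valuation ring `𝓞` of the place `P`). -/

namespace LocalUnif

variable {F : Type*} [Field F]

/-- `x` lies in the maximal ideal of the valuation subring `O`,
i.e. the residue `xP` is `0` (equivalently `v_P x > 0`, or `x = 0`). -/
def InMax (O : ValuationSubring F) (x : F) : Prop := x = 0 ∨ x⁻¹ ∉ O

/-- `x` is a unit of the valuation subring `O`, i.e. `v_P x = 0`. -/
def IsVUnit (O : ValuationSubring F) (x : F) : Prop := x ≠ 0 ∧ x ∈ O ∧ x⁻¹ ∈ O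

/-- The valuation with valuation ring `O` is trivial on the subfield `K`;
equivalently, every nonzero element of `K` is a unit of `O`. -/
def TrivialOn (O : ValuationSubring F) (K : Subfield F) : Prop :=
  ∀ x ∈ K, x ∈ O ∧ x⁻¹ ∈ O

/-- The residue field of `O` equals (the isomorphic image of) the subfield `K`:
every element of `O` is congruent to an element of `K` modulo the maximal ideal.
(For a place `P` of `F|K` this says that `P` is a rational place, `FP = K`.) -/
def ResidueEq (O : ValuationSubring F) (K : Subfield F) : Prop :=
  ∀ x ∈ O, ∃ c ∈ K, InMax O (x - c)

/-- The residue field of `O` is algebraic over (the image of) `K`; for a place of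
`F|K` this says that `P` is zero-dimensional. -/
def ResidueAlgebraic (O : ValuationSubring F) (K : Subfield F) : Prop :=
  ∀ x ∈ O, ∃ p : Polynomial F, p ≠ 0 ∧ (∀ i, p.coeff i ∈ K) ∧ InMax O (Polynomial.eval x p)

/-- The values `v_P (x i)` are rationally independent modulo `v_P K`:
no nontrivial ℤ-linear combination of the values lies in `ℚ ⊗ v_P K`
(equivalently, in `v_P K`, by clearing denominators). -/
def ValIndepMod (O : ValuationSubring F) (K : Subfield F) {ρ : ℕ} (x : Fin ρ → F) : Prop :=
  (∀ i, x i ≠ 0) ∧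
  ∀ e : Fin ρ → ℤ, (∃ c ∈ K, c ≠ 0 ∧ IsVUnit O ((∏ i, x i ^ e i) / c)) → e = 0

/-- The residues `(y i)P` are algebraically independent over the residue field `KP`:
for every polynomial with coefficients in `𝓞_K = K ∩ O`, at least one of which is
a unit, the value of the polynomial at `y` is a unit (so its residue is nonzero). -/
def ResIndep (O : ValuationSubring F) (K : Subfield F) {τ : ℕ} (y : Fin τ → F) : Prop :=
  (∀ i, y i ∈ O) ∧
  ∀ p : MvPolynomial (Fin τ) F, (∀ m, p.coeff m ∈ K ∧ p.coeff m ∈ O) →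
    (∃ m, IsVUnit O (p.coeff m)) → ¬ InMax O (MvPolynomial.eval y p)

/-- `dim_ℚ (ℚ ⊗ (v_P F / v_P K)) = ρ`: there is a maximal set of `ρ` elements of `F`
whose values are rationally independent modulo `v_P K`. -/
def RatRankEq (O : ValuationSubring F) (K : Subfield F) (ρ : ℕ) : Prop :=
  (∃ x : Fin ρ → F, ValIndepMod O K x) ∧ ∀ x : Fin (ρ + 1) → F, ¬ ValIndepMod O K x

/-- `trdeg (FP | KP) = τ`: there is a maximal set of `τ` elements of `O` whose
residues are algebraically independent over `KP`. -/
def ResTrdegEq (O : ValuationSubring F) (K : Subfield F) (τ : ℕ) : Prop :=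
  (∃ y : Fin τ → F, ResIndep O K y) ∧ ∀ y : Fin (τ + 1) → F, ¬ ResIndep O K y

/-- `trdeg (F | K) = d`. -/
def TrdegEq (K : Subfield F) (d : ℕ) : Prop :=
  ∃ t : Fin d → F, IsTranscendenceBasis ↥K t

/-- `P` is an Abhyankar place of `F|K`:
`trdeg F|K = trdeg FP|K + dim_ℚ (ℚ ⊗ v_P F)`. -/
def IsAbhyankar (O : ValuationSubring F) (K : Subfield F) : Prop :=
  ∃ d ρ τ : ℕ, d = ρ + τ ∧ TrdegEq K d ∧ RatRankEq O K ρ ∧ ResTrdegEq O K τ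

/-- The value group of `O` is archimedean ordered (rank at most 1):
for any two positive values `v_P a, v_P b` there is `n` with `n · v_P a ≥ v_P b`. -/
def RankOne (O : ValuationSubring F) : Prop :=
  ∀ a b : F, a ≠ 0 → InMax O a → b ≠ 0 → InMax O b → ∃ n : ℕ, a ^ n / b ∈ O

/-- The value group of `O` has (rank) at least `r`: there is a chain of `r` positive
values, each infinitely larger than the previous one. -/
def RankAtLeast (O : ValuationSubring F) (r : ℕ) : Prop :=
  ∃ a : Fin r → F, (∀ i, a i ≠ 0 ∧ InMax O (a i)) ∧
    ∀ i j : Fin r, i < j → ∀ n : ℕ, a i ^ n / a j ∉ O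

/-- The value group of `O` has rank exactly `r`. -/
def RankEq (O : ValuationSubring F) (r : ℕ) : Prop :=
  RankAtLeast O r ∧ ¬ RankAtLeast O (r + 1)

/-- The valuation is discrete: its value group is order isomorphic to `ℤ`,
i.e. there is a uniformizer `π` with every value an integer multiple of `v_P π`. -/
def IsDiscrete (O : ValuationSubring F) : Prop :=
  ∃ π : F, π ≠ 0 ∧ InMax O π ∧ ∀ x : F, x ≠ 0 → ∃ n : ℤ, IsVUnit O (x / π ^ n)

/-- `F|K` is an algebraic function field: a finitely generated field extension of
transcendence degree at least 1. -/
def IsFunctionField (K : Subfield F) : Prop :=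
  (∃ S : Finset F, IntermediateField.adjoin ↥K (S : Set F) = ⊤) ∧
  ∃ x : F, Transcendental ↥K x

/-- The data of a weak uniformization of `(𝓛|𝓚, P)` (both subfields of an ambient
valued field `F`, `𝓚 ⊆ 𝓛`) with uniformizing transcendence basis `t` and generators
`η`: there are polynomials `f i` in `n` variables `X₁, …, Xₙ` with coefficients in
`𝓞_𝓚[t₁,…,tₛ]` such that (U1) `X j` does not occur in `f i` for `i < j`,
(U2) `f i (η) = 0`, and (U3) the residue of `det J_f (η)` is nonzero; moreover `t`
is a transcendence basis of `𝓛|𝓚` inside `𝓞_𝓛` and `𝓛 = 𝓚(t, η)`. -/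
def UnifData (𝓛 𝓚 : Subfield F) (O : ValuationSubring F) {s n : ℕ}
    (t : Fin s → F) (η : Fin n → F) : Prop :=
  (∀ i, t i ∈ 𝓛 ∧ t i ∈ O) ∧ (∀ i, η i ∈ 𝓛 ∧ η i ∈ O) ∧
  AlgebraicIndependent ↥𝓚 t ∧
  (∀ z ∈ 𝓛, IsAlgebraic ↥(IntermediateField.adjoin ↥𝓚 (Set.range t)) z) ∧
  Subfield.closure ((𝓚 : Set F) ∪ Set.range t ∪ Set.range η) = 𝓛 ∧
  ∃ f : Fin n → MvPolynomial (Fin n) F,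
    (∀ i m, (f i).coeff m ∈
      Subring.closure ((↑(𝓚.toSubring ⊓ O.toSubring) : Set F) ∪ Set.range t)) ∧
    (∀ i j : Fin n, (i : ℕ) < (j : ℕ) → MvPolynomial.degreeOf j (f i) = 0) ∧
    (∀ i, MvPolynomial.eval η (f i) = 0) ∧
    IsVUnit O (Matrix.det (Matrix.of fun i j : Fin n =>
      MvPolynomial.eval η (MvPolynomial.pderiv j (f i))))

/-- `(𝓛|𝓚, P)` is uniformizable with respect to `ζ₁, …, ζ_m`:
there is a weak uniformization whose generators `η` include all the `ζ k`. -/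
def UnifWrt (𝓛 𝓚 : Subfield F) (O : ValuationSubring F) {m : ℕ} (ζ : Fin m → F) : Prop :=
  ∃ (s n : ℕ) (t : Fin s → F) (η : Fin n → F),
    UnifData 𝓛 𝓚 O t η ∧ ∃ σ : Fin m → Fin n, ∀ k, η (σ k) = ζ k

/-- `(𝓛|𝓚, P)` is uniformizable: uniformizable with respect to every finite
list of elements of `𝓞_𝓛`. -/
def UnifIn (𝓛 𝓚 : Subfield F) (O : ValuationSubring F) : Prop :=
  ∀ (m : ℕ) (ζ : Fin m → F), (∀ k, ζ k ∈ 𝓛 ∧ ζ k ∈ O) → UnifWrt 𝓛 𝓚 O ζ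

section Defectless

variable {K L : Type*} [Field K] [Field L]

/-- The values of the `a i` lie in pairwise distinct cosets modulo the value group of
the ground field along `φ`; thus there are at least `e` distinct cosets. -/
def ValClassIndep (φ : K →+* L) (OL : ValuationSubring L) {e : ℕ} (a : Fin e → L) : Prop :=
  (∀ i, a i ≠ 0) ∧ ∀ i j : Fin e, i ≠ j →
    ¬ ∃ c : K, c ≠ 0 ∧ IsVUnit OL (a i / (a j * φ c))

/-- The ramification index `e = (v_P L : v_P K)` of `OL` over the ground field along `φ`. -/
def RamIdxEq (φ : K →+* L) (OL : ValuationSubring L) (e : ℕ) : Prop :=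
  (∃ a : Fin e → L, ValClassIndep φ OL a) ∧ ∀ a : Fin (e + 1) → L, ¬ ValClassIndep φ OL a

/-- The residues of the `b i` are linearly independent over the residue field of the
ground field along `φ`. -/
def ResLinIndep (φ : K →+* L) (OK : ValuationSubring K) (OL : ValuationSubring L)
    {f : ℕ} (b : Fin f → L) : Prop :=
  (∀ i, b i ∈ OL) ∧ ∀ c : Fin f → K, (∀ i, c i ∈ OK) → (∃ i, ¬ InMax OK (c i)) →
    ¬ InMax OL (∑ i, φ (c i) * b i)

/-- The inertia degree `f = [LP : KP]` of `OL` over `(K, OK)` along `φ`. -/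
def InertiaDegEq (φ : K →+* L) (OK : ValuationSubring K) (OL : ValuationSubring L)
    (f : ℕ) : Prop :=
  (∃ b : Fin f → L, ResLinIndep φ OK OL b) ∧ ∀ b : Fin (f + 1) → L, ¬ ResLinIndep φ OK OL b

end Defectless

/-- `(K, OK)` is a defectless (stable) valued field: for every finite extension `L|K`
(inside a fixed algebraic closure) the fundamental equality
`[L : K] = ∑ᵢ eᵢ fᵢ` holds, the sum running over all extensions of the valuation. -/
def IsDefectless (K : Type*) [Field K] (OK : ValuationSubring K) : Prop :=
  ∀ L : IntermediateField K (AlgebraicClosure K), FiniteDimensional K ↥L →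
    ∃ (g : ℕ) (Os : Fin g → ValuationSubring ↥L) (e f : Fin g → ℕ),
      Function.Injective Os ∧
      (∀ O' : ValuationSubring ↥L, O'.comap (algebraMap K ↥L) = OK ↔ ∃ i, O' = Os i) ∧
      (∀ i, RamIdxEq (algebraMap K ↥L) (Os i) (e i)) ∧
      (∀ i, InertiaDegEq (algebraMap K ↥L) OK (Os i) (f i)) ∧
      Module.finrank K ↥L = ∑ i, e i * f i

/-- The extension `𝓛|𝓚` of subfields of `F` is separable (in the general sense of
MacLane): every finitely generated subextension is separably generated, i.e. admits
a separating transcendence basis. -/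
def IsSeparableExt (𝓚 𝓛 : Subfield F) : Prop :=
  ∀ S : Finset F, ↑S ⊆ (𝓛 : Set F) →
    ∃ (d : ℕ) (u : Fin d → F), (∀ i, u i ∈ 𝓛) ∧ AlgebraicIndependent ↥𝓚 u ∧
      ∀ x ∈ Subfield.closure ((𝓚 : Set F) ∪ ↑S),
        IsSeparable ↥(IntermediateField.adjoin ↥𝓚 (Set.range u)) x

/-- The embedding of a subfield `K`, on which the valuation is trivial, into
the residue field of `O`. -/
noncomputable def resEmb (O : ValuationSubring F) (K : Subfield F) (h : ∀ x ∈ K, x ∈ O) :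
    ↥K →+* IsLocalRing.ResidueField ↥O :=
  (IsLocalRing.residue ↥O).comp
    { toFun := fun x => (⟨x.1, h x.1 x.2⟩ : ↥O)
      map_one' := rfl
      map_mul' := fun _ _ => rfl
      map_zero' := rfl
      map_add' := fun _ _ => rfl }

end LocalUnif

namespace LU
set_option autoImplicit false
open Polynomial
variable {Q : Type*} [Field Q] {Γ : Type*} [LinearOrderedCommGroupWithZero Γ]

section
inductive Het (v : Valuation Q Γ) (L : Subfield Q) (A : Set Q) : Q → Prop
  | base (a : Q) : a ∈ A → a ∈ L → v a ≤ 1 → Het v L A a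
  | zero : Het v L A 0
  | one : Het v L A 1
  | add (a b : Q) : Het v L A a → Het v L A b → Het v L A (a + b)
  | mul (a b : Q) : Het v L A a → Het v L A b → Het v L A (a * b)
  | neg (a : Q) : Het v L A a → Het v L A (-a)
  | root (f : Q[X]) (z : Q) : (∀ i, Het v L A (f.coeff i)) → z ∈ L → v z ≤ 1 →
      f.eval z = 0 → v (f.derivative.eval z) = 1 → Het v L A z

namespace Het
variable {v : Valuation Q Γ} {L L' : Subfield Q} {A B : Set Q} {z w : Q}

lemma mem (h : Het v L A z) : z ∈ L := by
  induction h with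
  | base a _ h _ => exact h
  | zero => exact L.zero_mem
  | one => exact L.one_mem
  | add a b _ _ h1 h2 => exact L.add_mem h1 h2
  | mul a b _ _ h1 h2 => exact L.mul_mem h1 h2
  | neg a _ h1 => exact L.neg_mem h1
  | root f z _ h => exact h

lemma le_one (h : Het v L A z) : v z ≤ 1 := by
  induction h with
  | base a _ _ h => exact h
  | zero => simp
  | one => simp
  | add a b _ _ h1 h2 => exact v.map_add_le h1 h2
  | mul a b _ _ h1 h2 => rw [map_mul]; exact mul_le_one' h1 h2
  | neg a _ h1 => rwa [Valuation.map_neg]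
  | root f z _ _ h => exact h

lemma trans' (hL : L ≤ L') (hA : ∀ a ∈ A, a ∈ L → v a ≤ 1 → Het v L' B a) (h : Het v L A z) :
    Het v L' B z := by
  induction h with
  | base a h1 h2 h3 => exact hA a h1 h2 h3
  | zero => exact .zero
  | one => exact .one
  | add a b _ _ h1 h2 => exact .add _ _ h1 h2
  | mul a b _ _ h1 h2 => exact .mul _ _ h1 h2
  | neg a _ h1 => exact .neg _ h1
  | root f z _ h1 h2 h3 h4 h5 => exact .root f z h5 (hL h1) h2 h3 h4

lemma mono (hL : L ≤ L') (hA : ∀ a ∈ A, a ∈ L → v a ≤ 1 → a ∈ B) (h : Het v L A z) :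
    Het v L' B z :=
  h.trans' hL fun a h1 h2 h3 => .base a (hA a h1 h2 h3) (hL h2) h3

lemma sub (h1 : Het v L A z) (h2 : Het v L A w) : Het v L A (z - w) := by
  rw [sub_eq_add_neg]; exact .add _ _ h1 (.neg _ h2)

lemma pow (h1 : Het v L A z) (n : ℕ) : Het v L A (z ^ n) := by
  induction n with
  | zero => simpa using Het.one
  | succ n ih => rw [pow_succ]; exact .mul _ _ ih h1

lemma prod {ι : Type*} (s : Finset ι) (g : ι → Q) (h : ∀ i ∈ s, Het v L A (g i)) :
    Het v L A (∏ i ∈ s, g i) := by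
  classical
  induction s using Finset.induction_on with
  | empty => simpa using Het.one
  | insert a s ha ih =>
    rw [Finset.prod_insert ha]
    exact .mul _ _ (h _ (by simp)) (ih fun i hi => h i (by simp [hi]))

lemma sum {ι : Type*} (s : Finset ι) (g : ι → Q) (h : ∀ i ∈ s, Het v L A (g i)) :
    Het v L A (∑ i ∈ s, g i) := by
  classical
  induction s using Finset.induction_on with
  | empty => simpa using Het.zero
  | insert a s ha ih =>
    rw [Finset.sum_insert ha]
    exact .add _ _ (h _ (by simp)) (ih fun i hi => h i (by simp [hi]))

lemma inv (h : Het v L A z) (hz : v z = 1) : Het v L A z⁻¹ := by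
  have hz0 : z ≠ 0 := by rintro rfl; simp at hz
  refine .root (C z * X - 1) _ (fun i => ?_) (L.inv_mem h.mem) (by simp [hz]) (by simp [hz0]) (by simp [hz])
  rw [coeff_sub, coeff_C_mul, coeff_X, coeff_one]
  refine sub (.mul _ _ h ?_) ?_ <;> split_ifs <;> first | exact .zero | exact .one

def ring (v : Valuation Q Γ) (L : Subfield Q) (A : Set Q) : Subring Q where
  carrier := {z | Het v L A z}
  zero_mem' := .zero
  one_mem' := .one
  add_mem' h1 h2 := .add _ _ h1 h2
  mul_mem' h1 h2 := .mul _ _ h1 h2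
  neg_mem' h1 := .neg _ h1

lemma of_closure (hA : ∀ a ∈ A, a ∈ L ∧ v a ≤ 1) (h : z ∈ Subring.closure A) : Het v L A z := by
  have : Subring.closure A ≤ ring v L A := by
    rw [Subring.closure_le]; exact fun a ha => .base a ha (hA a ha).1 (hA a ha).2
  exact this h

lemma finite (h : Het v L A z) : ∃ l : Set Q, l.Finite ∧ l ⊆ L ∧
    ∀ L₁ : Subfield Q, l ⊆ L₁ → Het v L₁ (A ∩ l) z := by
  have mon : ∀ {l l' : Set Q} {L₁ : Subfield Q} {z}, l ⊆ l' → Het v L₁ (A ∩ l) z →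
    Het v L₁ (A ∩ l') z := fun h1 h2 => h2.mono le_rfl fun a ha _ _ => ⟨ha.1, h1 ha.2⟩
  induction h with
  | base a h1 h2 h3 => exact ⟨{a}, by simp, by simpa using h2, fun L₁ h => .base a ⟨h1, rfl⟩ (by simpa using h) h3⟩
  | zero => exact ⟨∅, by simp, by simp, fun _ _ => .zero⟩
  | one => exact ⟨∅, by simp, by simp, fun _ _ => .one⟩
  | add a b _ _ h1 h2 =>
    obtain ⟨l, f, s, h⟩ := h1
    obtain ⟨l', f', s', h'⟩ := h2
    exact ⟨l ∪ l', f.union f', Set.union_subset s s', fun L₁ hl => .add _ _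
      (mon Set.subset_union_left (h L₁ (Set.subset_union_left.trans hl)))
      (mon Set.subset_union_right (h' L₁ (Set.subset_union_right.trans hl)))⟩
  | mul a b _ _ h1 h2 =>
    obtain ⟨l, f, s, h⟩ := h1
    obtain ⟨l', f', s', h'⟩ := h2
    exact ⟨l ∪ l', f.union f', Set.union_subset s s', fun L₁ hl => .mul _ _
      (mon Set.subset_union_left (h L₁ (Set.subset_union_left.trans hl)))
      (mon Set.subset_union_right (h' L₁ (Set.subset_union_right.trans hl)))⟩
  | neg a _ h1 =>
    obtain ⟨l, f, s, h⟩ := h1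
    exact ⟨l, f, s, fun L₁ hl => .neg _ (h L₁ hl)⟩
  | root f z _ h1 h2 h3 h4 h5 =>
    choose l hl using h5
    refine ⟨insert z (⋃ i ∈ f.support, l i), ?_, ?_, ?_⟩
    · exact (Set.Finite.biUnion f.support.finite_toSet fun i _ => (hl i).1).insert _
    · exact Set.insert_subset h1 (Set.iUnion₂_subset fun i _ => (hl i).2.1)
    · intro L₁ h
      refine .root f z (fun i => ?_) (h (by simp)) h2 h3 h4
      by_cases hi : i ∈ f.support
      · have : l i ⊆ insert z (⋃ i ∈ f.support, l i) :=
          (Set.subset_biUnion_of_mem (u := l) hi).trans (Set.subset_insert _ _)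
        exact mon this ((hl i).2.2 _ (this.trans h))
      · rw [notMem_support_iff.1 hi]; exact .zero
end Het

section basic
variable (v : Valuation Q Γ)

lemma sum_zero_two {ι : Type*} (s : Finset ι) (g : ι → Q) (h0 : ∑ i ∈ s, g i = 0)
    (h1 : ∃ i ∈ s, g i ≠ 0) : ∃ i ∈ s, ∃ j ∈ s, i ≠ j ∧ g i ≠ 0 ∧ g j ≠ 0 ∧ v (g i) = v (g j) := by
  classical
  obtain ⟨i0, hi0, hg0⟩ := h1
  obtain ⟨i, hi, hmax⟩ := s.exists_max_image (fun i => v (g i)) ⟨i0, hi0⟩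
  have hgi : g i ≠ 0 := by
    intro h
    have := hmax i0 hi0
    rw [h, map_zero, le_zero_iff, map_eq_zero] at this
    exact hg0 this
  by_contra! hc
  have : ∀ j ∈ s.erase i, v (g j) < v (g i) := by
    intro j hj
    rw [Finset.mem_erase] at hj
    refine lt_of_le_of_ne (hmax j hj.2) fun h => ?_
    refine hc i hi j hj.2 hj.1.symm hgi (fun h0 => ?_) h.symm
    rw [h0, map_zero] at h
    exact hgi (by rwa [eq_comm, map_eq_zero] at h)
  have h2 := v.map_sum_lt (v.ne_zero_iff.2 hgi) this
  rw [← Finset.add_sum_erase _ _ hi, add_eq_zero_iff_eq_neg] at h0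
  rw [h0, Valuation.map_neg] at h2
  exact lt_irrefl _ h2

lemma torsion (M : Subfield Q) (z : Q) (hz : IsAlgebraic M z) (hz0 : z ≠ 0) :
    ∃ n : ℕ, 0 < n ∧ ∃ c ∈ M, c ≠ 0 ∧ v z ^ n = v c := by
  obtain ⟨f, hf, hfz⟩ := hz
  rw [aeval_eq_sum_range] at hfz
  obtain ⟨i, hi, j, hj, hij, h1, h2, h3⟩ := sum_zero_two v _ _ hfz
    ⟨f.natDegree, by simp, by
      simp [Algebra.smul_def, hz0, hf]⟩
  wlog hlt : i < j generalizing i j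
  · exact this j hj i hi hij.symm h2 h1 h3.symm (by omega)
  simp only [Algebra.smul_def, ne_eq, mul_eq_zero, not_or, map_mul, map_pow] at h1 h2 h3
  refine ⟨j - i, by omega, (f.coeff i / f.coeff j : M), Subtype.mem _, ?_, ?_⟩
  · simpa using ⟨fun h => h1.1 (by simp [h]), fun h => h2.1 (by simp [h])⟩
  · have hvz : v z ≠ 0 := v.ne_zero_iff.2 hz0
    have hvj : v (f.coeff j : Q) ≠ 0 := v.ne_zero_iff.2 h2.1
    have : j = (j - i) + i := by omega
    have h4 : v (f.coeff i : Q) * v z ^ i = v (f.coeff j : Q) * (v z ^ (j-i) * v z ^ i) := by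
      rw [← pow_add, ← this]; exact h3
    push_cast
    rw [map_div₀, eq_div_iff hvj]
    rw [← mul_assoc] at h4
    rw [mul_comm, mul_right_cancel₀ (pow_ne_zero _ hvz) h4]
end basic
end

section
def VR (v : Valuation Q Γ) (M : Subfield Q) : Subring Q := M.toSubring ⊓ v.integer

structure HomOn (L : Subfield Q) (σ : Q → Q) : Prop where
  one : σ 1 = 1
  add : ∀ z ∈ L, ∀ w ∈ L, σ (z + w) = σ z + σ w
  mul : ∀ z ∈ L, ∀ w ∈ L, σ (z * w) = σ z * σ w

def HomOn.toHom {L : Subfield Q} {σ : Q → Q} (h : HomOn L σ) : L →+* Q :=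
  RingHom.mk' ⟨⟨fun z => σ z, h.one⟩, fun z w => h.mul z z.2 w w.2⟩ fun z w => h.add z z.2 w w.2

@[simp] lemma HomOn.toHom_apply {L : Subfield Q} {σ : Q → Q} (h : HomOn L σ) (z : L) :
    h.toHom z = σ z := rfl

lemma HomOn.mono {L L' : Subfield Q} {σ : Q → Q} (h : HomOn L σ) (hL : L' ≤ L) : HomOn L' σ :=
  ⟨h.one, fun z hz w hw => h.add z (hL hz) w (hL hw), fun z hz w hw => h.mul z (hL hz) w (hL hw)⟩

open Classical in

noncomputable def ext0 {L : Subfield Q} (φ : L → Q) (z : Q) : Q := if h : z ∈ L then φ ⟨z, h⟩ else 0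

lemma ext0_of {L : Subfield Q} (φ : L → Q) (z : Q) (h : z ∈ L) : ext0 φ z = φ ⟨z, h⟩ := by
  simp [ext0, h]

lemma homOn_ext0 {L : Subfield Q} (φ : L →+* Q) : HomOn L (ext0 φ) where
  one := by rw [ext0_of _ _ L.one_mem]; exact map_one φ
  add z hz w hw := by
    rw [ext0_of _ _ hz, ext0_of _ _ hw, ext0_of _ _ (L.add_mem hz hw), ← map_add]; rfl
  mul z hz w hw := by
    rw [ext0_of _ _ hz, ext0_of _ _ hw, ext0_of _ _ (L.mul_mem hz hw), ← map_mul]; rfl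

variable (v : Valuation Q Γ)

lemma mem_VR {M : Subfield Q} {z : Q} : z ∈ VR v M ↔ z ∈ M ∧ v z ≤ 1 := Iff.rfl

lemma le_one_of_integral {M : Subfield Q} {z : Q} (h : IsIntegral (VR v M) z) : v z ≤ 1 := by
  have : IsIntegral v.integer z := by
    obtain ⟨f, hf, h0⟩ := h
    refine ⟨f.map (Subring.inclusion (S := VR v M) inf_le_right), hf.map _, ?_⟩
    rw [eval₂_map]; exact h0
  exact Valuation.Integers.mem_of_integral (Valuation.integer.integers v) this

lemma bs_aux (M L : Subfield Q) (hML : M ≤ L) (z : Q) (hzL : z ∈ L) (hz : v z ≤ 1) (n : ℕ) :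
    ∀ (y : Q) (c : ℕ → Q), y ∈ L → IsIntegral (VR v M) y → (∀ i, c i ∈ VR v M) →
      y * z ^ n + ∑ i ∈ Finset.range n, c i * z ^ i = 0 → (v y = 1 ∨ ∃ i < n, v (c i) = 1) →
      ∃ b ∈ L, ∃ s ∈ L, IsIntegral (VR v M) b ∧ IsIntegral (VR v M) s ∧ v s = 1 ∧ z * s = b := by
  induction n with
  | zero =>
    intro y c _ _ _ h h1
    simp at h
    simp [h] at h1
  | succ n ih =>
    intro y c hyL hy hc h h1
    have hint : IsIntegral (VR v M) (y * z) := by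
      by_cases hy0 : y = 0
      · simpa [hy0] using isIntegral_zero
      let R := integralClosure (VR v M) Q
      let y' : R := ⟨y, hy⟩
      let c' : ℕ → R := fun i => algebraMap (VR v M) R ⟨c i, hc i⟩
      let p : R[X] := C y' * X ^ (n+1) + ∑ i ∈ Finset.range (n+1), C (c' i) * X ^ i
      have hp : p.leadingCoeff = y' := by
        have hy0' : y' ≠ 0 := fun h => hy0 (congrArg Subtype.val h)
        have hd : (∑ i ∈ Finset.range (n+1), C (c' i) * X ^ i).degree < (C y' * X ^ (n+1)).degree := by
          rw [degree_C_mul_X_pow _ hy0']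
          refine (Polynomial.degree_sum_le _ _).trans_lt ?_
          rw [Finset.sup_lt_iff (WithBot.bot_lt_coe _)]
          intro i hi
          refine (degree_C_mul_X_pow_le _ _).trans_lt ?_
          simpa using Nat.cast_lt.2 (Finset.mem_range.1 hi)
        rw [leadingCoeff_add_of_degree_lt' hd, leadingCoeff_C_mul_X_pow]
      have h3 := isIntegral_leadingCoeff_smul p z (by simpa [p, y', c', Algebra.smul_def] using! h)
      rw [hp] at h3
      exact isIntegral_trans (R := VR v M) (A := R) _ h3
    by_cases hvy : v y = 1
    · exact ⟨y * z, L.mul_mem hyL hzL, y, hyL, hint, hy, hvy, mul_comm _ _⟩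
    have hcn : IsIntegral (VR v M) (c n) := isIntegral_algebraMap (x := (⟨c n, hc n⟩ : VR v M))
    refine ih (y * z + c n) c (L.add_mem (L.mul_mem hyL hzL) (hML (hc n).1)) (hint.add hcn) hc ?_ ?_
    · rw [Finset.sum_range_succ] at h
      rw [← h]; ring
    · rcases h1 with h1 | ⟨i, hi, h1⟩
      · exact absurd h1 hvy
      rcases (Nat.lt_succ_iff_lt_or_eq.1 hi) with hi | rfl
      · exact .inr ⟨i, hi, h1⟩
      · left
        have : v (y * z) < v (c i) := by
          rw [h1, map_mul]
          exact mul_lt_one_of_lt_of_le (lt_of_le_of_ne (le_one_of_integral v hy) hvy) hz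
        rw [Valuation.map_add_eq_of_lt_right _ this, h1]

lemma exists_bs (M L : Subfield Q) (hML : M ≤ L) (z : Q) (hzL : z ∈ L) (hz : v z ≤ 1)
    (ha : IsAlgebraic M z) :
    ∃ b ∈ L, ∃ s ∈ L, IsIntegral (VR v M) b ∧ IsIntegral (VR v M) s ∧ v s = 1 ∧ z * s = b := by
  obtain ⟨f, hf, hfz⟩ := ha
  rw [aeval_eq_sum_range] at hfz
  obtain ⟨j, hj, hmax⟩ := (Finset.range (f.natDegree + 1)).exists_max_image
    (fun i => v (f.coeff i)) ⟨0, by simp⟩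
  have hj0 : (f.coeff j : Q) ≠ 0 := by
    intro h
    have := hmax f.natDegree (by simp)
    rw [h, map_zero, le_zero_iff, map_eq_zero] at this
    simp [hf] at this
  set d : M := f.coeff j
  have hle : ∀ i, v (f.coeff i / d : Q) ≤ 1 := by
    intro i
    by_cases hi : i ≤ f.natDegree
    · rw [map_div₀]
      exact div_le_one_of_le₀ (hmax i (by simpa [Nat.lt_succ_iff] using hi)) zero_le
    · rw [coeff_eq_zero_of_natDegree_lt (by omega)]; simp
  have hmem : ∀ i, (f.coeff i / d : Q) ∈ VR v M :=
    fun i => ⟨M.div_mem (Subtype.mem _) (Subtype.mem _), hle i⟩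
  refine bs_aux v M L hML z hzL hz f.natDegree (f.coeff f.natDegree / d) (fun i => f.coeff i / d)
    (hML (hmem _).1) (isIntegral_algebraMap (x := (⟨_, hmem _⟩ : VR v M))) hmem ?_ ?_
  · rw [Finset.sum_range_succ] at hfz
    rw [← mul_right_inj' hj0, mul_zero, ← hfz, mul_add, Finset.mul_sum, add_comm]
    simp only [Algebra.smul_def]
    congr 1
    · refine Finset.sum_congr rfl fun i _ => ?_
      field_simp; exact mul_comm _ _
    · field_simp; exact mul_comm _ _
  · have h1 : v (f.coeff j / d : Q) = 1 := by
      rw [div_self hj0, map_one]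
    rcases (Nat.lt_succ_iff_lt_or_eq.1 (Finset.mem_range.1 hj)) with hi | rfl
    · exact .inr ⟨j, hi, h1⟩
    · exact .inl h1

lemma integral_hom {M L : Subfield Q} {σ : Q → Q} (hσ : HomOn L σ) (hfix : ∀ z ∈ M, σ z = z)
    (hML : M ≤ L) {b : Q} (hbL : b ∈ L) (hb : IsIntegral (VR v M) b) : IsIntegral (VR v M) (σ b) := by
  obtain ⟨f, hf, h0⟩ := hb
  refine ⟨f, hf, ?_⟩
  have hin : VR v M ≤ L.toSubring := fun z hz => hML hz.1
  have e1 : algebraMap (VR v M) Q = L.subtype.comp (Subring.inclusion hin) := rfl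
  have e2 : algebraMap (VR v M) Q = hσ.toHom.comp (Subring.inclusion hin) := by
    ext z; exact (hfix z z.2.1).symm
  have h1 : eval₂ (Subring.inclusion hin) (⟨b, hbL⟩ : L.toSubring) f = 0 := by
    apply L.subtype_injective
    rw [map_zero, hom_eval₂, ← e1]; exact h0
  have h2 := congrArg hσ.toHom h1
  rw [map_zero, hom_eval₂, ← e2] at h2
  exact h2

lemma sum_coeff_mem (f : Q[X]) (s : Multiset Q) (hs : ∀ a ∈ s, v a ≤ 1)
    (hf : f = (s.map fun a => X - C a).prod) (i : ℕ) : v (f.coeff i) ≤ 1 := by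
  have : f ∈ liftsRing v.integer.subtype := by
    rw [hf]
    refine multiset_prod_mem _ fun g hg => ?_
    obtain ⟨a, ha, rfl⟩ := Multiset.mem_map.1 hg
    exact sub_mem ((lifts_iff_liftsRing _ _).1 (X_mem_lifts _))
      ((lifts_iff_liftsRing _ _).1 (C'_mem_lifts ⟨⟨a, hs a ha⟩, rfl⟩))
  rw [← lifts_iff_liftsRing, lifts_iff_coeff_lifts] at this
  obtain ⟨z, hz⟩ := this i
  rw [← hz]; exact z.2

lemma lemD [IsAlgClosed Q] (M L : Subfield Q) (hML : M ≤ L)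
    (hfin : FiniteDimensional M (Subfield.extendScalars hML))
    (hsep : ∀ z ∈ L, IsSeparable M z)
    (H : ∀ σ, HomOn L σ → (∀ z ∈ M, σ z = z) → (∀ z ∈ L, v z ≤ 1 → v (σ z) ≤ 1) → ∀ z ∈ L, σ z = z)
    (z : Q) (hzL : z ∈ L) (hz : v z ≤ 1) : Het v L M z := by
  classical
  set L' := Subfield.extendScalars hML with hL'
  have halg : ∀ z ∈ L, IsAlgebraic M z := fun z hz => (hsep z hz).isIntegral.isAlgebraic
  let s (φ : L' →ₐ[M] Q) : Q → Q := ext0 (L := L) (φ : L' →+* Q)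
  have shom : ∀ φ : L' →ₐ[M] Q, HomOn L (s φ) := fun φ => homOn_ext0 (L := L) (φ : L' →+* Q)
  have sfix : ∀ φ : L' →ₐ[M] Q, ∀ z ∈ M, s φ z = z := fun φ z hz =>
    (ext0_of _ _ (hML hz)).trans (φ.commutes ⟨z, hz⟩)
  have sapp : ∀ (φ : L' →ₐ[M] Q) (z) (hz : z ∈ L), s φ z = φ ⟨z, hz⟩ := fun φ z hz =>
    ext0_of _ _ hz
  have hu : ∀ φ : L' →ₐ[M] Q, φ ≠ L'.val → ∃ u ∈ L, IsIntegral (VR v M) u ∧ v u = 1 ∧ v (s φ u) < 1 := by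
    intro φ hφ
    by_contra! hc
    refine hφ (AlgHom.ext fun z => ?_)
    rw [← sapp φ z z.2]
    refine H _ (shom φ) (sfix φ) (fun z hzL hz => ?_) z z.2
    obtain ⟨b, hb, t, ht, ib, it, vt, e⟩ := exists_bs v M L hML z hzL hz (halg z hzL)
    have h1 := hc t ht it vt
    have h2 : s φ z * s φ t = s φ b := by rw [← (shom φ).mul z hzL t ht, e]
    have h3 := le_one_of_integral v (integral_hom v (shom φ) (sfix φ) hML hb ib)
    rw [← h2, map_mul] at h3
    by_contra! h4
    exact absurd h3 (not_le.2 (one_lt_mul_of_lt_of_le h4 h1))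
  choose u0 hu0 using hu
  have hfinφ : Finite (L' →ₐ[M] Q) := inferInstance
  have := Fintype.ofFinite (L' →ₐ[M] Q)
  let u : (L' →ₐ[M] Q) → Q := fun φ => if h : φ ≠ L'.val then u0 φ h else 1
  let w : Q := ∏ φ, u φ
  have uL : ∀ φ, u φ ∈ L := fun φ => by
    simp only [u]; split_ifs with h; exacts [(hu0 φ h).1, L.one_mem]
  have uI : ∀ φ, IsIntegral (VR v M) (u φ) := fun φ => by
    simp only [u]; split_ifs with h; exacts [(hu0 φ h).2.1, isIntegral_one]
  have u1 : ∀ φ, v (u φ) = 1 := fun φ => by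
    simp only [u]; split_ifs with h; exacts [(hu0 φ h).2.2.1, map_one v]
  have wL : w ∈ L := prod_mem fun φ _ => uL φ
  have wI : IsIntegral (VR v M) w := IsIntegral.prod _ fun φ _ => uI φ
  have w1 : v w = 1 := by simp [w, map_prod, u1]
  have wφ : ∀ φ, φ ≠ L'.val → v (s φ w) < 1 := by
    intro φ hφ
    have hle : ∀ ψ, v (s φ (u ψ)) ≤ 1 := fun ψ =>
      le_one_of_integral v (integral_hom v (shom φ) (sfix φ) hML (uL ψ) (uI ψ))
    have : s φ w = ∏ ψ, s φ (u ψ) := by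
      have e : (⟨w, wL⟩ : L) = ∏ ψ, (⟨u ψ, uL ψ⟩ : L) := by
        apply Subtype.ext; simp [w]
      have := congrArg (shom φ).toHom e
      rw [map_prod] at this
      simpa using this
    rw [this, map_prod, ← Finset.mul_prod_erase _ _ (Finset.mem_univ φ)]
    refine mul_lt_one_of_lt_of_le ?_ (Finset.prod_le_one' fun ψ _ => hle ψ)
    have : u φ = u0 φ hφ := by simp [u, hφ]
    rw [this]; exact (hu0 φ hφ).2.2.2
  have key : ∀ x ∈ L, v x = 1 → (∀ φ, φ ≠ L'.val → v (s φ x) < 1) → Het v L M x := by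
    intro x hx vx hφ
    have hint : IsIntegral M x := (halg x hx).isIntegral
    set f : Q[X] := (minpoly M x).map (algebraMap M Q) with hf
    have hmonic : f.Monic := (minpoly.monic hint).map _
    have hsplit : f.Splits := IsAlgClosed.splits f
    have hroots : ∀ a ∈ f.roots, a ≠ x → v a < 1 := by
      intro a ha hax
      have e : minpoly M (⟨x, hx⟩ : L') = minpoly M x :=
        (minpoly.algebraMap_eq (algebraMap L' Q).injective (⟨x, hx⟩ : L')).symm
      have : a ∈ (minpoly M (⟨x, hx⟩ : L')).rootSet Q := by
        rw [e, mem_rootSet']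
        have := (mem_roots'.1 ha)
        refine ⟨this.1, ?_⟩
        have h2 := this.2
        rw [IsRoot.def, hf, eval_map_algebraMap] at h2; exact h2
      rw [← Algebra.IsAlgebraic.range_eval_eq_rootSet_minpoly] at this
      obtain ⟨φ, rfl⟩ := this
      have h3 := hφ φ (by rintro rfl; exact hax rfl)
      rw [sapp φ x hx] at h3; exact h3
    have hx0 : f.eval x = 0 := by rw [hf, eval_map_algebraMap, minpoly.aeval]
    have hprod : f = (f.roots.map fun a => X - C a).prod := by
      have := hsplit.eq_prod_roots
      rwa [hmonic.leadingCoeff, C_1, one_mul] at this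
    refine .root f x (fun i => .base _ ?_ ?_ ?_) hx vx.le hx0 ?_
    · rw [hf, coeff_map]; exact Subtype.mem _
    · rw [hf, coeff_map]; exact hML (Subtype.mem _)
    · refine sum_coeff_mem v f _ (fun a ha => ?_) hprod i
      by_cases hax : a = x
      · rw [hax, vx]
      · exact (hroots a ha hax).le
    · have hnd : f.roots.Nodup := nodup_roots (Separable.map (hsep x hx))
      have hxr : x ∈ f.roots := (mem_roots hmonic.ne_zero).2 hx0
      have := hsplit.eval_root_derivative  hmonic hxr
      rw [this, map_multiset_prod, Multiset.map_map]
      refine Multiset.prod_eq_one fun b hb => ?_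
      obtain ⟨a, ha, rfl⟩ := Multiset.mem_map.1 hb
      rw [hnd.mem_erase_iff] at ha
      have : v (x - a) = v x := Valuation.map_sub_eq_of_lt_left _ (by rw [vx]; exact hroots a ha.2 ha.1)
      simp [this, vx]
  have hw : Het v L M w := key w wL w1 wφ
  have key2 : ∀ x ∈ L, IsIntegral (VR v M) x → Het v L M x := by
    have k3 : ∀ x ∈ L, IsIntegral (VR v M) x → v x = 1 → Het v L M x := by
      intro x hx hi vx
      have : Het v L M (x * w) := by
        refine key _ (L.mul_mem hx wL) (by simp [vx, w1]) fun φ hφ => ?_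
        rw [(shom φ).mul x hx w wL, map_mul]
        rw [mul_comm]
        exact mul_lt_one_of_lt_of_le (wφ φ hφ)
          (le_one_of_integral v (integral_hom v (shom φ) (sfix φ) hML hx hi))
      have h2 := Het.mul _ _ this (hw.inv w1)
      have hw0 : w ≠ 0 := by intro h; rw [h] at w1; simp at w1
      rwa [mul_assoc, mul_inv_cancel₀ hw0, mul_one] at h2
    intro x hx hi
    by_cases vx : v x = 1
    · exact k3 x hx hi vx
    · have vx' := lt_of_le_of_ne (le_one_of_integral v hi) vx
      have : Het v L M (x + 1) := k3 _ (L.add_mem hx L.one_mem) (hi.add isIntegral_one)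
        (by rw [Valuation.map_add_eq_of_lt_right] <;> simp [vx'])
      have h2 := this.sub .one
      simpa using h2
  obtain ⟨b, hb, t, ht, ib, it, vt, e⟩ := exists_bs v M L hML z hzL hz (halg z hzL)
  have ht0 : t ≠ 0 := by intro h; rw [h] at vt; simp at vt
  have := Het.mul _ _ (key2 b hb ib) ((key2 t ht it).inv vt)
  rwa [← e, mul_assoc, mul_inv_cancel₀ ht0, mul_one] at this
end

section
namespace Het
variable {v : Valuation Q Γ} {L : Subfield Q} {A : Set Q} {z w : Q}
lemma natCast (n : ℕ) : Het v L A (n : Q) := natCast_mem (Het.ring v L A) n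

lemma eval (f : Q[X]) (hf : ∀ i, Het v L A (f.coeff i)) (hz : Het v L A z) : Het v L A (f.eval z) := by
  rw [eval_eq_sum_range]
  exact sum _ _ fun i _ => .mul _ _ (hf i) (hz.pow i)
end Het

section poly
variable (v : Valuation Q Γ)

lemma eval_le (f : Q[X]) (hf : ∀ i, v (f.coeff i) ≤ 1) (x : Q) (hx : v x ≤ 1) : v (f.eval x) ≤ 1 := by
  rw [eval_eq_sum_range]
  exact v.map_sum_le fun i _ => by rw [map_mul, map_pow]; exact mul_le_one' (hf i) (pow_le_one' hx i)

lemma lift_int (f : Q[X]) (hf : ∀ i, v (f.coeff i) ≤ 1) :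
    ∃ g : v.integer[X], g.map v.integer.subtype = f :=
  (mem_lifts _).1 ((lifts_iff_coeff_lifts _).2 fun i => ⟨⟨_, hf i⟩, rfl⟩)

lemma eval_sub_le (f : Q[X]) (hf : ∀ i, v (f.coeff i) ≤ 1) (x y : Q) (hx : v x ≤ 1) (hy : v y ≤ 1) :
    v (f.eval x - f.eval y) ≤ v (x - y) := by
  obtain ⟨g, rfl⟩ := lift_int v f hf
  obtain ⟨k, hk⟩ := sub_dvd_eval_sub (⟨x, hx⟩ : v.integer) ⟨y, hy⟩ g
  have := congrArg v.integer.subtype hk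
  rw [map_sub, ← eval_map_apply, ← eval_map_apply, map_mul, map_sub] at this
  erw [this, map_mul]
  exact mul_le_of_le_one_right' k.2

lemma eval_taylor (f : Q[X]) (hf : ∀ i, v (f.coeff i) ≤ 1) (x y : Q) (hx : v x ≤ 1) (hy : v y ≤ 1) :
    ∃ k, v k ≤ 1 ∧ f.eval (x + y) = f.eval x + f.derivative.eval x * y + k * y ^ 2 := by
  obtain ⟨g, rfl⟩ := lift_int v f hf
  obtain ⟨k, hk⟩ := binomExpansion g (⟨x, hx⟩ : v.integer) ⟨y, hy⟩
  have := congrArg v.integer.subtype hk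
  simp only [map_add, map_mul, map_pow, ← eval_map_apply] at this
  refine ⟨k, k.2, ?_⟩
  rw [derivative_map]
  exact this

lemma deriv_le (f : Q[X]) (hf : ∀ i, v (f.coeff i) ≤ 1) (i : ℕ) : v (f.derivative.coeff i) ≤ 1 := by
  rw [coeff_derivative, map_mul]
  refine mul_le_one' (hf _) ?_
  exact_mod_cast natCast_mem v.integer (i + 1)
end poly

section cong
variable {v : Valuation Q Γ}

lemma cg_mul {x x' y y' : Q} (hx : v x ≤ 1) (hy : v y' ≤ 1) (h : v (x - x') < 1) (h' : v (y - y') < 1) :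
    v (x * y - x' * y') < 1 := by
  have : x * y - x' * y' = (y - y') * x + (x - x') * y' := by ring
  rw [this]
  refine v.map_add_lt ?_ ?_ <;> rw [map_mul]
  · exact mul_lt_one_of_lt_of_le h' hx
  · exact mul_lt_one_of_lt_of_le h hy

lemma cg_le {x y : Q} (h : v (x - y) < 1) (hy : v y ≤ 1) : v x ≤ 1 := by
  have := v.map_add_le h.le hy
  simpa using this

lemma cg_symm {x y : Q} (h : v (x - y) < 1) : v (y - x) < 1 := by rwa [Valuation.map_sub_swap]

lemma cg_unit {x y : Q} (h : v (x - y) < 1) (hy : v y = 1) : v x = 1 := by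
  have : v ((x - y) + y) = v y := Valuation.map_add_eq_of_lt_right _ (by rwa [hy])
  simpa [hy] using this

lemma cg_pow {x y : Q} (hy : v y ≤ 1) (h : v (x - y) < 1) (n : ℕ) : v (x ^ n - y ^ n) < 1 := by
  induction n with
  | zero => simp
  | succ n ih =>
    rw [pow_succ, pow_succ]
    refine cg_mul ?_ hy ih h
    rw [map_pow]; exact pow_le_one' (cg_le h hy) _

lemma cg_sum {ι : Type*} (s : Finset ι) (f g : ι → Q) (h : ∀ i ∈ s, v (f i - g i) < 1) :
    v (∑ i ∈ s, f i - ∑ i ∈ s, g i) < 1 := by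
  rw [← Finset.sum_sub_distrib]
  exact v.map_sum_lt one_ne_zero h
end cong

structure Skew (v : Valuation Q Γ) (S L : Subfield Q) (σ Δ : Q → Q) : Prop where
  le : S ≤ L
  hom : HomOn L σ
  fixS : ∀ z ∈ S, σ z = z
  dadd : ∀ z ∈ L, ∀ w ∈ L, Δ (z + w) = Δ z + Δ w
  dmul : ∀ z ∈ L, ∀ w ∈ L, Δ (z * w) = σ z * Δ w + w * Δ z
  dS : ∀ z ∈ S, Δ z = 0
  cong : ∀ z ∈ L, v z ≤ 1 → v (σ z - z) < 1

namespace Skew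
variable {v : Valuation Q Γ} {S L : Subfield Q} {σ Δ : Q → Q} (h : Skew v S L σ Δ)
include h

lemma dsum {ι : Type*} (s : Finset ι) (g : ι → Q) (hg : ∀ i ∈ s, g i ∈ L) :
    Δ (∑ i ∈ s, g i) = ∑ i ∈ s, Δ (g i) := by
  classical
  induction s using Finset.induction_on with
  | empty => simpa using h.dS 0 S.zero_mem
  | insert a s ha ih =>
    rw [Finset.sum_insert ha, Finset.sum_insert ha, h.dadd _ (hg a (by simp)) _
      (sum_mem fun i hi => hg i (by simp [hi])), ih fun i hi => hg i (by simp [hi])]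

lemma dpow (z : Q) (hz : z ∈ L) (n : ℕ) :
    Δ (z ^ n) = Δ z * ∑ i ∈ Finset.range n, σ z ^ i * z ^ (n - 1 - i) := by
  induction n with
  | zero => simpa using h.dS 1 S.one_mem
  | succ n ih =>
    rw [pow_succ', h.dmul z hz _ (L.pow_mem hz n), ih, Finset.sum_range_succ']
    simp only [pow_zero, one_mul, Nat.add_sub_cancel, Nat.sub_zero]
    have : ∑ i ∈ Finset.range n, σ z ^ (i + 1) * z ^ (n - (i + 1)) =
        σ z * ∑ i ∈ Finset.range n, σ z ^ i * z ^ (n - 1 - i) := by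
      rw [Finset.mul_sum]
      refine Finset.sum_congr rfl fun i _ => ?_
      rw [show n - (i + 1) = n - 1 - i by omega]; ring
    rw [this]; ring

lemma sle {z : Q} (hz : z ∈ L) (h1 : v z ≤ 1) : v (σ z) ≤ 1 := cg_le (h.cong z hz h1) h1

lemma gle {z : Q} (hz : z ∈ L) (h1 : v z ≤ 1) (n : ℕ) :
    v (∑ i ∈ Finset.range n, σ z ^ i * z ^ (n - 1 - i)) ≤ 1 :=
  v.map_sum_le fun i _ => by
    rw [map_mul, map_pow, map_pow]
    exact mul_le_one' (pow_le_one' (h.sle hz h1) _) (pow_le_one' h1 _)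

lemma dpow_le {z : Q} (hz : z ∈ L) (h1 : v z ≤ 1) (n : ℕ) : v (Δ (z ^ n)) ≤ v (Δ z) := by
  rw [h.dpow z hz, map_mul]
  exact mul_le_of_le_one_right' (h.gle hz h1 n)

lemma lip {A : Set Q} (B : Γ) (hA : ∀ a ∈ A, a ∈ L → v a ≤ 1 → v (Δ a) ≤ B) {z : Q} (hz : Het v L A z) :
    v (Δ z) ≤ B := by
  induction hz with
  | base a h1 h2 h3 => exact hA a h1 h2 h3
  | zero => rw [h.dS 0 S.zero_mem]; simp
  | one => rw [h.dS 1 S.one_mem]; simp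
  | add a b ha hb h1 h2 => rw [h.dadd _ ha.mem _ hb.mem]; exact v.map_add_le h1 h2
  | mul a b ha hb h1 h2 =>
    rw [h.dmul _ ha.mem _ hb.mem]
    refine v.map_add_le ?_ ?_ <;> rw [map_mul]
    · exact (mul_le_of_le_one_left' (h.sle ha.mem ha.le_one)).trans h2
    · exact (mul_le_of_le_one_left' hb.le_one).trans h1
  | neg a ha h1 =>
    have := h.dadd a ha.mem (-a) (L.neg_mem ha.mem)
    rw [add_neg_cancel, h.dS 0 S.zero_mem] at this
    rw [eq_neg_of_add_eq_zero_right this.symm, Valuation.map_neg]; exact h1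
  | root f z hf hz h1 h2 h3 ih =>
    set G : ℕ → Q := fun n => ∑ i ∈ Finset.range n, σ z ^ i * z ^ (n - 1 - i) with hG
    have e1 : Δ z * (∑ i ∈ Finset.range (f.natDegree + 1), σ (f.coeff i) * G i) =
        - ∑ i ∈ Finset.range (f.natDegree + 1), z ^ i * Δ (f.coeff i) := by
      rw [eq_neg_iff_add_eq_zero, Finset.mul_sum, ← Finset.sum_add_distrib]
      rw [eval_eq_sum_range] at h2
      rw [← h.dS 0 S.zero_mem, ← h2, h.dsum _ _ fun i _ => L.mul_mem (hf i).mem (L.pow_mem hz i)]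
      refine Finset.sum_congr rfl fun i _ => ?_
      rw [h.dmul _ (hf i).mem _ (L.pow_mem hz i), h.dpow z hz]; ring
    have e2 : v (∑ i ∈ Finset.range (f.natDegree + 1), σ (f.coeff i) * G i) = 1 := by
      refine cg_unit ?_ h3
      rw [derivative_eval, sum_over_range _ (by simp)]
      refine cg_sum _ _ _ fun i _ => ?_
      rw [mul_assoc]
      refine cg_mul (h.sle (hf i).mem (hf i).le_one) ?_ (h.cong _ (hf i).mem (hf i).le_one) ?_
      · rw [map_mul, map_pow]
        exact mul_le_one' (natCast_mem v.integer i) (pow_le_one' h1 _)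
      · have : (i : Q) * z ^ (i - 1) = ∑ j ∈ Finset.range i, z ^ j * z ^ (i - 1 - j) := by
          rw [Finset.sum_congr rfl (g := fun _ => z ^ (i - 1)), Finset.sum_const, Finset.card_range,
            nsmul_eq_mul]
          intro j hj
          rw [← pow_add]; congr 1; have := Finset.mem_range.1 hj; omega
        rw [this]
        refine cg_sum _ _ _ fun j _ => cg_mul ?_ ?_ (cg_pow h1 (h.cong z hz h1) j) (by simp)
        · rw [map_pow]; exact pow_le_one' (h.sle hz h1) _
        · rw [map_pow]; exact pow_le_one' h1 _
    have e3 := congrArg v e1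
    rw [map_mul, e2, mul_one, Valuation.map_neg] at e3
    rw [e3]
    refine v.map_sum_le fun i _ => ?_
    rw [map_mul, map_pow]
    exact (mul_le_of_le_one_left' (pow_le_one' h1 i)).trans (ih i)
end Skew

lemma density (v : Valuation Q Γ) (L : Subfield Q) (R : Subring Q) (hRL : ∀ r ∈ R, r ∈ L ∧ v r ≤ 1)
    (hres : ∀ z ∈ L, v z ≤ 1 → ∃ r ∈ R, v (z - r) < 1) (c : Q) (hcR : c ∈ R) (hc0 : c ≠ 0)
    (hdiv : ∀ z ∈ R, v z ≤ v c → z / c ∈ R) (arch : ∀ a, v a < 1 → ∃ n : ℕ, v a ^ n ≤ v c)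
    {h : Q} (hh : Het v L R h) : ∃ r ∈ R, ∃ h', Het v L R h' ∧ h = r + c * h' := by
  have base : ∀ r ∈ R, Het v L R r := fun r hr => .base r hr (hRL r hr).1 (hRL r hr).2
  have hc := base c hcR
  rcases eq_or_lt_of_le hc.le_one with hc1 | hc1
  · exact ⟨0, R.zero_mem, c⁻¹ * h, .mul _ _ (hc.inv hc1) hh, by field_simp; simp⟩
  induction hh with
  | base a h1 _ _ => exact ⟨a, h1, 0, .zero, by simp⟩
  | zero => exact ⟨0, R.zero_mem, 0, .zero, by simp⟩
  | one => exact ⟨1, R.one_mem, 0, .zero, by simp⟩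
  | add a b _ _ h1 h2 =>
    obtain ⟨r, hr, k, hk, rfl⟩ := h1
    obtain ⟨s, hs, l, hl, rfl⟩ := h2
    exact ⟨r + s, R.add_mem hr hs, k + l, .add _ _ hk hl, by ring⟩
  | mul a b ha hb h1 h2 =>
    obtain ⟨r, hr, k, hk, e1⟩ := h1
    obtain ⟨s, hs, l, hl, e2⟩ := h2
    exact ⟨r * s, R.mul_mem hr hs, r * l + k * b, .add _ _ (.mul _ _ (base r hr) hl)
      (.mul _ _ hk hb), by rw [e1, e2]; ring⟩
  | neg a _ h1 =>
    obtain ⟨r, hr, k, hk, rfl⟩ := h1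
    exact ⟨-r, R.neg_mem hr, -k, .neg _ hk, by ring⟩
  | root f z hf hz h1 h2 h3 ih =>
    choose r hr g hg e using ih
    obtain ⟨F, hF⟩ : ∃ F : R[X], ∀ i, ((F.coeff i : R) : Q) = if i ≤ f.natDegree then r i else 0 := by
      refine ⟨∑ i ∈ Finset.range (f.natDegree + 1), C ⟨r i, hr i⟩ * X ^ i, fun i => ?_⟩
      simp [coeff_X_pow, Nat.lt_succ_iff]
      split_ifs <;> rfl
    set f1 : Q[X] := F.map R.subtype with hf1
    have cf1 : ∀ i, f1.coeff i = if i ≤ f.natDegree then r i else 0 := fun i => by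
      rw [hf1, coeff_map]; exact hF i
    have hfle : ∀ i, v (f.coeff i) ≤ 1 := fun i => (hf i).le_one
    have hf1le : ∀ i, v (f1.coeff i) ≤ 1 := fun i => by
      rw [cf1]; split_ifs; exacts [(base _ (hr i)).le_one, by simp]
    obtain ⟨gp, hgp, hgp0⟩ : ∃ gp : Q[X], f = f1 + C c * gp ∧ ∀ i, Het v L R (gp.coeff i) := by
      refine ⟨∑ i ∈ Finset.range (f.natDegree + 1), C (g i) * X ^ i, ?_, ?_⟩
      · ext i
        simp only [coeff_add, cf1, coeff_C_mul, finsetSum_coeff, coeff_X_pow]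
        by_cases hi : i ≤ f.natDegree
        · simp [hi, Nat.lt_succ_iff]; exact e i
        · simp [hi, Nat.lt_succ_iff, coeff_eq_zero_of_natDegree_lt (not_le.1 hi)]
      · intro i
        simp only [finsetSum_coeff, coeff_C_mul, coeff_X_pow]
        refine Het.sum _ _ fun j _ => .mul _ _ (hg j) ?_
        split_ifs; exacts [.one, .zero]
    have hgple : ∀ i, v (gp.coeff i) ≤ 1 := fun i => (hgp0 i).le_one
    obtain ⟨e0, he0, hz0⟩ := hres z hz h1
    have hne0 : v e0 ≤ 1 := (hRL _ he0).2
    have d1 : v (f1.eval e0) < 1 := by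
      have t1 : v (f1.eval z) < 1 := by
        have : f1.eval z = -(c * gp.eval z) := by
          rw [hgp] at h2; simp at h2; exact eq_neg_of_add_eq_zero_left h2
        rw [this, Valuation.map_neg, map_mul]
        exact mul_lt_one_of_lt_of_le hc1 (eval_le v gp hgple z h1)
      have t2 := (eval_sub_le v f1 hf1le e0 z hne0 h1).trans_lt (cg_symm hz0)
      have := v.map_add_lt t2 t1
      simpa using this
    have d2 : v (f1.derivative.eval e0) = 1 := by
      refine cg_unit (y := f1.derivative.eval z)
        ((eval_sub_le v _ (deriv_le v f1 hf1le) e0 z hne0 h1).trans_lt (cg_symm hz0)) ?_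
      have : f.derivative.eval z = f1.derivative.eval z + c * gp.derivative.eval z := by
        conv_lhs => rw [hgp]
        simp
      refine cg_unit (y := f.derivative.eval z) ?_ h3
      rw [this, sub_add_cancel_left, Valuation.map_neg, map_mul]
      exact mul_lt_one_of_lt_of_le hc1 (eval_le v _ (deriv_le v gp hgple) z h1)
    have d3 : f1.derivative.eval e0 ∈ R := by
      have : f1.derivative.eval e0 = (F.derivative.eval ⟨e0, he0⟩ : R) := by
        rw [hf1, derivative_map]
        exact eval_map_apply (f := R.subtype) (p := F.derivative) (x := ⟨e0, he0⟩)
      rw [this]; exact Subtype.mem _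
    have d0 : f1.derivative.eval e0 ≠ 0 := fun h => by rw [h] at d2; simp at d2
    obtain ⟨gg, hgg, hgg1⟩ := hres (f1.derivative.eval e0)⁻¹ (L.inv_mem (hRL _ d3).1) (by simp [d2])
    have hggle := (hRL _ hgg).2
    have d4 : v (1 - f1.derivative.eval e0 * gg) < 1 := by
      have := cg_mul (x := f1.derivative.eval e0) (x' := f1.derivative.eval e0) d2.le hggle (by simp) hgg1
      rwa [mul_inv_cancel₀ d0] at this
    obtain ⟨a, ha, ha1, ha2⟩ : ∃ a, v a < 1 ∧ v (f1.eval e0) ≤ v a ∧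
        v (1 - f1.derivative.eval e0 * gg) ≤ v a := by
      rcases le_total (v (f1.eval e0)) (v (1 - f1.derivative.eval e0 * gg)) with h | h
      · exact ⟨_, d4, h, le_rfl⟩
      · exact ⟨_, d1, le_rfl, h⟩
    have newton : ∀ n : ℕ, ∃ e ∈ R, v (f1.eval e) ≤ v a ^ (n + 1) ∧ v (e - e0) ≤ v a := by
      intro n
      induction n with
      | zero => exact ⟨e0, he0, by simpa using ha1, by simp⟩
      | succ n ih =>
        obtain ⟨e, he, h1, h2⟩ := ih
        have hele := (hRL _ he).2
        have hyR : f1.eval e ∈ R := by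
          have : f1.eval e = (F.eval ⟨e, he⟩ : R) :=
            eval_map_apply (f := R.subtype) (p := F) (x := ⟨e, he⟩)
          rw [this]; exact Subtype.mem _
        have hyle : v (f1.eval e) ≤ v a := h1.trans (by
          rw [pow_succ]; exact mul_le_of_le_one_left' (pow_le_one' ha.le n))
        have hR : gg * f1.eval e ∈ R := R.mul_mem hgg hyR
        obtain ⟨k, hk, hke⟩ := eval_taylor v f1 hf1le e (-(gg * f1.eval e)) hele
          (by rw [Valuation.map_neg]; exact (hRL _ hR).2)
        refine ⟨e + -(gg * f1.eval e), R.add_mem he (R.neg_mem hR), ?_, ?_⟩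
        · have : f1.eval (e + -(gg * f1.eval e)) = f1.eval e * ((1 - f1.derivative.eval e0 * gg) -
              (f1.derivative.eval e - f1.derivative.eval e0) * gg + k * gg ^ 2 * f1.eval e) := by
            rw [hke]; ring
          rw [this, map_mul, pow_succ (v a) (n + 1)]
          refine mul_le_mul' h1 (v.map_add_le (v.map_sub_le ha2 ?_) ?_)
          · rw [map_mul]
            refine (mul_le_of_le_one_right' hggle).trans (le_trans ?_ h2)
            exact eval_sub_le v _ (deriv_le v f1 hf1le) e e0 hele hne0
          · rw [map_mul, map_mul, map_pow]
            exact (mul_le_of_le_one_left' (mul_le_one' hk (pow_le_one' hggle 2))).trans hyle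
        · have : e + -(gg * f1.eval e) - e0 = (e - e0) - gg * f1.eval e := by ring
          rw [this]
          refine v.map_sub_le h2 ?_
          rw [map_mul]; exact (mul_le_of_le_one_left' hggle).trans hyle
    obtain ⟨n, hn⟩ := arch a ha
    obtain ⟨e, he, h5, h6⟩ := newton n
    have hele := (hRL _ he).2
    have h5 : v (f1.eval e) ≤ v c := h5.trans (le_trans (by
      rw [pow_succ]; exact mul_le_of_le_one_right' ha.le) hn)
    have hyR : f1.eval e ∈ R := by
      have : f1.eval e = (F.eval ⟨e, he⟩ : R) :=
        eval_map_apply (f := R.subtype) (p := F) (x := ⟨e, he⟩)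
      rw [this]; exact Subtype.mem _
    have h7 := hdiv _ hyR h5
    have hze : v (z - e) < 1 := by
      have : z - e = (z - e0) - (e - e0) := by ring
      rw [this]; exact v.map_sub_lt hz0 (h6.trans_lt ha)
    have hfe : f.eval e = c * (f1.eval e / c + gp.eval e) := by
      rw [mul_add, mul_div_cancel₀ _ hc0]
      conv_lhs => rw [hgp]
      simp
    have hHfe : Het v L R (f1.eval e / c + gp.eval e) :=
      .add _ _ (base _ h7) (Het.eval gp hgp0 (base _ he))
    have hvze : v (z - e) ≤ v c := by
      obtain ⟨k, hk, hke⟩ := eval_taylor v f hfle e (z - e) hele hze.le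
      rw [add_sub_cancel, h2] at hke
      have u1 : v (f.derivative.eval e + k * (z - e)) = 1 := by
        refine cg_unit (y := f.derivative.eval z) ?_ h3
        have : f.derivative.eval e + k * (z - e) - f.derivative.eval z =
          (f.derivative.eval e - f.derivative.eval z) + k * (z - e) := by ring
        rw [this]
        refine v.map_add_lt ((eval_sub_le v _ (deriv_le v f hfle) e z hele h1).trans_lt (cg_symm hze)) ?_
        rw [mul_comm, map_mul]; exact mul_lt_one_of_lt_of_le hze hk
      have : (z - e) * (f.derivative.eval e + k * (z - e)) = - f.eval e := by
        rw [eq_neg_iff_add_eq_zero, hke]; ring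
      have := congrArg v this
      rw [map_mul, u1, mul_one, Valuation.map_neg, hfe, map_mul] at this
      rw [this]; exact mul_le_of_le_one_right' hHfe.le_one
    have hz' : e + c * ((z - e) / c) = z := by rw [mul_div_cancel₀ _ hc0]; ring
    have hcomp : f.comp (C c * X + C e) = (taylor e f).comp (C c * X) := by
      rw [taylor_apply, comp_assoc]; simp
    refine ⟨e, he, (z - e) / c, ?_, hz'.symm⟩
    refine .root (C c⁻¹ * f.comp (C c * X + C e)) _ (fun i => ?_)
      (L.div_mem (L.sub_mem hz (hRL _ he).1) hc.mem) ?_ ?_ ?_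
    · rw [coeff_C_mul, hcomp, comp_C_mul_X_coeff, taylor_coeff]
      rcases i with _ | i
      · rw [hasseDeriv_zero', hfe]
        simpa [hc0] using hHfe
      · have : c⁻¹ * (eval e (hasseDeriv (i + 1) f) * c ^ (i + 1)) =
          eval e (hasseDeriv (i + 1) f) * c ^ i := by
          field_simp; ring
        rw [this]
        refine .mul _ _ (Het.eval _ (fun j => ?_) (base _ he)) (hc.pow i)
        rw [hasseDeriv_coeff]
        exact .mul _ _ (.natCast _) (hf _)
    · rw [map_div₀]; exact div_le_one_of_le₀ hvze zero_le
    · rw [eval_mul, eval_comp]; simp only [eval_add, eval_mul, eval_C, eval_X]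
      rw [add_comm, hz', h2, mul_zero]
    · have : derivative (C c⁻¹ * f.comp (C c * X + C e)) = f.derivative.comp (C c * X + C e) := by
        rw [derivative_C_mul, derivative_comp]
        simp only [derivative_add, derivative_mul, derivative_C, derivative_X]
        rw [zero_mul, zero_add, mul_one, add_zero, ← mul_assoc, ← C_mul, inv_mul_cancel₀ hc0, C_1, one_mul]
      rw [this, eval_comp]; simp only [eval_add, eval_mul, eval_C, eval_X]
      rw [add_comm, hz', h3]
end

section
structure Base (v : Valuation Q Γ) (S : Subfield Q) (p : ℕ) : Prop where
  arch : ∀ a b, v a < 1 → b ≠ 0 → ∃ n : ℕ, v a ^ n ≤ v b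
  res : ∀ z, v z ≤ 1 → ∃ e ∈ S, v (z - e) < 1
  dense : ∀ z, IsAlgebraic S z → ∀ e, e ≠ 0 → ∃ a ∈ S, v (z - a) < v e
  as : p.Prime → ∀ c ∈ S, ∃ s ∈ S, s ^ p - s = c
  nat : ∀ n : ℕ, (n : Q) ≠ 0 → v (n : Q) = 1
  sep : ∀ z : Q, IsSeparable S z → z ∈ S

lemma val_pow_inj {a b : Γ} {n : ℕ} (hn : 0 < n) (h : a ^ n = b ^ n) : a = b :=
  (pow_left_inj₀ zero_le zero_le hn.ne').1 h

lemma Base.divi [IsAlgClosed Q] {v : Valuation Q Γ} {S : Subfield Q} {p : ℕ} (hB : Base v S p) (c : Q) (hc : c ∈ S)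
    (n : ℕ) (hn : 0 < n) : ∃ d ∈ S, v d ^ n = v c := by
  by_cases hc0 : c = 0
  · exact ⟨0, S.zero_mem, by simp [hc0, hn.ne']⟩
  obtain ⟨r, hr⟩ := IsAlgClosed.exists_pow_nat_eq c hn
  have hr0 : r ≠ 0 := by rintro rfl; rw [zero_pow hn.ne'] at hr; exact hc0 hr.symm
  have hra : IsAlgebraic S r := by
    refine IsAlgebraic.of_pow hn ?_
    rw [hr]; exact isAlgebraic_algebraMap (⟨c, hc⟩ : S)
  obtain ⟨a, ha, h⟩ := hB.dense r hra r hr0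
  refine ⟨a, ha, ?_⟩
  rw [← hr, map_pow, ← v.map_add_eq_of_lt_right (x := a - r) (y := r)]
  · simp
  · rwa [Valuation.map_sub_swap]

lemma Base.tors [IsAlgClosed Q] {v : Valuation Q Γ} {S : Subfield Q} {p : ℕ} (hB : Base v S p) {z c : Q} (hc : c ∈ S)
    {n : ℕ} (hn : 0 < n) (h : v z ^ n = v c) : ∃ d ∈ S, v z = v d := by
  obtain ⟨d, hd, h1⟩ := hB.divi c hc n hn
  exact ⟨d, hd, val_pow_inj hn (h.trans h1.symm)⟩

lemma Base.proot [IsAlgClosed Q] {v : Valuation Q Γ} {S : Subfield Q} {p : ℕ} (hB : Base v S p) [Fact p.Prime]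
    [CharP Q p] (r : ℕ) (c : Q) (hc : c ∈ S) : ∃ w ∈ S, v (w ^ p ^ r - c) ≤ 1 := by
  have hn : 0 < p ^ r := pow_pos (Fact.out : p.Prime).pos _
  obtain ⟨t, ht⟩ := IsAlgClosed.exists_pow_nat_eq c hn
  have hra : IsAlgebraic S t := by
    refine IsAlgebraic.of_pow hn ?_
    rw [ht]; exact isAlgebraic_algebraMap (⟨c, hc⟩ : S)
  obtain ⟨a, ha, h⟩ := hB.dense t hra 1 one_ne_zero
  refine ⟨a, ha, ?_⟩
  rw [← ht, ← sub_pow_char_pow, map_pow, Valuation.map_sub_swap]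
  exact pow_le_one' (by simpa using h.le) _

def adj (S : Subfield Q) (Y : Q) : Subfield Q := Subfield.closure (S ∪ {Y})

lemma le_adj (S : Subfield Q) (Y : Q) : S ≤ adj S Y :=
  fun _ hz => Subfield.subset_closure (.inl hz)
lemma mem_adj (S : Subfield Q) (Y : Q) : Y ∈ adj S Y := Subfield.subset_closure (.inr rfl)
lemma adj_le {S L : Subfield Q} {Y : Q} (h : S ≤ L) (hY : Y ∈ L) : adj S Y ≤ L := by
  rw [adj, Subfield.closure_le]
  rintro z (hz | rfl)
  exacts [h hz, hY]

lemma eval_mem {L : Subfield Q} (G : Q[X]) (hG : ∀ i, G.coeff i ∈ L) (Y : Q) (hY : Y ∈ L) :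
    G.eval Y ∈ L := by
  rw [eval_eq_sum_range]
  exact sum_mem fun i _ => L.mul_mem (hG i) (L.pow_mem hY i)

lemma mul_coeff_mem {L : Subfield Q} {G H : Q[X]} (hG : ∀ i, G.coeff i ∈ L) (hH : ∀ i, H.coeff i ∈ L) (i : ℕ) :
    (G * H).coeff i ∈ L := by
  rw [coeff_mul]; exact sum_mem fun i _ => L.mul_mem (hG _) (hH _)

lemma adj_frac {S : Subfield Q} {Y z : Q} (hz : z ∈ adj S Y) : ∃ G H : Q[X], (∀ i, G.coeff i ∈ S) ∧
    (∀ i, H.coeff i ∈ S) ∧ H.eval Y ≠ 0 ∧ z = G.eval Y / H.eval Y := by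
  have h1 : ∀ i, (1 : Q[X]).coeff i ∈ S := fun i => by
    rw [coeff_one]; split_ifs; exacts [S.one_mem, S.zero_mem]
  induction hz using Subfield.closure_induction with
  | mem x hx =>
    rcases hx with hx | rfl
    · refine ⟨C x, 1, fun i => ?_, h1, by simp, by simp⟩
      rw [coeff_C]; split_ifs; exacts [hx, S.zero_mem]
    · refine ⟨X, 1, fun i => ?_, h1, by simp, by simp⟩
      rw [coeff_X]; split_ifs; exacts [S.one_mem, S.zero_mem]
  | one => exact ⟨1, 1, h1, h1, by simp, by simp⟩
  | add x y _ _ hx hy =>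
    obtain ⟨G, H, hG, hH, h0, rfl⟩ := hx
    obtain ⟨G', H', hG', hH', h0', rfl⟩ := hy
    refine ⟨G * H' + H * G', H * H', fun i => ?_, mul_coeff_mem hH hH', by simp [h0, h0'], ?_⟩
    · rw [coeff_add]; exact S.add_mem (mul_coeff_mem hG hH' i) (mul_coeff_mem hH hG' i)
    · simp only [eval_add, eval_mul]; exact div_add_div _ _ h0 h0'
  | neg x _ hx =>
    obtain ⟨G, H, hG, hH, h0, rfl⟩ := hx
    exact ⟨-G, H, fun i => by rw [coeff_neg]; exact S.neg_mem (hG i), hH, h0, by simp [neg_div]⟩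
  | inv x _ hx =>
    obtain ⟨G, H, hG, hH, h0, rfl⟩ := hx
    by_cases hG0 : G.eval Y = 0
    · exact ⟨0, 1, fun i => by simp, h1, by simp, by simp [hG0]⟩
    · exact ⟨H, G, hH, hG, hG0, by simp⟩
  | mul x y _ _ hx hy =>
    obtain ⟨G, H, hG, hH, h0, rfl⟩ := hx
    obtain ⟨G', H', hG', hH', h0', rfl⟩ := hy
    exact ⟨G * G', H * H', mul_coeff_mem hG hG', mul_coeff_mem hH hH', by simp [h0, h0'],
      by simp [div_mul_div_comm]⟩

structure Sys (v : Valuation Q Γ) (S : Subfield Q) (Y : Q) (C A : Set Q) : Prop where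
  C0 : ∀ c ∈ C, c ≠ 0
  C_one : (1 : Q) ∈ C
  C_mul : ∀ c ∈ C, ∀ d ∈ C, c * d ∈ C
  C_inv : ∀ c ∈ C, c⁻¹ ∈ C
  C_adj : ∀ c ∈ C, c ∈ adj S Y
  CA : ∀ c ∈ C, v c ≤ 1 → c ∈ A
  SA : ∀ c ∈ S, v c ≤ 1 → c ∈ A
  A_le : ∀ a ∈ A, v a ≤ 1
  A_adj : ∀ a ∈ A, a ∈ adj S Y
  V : ∀ G : Q[X], (∀ i, G.coeff i ∈ S) → G.eval Y ≠ 0 → ∃ c ∈ C, v c = v (G.eval Y) ∧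
    G.eval Y / c ∈ Subring.closure A
  lau : ∀ r ∈ Subring.closure A, ∃ c ∈ C, ∃ G : Q[X], (∀ i, G.coeff i ∈ S) ∧ r * c = G.eval Y

namespace Sys
variable {v : Valuation Q Γ} {S L : Subfield Q} {Y : Q} {C A : Set Q} (h : Sys v S Y C A)
include h

lemma hetc (hL : adj S Y ≤ L) {z : Q} (hz : z ∈ Subring.closure A) : Het v L A z :=
  Het.of_closure (fun a ha => ⟨hL (h.A_adj a ha), h.A_le a ha⟩) hz

lemma het (hL : adj S Y ≤ L) {z : Q} (hz : z ∈ adj S Y) (h1 : v z ≤ 1) : Het v L A z := by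
  obtain ⟨G, H, hG, hH, h0, rfl⟩ := adj_frac hz
  by_cases hG0 : G.eval Y = 0
  · rw [hG0, zero_div]; exact .zero
  obtain ⟨c, hc, e1, m1⟩ := h.V G hG hG0
  obtain ⟨d, hd, e2, m2⟩ := h.V H hH h0
  have hc0 := h.C0 c hc
  have hd0 := h.C0 d hd
  have e : G.eval Y / H.eval Y = (c * d⁻¹) * (G.eval Y / c) * (H.eval Y / d)⁻¹ := by
    field_simp
  have hcd : v (c * d⁻¹) ≤ 1 := by
    rw [map_mul, map_inv₀, e1, e2, ← div_eq_mul_inv, ← map_div₀]; exact h1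
  rw [e]
  refine .mul _ _ (.mul _ _ (.base _ (h.CA _ (h.C_mul _ hc _ (h.C_inv _ hd)) hcd) (hL ?_) hcd)
    (h.hetc hL m1)) ((h.hetc hL m2).inv ?_)
  · exact h.C_adj _ (h.C_mul _ hc _ (h.C_inv _ hd))
  · rw [map_div₀, e2, div_self]; exact v.ne_zero_iff.2 h0

lemma hdiv {z c : Q} (hz : z ∈ Subring.closure A) (hc : c ∈ C) (hle : v z ≤ v c) :
    z / c ∈ Subring.closure A := by
  by_cases hz0 : z = 0
  · rw [hz0, zero_div]; exact zero_mem _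
  obtain ⟨d, hd, G, hG, e⟩ := h.lau z hz
  have hc0 := h.C0 c hc
  have hd0 := h.C0 d hd
  obtain ⟨c', hc', e1, m1⟩ := h.V G hG (by rw [← e]; exact mul_ne_zero hz0 hd0)
  have hc0' := h.C0 c' hc'
  have : z / c = (G.eval Y / c') * (c' * (d * c)⁻¹) := by
    rw [← e]; field_simp
  rw [this]
  have hm := h.C_mul _ hc' _ (h.C_inv _ (h.C_mul _ hd _ hc))
  refine mul_mem m1 (Subring.subset_closure (h.CA _ hm ?_))
  rw [map_mul, e1, ← e, map_inv₀, map_mul, map_mul, mul_inv, mul_assoc, mul_inv_cancel_left₀,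
    ← div_eq_mul_inv]
  · exact div_le_one_of_le₀ hle zero_le
  · exact v.ne_zero_iff.2 hd0

lemma dens {p : ℕ} (hB : Base v S p) (hL : adj S Y ≤ L) {z c : Q} (hz : Het v L A z) (hc : c ∈ C)
    (hc1 : v c ≤ 1) : ∃ r ∈ Subring.closure A, ∃ z', Het v L A z' ∧ z = r + c * z' := by
  have t1 : ∀ {z}, Het v L A z → Het v L (Subring.closure A) z := fun hz =>
    hz.mono le_rfl fun a ha _ _ => Subring.subset_closure ha
  have t2 : ∀ {z}, Het v L (Subring.closure A) z → Het v L A z := fun hz =>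
    hz.trans' le_rfl fun a ha _ _ => h.hetc hL ha
  obtain ⟨r, hr, z', hz', e⟩ := density v L (Subring.closure A)
    (fun r hr => ⟨(h.hetc hL hr).mem, (h.hetc hL hr).le_one⟩)
    (fun z _ hz => by
      obtain ⟨e, he, hv⟩ := hB.res z hz
      refine ⟨e, Subring.subset_closure (h.SA e he (cg_le (cg_symm hv) hz)), hv⟩)
    c (Subring.subset_closure (h.CA c hc hc1)) (h.C0 c hc) (fun z hz hle => h.hdiv hz hc hle)
    (fun a ha => hB.arch a c ha (h.C0 c hc)) (t1 hz)
  exact ⟨r, hr, z', t2 hz', e⟩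
end Sys

def Cvt (S : Subfield Q) (Y : Q) : Set Q := {z | ∃ c ∈ S, c ≠ 0 ∧ ∃ k : ℤ, z = c * Y ^ k}
def Avt (v : Valuation Q Γ) (S : Subfield Q) (Y : Q) : Set Q := {z | v z ≤ 1 ∧ ∃ c ∈ S, ∃ k : ℤ, z = c * Y ^ k}

def VT (v : Valuation Q Γ) (S : Subfield Q) (Y : Q) : Prop :=
  Y ≠ 0 ∧ ∀ k : ℤ, ∀ c ∈ S, v Y ^ k = v c → k = 0

lemma VT.dom {v : Valuation Q Γ} {S : Subfield Q} {Y : Q} (h : VT v S Y) {ι : Type*} (s : Finset ι)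
    (c : ι → Q) (k : ι → ℤ) (hk : Set.InjOn k s) (hc : ∀ i ∈ s, c i ∈ S)
    (hne : ∃ i ∈ s, c i ≠ 0) : ∃ i ∈ s, c i ≠ 0 ∧ (∀ j ∈ s, j ≠ i → v (c j * Y ^ k j) < v (c i * Y ^ k i)) ∧
      v (∑ j ∈ s, c j * Y ^ k j) = v (c i * Y ^ k i) := by
  classical
  obtain ⟨i0, hi0, h0⟩ := hne
  obtain ⟨i, hi, hmax⟩ := s.exists_max_image (fun i => v (c i * Y ^ k i)) ⟨i0, hi0⟩
  have hY := h.1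
  have hci : c i ≠ 0 := by
    intro hi0'
    have := hmax i0 hi0
    simp [hi0', h0, hY, zpow_ne_zero] at this
  have hlt : ∀ j ∈ s, j ≠ i → v (c j * Y ^ k j) < v (c i * Y ^ k i) := by
    intro j hj hji
    refine lt_of_le_of_ne (hmax j hj) fun he => ?_
    have hcj : c j ≠ 0 := by
      intro hj0
      have : v (c i * Y ^ k i) ≠ 0 := v.ne_zero_iff.2 (mul_ne_zero hci (zpow_ne_zero _ hY))
      rw [hj0, zero_mul, map_zero] at he
      exact this he.symm
    have := h.2 (k j - k i) (c i / c j) (S.div_mem (hc i hi) (hc j hj)) (by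
      have hvY : v Y ≠ 0 := v.ne_zero_iff.2 hY
      have hvj : v (c j) ≠ 0 := v.ne_zero_iff.2 hcj
      rw [map_mul, map_mul, map_zpow₀, map_zpow₀] at he
      rw [zpow_sub₀ hvY, map_div₀, div_eq_div_iff (zpow_ne_zero _ hvY) hvj, mul_comm, he])
    exact hji (hk hj hi (by omega))
  refine ⟨i, hi, hci, hlt, ?_⟩
  rw [← Finset.add_sum_erase _ _ hi]
  refine v.map_add_eq_of_lt_left (v.map_sum_lt ?_ fun j hj => ?_)
  · exact v.ne_zero_iff.2 (mul_ne_zero hci (zpow_ne_zero _ hY))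
  · exact hlt j (Finset.mem_of_mem_erase hj) (Finset.ne_of_mem_erase hj)

lemma VT.sys {v : Valuation Q Γ} {S : Subfield Q} {Y : Q} (h : VT v S Y) :
    Sys v S Y (Cvt S Y) (Avt v S Y) := by
  have hY := h.1
  have hz : ∀ k : ℤ, Y ^ k ≠ 0 := fun k => zpow_ne_zero k hY
  have hm : ∀ c ∈ S, ∀ k : ℤ, c * Y ^ k ∈ adj S Y := fun c hc k =>
    (adj S Y).mul_mem (le_adj S Y hc) ((adj S Y).zpow_mem (mem_adj S Y) k)
  constructor
  · rintro _ ⟨c, _, hc, k, rfl⟩; exact mul_ne_zero hc (hz k)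
  · exact ⟨1, S.one_mem, one_ne_zero, 0, by simp⟩
  · rintro _ ⟨c, hc, hc0, k, rfl⟩ _ ⟨d, hd, hd0, l, rfl⟩
    exact ⟨c * d, S.mul_mem hc hd, mul_ne_zero hc0 hd0, k + l, by rw [zpow_add₀ hY]; ring⟩
  · rintro _ ⟨c, hc, hc0, k, rfl⟩
    exact ⟨c⁻¹, S.inv_mem hc, inv_ne_zero hc0, -k, by rw [mul_inv, zpow_neg]⟩
  · rintro _ ⟨c, hc, _, k, rfl⟩; exact hm c hc k
  · rintro _ ⟨c, hc, _, k, rfl⟩ h1; exact ⟨h1, c, hc, k, rfl⟩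
  · intro c hc h1; exact ⟨h1, c, hc, 0, by simp⟩
  · intro a ha; exact ha.1
  · rintro _ ⟨_, c, hc, k, rfl⟩; exact hm c hc k
  · intro G hG h0
    have hs : G.eval Y = ∑ j ∈ Finset.range (G.natDegree + 1), G.coeff j * Y ^ (j : ℤ) := by
      rw [eval_eq_sum_range]; simp
    obtain ⟨i, hi, hci, hlt, e⟩ := h.dom (Finset.range (G.natDegree + 1)) (fun j => G.coeff j) (fun j => (j : ℤ))
      (fun a _ b _ h => by simpa using h) (fun i _ => hG i) (by
        by_contra! hc
        exact h0 (by rw [hs]; exact Finset.sum_eq_zero fun i hi => by rw [hc i hi, zero_mul]))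
    refine ⟨G.coeff i * Y ^ (i : ℤ), ⟨_, hG i, hci, i, rfl⟩, by rw [hs, e], ?_⟩
    rw [hs, Finset.sum_div]
    refine sum_mem fun j hj => Subring.subset_closure ⟨?_, G.coeff j / G.coeff i,
      S.div_mem (hG j) (hG i), j - i, ?_⟩
    · rw [map_div₀]
      refine div_le_one_of_le₀ ?_ zero_le
      by_cases hji : j = i
      · rw [hji]
      · exact (hlt j hj hji).le
    · rw [zpow_sub₀ hY]; field_simp
  · intro r hr
    suffices ∃ m : ℕ, ∃ G : Q[X], (∀ i, G.coeff i ∈ S) ∧ r * Y ^ m = G.eval Y by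
      obtain ⟨m, G, hG, e⟩ := this
      exact ⟨Y ^ m, ⟨1, S.one_mem, one_ne_zero, m, by simp⟩, G, hG, e⟩
    induction hr using Subring.closure_induction with
    | mem x hx =>
      obtain ⟨_, c, hc, k, rfl⟩ := hx
      refine ⟨k.natAbs, monomial (k + k.natAbs).toNat c, fun i => ?_, ?_⟩
      · rw [coeff_monomial]; split_ifs; exacts [hc, S.zero_mem]
      · rw [eval_monomial, mul_assoc, ← zpow_natCast Y k.natAbs, ← zpow_add₀ hY, ← zpow_natCast, Int.toNat_of_nonneg]
        have := neg_abs_le k; rw [Int.natCast_natAbs]; linarith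
    | zero => exact ⟨0, 0, by simp, by simp⟩
    | one => exact ⟨0, 1, fun i => by rw [coeff_one]; split_ifs; exacts [S.one_mem, S.zero_mem], by simp⟩
    | add x y _ _ hx hy =>
      obtain ⟨m, G, hG, e⟩ := hx
      obtain ⟨n, H, hH, e'⟩ := hy
      have hX : ∀ m i, (X ^ m : Q[X]).coeff i ∈ S := fun m i => by
        rw [coeff_X_pow]; split_ifs; exacts [S.one_mem, S.zero_mem]
      refine ⟨m + n, G * X ^ n + H * X ^ m, fun i => ?_, ?_⟩
      · rw [coeff_add]; exact S.add_mem (mul_coeff_mem hG (hX n) i) (mul_coeff_mem hH (hX m) i)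
      · simp only [eval_add, eval_mul, eval_pow, eval_X, ← e, ← e']; ring
    | neg x _ hx =>
      obtain ⟨m, G, hG, e⟩ := hx
      exact ⟨m, -G, fun i => by rw [coeff_neg]; exact S.neg_mem (hG i), by simp [← e]⟩
    | mul x y _ _ hx hy =>
      obtain ⟨m, G, hG, e⟩ := hx
      obtain ⟨n, H, hH, e'⟩ := hy
      exact ⟨m + n, G * H, mul_coeff_mem hG hH, by rw [eval_mul, ← e, ← e']; ring⟩
end

section
structure IM (v : Valuation Q Γ) (S : Subfield Q) (Y : Q) : Prop where
  imm : ∀ z ∈ adj S Y, z ≠ 0 → ∃ c ∈ S, v z = v c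
  tr : ∀ z, IsAlgebraic S z → Y ≠ z

def Disc (v : Valuation Q Γ) (S : Subfield Q) (Y a b : Q) : Prop :=
  a ∈ S ∧ b ∈ S ∧ b ≠ 0 ∧ v (Y - a) ≤ v b

def Ev (v : Valuation Q Γ) (S : Subfield Q) (Y : Q) (P : Q → Q → Prop) : Prop :=
  ∃ b, (∃ a, Disc v S Y a b) ∧ ∀ a' b', Disc v S Y a' b' → v b' ≤ v b → P a' b'

variable {v : Valuation Q Γ} {S : Subfield Q} {Y : Q} {P P' : Q → Q → Prop} {p : ℕ}

lemma Ev.and (h : Ev v S Y P) (h' : Ev v S Y P') : Ev v S Y fun a b => P a b ∧ P' a b := by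
  obtain ⟨b, hb, h1⟩ := h
  obtain ⟨b', hb', h2⟩ := h'
  rcases le_total (v b) (v b') with hle | hle
  · exact ⟨b, hb, fun a c hc hl => ⟨h1 a c hc hl, h2 a c hc (hl.trans hle)⟩⟩
  · exact ⟨b', hb', fun a c hc hl => ⟨h1 a c hc (hl.trans hle), h2 a c hc hl⟩⟩

lemma Ev.mono (h : Ev v S Y P) (hP : ∀ a b, Disc v S Y a b → P a b → P' a b) : Ev v S Y P' := by
  obtain ⟨b, hb, h1⟩ := h
  exact ⟨b, hb, fun a' b' hd hl => hP _ _ hd (h1 a' b' hd hl)⟩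

lemma Ev.ex (h : Ev v S Y P) : ∃ a b, Disc v S Y a b ∧ P a b := by
  obtain ⟨b, ⟨a, ha⟩, h1⟩ := h
  exact ⟨a, b, ha, h1 a b ha le_rfl⟩

lemma isAlg_mem {S : Subfield Q} {z : Q} (hz : z ∈ S) : IsAlgebraic S z :=
  isAlgebraic_algebraMap (⟨z, hz⟩ : S)

lemma IM.ev (h : IM v S Y) (hP : ∀ a b, Disc v S Y a b → P a b) : Ev v S Y P := by
  have h0 : Y ≠ 0 := h.tr 0 isAlgebraic_zero
  obtain ⟨c, hc, e⟩ := h.imm Y (mem_adj S Y) h0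
  refine ⟨c, ⟨0, S.zero_mem, hc, ?_, by simp [e]⟩, fun a b hd _ => hP a b hd⟩
  rintro rfl; simp [h0] at e

lemma Ev.list (h : IM v S Y) {ι : Type*} (s : Finset ι) (R : ι → Q → Q → Prop)
    (hR : ∀ i ∈ s, Ev v S Y (R i)) : Ev v S Y fun a b => ∀ i ∈ s, R i a b := by
  classical
  induction s using Finset.induction_on with
  | empty => exact h.ev (by simp)
  | insert i s hi ih =>
    refine ((hR i (by simp)).and (ih fun j hj => hR j (by simp [hj]))).mono fun a b _ hh j hj => ?_
    rcases Finset.mem_insert.1 hj with rfl | hj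
    exacts [hh.1, hh.2 j hj]

lemma IM.root (h : IM v S Y) (hB : Base v S p) {ρ : Q} (hρ : IsAlgebraic S ρ) :
    Ev v S Y fun a b => v b < v (a - ρ) := by
  have h0 : Y - ρ ≠ 0 := sub_ne_zero.2 (h.tr ρ hρ)
  obtain ⟨a1, ha1, hl⟩ := hB.dense ρ hρ _ h0
  have hm : ∀ a ∈ S, Y - a ∈ adj S Y := fun a ha => (adj S Y).sub_mem (mem_adj S Y) (le_adj S Y ha)
  have hn : ∀ a ∈ S, Y - a ≠ 0 := fun a ha => sub_ne_zero.2 (h.tr a (isAlg_mem ha))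
  obtain ⟨c, hc, ec⟩ := h.imm _ (hm a1 ha1) (hn a1 ha1)
  have hc0 : c ≠ 0 := by rintro rfl; rw [map_zero] at ec; exact v.ne_zero_iff.2 (hn a1 ha1) ec
  have hvc : v c ≠ 0 := v.ne_zero_iff.2 hc0
  have e1 : v (Y - a1) = v (Y - ρ) := by
    have : Y - a1 = (Y - ρ) + (ρ - a1) := by ring
    rw [this]; exact v.map_add_eq_of_lt_left hl
  obtain ⟨e, he, hv⟩ := hB.res ((Y - a1) / c) (by rw [map_div₀, ec, div_self hvc])
  have ha : a1 + c * e ∈ S := S.add_mem ha1 (S.mul_mem hc he)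
  obtain ⟨b, hb, eb⟩ := h.imm _ (hm _ ha) (hn _ ha)
  have hb0 : b ≠ 0 := by rintro rfl; rw [map_zero] at eb; exact v.ne_zero_iff.2 (hn _ ha) eb
  have hlt : v b < v (Y - ρ) := by
    have : Y - (a1 + c * e) = ((Y - a1) / c - e) * c := by field_simp; ring
    rw [← eb, this, map_mul, ← e1, ec]
    calc _ < 1 * v c := mul_lt_mul_of_pos_right hv (zero_lt_iff.2 hvc)
      _ = _ := one_mul _
  refine ⟨b, ⟨_, ha, hb, hb0, eb.le⟩, fun a' b' hd hl => ?_⟩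
  have h2 : v (Y - a') < v (Y - ρ) := hd.2.2.2.trans_lt (hl.trans_lt hlt)
  have : a' - ρ = -(Y - a') + (Y - ρ) := by ring
  show v b' < v (a' - ρ)
  rw [this, v.map_add_eq_of_lt_right (by rwa [Valuation.map_neg])]
  exact hl.trans_lt hlt

def Dm (v : Valuation Q Γ) (H : Q[X]) : Prop := H.coeff 0 ≠ 0 ∧ ∀ n, n ≠ 0 → v (H.coeff n) < v (H.coeff 0)

lemma Dm.mul {G H : Q[X]} (hG : Dm v G) (hH : Dm v H) : Dm v (G * H) := by
  have h0 := mul_ne_zero hG.1 hH.1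
  refine ⟨by rwa [mul_coeff_zero], fun n hn => ?_⟩
  rw [mul_coeff_zero, coeff_mul]
  have hle : ∀ {H : Q[X]}, Dm v H → ∀ n, v (H.coeff n) ≤ v (H.coeff 0) := fun hH n => by
    by_cases hn : n = 0
    · rw [hn]
    · exact (hH.2 n hn).le
  refine v.map_sum_lt (v.ne_zero_iff.2 h0) fun x hx => ?_
  rw [map_mul, map_mul]
  by_cases hx1 : x.1 = 0
  · rw [hx1]
    refine mul_lt_mul_of_pos_left (hH.2 _ fun h2 => hn ?_) (zero_lt_iff.2 (v.ne_zero_iff.2 hG.1))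
    rw [← Finset.HasAntidiagonal.mem_antidiagonal.1 hx, hx1, h2]
  · calc _ ≤ v (G.coeff x.1) * v (H.coeff 0) := mul_le_mul_right (hle hH _) _
      _ < _ := mul_lt_mul_of_pos_right (hG.2 _ hx1) (zero_lt_iff.2 (v.ne_zero_iff.2 hH.1))

noncomputable def sb (a b : Q) (G : Q[X]) : Q[X] := G.comp (C a + C b * X)

lemma sb_eval {a b : Q} (hb : b ≠ 0) (G : Q[X]) : (sb a b G).eval ((Y - a) / b) = G.eval Y := by
  rw [sb, eval_comp]; congr 1; simp; field_simp; ring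

lemma sb_coeff (a b : Q) (G : Q[X]) (n : ℕ) : (sb a b G).coeff n = (hasseDeriv n G).eval a * b ^ n := by
  have : sb a b G = (taylor a G).comp (C b * X) := by
    rw [sb, taylor_apply, comp_assoc]; congr 1; simp; ring
  rw [this, comp_C_mul_X_coeff, taylor_coeff]

lemma hasse_mem {S : Subfield Q} {G : Q[X]} (hG : ∀ i, G.coeff i ∈ S) (n i : ℕ) : (hasseDeriv n G).coeff i ∈ S := by
  rw [hasseDeriv_coeff]; exact S.mul_mem (natCast_mem S _) (hG _)

lemma sb_mem {S : Subfield Q} {G : Q[X]} (hG : ∀ i, G.coeff i ∈ S) {a b : Q} (ha : a ∈ S) (hb : b ∈ S) (i : ℕ) :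
    (sb a b G).coeff i ∈ S := by
  rw [sb_coeff]; exact S.mul_mem (eval_mem _ (hasse_mem hG i) a ha) (S.pow_mem hb _)

lemma lift_S {S : Subfield Q} (G : Q[X]) (hG : ∀ i, G.coeff i ∈ S) : ∃ g : S[X], g.map (algebraMap S Q) = G := by
  refine ⟨G.toSubring S.toSubring (fun x hx => ?_), ?_⟩
  · obtain ⟨n, _, rfl⟩ := mem_coeffs_iff.1 hx
    exact hG n
  · ext i; rw [coeff_map]; exact coeff_toSubring _ _ _

lemma root_alg {S : Subfield Q} {G : Q[X]} (hG : ∀ i, G.coeff i ∈ S) (h0 : G ≠ 0) {ρ : Q} (h : G.eval ρ = 0) :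
    IsAlgebraic S ρ := by
  obtain ⟨g, rfl⟩ := lift_S G hG
  refine ⟨g, by rintro rfl; simp at h0, by rwa [aeval_def, ← eval_map]⟩

lemma IM.core [IsAlgClosed Q] (h : IM v S Y) (hB : Base v S p) (G : Q[X]) (hG : ∀ i, G.coeff i ∈ S) (h0 : G ≠ 0) :
    Ev v S Y fun a b => Dm v (sb a b G) := by
  have key : ∀ s : Multiset Q, (∀ ρ ∈ s, IsAlgebraic S ρ) →
      Ev v S Y fun a b => Dm v (sb a b (s.map fun ρ => X - C ρ).prod) := by
    intro s
    induction s using Multiset.induction_on with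
    | empty =>
      intro _
      refine h.ev fun a b _ => ?_
      simp only [Multiset.map_zero, Multiset.prod_zero, sb, one_comp]
      exact ⟨by simp, fun n hn => by simp [coeff_one, hn]⟩
    | cons ρ s ih =>
      intro hs
      refine ((h.root hB (hs ρ (by simp))).and (ih fun r hr => hs r (by simp [hr]))).mono fun a b hd ⟨h1, h2⟩ => ?_
      rw [Multiset.map_cons, Multiset.prod_cons, sb, mul_comp]
      refine Dm.mul ?_ h2
      have e : (X - C ρ : Q[X]).comp (C a + C b * X) = C (a - ρ) + C b * X := by simp; ring
      have hne : a - ρ ≠ 0 := by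
        intro h0; rw [h0, map_zero] at h1; exact not_lt_zero' h1
      rw [e]
      refine ⟨by simpa using hne, fun n hn => ?_⟩
      have e0 : (C (a - ρ) + C b * X : Q[X]).coeff 0 = a - ρ := by simp
      rw [e0, coeff_add, coeff_C_ne_zero hn, zero_add, coeff_C_mul_X]
      split_ifs
      · exact h1
      · simpa [zero_lt_iff] using hne
  have hsp := (IsAlgClosed.splits G).eq_prod_roots
  refine (key G.roots fun ρ hρ => root_alg hG h0 ((mem_roots h0).1 hρ)).mono fun a b _ hd => ?_
  rw [hsp, sb, mul_comp, C_comp]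
  refine Dm.mul ⟨by simpa using h0, fun n hn => ?_⟩ hd
  simpa [coeff_C, hn, zero_lt_iff] using h0

lemma IM.aff (h : IM v S Y) {α β : Q} (hα : α ∈ S) (hβ : β ∈ S) (hv : v (α + β * Y) ≤ 1) :
    Ev v S Y fun a b => v (α + β * a) ≤ 1 ∧ v (β * b) ≤ 1 := by
  by_cases h0 : β = 0
  · subst h0; simp at hv
    exact h.ev fun a b _ => by simpa using hv
  have hvβ : v β ≠ 0 := v.ne_zero_iff.2 h0
  refine ⟨β⁻¹, ⟨-(α / β), S.neg_mem (S.div_mem hα hβ), S.inv_mem hβ, inv_ne_zero h0, ?_⟩, fun a b hd hl => ?_⟩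
  · have : Y - -(α / β) = (α + β * Y) * β⁻¹ := by field_simp; ring
    rw [this, map_mul]; exact mul_le_of_le_one_left' hv
  · have h2 : v (β * b) ≤ 1 := by
      rw [map_mul]
      calc _ ≤ v β * v β⁻¹ := mul_le_mul_right hl _
        _ = 1 := by rw [← map_mul, mul_inv_cancel₀ h0, map_one]
    refine ⟨?_, h2⟩
    have : α + β * a = (α + β * Y) - β * (Y - a) := by ring
    rw [this]
    refine (v.map_sub _ _).trans (max_le hv ?_)
    rw [map_mul] at h2 ⊢
    exact (mul_le_mul_right hd.2.2.2 _).trans h2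

def Cim (S : Subfield Q) : Set Q := {z | z ∈ S ∧ z ≠ 0}
def Aim (v : Valuation Q Γ) (S : Subfield Q) (Y : Q) : Set Q := {z | v z ≤ 1 ∧ ∃ a ∈ S, ∃ b ∈ S, z = a + b * Y}

lemma Disc.le {a b : Q} (hd : Disc v S Y a b) : v ((Y - a) / b) ≤ 1 := by
  rw [map_div₀]; exact div_le_one_of_le₀ hd.2.2.2 zero_le

lemma Disc.mem {a b : Q} (hd : Disc v S Y a b) : (Y - a) / b ∈ Aim v S Y :=
  ⟨hd.le, -a / b, S.div_mem (S.neg_mem hd.1) hd.2.1, b⁻¹, S.inv_mem hd.2.1, by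
    have := hd.2.2.1; field_simp; ring⟩

lemma IM.sys [IsAlgClosed Q] (h : IM v S Y) (hB : Base v S p) : Sys v S Y (Cim S) (Aim v S Y) := by
  constructor
  · exact fun c hc => hc.2
  · exact ⟨S.one_mem, one_ne_zero⟩
  · exact fun c hc d hd => ⟨S.mul_mem hc.1 hd.1, mul_ne_zero hc.2 hd.2⟩
  · exact fun c hc => ⟨S.inv_mem hc.1, inv_ne_zero hc.2⟩
  · exact fun c hc => le_adj S Y hc.1
  · exact fun c hc h1 => ⟨h1, c, hc.1, 0, S.zero_mem, by simp⟩
  · exact fun c hc h1 => ⟨h1, c, hc, 0, S.zero_mem, by simp⟩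
  · exact fun a ha => ha.1
  · rintro _ ⟨_, a, ha, b, hb, rfl⟩
    exact (adj S Y).add_mem (le_adj S Y ha) ((adj S Y).mul_mem (le_adj S Y hb) (mem_adj S Y))
  · intro G hG h0
    obtain ⟨a, b, hd, hm⟩ := (h.core hB G hG (by rintro rfl; simp at h0)).ex
    have hb := hd.2.2.1
    have e := sb_eval (Y := Y) (a := a) hb G
    set H := sb a b G
    have hx := hd.le
    have hHS : ∀ i, H.coeff i ∈ S := sb_mem hG hd.1 hd.2.1
    have hv0 : v (H.coeff 0) ≠ 0 := v.ne_zero_iff.2 hm.1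
    have hle : ∀ n, v (H.coeff n) ≤ v (H.coeff 0) := fun n => by
      by_cases hn : n = 0
      · rw [hn]
      · exact (hm.2 n hn).le
    refine ⟨H.coeff 0, ⟨hHS 0, hm.1⟩, ?_, ?_⟩
    · rw [← e, eval_eq_sum_range, Finset.sum_range_succ', add_comm, v.map_add_eq_of_lt_left]
      · simp
      · refine v.map_sum_lt (by simpa using hm.1) fun i _ => ?_
        rw [map_mul, map_pow, pow_zero, mul_one]
        exact (mul_le_of_le_one_right' (pow_le_one' hx _)).trans_lt (hm.2 _ (by simp))
    · rw [← e, eval_eq_sum_range, Finset.sum_div]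
      refine sum_mem fun i _ => ?_
      rw [mul_div_right_comm]
      refine mul_mem (Subring.subset_closure ⟨?_, _, S.div_mem (hHS i) (hHS 0), 0, S.zero_mem, by simp⟩)
        (pow_mem (Subring.subset_closure hd.mem) i)
      rw [map_div₀]; exact div_le_one_of_le₀ (hle i) zero_le
  · intro r hr
    suffices ∃ G : Q[X], (∀ i, G.coeff i ∈ S) ∧ r = G.eval Y by
      obtain ⟨G, hG, e⟩ := this
      exact ⟨1, ⟨S.one_mem, one_ne_zero⟩, G, hG, by rw [mul_one, e]⟩
    induction hr using Subring.closure_induction with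
    | mem x hx =>
      obtain ⟨_, a, ha, b, hb, rfl⟩ := hx
      refine ⟨C a + C b * X, fun i => ?_, by simp⟩
      rw [coeff_add, coeff_C, coeff_C_mul_X]
      refine S.add_mem ?_ ?_ <;> split_ifs <;> first | assumption | exact S.zero_mem
    | zero => exact ⟨0, by simp, by simp⟩
    | one => exact ⟨1, fun i => by rw [coeff_one]; split_ifs; exacts [S.one_mem, S.zero_mem], by simp⟩
    | add x y _ _ hx hy =>
      obtain ⟨G, hG, e⟩ := hx
      obtain ⟨H, hH, e'⟩ := hy
      exact ⟨G + H, fun i => by rw [coeff_add]; exact S.add_mem (hG i) (hH i), by rw [eval_add, e, e']⟩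
    | neg x _ hx =>
      obtain ⟨G, hG, e⟩ := hx
      exact ⟨-G, fun i => by rw [coeff_neg]; exact S.neg_mem (hG i), by simp [← e]⟩
    | mul x y _ _ hx hy =>
      obtain ⟨G, hG, e⟩ := hx
      obtain ⟨H, hH, e'⟩ := hy
      exact ⟨G * H, mul_coeff_mem hG hH, by rw [eval_mul, e, e']⟩
end

section
structure Good (v : Valuation Q Γ) (S : Subfield Q) (Y : Q) (L : Subfield Q) : Prop where
  le : adj S Y ≤ L
  fin : ∃ s : Set Q, s.Finite ∧ L = Subfield.closure (S ∪ s)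
  skew : ∀ σ Δ, Skew v S L σ Δ → σ Y = Y → Δ Y = 0 → ∀ z ∈ L, Δ z = 0

variable {v : Valuation Q Γ} {S L M : Subfield Q} {Y : Q} {p : ℕ} {σ Δ : Q → Q}

namespace HomOn
lemma zero (h : HomOn L σ) : σ 0 = 0 := map_zero h.toHom
lemma neg (h : HomOn L σ) {z : Q} (hz : z ∈ L) : σ (-z) = -σ z := map_neg h.toHom ⟨z, hz⟩
lemma sub (h : HomOn L σ) {z w : Q} (hz : z ∈ L) (hw : w ∈ L) : σ (z - w) = σ z - σ w :=
  map_sub h.toHom ⟨z, hz⟩ ⟨w, hw⟩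
lemma inv (h : HomOn L σ) {z : Q} (hz : z ∈ L) : σ (z⁻¹) = (σ z)⁻¹ := map_inv₀ h.toHom ⟨z, hz⟩
lemma div (h : HomOn L σ) {z w : Q} (hz : z ∈ L) (hw : w ∈ L) : σ (z / w) = σ z / σ w :=
  map_div₀ h.toHom ⟨z, hz⟩ ⟨w, hw⟩
lemma pow (h : HomOn L σ) {z : Q} (hz : z ∈ L) (n : ℕ) : σ (z ^ n) = σ z ^ n := map_pow h.toHom ⟨z, hz⟩ n
lemma zpow (h : HomOn L σ) {z : Q} (hz : z ∈ L) (n : ℤ) : σ (z ^ n) = σ z ^ n := map_zpow₀ h.toHom ⟨z, hz⟩ n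
lemma ne (h : HomOn L σ) {z : Q} (hz : z ∈ L) (h0 : z ≠ 0) : σ z ≠ 0 := by
  have := (map_ne_zero h.toHom (a := ⟨z, hz⟩)).2 (fun h => h0 (congrArg Subtype.val h))
  exact this

lemma fix (h : HomOn L σ) {s : Set Q} (hs : Subfield.closure s ≤ L) (hf : ∀ z ∈ s, σ z = z) :
    ∀ z ∈ Subfield.closure s, σ z = z := by
  intro z hz
  induction hz using Subfield.closure_induction with
  | mem x hx => exact hf x hx
  | one => exact h.one
  | add x y hx hy ex ey => rw [h.add _ (hs hx) _ (hs hy), ex, ey]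
  | neg x hx ex => rw [h.neg (hs hx), ex]
  | inv x hx ex => rw [h.inv (hs hx), ex]
  | mul x y hx hy ex ey => rw [h.mul _ (hs hx) _ (hs hy), ex, ey]
end HomOn

namespace Skew
lemma mono (h : Skew v S L σ Δ) (hM : M ≤ L) (hS : S ≤ M) : Skew v S M σ Δ :=
  ⟨hS, h.hom.mono hM, h.fixS, fun z hz w hw => h.dadd z (hM hz) w (hM hw),
    fun z hz w hw => h.dmul z (hM hz) w (hM hw), h.dS, fun z hz => h.cong z (hM hz)⟩

lemma sub1 (h : Skew v S L σ Δ) : Skew v S L σ fun z => σ z - z where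
  le := h.le
  hom := h.hom
  fixS := h.fixS
  cong := h.cong
  dS z hz := by rw [h.fixS z hz, sub_self]
  dadd z hz w hw := by rw [h.hom.add z hz w hw]; ring
  dmul z hz w hw := by rw [h.hom.mul z hz w hw]; ring

lemma killed (h : Skew v S L σ Δ) {s : Set Q} (hs : Subfield.closure s ≤ L) (hf : ∀ z ∈ s, Δ z = 0) :
    ∀ z ∈ Subfield.closure s, Δ z = 0 := by
  intro z hz
  have h1 : Δ 1 = 0 := h.dS 1 S.one_mem
  induction hz using Subfield.closure_induction with
  | mem x hx => exact hf x hx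
  | one => exact h1
  | add x y hx hy ex ey => rw [h.dadd _ (hs hx) _ (hs hy), ex, ey, add_zero]
  | neg x hx ex =>
    have := h.dadd x (hs hx) (-x) (L.neg_mem (hs hx))
    rw [add_neg_cancel, h.dS 0 S.zero_mem, ex, zero_add] at this
    exact this.symm
  | inv x hx ex =>
    by_cases h0 : x = 0
    · rw [h0, inv_zero]; exact h.dS 0 S.zero_mem
    have := h.dmul x (hs hx) x⁻¹ (L.inv_mem (hs hx))
    rw [mul_inv_cancel₀ h0, h1, ex, mul_zero, add_zero] at this
    exact (mul_eq_zero.1 this.symm).resolve_left (h.hom.ne (hs hx) h0)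
  | mul x y hx hy ex ey => rw [h.dmul _ (hs hx) _ (hs hy), ex, ey]; simp
end Skew

lemma sep_int {K E : Type*} [Field K] [Field E] [Algebra K E] (N : IntermediateField K E)
    (h : Algebra.IsSeparable K N) {z : E} (hz : z ∈ N) : IsSeparable K z := by
  have h1 := Algebra.IsSeparable.isSeparable K (⟨z, hz⟩ : N)
  exact IsSeparable.map (K := N) (x := ⟨z, hz⟩) N.val N.val.injective h1

section
variable {C A : Set Q}

lemma Sys.val (h : Sys v S Y C A) {z : Q} (hz : IsAlgebraic (adj S Y) z) (h0 : z ≠ 0) :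
    ∃ n : ℕ, 0 < n ∧ ∃ c ∈ C, v z ^ n = v c := by
  obtain ⟨n, hn, c, hc, hc0, e⟩ := torsion v _ z hz h0
  obtain ⟨G, H, hG, hH, hH0, rfl⟩ := adj_frac hc
  have hG0 : G.eval Y ≠ 0 := fun h => by simp [h] at hc0
  obtain ⟨c, hc, e1, -⟩ := h.V G hG hG0
  obtain ⟨d, hd, e2, -⟩ := h.V H hH hH0
  exact ⟨n, hn, c * d⁻¹, h.C_mul _ hc _ (h.C_inv _ hd), by rw [e, map_div₀, map_mul, map_inv₀, e1, e2, div_eq_mul_inv]⟩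

lemma hom_val (h : Sys v S Y C A) (hle : adj S Y ≤ L) (ha : ∀ z ∈ L, IsAlgebraic (adj S Y) z) (hσ : HomOn L σ)
    (hS : ∀ z ∈ S, σ z = z) (hY : σ Y = Y) (hO : ∀ z ∈ L, v z ≤ 1 → v (σ z) ≤ 1) {z : Q} (hz : z ∈ L) :
    v (σ z) = v z := by
  by_cases h0 : z = 0
  · rw [h0, hσ.zero]
  obtain ⟨n, hn, c, hc, e⟩ := h.val (ha z hz) h0
  have hc0 := h.C0 c hc
  have hcL := hle (h.C_adj c hc)
  have hcf : σ c = c := hσ.fix (s := S ∪ {Y}) hle (by rintro z (hz | rfl); exacts [hS z hz, hY]) c (h.C_adj c hc)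
  have hu : v (z ^ n / c) = 1 := by rw [map_div₀, map_pow, e, div_self]; exact v.ne_zero_iff.2 hc0
  have hm : z ^ n / c ∈ L := L.div_mem (L.pow_mem hz n) hcL
  have h1 := hO _ hm hu.le
  have h2 := hO _ (L.inv_mem hm) (by rw [map_inv₀, hu, inv_one])
  rw [hσ.inv hm, map_inv₀] at h2
  rw [hσ.div (L.pow_mem hz n) hcL, hσ.pow hz, hcf] at h1 h2
  have h3 : v (σ z ^ n / c) = 1 := by
    refine le_antisymm h1 ?_
    have hne : v (σ z ^ n / c) ≠ 0 := v.ne_zero_iff.2 (div_ne_zero (pow_ne_zero _ (hσ.ne hz h0)) hc0)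
    exact (inv_le_one₀ (zero_lt_iff.2 hne)).1 h2
  refine val_pow_inj hn ?_
  rw [e, ← map_pow]
  rw [map_div₀, div_eq_one_iff_eq (v.ne_zero_iff.2 hc0)] at h3
  exact h3

lemma hom_cong (hB : Base v S p) (hSL : S ≤ L) (hσ : HomOn L σ)
    (hS : ∀ z ∈ S, σ z = z) (hO : ∀ z ∈ L, v (σ z) = v z) {z : Q} (hz : z ∈ L) (h1 : v z ≤ 1) : v (σ z - z) < 1 := by
  obtain ⟨e, he, hv⟩ := hB.res z h1
  have h2 : v (σ z - e) < 1 := by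
    rw [← hS e he, ← hσ.sub hz (hSL he), hO _ (L.sub_mem hz (hSL he))]; exact hv
  have : σ z - z = (σ z - e) - (z - e) := by ring
  rw [this]; exact (v.map_sub _ _).trans_lt (max_lt h2 hv)

lemma hom_skew (hB : Base v S p) (hSL : S ≤ L) (hσ : HomOn L σ)
    (hS : ∀ z ∈ S, σ z = z) (hO : ∀ z ∈ L, v (σ z) = v z) : Skew v S L σ fun z => σ z - z where
  le := hSL
  hom := hσ
  fixS := hS
  cong _ hz := hom_cong hB hSL hσ hS hO hz
  dS z hz := by rw [hS z hz, sub_self]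
  dadd z hz w hw := by rw [hσ.add z hz w hw]; ring
  dmul z hz w hw := by rw [hσ.mul z hz w hw]; ring

namespace Good

lemma sep (h : Good v S Y L) : Algebra.IsSeparable (adj S Y) (Subfield.extendScalars h.le) ∧
    FiniteDimensional (adj S Y) (Subfield.extendScalars h.le) := by
  set M := adj S Y
  set L' := Subfield.extendScalars h.le
  have hess : Algebra.EssFiniteType M L' := by
    rw [IntermediateField.essFiniteType_iff]
    obtain ⟨s, hs, e⟩ := h.fin
    refine IntermediateField.fg_def.2 ⟨s, hs, ?_⟩
    apply le_antisymm
    · rw [IntermediateField.adjoin_le_iff]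
      intro z hz
      change z ∈ L
      rw [e]; exact Subfield.subset_closure (.inr hz)
    · intro z hz
      change z ∈ L at hz
      rw [e] at hz
      have : Subfield.closure (S ∪ s) ≤ (IntermediateField.adjoin M s).toSubfield := by
        rw [Subfield.closure_le]
        rintro z (hz | hz)
        · exact (IntermediateField.adjoin M s).algebraMap_mem ⟨z, le_adj S Y hz⟩
        · exact IntermediateField.subset_adjoin M s hz
      exact this hz
  have hder : ∀ D : Derivation M L' L', D = 0 := by
    intro D
    let Δ : Q → Q := ext0 (L := L) fun z => ((D z : L') : Q)
    have hΔ : ∀ z : L', Δ z = D z := fun z => ext0_of _ _ z.2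
    have hS0 : ∀ z, ∀ hz : z ∈ M, Δ z = 0 := fun z hz => by
      have := hΔ (algebraMap M L' ⟨z, hz⟩)
      rw [D.map_algebraMap] at this
      exact this
    have hsk : Skew v S L id Δ := by
      refine ⟨(le_adj S Y).trans h.le, ⟨rfl, fun _ _ _ _ => rfl, fun _ _ _ _ => rfl⟩, fun _ _ => rfl, ?_, ?_,
        fun z hz => hS0 z (le_adj S Y hz), fun z _ _ => by simp⟩
      · intro z hz w hw
        have := hΔ (⟨z, hz⟩ + ⟨w, hw⟩)
        rw [map_add] at this
        have e1 := hΔ ⟨z, hz⟩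
        have e2 := hΔ ⟨w, hw⟩
        change Δ (z + w) = _ at this
        rw [this]
        change Δ z = _ at e1
        change Δ w = _ at e2
        rw [e1, e2]; rfl
      · intro z hz w hw
        have := hΔ (⟨z, hz⟩ * ⟨w, hw⟩)
        rw [D.leibniz] at this
        have e1 := hΔ ⟨z, hz⟩
        have e2 := hΔ ⟨w, hw⟩
        change Δ (z * w) = _ at this
        rw [this]
        change Δ z = _ at e1
        change Δ w = _ at e2
        rw [e1, e2]; rfl
    have := h.skew id Δ hsk rfl (hS0 Y (mem_adj S Y))
    ext z
    rw [← hΔ]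
    exact this z z.2
  have hu : Algebra.FormallyUnramified M L' := by
    constructor
    refine subsingleton_of_forall_eq 0 fun w => ?_
    rw [← Module.forall_dual_apply_eq_zero_iff L' w]
    intro f
    have := hder ((KaehlerDifferential.linearMapEquivDerivation M L') f)
    rw [LinearEquiv.map_eq_zero_iff] at this
    rw [this]; rfl
  exact ⟨Algebra.FormallyUnramified.isSeparable M L', Algebra.FormallyUnramified.finite_of_free M L'⟩

lemma isSep (h : Good v S Y L) {z : Q} (hz : z ∈ L) : IsSeparable (adj S Y) z := by
  exact sep_int (Subfield.extendScalars h.le) h.sep.1 hz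

lemma isAlg (h : Good v S Y L) {z : Q} (hz : z ∈ L) : IsAlgebraic (adj S Y) z := (h.isSep hz).isIntegral.isAlgebraic

lemma het [IsAlgClosed Q] (h : Good v S Y L) (hB : Base v S p) (hs : Sys v S Y C A) {z : Q} (hz : z ∈ L) (h1 : v z ≤ 1) :
    Het v L A z := by
  refine (lemD v (adj S Y) L h.le h.sep.2 (fun z hz => h.isSep hz) (fun σ hσ hf hO z hz => ?_) z hz h1).trans' le_rfl
    fun a ha _ h1 => hs.het h.le ha h1
  have hSL := (le_adj S Y).trans h.le
  have hS : ∀ z ∈ S, σ z = z := fun z hz => hf z (le_adj S Y hz)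
  have hY := hf Y (mem_adj S Y)
  have := h.skew σ _ (hom_skew hB hSL hσ hS fun z hz => hom_val hs h.le (fun z hz => h.isAlg hz) hσ hS hY hO hz)
    hY (by simp [hY]) z hz
  exact sub_eq_zero.1 this

end Good

lemma good_of (hle : adj S Y ≤ L) (fin : ∃ s : Set Q, s.Finite ∧ L = Subfield.closure (S ∪ s))
    (hsep : ∀ z ∈ L, IsSeparable (adj S Y) z)
    (rig : ∀ σ, HomOn L σ → (∀ z ∈ S, σ z = z) → σ Y = Y → (∀ z ∈ L, v z ≤ 1 → v (σ z) ≤ 1) → ∀ z ∈ L, σ z = z) :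
    Good v S Y L := by
  refine ⟨hle, fin, fun σ Δ h hY hΔ z hz => ?_⟩
  have hid := rig σ h.hom h.fixS hY fun z hz h1 => h.sle hz h1
  have hM : ∀ z ∈ adj S Y, Δ z = 0 := h.killed (s := S ∪ {Y}) hle (by
    rintro z (hz | rfl); exacts [h.dS z hz, hΔ])
  have hev : ∀ f : (adj S Y)[X], Δ (aeval z f) = aeval z (derivative f) * Δ z := by
    intro f
    induction f using Polynomial.induction_on' with
    | add f g hf hg =>
      have hm : ∀ f : (adj S Y)[X], aeval z f ∈ L := fun f => by
        rw [aeval_eq_sum_range]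
        refine sum_mem fun i _ => ?_
        rw [Algebra.smul_def]; exact L.mul_mem (hle (f.coeff i).2) (L.pow_mem hz i)
      rw [map_add, h.dadd _ (hm f) _ (hm g), hf, hg, map_add, map_add, add_mul]
    | monomial n a =>
      rw [aeval_monomial, derivative_monomial, aeval_monomial,
        h.dmul (algebraMap (adj S Y) Q a) (hle a.2) _ (L.pow_mem hz n), h.dpow z hz, hid z hz,
        hid (algebraMap (adj S Y) Q a) (hle a.2)]
      have e0 : Δ (algebraMap (adj S Y) Q a) = 0 := hM _ a.2
      have e1 : ∑ i ∈ Finset.range n, z ^ i * z ^ (n - 1 - i) = n * z ^ (n - 1) := by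
        rw [Finset.sum_congr rfl (g := fun _ => z ^ (n - 1)) fun i hi => ?_, Finset.sum_const, Finset.card_range, nsmul_eq_mul]
        rw [← pow_add]; congr 1; have := Finset.mem_range.1 hi; omega
      rw [e0, e1, map_mul, map_natCast]
      change (a : Q) * _ + _ = (a : Q) * _ * _ * _
      ring
  have := hev (minpoly (adj S Y) z)
  rw [minpoly.aeval, h.dS 0 S.zero_mem] at this
  exact (mul_eq_zero.1 this.symm).resolve_left ((hsep z hz).aeval_derivative_ne_zero (minpoly.aeval _ _))

end
end

section
variable {v : Valuation Q Γ} {S L M N : Subfield Q} {Y θ : Q} {p : ℕ} {σ Δ : Q → Q} {C A : Set Q}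

lemma alg_closure {s : Set Q} (h : ∀ z ∈ s, IsAlgebraic M z) : ∀ z ∈ Subfield.closure s, IsAlgebraic M z := by
  have : Subfield.closure s ≤ (algebraicClosure M Q).toSubfield := by
    rw [Subfield.closure_le]; exact fun z hz => mem_algebraicClosure_iff.2 (h z hz)
  exact fun z hz => mem_algebraicClosure_iff.1 (this hz)

lemma alg_trans (h : ∀ z ∈ N, IsAlgebraic M z) {y : Q} (hy : IsAlgebraic N y) : IsAlgebraic M y := by
  obtain ⟨f, hf, h0⟩ := hy
  have h1 : IsAlgebraic (algebraicClosure M Q).toSubfield y := by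
    refine root_alg (G := f.map (algebraMap N Q)) (fun i => ?_) ?_ (by rwa [eval_map])
    · rw [coeff_map]; exact mem_algebraicClosure_iff.2 (h _ (f.coeff i).2)
    · exact (Polynomial.map_ne_zero_iff (algebraMap N Q).injective).2 hf
  have h2 : IsIntegral (algebraicClosure M Q) y := h1.isIntegral
  exact (isIntegral_trans y h2).isAlgebraic

structure ASx (v : Valuation Q Γ) (p : ℕ) (L : Subfield Q) (θ : Q) : Prop where
  mem : θ ^ p - θ ∈ L
  ex : ∃ τ, HomOn (adj L θ) τ ∧ (∀ z ∈ L, τ z = z) ∧ τ θ = θ + 1 ∧ ∀ z ∈ adj L θ, v z ≤ 1 → v (τ z) ≤ 1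

lemma adj_shift {s : Q} (hs : s ∈ L) : adj L (θ - s) = adj L θ := by
  apply le_antisymm
  · exact adj_le (le_adj L θ) ((adj L θ).sub_mem (mem_adj L θ) (le_adj L θ hs))
  · refine adj_le (le_adj L _) ?_
    have := (adj L (θ - s)).add_mem (mem_adj L (θ - s)) (le_adj L _ hs)
    rwa [sub_add_cancel] at this

lemma ASx.shift [Fact p.Prime] [CharP Q p] (h : ASx v p L θ) {s : Q} (hs : s ∈ L) : ASx v p L (θ - s) := by
  refine ⟨?_, ?_⟩
  · have : (θ - s) ^ p - (θ - s) = (θ ^ p - θ) - (s ^ p - s) := by rw [sub_pow_char]; ring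
    rw [this]; exact L.sub_mem h.mem (L.sub_mem (L.pow_mem hs p) hs)
  · rw [adj_shift hs]
    obtain ⟨τ, h1, h2, h3, h4⟩ := h.ex
    refine ⟨τ, h1, h2, ?_, h4⟩
    rw [h1.sub (mem_adj L θ) (le_adj L θ hs), h3, h2 s hs]; ring

lemma ASx.alg [Fact p.Prime] (h : ASx v p L θ) (hL : ∀ z ∈ L, IsAlgebraic M z) : ∀ z ∈ adj L θ, IsAlgebraic M z := by
  refine alg_closure ?_
  rintro z (hz | rfl)
  · exact hL z hz
  refine alg_trans hL (root_alg (G := X ^ p - X - Polynomial.C (z ^ p - z)) (fun i => ?_) ?_ (by simp))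
  · rw [coeff_sub, coeff_sub, coeff_X_pow, coeff_X, coeff_C]
    refine L.sub_mem (L.sub_mem ?_ ?_) ?_ <;> split_ifs <;>
      first | exact L.one_mem | exact L.zero_mem | exact h.mem
  · intro h0
    have := congrArg (fun f => f.coeff p) h0
    have hp := (Fact.out : p.Prime)
    simp only [coeff_sub, coeff_X_pow, coeff_X, coeff_C, hp.ne_zero, hp.one_lt.ne, if_true, if_false, coeff_zero] at this
    simp at this

lemma val_as_le [Fact p.Prime] (h : v (θ ^ p - θ) ≤ 1) : v θ ≤ 1 := by
  by_contra! h1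
  have hp := (Fact.out : p.Prime)
  have h2 : v θ < v (θ ^ p) := by
    rw [map_pow]; exact lt_self_pow₀ h1 hp.one_lt
  have h3 : v (θ ^ p - θ) = v (θ ^ p) := by
    rw [sub_eq_add_neg]; exact v.map_add_eq_of_lt_left (by rwa [Valuation.map_neg])
  rw [h3] at h
  exact absurd (h1.trans h2) (not_lt.2 h)

lemma ASx.big [Fact p.Prime] (h : ASx v p L θ) (hB : Base v S p) (hs : Sys v S Y C A) (hG : Good v S Y L) :
    1 < v (θ ^ p - θ) := by
  by_contra! h1
  have h2 := val_as_le h1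
  obtain ⟨τ, t1, t2, t3, t4⟩ := h.ex
  have hSL := (le_adj S Y).trans hG.le
  have h5 := hom_cong hB (hSL.trans (le_adj L θ)) t1 (fun z hz => t2 z (hSL hz)) (fun z hz => hom_val hs
    (hG.le.trans (le_adj L θ)) (h.alg fun z hz => hG.isAlg hz) t1 (fun z hz => t2 z (hSL hz)) (t2 Y (hG.le (mem_adj S Y)))
    t4 hz) (mem_adj L θ) h2
  rw [t3, add_sub_cancel_left, map_one] at h5
  exact lt_irrefl _ h5

lemma Good.decomp [IsAlgClosed Q] (hG : Good v S Y L) (hB : Base v S p) (hs : Sys v S Y C A) {a : Q} (ha : a ∈ L) :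
    ∃ c ∈ C, ∃ G : Q[X], (∀ i, G.coeff i ∈ S) ∧ ∃ h, Het v L A h ∧ a = G.eval Y / c + h := by
  have : ∃ c ∈ C, v c ≤ 1 ∧ v (c * a) ≤ 1 := by
    by_cases h1 : v a ≤ 1
    · exact ⟨1, hs.C_one, by simp, by simpa⟩
    push Not at h1
    obtain ⟨n, hn, d, hd, e⟩ := hs.val (hG.isAlg ha) (by rintro rfl; simp at h1)
    have h2 : v a ≤ v d := by rw [← e]; exact le_self_pow₀ h1.le hn.ne'
    have h3 : 0 < v d := zero_lt_iff.2 (v.ne_zero_iff.2 (hs.C0 d hd))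
    refine ⟨d⁻¹, hs.C_inv d hd, ?_, ?_⟩
    · rw [map_inv₀]; exact (inv_le_one₀ h3).2 (h1.le.trans h2)
    · rw [map_mul, map_inv₀, mul_comm, ← div_eq_mul_inv]; exact div_le_one_of_le₀ h2 zero_le
  obtain ⟨c, hc, h1, h2⟩ := this
  have hc0 := hs.C0 c hc
  obtain ⟨r, hr, z, hz, e⟩ := hs.dens hB hG.le
    (hG.het hB hs (L.mul_mem (hG.le (hs.C_adj c hc)) ha) h2) hc h1
  obtain ⟨d, hd, G, hG', e2⟩ := hs.lau r hr
  have hd0 := hs.C0 d hd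
  refine ⟨d * c, hs.C_mul d hd c hc, G, hG', z, hz, ?_⟩
  rw [← e2]
  field_simp
  linear_combination e

lemma good_step (hG : Good v S Y L) {Y' : Q} (hY' : Y' ∈ adj L θ)
    (core : ∀ σ Δ, Skew v S (adj L θ) σ Δ → σ Y' = Y' → Δ Y' = 0 → Δ Y = 0 ∧ ((∀ z ∈ L, Δ z = 0) → Δ θ = 0)) :
    Good v S Y' (adj L θ) := by
  have hSL := (le_adj S Y).trans hG.le
  refine ⟨adj_le (hSL.trans (le_adj L θ)) hY', ?_, fun σ Δ h h1 h2 => ?_⟩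
  · obtain ⟨s, hs, e⟩ := hG.fin
    refine ⟨s ∪ {θ}, hs.union (Set.finite_singleton θ), ?_⟩
    apply le_antisymm
    · refine adj_le ?_ (Subfield.subset_closure (.inr (.inr rfl)))
      rw [e]; apply Subfield.closure_mono
      rintro z (hz | hz); exacts [.inl hz, .inr (.inl hz)]
    · rw [Subfield.closure_le]
      rintro z (hz | hz | rfl)
      · exact le_adj L θ (hSL hz)
      · exact le_adj L θ (e ▸ Subfield.subset_closure (.inr hz))
      · exact mem_adj L z
  · have e1 := (core σ _ h.sub1 h1 (by simp [h1])).1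
    have e2 := core σ Δ h h1 h2
    have e3 := hG.skew σ Δ (h.mono (le_adj L θ) hSL) (sub_eq_zero.1 e1) e2.1
    refine h.killed (s := L ∪ {θ}) le_rfl ?_
    rintro z (hz | rfl)
    exacts [e3 z hz, e2.2 e3]

def PL (p : ℕ) [Fact p.Prime] [CharP Q p] (L : Subfield Q) : AddSubgroup Q where
  carrier := {z | ∃ s ∈ L, z = s ^ p - s}
  zero_mem' := ⟨0, L.zero_mem, by simp [(Fact.out : p.Prime).ne_zero]⟩
  add_mem' := by
    rintro _ _ ⟨s, hs, rfl⟩ ⟨t, ht, rfl⟩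
    exact ⟨s + t, L.add_mem hs ht, by rw [add_pow_char]; ring⟩
  neg_mem' := by
    rintro _ ⟨s, hs, rfl⟩
    refine ⟨0 - s, L.sub_mem L.zero_mem hs, ?_⟩
    rw [sub_pow_char, zero_pow (Fact.out : p.Prime).ne_zero]; ring

variable [Fact p.Prime] [CharP Q p]

lemma PL_pow {f : Q} (hf : f ∈ L) (m : ℕ) : f - f ^ p ^ m ∈ PL p L := by
  induction m with
  | zero => simpa using (PL p L).zero_mem
  | succ m ih =>
    have : f ^ p ^ m - f ^ p ^ (m + 1) ∈ PL p L := by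
      rw [← neg_mem_iff]
      exact ⟨f ^ p ^ m, L.pow_mem hf _, by rw [pow_succ p m, pow_mul]; ring⟩
    have h2 := (PL p L).add_mem ih this
    rwa [sub_add_sub_cancel] at h2

lemma coeff_pow_char (g : Q[X]) (n m : ℕ) : (g ^ p ^ m).coeff (n * p ^ m) = g.coeff n ^ p ^ m := by
  rw [← map_iterateFrobenius_expand (p := p), coeff_map, coeff_expand_mul (pow_pos (Fact.out : p.Prime).pos m)]
  rfl

lemma natCast_pow_char (k j : ℕ) : ((k : Q) ^ p ^ j) = k := by
  have := map_natCast (iterateFrobenius Q p j) k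
  rwa [iterateFrobenius_def] at this

lemma choose_char (k j : ℕ) : (((k + 1) * p ^ j).choose (k * p ^ j) : Q) = (k + 1 : ℕ) := by
  have h := coeff_pow_char (p := p) ((X + 1 : Q[X]) ^ (k + 1)) k j
  rw [← pow_mul, coeff_X_add_one_pow, coeff_X_add_one_pow, Nat.choose_succ_self_right, natCast_pow_char] at h
  exact h

noncomputable def uk (p r : ℕ) (H : Q[X]) (k : ℕ) : Q :=
  ∑ j ∈ Finset.range (r + 1), H.coeff (k * p ^ j) ^ p ^ (r - j)
noncomputable def G1 (p r : ℕ) (P : Q[X]) : Q[X] :=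
  ∑ j ∈ Finset.range (r + 1), (hasseDeriv (p ^ j) P) ^ p ^ (r - j)

lemma G1_coeff (r : ℕ) (P : Q[X]) (a b : Q) (k : ℕ) :
    (sb a b (G1 p r P)).coeff (k * p ^ r) * b ^ p ^ r = (k + 1 : ℕ) * uk p r (sb a b P) (k + 1) := by
  have e : sb a b (G1 p r P) = ∑ j ∈ Finset.range (r + 1), (sb a b (hasseDeriv (p ^ j) P)) ^ p ^ (r - j) := by
    rw [G1, sb, sum_comp]; simp only [sb, pow_comp]
  rw [e, finset_sum_coeff, Finset.sum_mul, uk, Finset.mul_sum]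
  refine Finset.sum_congr rfl fun j hj => ?_
  have hj' : j ≤ r := by have := Finset.mem_range.1 hj; omega
  have hr : p ^ r = p ^ j * p ^ (r - j) := by rw [← pow_add]; congr 1; omega
  rw [hr, ← mul_assoc, coeff_pow_char, pow_mul b, ← mul_pow, sb_coeff, sb_coeff]
  have h1 := LinearMap.congr_fun (hasseDeriv_comp (R := Q) (k * p ^ j) (p ^ j)) P
  rw [LinearMap.comp_apply] at h1
  have h2 : k * p ^ j + p ^ j = (k + 1) * p ^ j := by ring
  rw [h1, h2, LinearMap.smul_apply, eval_smul, nsmul_eq_mul, choose_char]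
  rw [← natCast_pow_char (p := p) (Q := Q) (k + 1) (r - j), ← mul_pow, natCast_pow_char]
  congr 1
  have h3 : b ^ ((k + 1) * p ^ j) = b ^ (k * p ^ j) * b ^ p ^ j := by rw [← pow_add, h2]
  rw [h3]; ring

lemma G1_mem {P : Q[X]} (hP : ∀ i, P.coeff i ∈ S) (r i : ℕ) : (G1 p r P).coeff i ∈ S := by
  have hpw : ∀ (f : Q[X]) (n : ℕ), (∀ i, f.coeff i ∈ S) → ∀ i, (f ^ n).coeff i ∈ S := by
    intro f n hf
    induction n with
    | zero => intro i; rw [pow_zero, coeff_one]; split_ifs; exacts [S.one_mem, S.zero_mem]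
    | succ n ih => rw [pow_succ]; exact mul_coeff_mem ih hf
  rw [G1, finset_sum_coeff]
  exact sum_mem fun j _ => hpw _ _ (hasse_mem hP _) i

lemma sum_pow_split {N r : ℕ} (hN : N < p ^ r) (f : ℕ → Q) (hf : ∀ n, N < n → f n = 0) :
    ∑ n ∈ Finset.range (N + 1), f n = f 0 +
      ∑ k ∈ (Finset.range (N + 1)).filter (fun k => ¬ p ∣ k), ∑ j ∈ Finset.range (r + 1), f (k * p ^ j) := by
  have hp := (Fact.out : p.Prime)
  rw [← Finset.add_sum_erase _ _ (show 0 ∈ Finset.range (N + 1) by simp), ← Finset.sum_product']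
  congr 1
  set K := (Finset.range (N + 1)).filter (fun k => ¬ p ∣ k)
  rw [← Finset.sum_image (s := K ×ˢ Finset.range (r + 1)) (g := fun x : ℕ × ℕ => x.1 * p ^ x.2) (f := f)]
  · refine Finset.sum_subset ?_ ?_
    · intro n hn
      obtain ⟨h0, hn⟩ := Finset.mem_erase.1 hn
      have hn := Finset.mem_range.1 hn
      obtain ⟨e, k, hk, he⟩ := Nat.exists_eq_pow_mul_and_not_dvd h0 p hp.ne_one
      have hk0 : 0 < k := Nat.pos_of_ne_zero (by rintro rfl; simp at hk)
      have h1 : p ^ e ≤ n := by rw [he]; exact Nat.le_mul_of_pos_right _ hk0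
      have h2 : k ≤ n := by rw [he]; exact Nat.le_mul_of_pos_left _ (pow_pos hp.pos e)
      have h3 : e < r := (Nat.pow_lt_pow_iff_right hp.one_lt).1 (by omega)
      refine Finset.mem_image.2 ⟨(k, e), Finset.mem_product.2 ⟨?_, Finset.mem_range.2 (show e < r + 1 by omega)⟩, by
        rw [he, mul_comm]⟩
      exact Finset.mem_filter.2 ⟨Finset.mem_range.2 (show k < N + 1 by omega), hk⟩
    · intro n hn hn'
      obtain ⟨x, hx, rfl⟩ := Finset.mem_image.1 hn
      have hk := (Finset.mem_filter.1 (Finset.mem_product.1 hx).1).2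
      have h0 : x.1 * p ^ x.2 ≠ 0 := mul_ne_zero (fun h => hk (h ▸ dvd_zero p)) (pow_pos hp.pos _).ne'
      apply hf
      simp only [Finset.mem_erase, Finset.mem_range, not_and, h0, ne_eq, not_false_eq_true, forall_true_left] at hn'
      omega
  · have key : ∀ k k' j j' : ℕ, ¬ p ∣ k → j ≤ j' → k * p ^ j = k' * p ^ j' → k = k' ∧ j = j' := by
      intro k k' j j' hk hj h
      obtain ⟨d, rfl⟩ := Nat.exists_eq_add_of_le hj
      rw [pow_add, mul_comm (p ^ j), ← mul_assoc] at h
      have h := Nat.eq_of_mul_eq_mul_right (pow_pos hp.pos j) h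
      rcases Nat.eq_zero_or_pos d with rfl | hd
      · exact ⟨by simpa using h, rfl⟩
      · exact absurd (h ▸ (dvd_pow_self p hd.ne').mul_left k') hk
    rintro ⟨k, j⟩ hx ⟨k', j'⟩ hx' h
    have hk := (Finset.mem_filter.1 (Finset.mem_product.1 hx).1).2
    have hk' := (Finset.mem_filter.1 (Finset.mem_product.1 hx').1).2
    rcases le_total j j' with hj | hj
    · obtain ⟨rfl, rfl⟩ := key k k' j j' hk hj h; rfl
    · obtain ⟨rfl, rfl⟩ := key k' k j' j hk' hj h.symm; rfl
end

section
variable {v : Valuation Q Γ} {S L M N : Subfield Q} {Y θ : Q} {p : ℕ} {σ Δ : Q → Q} {C A : Set Q}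
variable [Fact p.Prime] [CharP Q p]

lemma IM.hets (hI : IM v S Y) {h : Q} (hh : Het v L (Aim v S Y) h) (hL : adj S Y ≤ L) :
    Ev v S Y fun a b => Het v L (S ∪ {(Y - a) / b}) h := by
  obtain ⟨l, lf, lL, hl⟩ := hh.finite
  have := Ev.list hI lf.toFinset (fun z a b => z ∈ Aim v S Y → Het v L (S ∪ {(Y - a) / b}) z) ?_
  · refine this.mono fun a b hd hP => ?_
    exact (hl L lL).trans' le_rfl fun z hz _ _ => hP z (by simpa using hz.2) hz.1
  · intro z _
    by_cases hz : z ∈ Aim v S Y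
    · obtain ⟨h1, α, hα, β, hβ, rfl⟩ := hz
      refine (hI.aff hα hβ h1).mono fun a b hd hP _ => ?_
      have hb := hd.2.2.1
      have hSL := (le_adj S Y).trans hL
      have e : α + β * Y = (α + β * a) + (β * b) * ((Y - a) / b) := by field_simp; ring
      rw [e]
      have m1 : α + β * a ∈ S := S.add_mem hα (S.mul_mem hβ hd.1)
      have m2 : β * b ∈ S := S.mul_mem hβ hd.2.1
      refine .add _ _ (.base _ (.inl m1) (hSL m1) hP.1) (.mul _ _ (.base _ (.inl m2) (hSL m2) hP.2)
        (.base _ (.inr rfl) ?_ hd.le))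
      exact L.div_mem (L.sub_mem (hL (mem_adj S Y)) (hSL hd.1)) (hSL hd.2.1)
    · exact hI.ev fun a b _ h => absurd h hz

lemma IM.dom [IsAlgClosed Q] (hI : IM v S Y) (hB : Base v S p) (r : ℕ) {P : Q[X]} (hP : ∀ i, P.coeff i ∈ S) :
    Ev v S Y fun a b => ∀ k, ¬ p ∣ k → k ≠ 1 → v (uk p r (sb a b P) k) < v (uk p r (sb a b P) 1) ∨
      uk p r (sb a b P) k = 0 := by
  have hp := (Fact.out : p.Prime)
  have kne : ∀ k : ℕ, ¬ p ∣ k → (k : Q) ≠ 0 := fun k hk h => hk ((CharP.cast_eq_zero_iff Q p k).1 h)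
  by_cases h0 : G1 p r P = 0
  · refine hI.ev fun a b hd k hk _ => .inr ?_
    obtain ⟨n, rfl⟩ : ∃ n, k = n + 1 := ⟨k - 1, by have : k ≠ 0 := (by rintro rfl; simp at hk); omega⟩
    have := G1_coeff (p := p) r P a b n
    rw [h0, sb, zero_comp, coeff_zero, zero_mul] at this
    exact (mul_eq_zero.1 this.symm).resolve_left (kne _ hk)
  · refine (hI.core hB _ (G1_mem hP r) h0).mono fun a b hd hD k hk hk1 => .inl ?_
    obtain ⟨n, rfl⟩ : ∃ n, k = n + 1 := ⟨k - 1, by have : k ≠ 0 := (by rintro rfl; simp at hk); omega⟩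
    have hb : v b ≠ 0 := v.ne_zero_iff.2 hd.2.2.1
    have e1 := congrArg v (G1_coeff (p := p) r P a b n)
    have e0 := congrArg v (G1_coeff (p := p) r P a b 0)
    rw [map_mul, map_mul, hB.nat _ (kne _ hk), one_mul] at e1
    simp only [map_mul, zero_mul, zero_add, Nat.cast_one, map_one, one_mul] at e0
    rw [← e1, ← e0]
    refine mul_lt_mul_of_pos_right (hD.2 _ ?_) (zero_lt_iff.2 ?_)
    · exact mul_ne_zero (by omega) (pow_pos hp.pos r).ne'
    · rw [map_pow]; exact pow_ne_zero _ hb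

lemma eval_split [IsAlgClosed Q] (hB : Base v S p) (hSL : S ≤ L) {H : Q[X]} (hH : ∀ i, H.coeff i ∈ S) {n r : ℕ}
    (hd : H.natDegree ≤ n) (hr : n < p ^ r) {x : Q} (hx : x ∈ L) {w : ℕ → Q} (hw : ∀ k, w k ∈ S) :
    H.eval x - ∑ k ∈ (Finset.range (n + 1)).filter (fun k => ¬ p ∣ k),
      (w k * x ^ k + (uk p r H k - w k ^ p ^ r) * x ^ (k * p ^ r)) ∈ PL p L := by
  have hp := (Fact.out : p.Prime)
  rw [eval_eq_sum_range' (show H.natDegree < n + 1 by omega), sum_pow_split hr (fun k => H.coeff k * x ^ k) fun k hk => by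
    rw [coeff_eq_zero_of_natDegree_lt (by omega), zero_mul]]
  simp only [pow_zero, mul_one]
  rw [add_sub_assoc, ← Finset.sum_sub_distrib]
  refine (PL p L).add_mem ?_ (sum_mem fun k hk => ?_)
  · obtain ⟨s, hs, e⟩ := hB.as hp _ (hH 0)
    exact ⟨s, hSL hs, e.symm⟩
  · have h1 : ∑ j ∈ Finset.range (r + 1), (H.coeff (k * p ^ j) * x ^ (k * p ^ j) -
        H.coeff (k * p ^ j) ^ p ^ (r - j) * x ^ (k * p ^ r)) ∈ PL p L := by
      refine sum_mem fun j hj => ?_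
      have hj' : j ≤ r := by have := Finset.mem_range.1 hj; omega
      have h2 := PL_pow (p := p) (L.mul_mem (hSL (hH (k * p ^ j))) (L.pow_mem hx (k * p ^ j))) (r - j)
      have h3 : k * p ^ r = k * p ^ j * p ^ (r - j) := by
        rw [mul_assoc, ← pow_add]; congr 2; omega
      rwa [mul_pow, ← pow_mul, ← h3] at h2
    rw [Finset.sum_sub_distrib, ← Finset.sum_mul] at h1
    have h4 := PL_pow (p := p) (L.mul_mem (hSL (hw k)) (L.pow_mem hx k)) r
    rw [mul_pow, ← pow_mul] at h4
    have := (PL p L).sub_mem h1 h4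
    refine (congrArg (· ∈ PL p L) ?_).mp this
    rw [uk]; ring

lemma im_step [IsAlgClosed Q] (hB : Base v S p) (hI : IM v S Y) (hG : Good v S Y L) (hx : ASx v p L θ) :
    ∃ Y', IM v S Y' ∧ Good v S Y' (adj L θ) := by
  have hp := (Fact.out : p.Prime)
  have hs := hI.sys hB
  have hSL := (le_adj S Y).trans hG.le
  obtain ⟨c, hc, G, hGS, h, hh, ea⟩ := hG.decomp hB hs hx.mem
  set P : Q[X] := Polynomial.C c⁻¹ * G with hPdef
  have hPS : ∀ i, P.coeff i ∈ S := fun i => by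
    rw [hPdef, coeff_C_mul]; exact S.mul_mem (S.inv_mem hc.1) (hGS i)
  have ea : θ ^ p - θ = P.eval Y + h := by rw [ea, hPdef, eval_mul, eval_C]; ring
  set n := P.natDegree + 1
  obtain ⟨r, hr⟩ : ∃ r, n < p ^ r := ⟨n, Nat.lt_pow_self hp.one_lt⟩
  obtain ⟨a0, b, hd, hD, hh'⟩ := ((hI.dom hB r hPS).and (hI.hets hh hG.le)).ex
  set x := (Y - a0) / b with hxdef
  have hb0 := hd.2.2.1
  have hxL : x ∈ L := L.div_mem (L.sub_mem (hG.le (mem_adj S Y)) (hSL hd.1)) (hSL hd.2.1)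
  have hx1 : v x ≤ 1 := hd.le
  set H := sb a0 b P with hHdef
  have hHS : ∀ i, H.coeff i ∈ S := sb_mem hPS hd.1 hd.2.1
  have hHd : H.natDegree ≤ n := by
    rw [hHdef, sb]
    refine natDegree_comp_le.trans ?_
    have : (Polynomial.C a0 + Polynomial.C b * X : Q[X]).natDegree ≤ 1 := by compute_degree
    calc _ ≤ P.natDegree * 1 := Nat.mul_le_mul_left _ this
      _ ≤ n := by omega
  have huS : ∀ k, uk p r H k ∈ S := fun k => sum_mem fun j _ => S.pow_mem (hHS _) _
  choose w hwS hw using fun k => hB.proot r _ (huS k)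
  set K := (Finset.range (n + 1)).filter (fun k => ¬ p ∣ k)
  have h1K : 1 ∈ K := Finset.mem_filter.2 ⟨Finset.mem_range.2 (by omega), by simpa using hp.ne_one⟩
  obtain ⟨s, hsL, es⟩ := eval_split hB hSL hHS hHd hr hxL hwS
  rw [hHdef, hxdef, sb_eval hb0, ← hxdef, ← hHdef, Finset.sum_add_distrib] at es
  set h' := h + ∑ k ∈ K, (uk p r H k - w k ^ p ^ r) * x ^ (k * p ^ r) with hh'def
  have het' : Het v L (S ∪ {x}) h' := by
    refine .add _ _ hh' (Het.sum _ _ fun k _ => .mul _ _ ?_ (Het.pow (.base _ (.inr rfl) hxL hx1) _))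
    have : uk p r H k - w k ^ p ^ r ∈ S := S.sub_mem (huS k) (S.pow_mem (hwS k) _)
    exact .base _ (.inl this) (hSL this) (by rw [Valuation.map_sub_swap]; exact hw k)
  have hx' := hx.shift hsL
  set θ' := θ - s with hθ'
  have eθ : θ' ^ p - θ' = ∑ k ∈ K, w k * x ^ k + h' := by
    have : θ' ^ p - θ' = (θ ^ p - θ) - (s ^ p - s) := by rw [hθ', sub_pow_char]; ring
    rw [this, ea, ← es, hh'def]; ring
  have big := hx'.big hB hs hG
  have hpr : p ^ r ≠ 0 := (pow_pos hp.pos r).ne'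
  have hu1 : 1 < v (uk p r H 1) := by
    by_contra! hu
    refine not_lt.2 ?_ big
    rw [eθ]
    refine v.map_add_le (v.map_sum_le fun k hk => ?_) het'.le_one
    rw [map_mul, map_pow]
    refine mul_le_one' ?_ (pow_le_one' hx1 _)
    have huk : v (uk p r H k) ≤ 1 := by
      by_cases hk1 : k = 1
      · rw [hk1]; exact hu
      · rcases hD k (Finset.mem_filter.1 hk).2 hk1 with h | h
        · exact h.le.trans hu
        · rw [h]; simp
    refine (pow_le_one_iff hpr).1 ?_
    rw [← map_pow, ← sub_add_cancel (w k ^ p ^ r) (uk p r H k)]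
    exact v.map_add_le (hw k) huk
  have hw1 : v (w 1) ^ p ^ r = v (uk p r H 1) := by
    rw [← map_pow, ← sub_add_cancel (w 1 ^ p ^ r) (uk p r H 1)]
    exact v.map_add_eq_of_lt_right ((hw 1).trans_lt hu1)
  have hw1' : 1 < v (w 1) := by
    by_contra! hc
    exact not_lt.2 (pow_le_one' hc (p ^ r)) (hw1 ▸ hu1)
  have hwk : ∀ k ∈ K, k ≠ 1 → v (w k) < v (w 1) := by
    intro k hk hk1
    refine lt_of_pow_lt_pow_left₀ (p ^ r) zero_le ?_
    rw [hw1, ← map_pow, ← sub_add_cancel (w k ^ p ^ r) (uk p r H k)]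
    refine v.map_add_lt ((hw k).trans_lt hu1) ?_
    rcases hD k (Finset.mem_filter.1 hk).2 hk1 with h | h
    · exact h
    · rw [h, map_zero]; exact zero_lt_one.trans hu1
  have ead : adj L θ' = adj L θ := adj_shift hsL
  have gd : Good v S θ' (adj L θ) := by
    refine good_step hG (ead ▸ mem_adj L θ') fun σ Δ hS hσ h0 => ?_
    have inL : ∀ {z}, z ∈ L → z ∈ adj L θ := fun hz => le_adj L θ hz
    have hθm : θ' ∈ adj L θ := ead ▸ mem_adj L θ'
    have dS : ∀ c ∈ S, ∀ z ∈ adj L θ, Δ (c * z) = c * Δ z := fun c hc z hz => by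
      rw [hS.dmul c (inL (hSL hc)) z hz, hS.fixS c hc, hS.dS c hc, mul_zero, add_zero]
    have hh'L : h' ∈ L := het'.mem
    have e1 : θ' ^ p = (∑ k ∈ K, w k * x ^ k) + h' + θ' := by rw [← eθ]; ring
    have mk : ∀ k, w k * x ^ k ∈ adj L θ := fun k => inL (L.mul_mem (hSL (hwS k)) (L.pow_mem hxL k))
    have e2 := congrArg Δ e1
    rw [hS.dpow θ' hθm, h0, zero_mul, hS.dadd _ ((adj L θ).add_mem (sum_mem fun k _ => mk k) (inL hh'L)) _ hθm, h0,
      add_zero, hS.dadd _ (sum_mem fun k _ => mk k) _ (inL hh'L), hS.dsum _ _ fun k _ => mk k,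
      ← Finset.add_sum_erase _ _ h1K, pow_one, dS _ (hwS 1) _ (inL hxL)] at e2
    have hx0 : Δ x = 0 := by
      by_contra hne
      have hvne : v (Δ x) ≠ 0 := v.ne_zero_iff.2 hne
      have b1 : v (Δ h') ≤ v (Δ x) := by
        refine hS.lip (A := S ∪ {x}) _ ?_ (het'.mono (le_adj L θ) fun a ha _ _ => ha)
        rintro z (hz | rfl) _ _
        · rw [hS.dS z hz, map_zero]; exact zero_le
        · exact le_rfl
      have b2 : v (Δ x) < v (w 1 * Δ x) := by
        rw [map_mul]; exact (lt_mul_iff_one_lt_left (zero_lt_iff.2 hvne)).2 hw1'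
      have b3 : v (∑ k ∈ K.erase 1, Δ (w k * x ^ k)) < v (w 1 * Δ x) := by
        refine v.map_sum_lt ((zero_le.trans_lt b2).ne') fun k hk => ?_
        rw [dS _ (hwS k) _ (inL (L.pow_mem hxL k)), map_mul, map_mul]
        calc _ ≤ v (w k) * v (Δ x) := mul_le_mul_right (hS.dpow_le (inL hxL) hx1 k) _
          _ < _ := mul_lt_mul_of_pos_right (hwk k (Finset.mem_of_mem_erase hk) (Finset.ne_of_mem_erase hk))
              (zero_lt_iff.2 hvne)
      have : w 1 * Δ x = -(∑ k ∈ K.erase 1, Δ (w k * x ^ k) + Δ h') := by linear_combination -e2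
      have h9 : v (w 1 * Δ x) < v (w 1 * Δ x) := by
        conv_lhs => rw [this, Valuation.map_neg]
        exact v.map_add_lt b3 (b1.trans_lt b2)
      exact lt_irrefl _ h9
    refine ⟨?_, fun hk => ?_⟩
    · have : Y = a0 + b * x := by rw [hxdef]; field_simp; ring
      rw [this, hS.dadd _ (inL (hSL hd.1)) _ (inL (L.mul_mem (hSL hd.2.1) hxL)), hS.dS _ hd.1, dS _ hd.2.1 _ (inL hxL),
        hx0]; simp
    · have : θ = θ' + s := by rw [hθ']; ring
      rw [this, hS.dadd _ hθm _ (inL hsL), h0, hk s hsL, add_zero]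
  have hle : adj S θ' ≤ adj L θ := gd.le
  refine ⟨θ', ⟨fun z hz hz0 => ?_, fun z hz ez => ?_⟩, gd⟩
  · obtain ⟨m, hm, d, hd, e⟩ := hs.val (hx.alg (fun z hz => hG.isAlg hz) z (hle hz)) hz0
    exact hB.tors hd.1 hm e
  · subst ez
    have : ∀ y ∈ adj S θ', IsAlgebraic S y := by
      refine alg_closure ?_
      rintro y (hy | rfl)
      exacts [isAlg_mem hy, hz]
    exact hI.tr Y (alg_trans this (gd.isAlg (le_adj L θ (hG.le (mem_adj S Y))))) rfl
end

section
variable {v : Valuation Q Γ} {S L M N : Subfield Q} {Y θ : Q} {p : ℕ} {σ Δ : Q → Q} {C A : Set Q}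

namespace Skew
variable (h : Skew v S L σ Δ)
include h

lemma lmul {z w : Q} (hz : z ∈ L) (hw : w ∈ L) (hz0 : z ≠ 0) (hw0 : w ≠ 0) :
    Δ (z * w) / (z * w) = Δ z / z + σ z / z * (Δ w / w) := by
  rw [h.dmul z hz w hw]; field_simp; ring

lemma lpow {z : Q} (hz : z ∈ L) (hz0 : z ≠ 0) (n : ℕ) :
    Δ (z ^ n) / z ^ n = Δ z / z * ∑ i ∈ Finset.range n, (σ z / z) ^ i := by
  induction n with
  | zero => simp [h.dS 1 S.one_mem]
  | succ n ih =>
    rw [pow_succ', h.lmul hz (L.pow_mem hz n) hz0 (pow_ne_zero _ hz0), ih, Finset.sum_range_succ', pow_zero]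
    simp only [pow_succ, ← Finset.sum_mul]; ring

omit h in
lemma lsum {ρ : Q} (hρ : v (ρ - 1) < 1) (n : ℕ) : v ((∑ i ∈ Finset.range n, ρ ^ i) - n) < 1 := by
  have := cg_sum (v := v) (Finset.range n) (fun i => ρ ^ i) (fun _ => 1) fun i _ => by
    have := cg_pow (v := v) (x := ρ) (y := 1) (by simp) hρ i
    simpa using this
  simpa using this

lemma lpow_nat {z : Q} (hz : z ∈ L) (hz0 : z ≠ 0) (hρ : v (σ z / z - 1) < 1) (n : ℕ) :
    v (Δ (z ^ n) / z ^ n) ≤ v (Δ z / z) ∧ (v (n : Q) = 1 → v (Δ (z ^ n) / z ^ n) = v (Δ z / z)) := by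
  rw [h.lpow hz hz0, map_mul]
  refine ⟨mul_le_of_le_one_right' (cg_le (lsum hρ n) (natCast_mem v.integer n)), fun hn => ?_⟩
  rw [cg_unit (lsum hρ n) hn, mul_one]

lemma linv {z : Q} (hz : z ∈ L) (hz0 : z ≠ 0) (hρ : v (σ z / z - 1) < 1) : v (Δ z⁻¹ / z⁻¹) = v (Δ z / z) := by
  have := h.lmul hz (L.inv_mem hz) hz0 (inv_ne_zero hz0)
  rw [mul_inv_cancel₀ hz0, h.dS 1 S.one_mem, zero_div] at this
  rw [eq_neg_of_add_eq_zero_left this.symm, Valuation.map_neg, map_mul, cg_unit hρ (by simp), one_mul]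

lemma spow {z : Q} (hz : z ∈ L) (hρ : v (σ z / z - 1) < 1) (n : ℕ) :
    v (σ (z ^ n) / z ^ n - 1) < 1 := by
  rw [h.hom.pow hz, ← div_pow]
  simpa using cg_pow (v := v) (y := 1) (by simp) hρ n

lemma lzpow {z : Q} (hz : z ∈ L) (hz0 : z ≠ 0) (hρ : v (σ z / z - 1) < 1) (n : ℤ) :
    v (Δ (z ^ n) / z ^ n) ≤ v (Δ z / z) ∧ (v (n : Q) = 1 → v (Δ (z ^ n) / z ^ n) = v (Δ z / z)) := by
  obtain ⟨m, rfl | rfl⟩ := n.eq_nat_or_neg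
  · simpa using h.lpow_nat hz hz0 hρ m
  · rw [zpow_neg, zpow_natCast, h.linv (L.pow_mem hz m) (pow_ne_zero _ hz0) (h.spow hz hρ m)]
    simpa using h.lpow_nat hz hz0 hρ m
end Skew

variable [Fact p.Prime] [CharP Q p]

lemma Base.proot' [IsAlgClosed Q] (hB : Base v S p) (r : ℕ) (c : Q) (hc : c ∈ S) (y : Q) :
    ∃ w ∈ S, v ((w ^ p ^ r - c) * y) ≤ 1 := by
  by_cases hy : y = 0
  · exact ⟨0, S.zero_mem, by simp [hy]⟩
  have hn : 0 < p ^ r := pow_pos (Fact.out : p.Prime).pos _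
  obtain ⟨t, ht⟩ := IsAlgClosed.exists_pow_nat_eq c hn
  obtain ⟨e, he⟩ := IsAlgClosed.exists_pow_nat_eq y hn
  have he0 : e ≠ 0 := by rintro rfl; rw [zero_pow hn.ne'] at he; exact hy he.symm
  have hra : IsAlgebraic S t := by
    refine IsAlgebraic.of_pow hn ?_
    rw [ht]; exact isAlg_mem hc
  obtain ⟨a, ha, h⟩ := hB.dense t hra e⁻¹ (inv_ne_zero he0)
  refine ⟨a, ha, ?_⟩
  rw [← ht, ← he, ← sub_pow_char_pow, ← mul_pow, map_pow]
  refine pow_le_one' ?_ _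
  rw [map_mul, Valuation.map_sub_swap]
  rw [map_inv₀] at h
  have := mul_lt_mul_of_pos_right h (zero_lt_iff.2 (v.ne_zero_iff.2 he0))
  rw [inv_mul_cancel₀ (v.ne_zero_iff.2 he0)] at this
  exact this.le

def Lau (v : Valuation Q Γ) (p : ℕ) [Fact p.Prime] [CharP Q p] (S L : Subfield Q) (Y z : Q) : Prop :=
  ∃ W : ℤ →₀ Q, (∀ k, W k ∈ S) ∧ (∀ k : ℤ, (p : ℤ) ∣ k → W k = 0) ∧ ∃ h, Het v L (Avt v S Y) h ∧
    z - (W.sum fun k c => c * Y ^ k) - h ∈ PL p L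

lemma Lau.add {z w : Q} (hz : Lau v p S L Y z) (hw : Lau v p S L Y w) : Lau v p S L Y (z + w) := by
  obtain ⟨W, h1, h2, h, h3, h4⟩ := hz
  obtain ⟨W', h1', h2', h', h3', h4'⟩ := hw
  refine ⟨W + W', fun k => S.add_mem (h1 k) (h1' k), fun k hk => ?_, h + h', .add _ _ h3 h3', ?_⟩
  · rw [Finsupp.add_apply, h2 k hk, h2' k hk, add_zero]
  · rw [Finsupp.sum_add_index' (by simp) (by intros; ring)]
    have := (PL p L).add_mem h4 h4'
    refine (congrArg (· ∈ PL p L) ?_).mp this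
    ring

lemma Lau.mono [IsAlgClosed Q] (hB : Base v S p) (hV : VT v S Y) (hL : adj S Y ≤ L) {c : Q} (hc : c ∈ S) (n : ℤ) :
    Lau v p S L Y (c * Y ^ n) := by
  have hp := (Fact.out : p.Prime)
  have hSL := (le_adj S Y).trans hL
  have hYL := hL (mem_adj S Y)
  by_cases hn : n = 0
  · refine ⟨0, fun k => S.zero_mem, fun _ _ => rfl, 0, .zero, ?_⟩
    obtain ⟨s, hs, e⟩ := hB.as hp c hc
    exact ⟨s, hSL hs, by rw [e, hn]; simp⟩
  · obtain ⟨j, k, hk, e⟩ : ∃ (j : ℕ) (k : ℤ), ¬ (p : ℤ) ∣ k ∧ n = k * p ^ j := by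
      obtain ⟨j, k, hk, e⟩ := Nat.exists_eq_pow_mul_and_not_dvd (Int.natAbs_ne_zero.2 hn) p hp.ne_one
      rcases Int.natAbs_eq n with h | h
      · exact ⟨j, k, by rwa [Int.natCast_dvd_natCast], by rw [h, e]; push_cast; ring⟩
      · exact ⟨j, -k, by rwa [dvd_neg, Int.natCast_dvd_natCast], by rw [h, e]; push_cast; ring⟩
    obtain ⟨w, hw, hw1⟩ := hB.proot' j c hc (Y ^ n)
    have hs : c - w ^ p ^ j ∈ S := S.sub_mem hc (S.pow_mem hw _)
    refine ⟨Finsupp.single k w, fun i => ?_, fun i hi => ?_, (c - w ^ p ^ j) * Y ^ n, .base _ ?_ ?_ ?_, ?_⟩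
    · rw [Finsupp.single_apply]; split_ifs; exacts [hw, S.zero_mem]
    · rw [Finsupp.single_apply, if_neg]; rintro rfl; exact hk hi
    · exact ⟨by rwa [← Valuation.map_neg, ← neg_mul, neg_sub], _, hs, n, rfl⟩
    · exact L.mul_mem (hSL hs) (L.zpow_mem hYL n)
    · rwa [← Valuation.map_neg, ← neg_mul, neg_sub]
    · rw [Finsupp.sum_single_index (by simp)]
      have := (PL p L).neg_mem (PL_pow (p := p) (L.mul_mem (hSL hw) (L.zpow_mem hYL k)) j)
      refine (congrArg (· ∈ PL p L) ?_).mp this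
      have e3 : (Y ^ k) ^ p ^ j = Y ^ n := by
        rw [e, ← zpow_natCast, ← zpow_mul]; push_cast; rfl
      rw [mul_pow, e3]; ring

lemma Lau.all [IsAlgClosed Q] (hB : Base v S p) (hV : VT v S Y) (hG : Good v S Y L) {a : Q} (ha : a ∈ L) :
    Lau v p S L Y a := by
  obtain ⟨c, ⟨c0, hc0, hne, m, rfl⟩, G, hGS, h, hh, rfl⟩ := hG.decomp hB hV.sys ha
  have h0 : Lau v p S L Y h := ⟨0, fun k => S.zero_mem, fun _ _ => rfl, h, hh, by simpa using (PL p L).zero_mem⟩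
  refine Lau.add ?_ h0
  have e : G.eval Y / (c0 * Y ^ m) = ∑ i ∈ Finset.range (G.natDegree + 1), (G.coeff i / c0) * Y ^ ((i : ℤ) - m) := by
    rw [eval_eq_sum_range, Finset.sum_div]
    refine Finset.sum_congr rfl fun i _ => ?_
    rw [zpow_sub₀ hV.1, zpow_natCast]; field_simp
  rw [e]
  generalize Finset.range (G.natDegree + 1) = s
  induction s using Finset.induction_on with
  | empty => exact ⟨0, fun k => S.zero_mem, fun _ _ => rfl, 0, .zero, by simpa using (PL p L).zero_mem⟩
  | insert i s hi ih => rw [Finset.sum_insert hi]; exact (Lau.mono hB hV hG.le (S.div_mem (hGS i) hc0) _).add ih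

lemma vt_core (hn : ∀ n : ℕ, (n : Q) ≠ 0 → v (n : Q) = 1) (hS : Skew v S N σ Δ) (hY : Y ∈ N) (hY0 : Y ≠ 0)
    (hθ : θ ∈ N) (hθ0 : θ ≠ 0) {W : ℤ →₀ Q} (hW : ∀ k, W k ∈ S) {h' : Q} (hh : Het v N (Avt v S Y) h')
    (eθ : θ ^ p = θ + ∑ k ∈ W.support, W k * Y ^ k + h') {k0 a b : ℤ} (hk0 : k0 ∈ W.support)
    (hdom : ∀ k ∈ W.support, k ≠ k0 → v (W k * Y ^ k) < v (W k0 * Y ^ k0)) (hM : 1 < v (W k0 * Y ^ k0))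
    (hθM : v θ < v (W k0 * Y ^ k0))
    (hab : a * p + b * k0 = 1) (hσ : σ (Y ^ a * θ ^ b) = Y ^ a * θ ^ b)
    (hΔ : Δ (Y ^ a * θ ^ b) = 0) {U : Q} (hU : U = θ ^ p / (W k0 * Y ^ k0)) (hU1 : v (U - 1) < 1) :
    Δ Y = 0 ∧ Δ θ = 0 := by
  have hp := (Fact.out : p.Prime)
  have hw0 : W k0 ≠ 0 := by simpa using hk0
  have vint : ∀ k : ℤ, ¬ (p : ℤ) ∣ k → v (k : Q) = 1 := fun k h => by
    have : v ((k.natAbs : ℕ) : Q) = 1 := hn _ fun h0 => h (by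
      rw [CharP.cast_eq_zero_iff Q p] at h0; exact Int.natCast_dvd.2 h0)
    rcases Int.natAbs_eq k with e | e <;> rw [e]
    · rwa [Int.cast_natCast]
    · rwa [Int.cast_neg, Valuation.map_neg, Int.cast_natCast]
  have h1p : ¬ (p : ℤ) ∣ 1 := fun h => hp.one_lt.ne' (by
    have := Int.natCast_dvd_natCast.1 (show ((p : ℕ) : ℤ) ∣ ((1 : ℕ) : ℤ) by simpa using h); simpa using this)
  have hk0p : ¬ (p : ℤ) ∣ k0 := fun h => h1p (hab ▸ dvd_add (Dvd.intro_left _ rfl) (h.mul_left b))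
  have hbp : ¬ (p : ℤ) ∣ b := fun h => h1p (hab ▸ dvd_add (Dvd.intro_left _ rfl) (h.mul_right k0))
  have memS : ∀ {c}, c ∈ S → c ∈ N := fun hc => hS.le hc
  have hUN : U ∈ N := hU ▸ N.div_mem (N.pow_mem hθ p) (N.mul_mem (memS (hW k0)) (N.zpow_mem hY k0))
  have vU : v U = 1 := cg_unit hU1 (by simp)
  have hU0 : U ≠ 0 := by rintro rfl; simp at vU
  have rU : v (σ U / U - 1) < 1 := by
    rw [div_sub_one hU0, map_div₀, vU, div_one]; exact hS.cong U hUN vU.le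
  have vρ : v (σ U / U) = 1 := cg_unit rU (by simp)
  have zρ : ∀ n : ℤ, v ((σ U / U) ^ n - 1) < 1 := by
    intro n
    obtain ⟨m, rfl | rfl⟩ := n.eq_nat_or_neg
    · simpa using cg_pow (v := v) (y := 1) (by simp) rU m
    · have h1 : v ((σ U / U) ^ m - 1) < 1 := by simpa using cg_pow (v := v) (y := 1) (by simp) rU m
      have h2 : v ((σ U / U) ^ m) = 1 := by rw [map_pow, vρ, one_pow]
      have h3 : (σ U / U) ^ m ≠ 0 := fun h => by rw [h] at h2; simp at h2
      rw [zpow_neg, zpow_natCast, ← Valuation.map_sub_swap, ← one_div, one_sub_div h3, map_div₀, h2, div_one]; exact h1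
  have e1 : Y = (Y ^ a * θ ^ b) ^ p * (W k0 * U) ^ (-b) := by
    have : W k0 * U = θ ^ (p : ℤ) * Y ^ (-k0) := by
      rw [hU, zpow_neg, zpow_natCast]; field_simp
    rw [this, mul_zpow, mul_pow, ← zpow_natCast (Y ^ a), ← zpow_natCast (θ ^ b), ← zpow_mul, ← zpow_mul, ← zpow_mul, ← zpow_mul]
    have r1 : Y ^ (a * (p : ℤ)) * θ ^ (b * (p : ℤ)) * (θ ^ ((p : ℤ) * -b) * Y ^ (-k0 * -b)) =
      (Y ^ (a * (p : ℤ)) * Y ^ (-k0 * -b)) * (θ ^ (b * (p : ℤ)) * θ ^ ((p : ℤ) * -b)) := by ring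
    rw [r1, ← zpow_add₀ hY0, ← zpow_add₀ hθ0, show a * (p : ℤ) + -k0 * -b = 1 by linarith,
      show b * (p : ℤ) + p * -b = 0 by ring]; simp
  have e2 : θ = (Y ^ a * θ ^ b) ^ k0 * (W k0 * U) ^ a := by
    have : W k0 * U = θ ^ (p : ℤ) * Y ^ (-k0) := by
      rw [hU, zpow_neg, zpow_natCast]; field_simp
    rw [this, mul_zpow, mul_zpow, ← zpow_mul, ← zpow_mul, ← zpow_mul, ← zpow_mul]
    have r1 : Y ^ (a * k0) * θ ^ (b * k0) * (θ ^ ((p : ℤ) * a) * Y ^ (-k0 * a)) =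
      (Y ^ (a * k0) * Y ^ (-k0 * a)) * (θ ^ (b * k0) * θ ^ ((p : ℤ) * a)) := by ring
    rw [r1, ← zpow_add₀ hY0, ← zpow_add₀ hθ0, show a * k0 + -k0 * a = 0 by ring,
      show b * k0 + p * a = 1 by linarith]; simp
  set Y' := Y ^ a * θ ^ b
  have hY'N : Y' ∈ N := N.mul_mem (N.zpow_mem hY a) (N.zpow_mem hθ b)
  have hWU : W k0 * U ∈ N := N.mul_mem (memS (hW k0)) hUN
  have sWU : σ (W k0 * U) = (W k0 * U) * (σ U / U) := by
    rw [hS.hom.mul _ (memS (hW k0)) _ hUN, hS.fixS _ (hW k0)]; field_simp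
  have rY : v (σ Y / Y - 1) < 1 := by
    have : σ Y = Y * (σ U / U) ^ (-b) := by
      conv_lhs => rw [e1]
      rw [hS.hom.mul _ (N.pow_mem hY'N p) _ (N.zpow_mem hWU _), hS.hom.pow hY'N, hS.hom.zpow hWU, hσ, sWU, mul_zpow,
        ← mul_assoc, ← e1]
    rw [this, mul_div_cancel_left₀ _ hY0]; exact zρ _
  have rθ : v (σ θ / θ - 1) < 1 := by
    have : σ θ = θ * (σ U / U) ^ a := by
      conv_lhs => rw [e2]
      rw [hS.hom.mul _ (N.zpow_mem hY'N k0) _ (N.zpow_mem hWU _), hS.hom.zpow hY'N, hS.hom.zpow hWU, hσ, sWU, mul_zpow (W k0 * U),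
        ← mul_assoc, ← e2]
    rw [this, mul_div_cancel_left₀ _ hθ0]; exact zρ _
  have hμ : v (Δ θ / θ) ≤ v (Δ Y / Y) := by
    have h1 := hS.lmul (N.zpow_mem hY a) (N.zpow_mem hθ b) (zpow_ne_zero _ hY0) (zpow_ne_zero _ hθ0)
    have h2 : v (σ (Y ^ a) / Y ^ a) = 1 := by
      rw [hS.hom.zpow hY, ← div_zpow, map_zpow₀, cg_unit rY (by simp), one_zpow]
    rw [show Y ^ a * θ ^ b = Y' from rfl, hΔ, zero_div] at h1
    have h3 := congrArg v (eq_neg_of_add_eq_zero_left h1.symm)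
    rw [Valuation.map_neg, map_mul, h2, one_mul] at h3
    rw [← (hS.lzpow hθ hθ0 rθ b).2 (vint b hbp), ← h3]
    exact (hS.lzpow hY hY0 rY a).1
  have dS : ∀ c ∈ S, ∀ z ∈ N, Δ (c * z) = c * Δ z := fun c hc z hz => by
    rw [hS.dmul c (memS hc) z hz, hS.fixS c hc, hS.dS c hc, mul_zero, add_zero]
  have dm : ∀ c ∈ S, ∀ k : ℤ, Δ (c * Y ^ k) = (c * Y ^ k) * (Δ (Y ^ k) / Y ^ k) := fun c hc k => by
    rw [dS c hc _ (N.zpow_mem hY k)]; have := zpow_ne_zero k hY0; field_simp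
  have h0 : Δ Y = 0 := by
    by_contra hne
    have hl : v (Δ Y / Y) ≠ 0 := v.ne_zero_iff.2 (div_ne_zero hne hY0)
    set B := v (W k0 * Y ^ k0) * v (Δ Y / Y) with hBd
    have hB0 : B ≠ 0 := mul_ne_zero (zero_le.trans_lt hM).ne' hl
    have hlB : v (Δ Y / Y) < B := (lt_mul_iff_one_lt_left (zero_lt_iff.2 hl)).2 hM
    have b1 : v (Δ h') < B := by
      refine lt_of_le_of_lt (hS.lip (A := Avt v S Y) _ ?_ hh) hlB
      rintro _ ⟨h1, c, hc, k, rfl⟩ _ _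
      rw [dm c hc, map_mul]
      exact (mul_le_of_le_one_left' h1).trans (hS.lzpow hY hY0 rY k).1
    have b2 : v (Δ θ) < B := by
      have : Δ θ = θ * (Δ θ / θ) := by field_simp
      rw [this, map_mul]
      calc _ ≤ v θ * v (Δ Y / Y) := mul_le_mul_right hμ _
        _ < _ := mul_lt_mul_of_pos_right hθM (zero_lt_iff.2 hl)
    have b3 : v (Δ (θ ^ p)) < B := by
      have e3 : Δ (θ ^ p) = θ ^ p * (Δ (θ ^ p) / θ ^ p) := by
        have := pow_ne_zero p hθ0; field_simp
      have e4 : v (θ ^ p) = v (W k0 * Y ^ k0) := by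
        have : v (W k0 * Y ^ k0) ≠ 0 := (zero_le.trans_lt hM).ne'
        rw [hU, map_div₀] at vU; exact (div_eq_one_iff_eq this).1 vU
      rw [e3, map_mul, e4]
      refine mul_lt_mul_of_pos_left ?_ (zero_le.trans_lt hM)
      rw [hS.lpow hθ hθ0, map_mul]
      have h5 := Skew.lsum rθ p
      rw [CharP.cast_eq_zero, sub_zero] at h5
      calc _ ≤ v (Δ Y / Y) * v (∑ i ∈ Finset.range p, (σ θ / θ) ^ i) := by gcongr
        _ < v (Δ Y / Y) * 1 := mul_lt_mul_of_pos_left h5 (zero_lt_iff.2 hl)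
        _ = _ := mul_one _
    have mk : ∀ k, W k * Y ^ k ∈ N := fun k => N.mul_mem (memS (hW k)) (N.zpow_mem hY k)
    have e2 := congrArg Δ eθ
    rw [hS.dadd _ (N.add_mem hθ (sum_mem fun k _ => mk k)) _ hh.mem, hS.dadd _ hθ _ (sum_mem fun k _ => mk k),
      hS.dsum _ _ fun k _ => mk k, ← Finset.add_sum_erase _ _ hk0] at e2
    have b4 : v (∑ k ∈ W.support.erase k0, Δ (W k * Y ^ k)) < B := by
      refine v.map_sum_lt hB0 fun k hk => ?_
      rw [dm _ (hW k), map_mul]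
      calc _ ≤ v (W k * Y ^ k) * v (Δ Y / Y) := mul_le_mul_right (hS.lzpow hY hY0 rY k).1 _
        _ < _ := mul_lt_mul_of_pos_right (hdom k (Finset.mem_of_mem_erase hk) (Finset.ne_of_mem_erase hk))
            (zero_lt_iff.2 hl)
    have b5 : v (Δ (W k0 * Y ^ k0)) = B := by
      rw [dm _ (hW k0), map_mul, (hS.lzpow hY hY0 rY k0).2 (vint k0 hk0p)]
    have e5 : Δ (W k0 * Y ^ k0) = Δ (θ ^ p) - Δ h' - Δ θ - ∑ k ∈ W.support.erase k0, Δ (W k * Y ^ k) := by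
      linear_combination -e2
    have : v (Δ (W k0 * Y ^ k0)) < B := by
      rw [e5]
      exact v.map_sub_lt (v.map_sub_lt (v.map_sub_lt b3 b1) b2) b4
    exact absurd b5 this.ne
  refine ⟨h0, ?_⟩
  rw [h0, zero_div, map_zero, le_zero_iff, v.zero_iff, div_eq_zero_iff] at hμ
  exact hμ.resolve_right hθ0

lemma vt_step [IsAlgClosed Q] (hB : Base v S p) (hV : VT v S Y) (hG : Good v S Y L) (hx : ASx v p L θ) :
    ∃ Y', VT v S Y' ∧ Good v S Y' (adj L θ) := by
  have hp := (Fact.out : p.Prime)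
  have hs := hV.sys
  have hSL := (le_adj S Y).trans hG.le
  have hY0 := hV.1
  obtain ⟨W, hW, hWp, h', hh, s, hsL, es⟩ := Lau.all hB hV hG hx.mem
  have hx' := hx.shift hsL
  set θ' := θ - s with hθ'
  have ead : adj L θ' = adj L θ := adj_shift hsL
  have eθ : θ' ^ p - θ' = (∑ k ∈ W.support, W k * Y ^ k) + h' := by
    have : θ' ^ p - θ' = (θ ^ p - θ) - (s ^ p - s) := by rw [hθ', sub_pow_char]; ring
    rw [this, ← es, Finsupp.sum]; ring
  have big := hx'.big hB hs hG
  have hne : ∃ i ∈ W.support, W i ≠ 0 := by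
    by_contra! hc
    rw [eθ, Finset.sum_eq_zero (fun i hi => by rw [hc i hi, zero_mul]), zero_add] at big
    exact not_lt.2 hh.le_one big
  obtain ⟨k0, hk0, hw0, hdom, eM⟩ := hV.dom W.support (fun k => W k) id (fun _ _ _ _ h => h) (fun k _ => hW k) hne
  simp only [id] at hdom eM
  have hM : 1 < v (W k0 * Y ^ k0) := by
    by_contra! hc
    rw [eθ] at big
    exact not_lt.2 (v.map_add_le (eM.trans_le hc) hh.le_one) big
  have vM : v (θ' ^ p - θ') = v (W k0 * Y ^ k0) := by
    rw [eθ, ← eM]; exact v.map_add_eq_of_lt_left (hh.le_one.trans_lt (eM ▸ hM))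
  have hθ1 : 1 < v θ' := by
    by_contra! hc
    refine not_lt.2 (v.map_sub_le ?_ hc) big
    rw [map_pow]; exact pow_le_one' hc p
  have hθp : v θ' < v (θ' ^ p) := by rw [map_pow]; exact lt_self_pow₀ hθ1 hp.one_lt
  have vθp : v (θ' ^ p) = v (W k0 * Y ^ k0) := by
    rw [← vM, sub_eq_add_neg]; exact (v.map_add_eq_of_lt_left (by rwa [Valuation.map_neg])).symm
  have hθ0 : θ' ≠ 0 := by intro h; rw [h, map_zero] at hθ1; exact not_lt.2 zero_le hθ1
  have hM0 : W k0 * Y ^ k0 ≠ 0 := mul_ne_zero hw0 (zpow_ne_zero _ hY0)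
  have hvM0 : v (W k0 * Y ^ k0) ≠ 0 := v.ne_zero_iff.2 hM0
  have hU1 : v (θ' ^ p / (W k0 * Y ^ k0) - 1) < 1 := by
    rw [div_sub_one hM0, map_div₀, div_lt_one₀ (zero_lt_iff.2 hvM0)]
    have : θ' ^ p - W k0 * Y ^ k0 = θ' + (∑ k ∈ W.support.erase k0, W k * Y ^ k) + h' := by
      rw [← Finset.add_sum_erase _ _ hk0] at eθ; linear_combination eθ
    rw [this]
    refine v.map_add_lt (v.map_add_lt (vθp ▸ hθp) (v.map_sum_lt hvM0 fun k hk => ?_)) (hh.le_one.trans_lt hM)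
    exact hdom k (Finset.mem_of_mem_erase hk) (Finset.ne_of_mem_erase hk)
  have hk0p : ¬ (p : ℤ) ∣ k0 := fun h => hw0 (hWp k0 h)
  obtain ⟨a, b, hab⟩ : ∃ a b : ℤ, a * p + b * k0 = 1 := by
    have : IsCoprime (p : ℤ) k0 := (Int.prime_iff_natAbs_prime.2 (by simpa using hp)).coprime_iff_not_dvd.2 hk0p
    exact this
  have hθm : θ' ∈ adj L θ := ead ▸ mem_adj L θ'
  have hYm : Y ∈ adj L θ := le_adj L θ (hG.le (mem_adj S Y))
  have gd : Good v S (Y ^ a * θ' ^ b) (adj L θ) := by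
    refine good_step hG ((adj L θ).mul_mem ((adj L θ).zpow_mem hYm a) ((adj L θ).zpow_mem hθm b))
      fun σ Δ hS hσ h0 => ?_
    have := vt_core hB.nat hS hYm hY0 hθm hθ0 hW (hh.mono (le_adj L θ) fun a ha _ _ => ha)
      (by linear_combination eθ) hk0 hdom hM (vθp ▸ hθp) hab hσ h0 rfl hU1
    refine ⟨this.1, fun hk => ?_⟩
    have e : θ = θ' + s := by rw [hθ']; ring
    rw [e, hS.dadd _ hθm _ (le_adj L θ hsL), this.2, hk s hsL, add_zero]
  refine ⟨_, ⟨mul_ne_zero (zpow_ne_zero _ hY0) (zpow_ne_zero _ hθ0), fun k c hc e => ?_⟩, gd⟩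
  have vY : v Y ≠ 0 := v.ne_zero_iff.2 hY0
  have vw : v (W k0) ≠ 0 := v.ne_zero_iff.2 hw0
  refine hV.2 k (c ^ p / W k0 ^ (b * k)) (S.div_mem (S.pow_mem hc p) (S.zpow_mem (hW k0) _)) ?_
  rw [map_div₀, map_pow, ← e, map_zpow₀, map_mul, map_zpow₀, map_zpow₀, eq_div_iff (zpow_ne_zero _ vw)]
  have e3 : v θ' ^ (p : ℤ) = v (W k0) * v Y ^ k0 := by
    rw [zpow_natCast, ← map_pow, vθp, map_mul, map_zpow₀]
  rw [← zpow_natCast, ← zpow_mul, mul_zpow, ← zpow_mul, ← zpow_mul,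
    show b * (k * (p : ℤ)) = (p : ℤ) * (b * k) by ring, zpow_mul (v θ'), e3, mul_zpow, ← zpow_mul,
    mul_comm (v (W k0) ^ _), ← mul_assoc, ← zpow_add₀ vY]
  congr 2
  linear_combination (-k) * hab
end

section
variable {v : Valuation Q Γ} {S L M N : Subfield Q} {Y θ : Q} {p : ℕ} {σ Δ : Q → Q} {C A : Set Q}

structure Act (G : Type*) [Group G] [Finite G] (M N : Subfield Q) (a : G → Q → Q) : Prop where
  le : M ≤ N
  hom : ∀ g, HomOn N (a g)
  mem : ∀ g, ∀ z ∈ N, a g z ∈ N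
  one : ∀ z ∈ N, a 1 z = z
  mul : ∀ g h, ∀ z ∈ N, a (g * h) z = a g (a h z)
  fixM : ∀ g, ∀ z ∈ M, a g z = z
  cor1 : ∀ L : Subfield Q, M ≤ L → L ≤ N → ∀ z ∈ N, (∀ g, (∀ w ∈ L, a g w = w) → a g z = z) → z ∈ L
  cor2 : ∀ H : Subgroup G, ∀ g, (∀ z ∈ N, (∀ h ∈ H, a h z = z) → a g z = z) → g ∈ H
  ext : ∀ L : Subfield Q, M ≤ L → L ≤ N → ∀ φ, HomOn L φ → (∀ z ∈ M, φ z = z) → ∃ g, ∀ z ∈ L, φ z = a g z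
  fin : ∀ L : Subfield Q, M ≤ L → L ≤ N → ∃ s : Set Q, s.Finite ∧ L = Subfield.closure (M ∪ s)
  sep : ∀ z ∈ N, IsSeparable M z

lemma ext_gal {K Q : Type*} [Field K] [Field Q] [Algebra K Q] [IsAlgClosed Q] (E : IntermediateField K Q) [Normal K E]
    (I : IntermediateField K E) (f : I →ₐ[K] Q) : ∃ g : E ≃ₐ[K] E, ∀ x : I, f x = (g x : E) := by
  obtain ⟨φ, hφ⟩ := IntermediateField.exists_algHom_of_splits' (L := I) (E := E) f
    fun s => ⟨(Normal.isIntegral (F := K) inferInstance s).tower_top, IsAlgClosed.splits _⟩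
  have hr := AlgHom.fieldRange_of_normal φ
  have hm : ∀ x, φ x ∈ E := fun x => (SetLike.ext_iff.1 hr (φ x)).1 ⟨x, rfl⟩
  let ψ : E →ₐ[K] E := AlgHom.codRestrict φ E.toSubalgebra hm
  refine ⟨AlgEquiv.ofBijective ψ (Algebra.IsAlgebraic.algHom_bijective ψ), fun x => ?_⟩
  rw [← hφ]; rfl

lemma act_exists [IsAlgClosed Q] (h : M ≤ N) [FiniteDimensional M (Subfield.extendScalars h)]
    [IsGalois M (Subfield.extendScalars h)] :
    ∃ a, Act (Subfield.extendScalars h ≃ₐ[M] Subfield.extendScalars h) M N a := by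
  set E := Subfield.extendScalars h with hE
  have key : ∀ (g : E ≃ₐ[M] E) z (hz : z ∈ N),
      ext0 (L := N) (fun x => ((g ⟨x.1, x.2⟩ : E) : Q)) z = (g ⟨z, hz⟩ : E) := fun g z hz => ext0_of _ _ hz
  have sub : ∀ L : Subfield Q, M ≤ L → L ≤ N → ∃ I : IntermediateField M E, ∀ z (hz : z ∈ N), (⟨z, hz⟩ : E) ∈ I ↔ z ∈ L := by
    intro L hM hN
    refine ⟨(Subfield.extendScalars hM).comap E.val, fun z hz => ?_⟩
    rfl
  refine ⟨fun g => ext0 (L := N) (fun x => ((g ⟨x.1, x.2⟩ : E) : Q)), ?_⟩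
  constructor
  · exact h
  · intro g
    exact homOn_ext0 (L := N) (((E.val : E →ₐ[M] Q).comp (g : E →ₐ[M] E) : E →ₐ[M] Q) : E →+* Q)
  · intro g z hz; rw [key g z hz]; exact (g ⟨z, hz⟩).2
  · intro z hz; rw [key 1 z hz]; rfl
  · intro g g' z hz
    rw [key _ z hz, key g' z hz, key g _ (g' ⟨z, hz⟩).2]; rfl
  · intro g z hz
    rw [key _ z (h hz)]
    exact congrArg Subtype.val (g.commutes ⟨z, hz⟩)
  · intro L hM hN z hz hg
    obtain ⟨I, hI⟩ := sub L hM hN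
    rw [← hI z hz, ← IsGalois.fixedField_fixingSubgroup I]
    rintro ⟨g, hg'⟩
    have := hg g fun w hw => by
      rw [key g w (hN hw)]
      exact congrArg Subtype.val (hg' ⟨⟨w, hN hw⟩, (hI w _).2 hw⟩)
    rw [key g z hz] at this
    exact Subtype.ext this
  · intro H g hg
    rw [← IntermediateField.fixingSubgroup_fixedField H]
    rintro ⟨z, hz⟩
    have := hg z.1 z.2 fun h hh => by
      rw [key h z z.2]; exact congrArg Subtype.val (hz ⟨h, hh⟩)
    rw [key g z z.2] at this
    exact Subtype.ext this
  · intro L hM hN φ hφ hfix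
    obtain ⟨I, hI⟩ := sub L hM hN
    let f : I →ₐ[M] Q := { 
      (hφ.toHom.comp (RingHom.codRestrict ((E.val : E →ₐ[M] Q).toRingHom.comp (I.val : I →ₐ[M] E).toRingHom) L
        (fun x => (hI _ x.1.2).1 x.2))) with
      commutes' := fun r => hfix r r.2 }
    have fa : ∀ x : I, f x = φ x := fun x => rfl
    obtain ⟨g, hg⟩ := ext_gal E I f
    refine ⟨g, fun z hz => ?_⟩
    rw [key g z (hN hz), ← fa ⟨⟨z, hN hz⟩, (hI _ _).2 hz⟩, hg]
  · intro L hM hN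
    obtain ⟨I, hI⟩ := sub L hM hN
    obtain ⟨s, hs, e⟩ := IntermediateField.fg_def.1 (IntermediateField.fg_of_noetherian I)
    refine ⟨E.val '' s, hs.image _, le_antisymm (fun z hz => ?_) ?_⟩
    · have hz' := (hI z (hN hz)).2 hz
      rw [← e] at hz'
      have : (IntermediateField.adjoin M s).map E.val = IntermediateField.adjoin M (E.val '' s) :=
        IntermediateField.adjoin_map _ _ _
      have h2 : z ∈ IntermediateField.adjoin M (E.val '' s) := this ▸ ⟨_, hz', rfl⟩
      rw [← IntermediateField.mem_toSubfield, IntermediateField.adjoin_toSubfield] at h2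
      refine Subfield.closure_mono (Set.union_subset_union_left _ ?_) h2
      rintro _ ⟨x, rfl⟩; exact x.2
    · refine Subfield.closure_le.2 (Set.union_subset hM ?_)
      rintro _ ⟨x, hx, rfl⟩
      exact (hI x x.2).1 (e ▸ IntermediateField.subset_adjoin M s hx)
  · intro z hz
    exact sep_int E (inferInstance : IsGalois M E).to_isSeparable hz
end

section
variable {v : Valuation Q Γ} {S L M N : Subfield Q} {Y θ : Q} {p : ℕ} {σ Δ : Q → Q}
variable {G : Type*} [Group G] [Finite G] {a : G → Q → Q}

def Act.Fx (h : Act G M N a) (H : Subgroup G) : Subfield Q where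
  carrier := {z | z ∈ N ∧ ∀ g ∈ H, a g z = z}
  mul_mem' := fun {x y} hx hy => ⟨N.mul_mem hx.1 hy.1, fun g hg => by
    rw [(h.hom g).mul _ hx.1 _ hy.1, hx.2 g hg, hy.2 g hg]⟩
  one_mem' := ⟨N.one_mem, fun g _ => (h.hom g).one⟩
  add_mem' := fun {x y} hx hy => ⟨N.add_mem hx.1 hy.1, fun g hg => by
    rw [(h.hom g).add _ hx.1 _ hy.1, hx.2 g hg, hy.2 g hg]⟩
  zero_mem' := ⟨N.zero_mem, fun g _ => (h.hom g).zero⟩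
  neg_mem' := fun {x} hx => ⟨N.neg_mem hx.1, fun g hg => by rw [(h.hom g).neg hx.1, hx.2 g hg]⟩
  inv_mem' := fun x hx => ⟨N.inv_mem hx.1, fun g hg => by rw [(h.hom g).inv hx.1, hx.2 g hg]⟩

namespace Act
variable (h : Act G M N a)

lemma mem_Fx {H : Subgroup G} {z : Q} : z ∈ h.Fx H ↔ z ∈ N ∧ ∀ g ∈ H, a g z = z := Iff.rfl
lemma Fx_le (H : Subgroup G) : h.Fx H ≤ N := fun _ hz => hz.1
lemma le_Fx (H : Subgroup G) : M ≤ h.Fx H := fun _ hz => ⟨h.le hz, fun g _ => h.fixM g _ hz⟩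
lemma Fx_anti {H H' : Subgroup G} (hh : H ≤ H') : h.Fx H' ≤ h.Fx H := fun _ hz => ⟨hz.1, fun g hg => hz.2 g (hh hg)⟩
lemma Fx_bot : h.Fx ⊥ = N := le_antisymm (h.Fx_le _) fun z hz => ⟨hz, fun g hg => by
  rw [Subgroup.mem_bot] at hg; rw [hg, h.one z hz]⟩

def Dec (v : Valuation Q Γ) : Subgroup G where
  carrier := {g | ∀ z ∈ N, v z ≤ 1 → v (a g z) ≤ 1}
  mul_mem' := fun {x y} hx hy z hz h1 => by
    rw [h.mul x y z hz]; exact hx _ (h.mem y z hz) (hy z hz h1)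
  one_mem' := fun z hz h1 => by rwa [h.one z hz]
  inv_mem' := fun {x} hx => by
    have hp : ∀ n : ℕ, ∀ z ∈ N, v z ≤ 1 → v (a (x ^ n) z) ≤ 1 := by
      intro n
      induction n with
      | zero => intro z hz h1; rwa [pow_zero, h.one z hz]
      | succ n ih => intro z hz h1; rw [pow_succ, h.mul _ _ z hz]; exact ih _ (h.mem _ z hz) (hx z hz h1)
    have : x⁻¹ = x ^ (orderOf x - 1) := by
      rw [inv_eq_iff_mul_eq_one, ← pow_succ', Nat.sub_add_cancel (orderOf_pos x), pow_orderOf_eq_one]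
    show ∀ z ∈ N, v z ≤ 1 → v (a (x⁻¹) z) ≤ 1
    rw [this]; exact hp _

lemma mem_Dec {g : G} : g ∈ h.Dec v ↔ ∀ z ∈ N, v z ≤ 1 → v (a g z) ≤ 1 := Iff.rfl

lemma prodpoly_mem (D : Subgroup G) {z : Q} (hz : z ∈ N) [Fintype D] (i : ℕ) :
    (∏ d : D, (X - Polynomial.C (a d z))).coeff i ∈ h.Fx D := by
  refine ⟨?_, fun g hg => ?_⟩
  · have : (∏ d : D, (X - Polynomial.C (a d z) : Q[X])) = (∏ d : D, (X - Polynomial.C (⟨a d z, h.mem _ z hz⟩ : N))).map N.subtype := by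
      rw [Polynomial.map_prod]; simp
    rw [this, coeff_map]; exact SetLike.coe_mem _
  · have e1 : (∏ d : D, (X - Polynomial.C (a d z) : Q[X])) = (∏ d : D, (X - Polynomial.C (⟨a d z, h.mem _ z hz⟩ : N))).map N.subtype := by
      rw [Polynomial.map_prod]; simp
    have e2 : (∏ d : D, (X - Polynomial.C (a d z) : Q[X])) = (∏ d : D, (X - Polynomial.C (⟨a d z, h.mem _ z hz⟩ : N))).map (h.hom g).toHom := by
      rw [Polynomial.map_prod]
      refine Fintype.prod_equiv (Equiv.mulLeft (⟨g, hg⟩ : D)⁻¹) _ _ fun d => ?_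
      simp only [Polynomial.map_sub, map_X, map_C]
      congr 2
      show a d z = a g (a _ z)
      rw [← h.mul _ _ z hz]; simp
    conv_lhs => rw [e1, coeff_map]
    conv_rhs => rw [e2, coeff_map]
    rfl

lemma dec_of {φ : Q → Q} {σ : G} (hφ : ∀ z ∈ h.Fx (h.Dec v), v z ≤ 1 → v (φ z) ≤ 1)
    (hs : ∀ z ∈ h.Fx (h.Dec v), φ z = a σ z) : σ ∈ h.Dec v := by
  classical
  intro z hz h1
  haveI := Fintype.ofFinite (h.Dec v)
  set P : Q[X] := ∏ d : h.Dec v, (X - Polynomial.C (a d z)) with hP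
  have hm : P.Monic := monic_prod_of_monic _ _ fun d _ => monic_X_sub_C _
  have hz0 : P.eval z = 0 := by
    rw [hP, eval_prod]
    refine Finset.prod_eq_zero (Finset.mem_univ 1) ?_
    rw [OneMemClass.coe_one, h.one z hz]; simp
  have hint : ∀ i, v (P.coeff i) ≤ 1 := by
    have : ∃ P' : v.integer[X], P'.map v.integer.subtype = P := by
      refine ⟨∏ d : h.Dec v, (X - Polynomial.C ⟨a d z, d.2 z hz h1⟩), ?_⟩
      rw [Polynomial.map_prod]; simp [hP]
    obtain ⟨P', e⟩ := this
    intro i; rw [← e, coeff_map]; exact (P'.coeff i).2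
  by_contra! hc
  have hZ : ∀ i, P.coeff i ∈ h.Fx (h.Dec v) := h.prodpoly_mem _ hz
  have hs1 : a σ z ≠ 0 := fun h0 => by rw [h0] at hc; simp at hc
  have e : a σ z ^ P.natDegree + ∑ i ∈ Finset.range P.natDegree, φ (P.coeff i) * a σ z ^ i = 0 := by
    have h2 : a σ (P.eval z) = 0 := by rw [hz0, (h.hom σ).zero]
    have h3 : a σ (P.eval z) = ∑ i ∈ Finset.range (P.natDegree + 1), φ (P.coeff i) * a σ z ^ i := by
      rw [eval_eq_sum_range]
      have := map_sum (h.hom σ).toHom (fun i => (⟨P.coeff i * z ^ i, N.mul_mem (hZ i).1 (N.pow_mem hz i)⟩ : N)) (Finset.range (P.natDegree + 1))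
      have e3 : (h.hom σ).toHom (∑ i ∈ Finset.range (P.natDegree + 1), (⟨P.coeff i * z ^ i, N.mul_mem (hZ i).1 (N.pow_mem hz i)⟩ : N))
        = a σ (∑ i ∈ Finset.range (P.natDegree + 1), P.coeff i * z ^ i) := by
        show a σ (N.subtype _) = _
        rw [map_sum]; rfl
      rw [← e3, this]
      refine Finset.sum_congr rfl fun i _ => ?_
      show a σ (P.coeff i * z ^ i) = _
      rw [(h.hom σ).mul _ (hZ i).1 _ (N.pow_mem hz i), (h.hom σ).pow hz, hs _ (hZ i)]
    rw [h3, Finset.sum_range_succ] at h2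
    have h4 : φ (P.coeff P.natDegree) = 1 := by
      rw [hs _ (hZ _), hm.coeff_natDegree, (h.hom σ).one]
    rw [h4, one_mul] at h2
    rw [add_comm]; exact h2
  have h5 : v (∑ i ∈ Finset.range P.natDegree, φ (P.coeff i) * a σ z ^ i) < v (a σ z ^ P.natDegree) := by
    refine v.map_sum_lt (v.ne_zero_iff.2 (pow_ne_zero _ hs1)) fun i hi => ?_
    rw [map_mul, map_pow, map_pow]
    refine (mul_le_of_le_one_left' (hφ _ (hZ i) (hint i))).trans_lt ?_
    exact pow_lt_pow_right₀ hc (Finset.mem_range.1 hi)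
  have h6 := congrArg v e
  rw [Valuation.map_add_eq_of_lt_left _ h5, map_zero, v.zero_iff] at h6
  exact pow_ne_zero _ hs1 h6

lemma good_dec (h : Act G (adj S Y) N a) : Good v S Y (h.Fx (h.Dec v)) := by
  refine good_of (h.le_Fx _) ?_ (fun z hz => h.sep z hz.1) fun φ hφ hS hY hO z hz => ?_
  · obtain ⟨s, hs, e⟩ := h.fin _ (h.le_Fx (h.Dec v)) (h.Fx_le _)
    refine ⟨{Y} ∪ s, (Set.finite_singleton Y).union hs, ?_⟩
    rw [e]
    refine le_antisymm (Subfield.closure_le.2 (Set.union_subset ?_ ?_)) (Subfield.closure_le.2 ?_)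
    · exact (Subfield.closure_mono (by rw [← Set.union_assoc]; exact Set.subset_union_left))
    · exact fun z hz => Subfield.subset_closure (.inr (.inr hz))
    · rintro z (hz | rfl | hz)
      · exact Subfield.subset_closure (.inl (le_adj S Y hz))
      · exact Subfield.subset_closure (.inl (mem_adj _ _))
      · exact Subfield.subset_closure (.inr hz)
  · obtain ⟨σ, hσ⟩ := h.ext _ (h.le_Fx _) (h.Fx_le _) φ hφ
      (hφ.fix (s := S ∪ {Y}) (h.le_Fx _) (by rintro z (hz | rfl); exacts [hS z hz, hY]))
    rw [hσ z hz, hz.2 σ (h.dec_of hO hσ)]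
end Act
end

section
variable {v : Valuation Q Γ} {S L M N : Subfield Q} {Y θ : Q} {p : ℕ} {σ Δ : Q → Q}
variable {G : Type*} [Group G] [Finite G] {a : G → Q → Q}

namespace Act
variable (h : Act G M N a)

noncomputable def Lag (_h : Act G M N a) (D : Subgroup G) (H : Subgroup D) (χ : D → Q) (z : Q) : Q :=
  haveI := Fintype.ofFinite (D ⧸ H)
  ∑ q : D ⧸ H, χ q.out * a (q.out : D) z

variable {D : Subgroup G} {H : Subgroup D} {χ : D → Q}

lemma Lag_mem (hχ : ∀ d, χ d ∈ M) {z : Q} (hz : z ∈ N) : h.Lag D H χ z ∈ N := by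
  unfold Lag
  exact N.sum_mem fun q _ => N.mul_mem (h.le (hχ _)) (h.mem _ z hz)

lemma hsum (h : Act G M N a) {ι : Type*} (s : Finset ι) (f : ι → Q) (hf : ∀ i ∈ s, f i ∈ N) (g : G) :
    a g (∑ i ∈ s, f i) = ∑ i ∈ s, a g (f i) := by
  classical
  induction s using Finset.induction_on with
  | empty => simp [(h.hom g).zero]
  | insert i s hi ih =>
    rw [Finset.sum_insert hi, Finset.sum_insert hi, (h.hom g).add _ (hf i (by simp)) _
      (N.sum_mem fun j hj => hf j (Finset.mem_insert_of_mem hj)), ih fun j hj => hf j (Finset.mem_insert_of_mem hj)]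

lemma Lag_act (hχ : ∀ d, χ d ∈ M) (hm : ∀ d d', χ (d * d') = χ d * χ d') (h1 : ∀ d ∈ H, χ d = 1)
    {z : Q} (hz : z ∈ h.Fx (H.map D.subtype)) (d : D) : χ d * a d (h.Lag D H χ z) = h.Lag D H χ z := by
  haveI := Fintype.ofFinite (D ⧸ H)
  have e : h.Lag D H χ z = ∑ q : D ⧸ H, χ q.out * a (q.out : D) z := by
    unfold Lag; congr!
  rw [e, h.hsum _ _ (fun q _ => N.mul_mem (h.le (hχ _)) (h.mem _ z hz.1)), Finset.mul_sum]
  refine Fintype.sum_equiv (MulAction.toPerm d) _ _ fun q => ?_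
  rw [(h.hom _).mul _ (h.le (hχ _)) _ (h.mem _ z hz.1), h.fixM _ _ (hχ _), ← mul_assoc, ← hm, ← h.mul _ _ z hz.1,
    ← Subgroup.coe_mul]
  obtain ⟨k, hk⟩ := QuotientGroup.mk_out_eq_mul H (d * q.out)
  have e2 : (MulAction.toPerm d q : D ⧸ H) = ((d * q.out : D) : D ⧸ H) := by
    rw [MulAction.toPerm_apply]
    conv_lhs => rw [← QuotientGroup.out_eq' q]
    rfl
  rw [e2, hk, hm _ (k : D), h1 k k.2, mul_one, Subgroup.coe_mul _ (d * _), h.mul _ _ z hz.1, hz.2 (k : D) ⟨k, k.2, rfl⟩]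

lemma Lag_cong {z : Q} (hz0 : z ≠ 0) (hc : ∀ d : D, v (χ d * a d z / z - 1) < 1) :
    v (h.Lag D H χ z / z - H.index) < 1 := by
  haveI := Fintype.ofFinite (D ⧸ H)
  have e : h.Lag D H χ z / z - H.index = ∑ q : D ⧸ H, (χ q.out * a (q.out : D) z / z - 1) := by
    rw [Finset.sum_sub_distrib, ← Finset.sum_div]
    congr 1
    · unfold Lag; congr!
    · simp [Subgroup.index]
  rw [e]
  exact v.map_sum_lt one_ne_zero fun q _ => hc _

lemma Lag_val {z : Q} (hz0 : z ≠ 0) (hn : v (H.index : Q) = 1) (hc : ∀ d : D, v (χ d * a d z / z - 1) < 1) :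
    v (h.Lag D H χ z) = v z := by
  have h1 := h.Lag_cong (H := H) hz0 hc
  have h2 : v (h.Lag D H χ z / z) = 1 := by
    have : h.Lag D H χ z / z = (h.Lag D H χ z / z - H.index) + H.index := by ring
    rw [this, Valuation.map_add_eq_of_lt_right _ (by rwa [hn]), hn]
  rwa [map_div₀, div_eq_one_iff_eq (v.ne_zero_iff.2 hz0)] at h2

lemma Lag_lin (hχ : ∀ d, χ d ∈ M) {z c e : Q} (hz : z ∈ N) (hc : c ∈ h.Fx D) (he : e ∈ h.Fx D) :
    h.Lag D H χ (c * z + e) = c * h.Lag D H χ z + e * h.Lag D H χ 1 := by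
  unfold Lag
  rw [Finset.mul_sum, Finset.mul_sum, ← Finset.sum_add_distrib]
  refine Finset.sum_congr rfl fun q _ => ?_
  rw [(h.hom _).add _ (N.mul_mem hc.1 hz) _ he.1, (h.hom _).mul _ hc.1 _ hz, hc.2 _ (SetLike.coe_mem _),
    he.2 _ (SetLike.coe_mem _), (h.hom _).one]
  ring

lemma trace_trick (hn : v (H.index : Q) = 1) (hcong : ∀ d ∈ D, ∀ z ∈ N, v z = 1 → v (a d z - z) < 1)
    (hval : ∀ b ∈ h.Fx (H.map D.subtype), b ≠ 0 → ∃ c ∈ h.Fx D, v b = v c) :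
    h.Fx (H.map D.subtype) = h.Fx D := by
  have hDH : H.map D.subtype ≤ D := by rintro _ ⟨x, -, rfl⟩; exact x.2
  refine le_antisymm (fun b hb => ?_) (h.Fx_anti hDH)
  let χ : D → Q := fun _ => 1
  have hχ : ∀ d, χ d ∈ M := fun _ => M.one_mem
  have hn0 : (H.index : Q) ≠ 0 := fun h0 => by simp [h0] at hn
  have hfix : ∀ z ∈ h.Fx (H.map D.subtype), h.Lag D H χ z ∈ h.Fx D := fun z hz =>
    ⟨h.Lag_mem hχ hz.1, fun d hd => by
      have := h.Lag_act (χ := χ) hχ (by simp [χ]) (by simp [χ]) hz ⟨d, hd⟩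
      simpa [χ] using this⟩
  have hone : h.Lag D H χ 1 = H.index := by
    simp only [Lag, χ, (h.hom _).one]; simp only [mul_one, Finset.sum_const, Finset.card_univ, nsmul_eq_mul, Subgroup.index]; rw [@Nat.card_eq_fintype_card _ (_)]
  obtain ⟨t, ht⟩ : ∃ t, t = h.Lag D H χ b := ⟨_, rfl⟩
  have htD : t ∈ h.Fx D := ht ▸ hfix b hb
  have htn : t / H.index ∈ h.Fx D := (h.Fx D).div_mem htD (natCast_mem _ _)
  by_cases h0 : b - t / H.index = 0
  · rw [sub_eq_zero.1 h0]; exact htn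
  exfalso
  have hb' : b - t / H.index ∈ h.Fx (H.map D.subtype) := Subfield.sub_mem _ hb (h.Fx_anti hDH htn)
  obtain ⟨c, hc, e⟩ := hval _ hb' h0
  have hc0 : c ≠ 0 := by rintro rfl; rw [map_zero, v.zero_iff] at e; exact h0 e
  have hT : h.Lag D H χ (c⁻¹ * b + (-(t / H.index) * c⁻¹)) = 0 := by
    rw [h.Lag_lin hχ hb.1 ((h.Fx D).inv_mem hc) ((h.Fx D).mul_mem ((h.Fx D).neg_mem htn) ((h.Fx D).inv_mem hc)), hone, ← ht]
    field_simp; ring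
  have e2 : c⁻¹ * b + (-(t / H.index) * c⁻¹) = (b - t / H.index) / c := by field_simp; ring
  rw [e2] at hT
  have hu : v ((b - t / H.index) / c) = 1 := by rw [map_div₀, e, div_self]; exact v.ne_zero_iff.2 hc0
  have hu0 : (b - t / H.index) / c ≠ 0 := div_ne_zero h0 hc0
  have huN := N.div_mem hb'.1 hc.1
  generalize (b - t / H.index) / c = w at hT hu hu0 huN
  have := h.Lag_val (H := H) (χ := χ) hu0 hn fun d => by
    have h2 := hcong d d.2 _ huN hu
    have : χ d * a d w / w - 1 = (a d w - w) / w := by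
      rw [sub_div, div_self hu0]; simp [χ]
    rw [this, map_div₀, hu, div_one]; exact h2
  rw [hT, map_zero, hu] at this
  exact zero_ne_one this
end Act
end

section
variable {v : Valuation Q Γ} {S L M N : Subfield Q} {Y θ : Q} {p : ℕ} {σ Δ : Q → Q} {C A : Set Q}

lemma Good.val [IsAlgClosed Q] (hG : Good v S Y L) (hB : Base v S p) (hs : Sys v S Y C A) {z : Q} (hz : z ∈ L) (h0 : z ≠ 0) :
    ∃ c ∈ C, v z = v c := by
  have key : ∀ z ∈ L, 1 < v z → ∃ c ∈ C, v z = v c := by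
    intro z hz h1
    obtain ⟨c, hc, P, hP, w, hw, e⟩ := hG.decomp hB hs hz
    have hlt : v w < v z := hw.le_one.trans_lt h1
    have e2 : v (P.eval Y / c) = v z := by
      have : P.eval Y / c = z - w := by rw [e]; ring
      rw [this]; exact Valuation.map_sub_eq_of_lt_left _ hlt
    have hP0 : P.eval Y ≠ 0 := fun h => by
      rw [h, zero_div, map_zero] at e2; rw [← e2] at h1; exact not_lt.2 zero_le h1
    obtain ⟨d, hd, ed, -⟩ := hs.V P hP hP0
    exact ⟨d * c⁻¹, hs.C_mul _ hd _ (hs.C_inv _ hc), by rw [← e2, map_div₀, map_mul, map_inv₀, ed, div_eq_mul_inv]⟩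
  rcases lt_trichotomy (v z) 1 with h1 | h1 | h1
  · obtain ⟨c, hc, e⟩ := key z⁻¹ (L.inv_mem hz) (by
      rw [map_inv₀]; exact (one_lt_inv₀ (zero_lt_iff.2 (v.ne_zero_iff.2 h0))).2 h1)
    exact ⟨c⁻¹, hs.C_inv _ hc, by rw [map_inv₀, ← e, map_inv₀, inv_inv]⟩
  · exact ⟨1, hs.C_one, by rw [h1, map_one]⟩
  · exact key z hz h1

lemma vt_tame_core [IsAlgClosed Q] (hB : Base v S p) (hV : VT v S Y) (hG : Good v S Y L) (h : Skew v S L σ Δ)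
    {u : Q} (hu : u ∈ L) (hu1 : v (u - 1) < 1) (hσ : σ (Y * u) = Y * u) (hΔ : Δ (Y * u) = 0) : Δ Y = 0 := by
  have hs := hV.sys
  have hY : Y ∈ L := hG.le (mem_adj S Y)
  have hY0 := hV.1
  have vY0 : v Y ≠ 0 := v.ne_zero_iff.2 hY0
  have vu : v u = 1 := cg_unit hu1 (by simp)
  have hu0 : u ≠ 0 := by rintro rfl; simp at vu
  have vσu : v (σ u) = 1 := cg_unit (h.cong u hu vu.le) vu
  have hσu0 : σ u ≠ 0 := h.hom.ne hu hu0
  have e1 : σ Y / Y = u / σ u := by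
    rw [h.hom.mul _ hY _ hu] at hσ
    rw [div_eq_div_iff hY0 hσu0, hσ]; ring
  have hρ : v (σ Y / Y - 1) < 1 := by
    have : u / σ u - 1 = -((σ u - u) / σ u) := by field_simp; ring
    rw [e1, this, Valuation.map_neg, map_div₀, vσu, div_one]; exact h.cong u hu vu.le
  have vσY : v (σ Y) = v Y := by
    have := cg_unit hρ (by simp)
    rwa [map_div₀, div_eq_one_iff_eq vY0] at this
  set δ := v (Δ Y / Y) with hδ
  have mono : ∀ c ∈ S, ∀ k : ℤ, v (Δ (c * Y ^ k)) ≤ v (c * Y ^ k) * δ := by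
    intro c hc k
    rw [h.dmul c (h.le hc) _ (L.zpow_mem hY k), h.dS c hc, h.fixS c hc, mul_zero, add_zero]
    have h2 := (h.lzpow hY hY0 hρ k).1
    have : c * Δ (Y ^ k) = c * Y ^ k * (Δ (Y ^ k) / Y ^ k) := by
      have := zpow_ne_zero k hY0; field_simp
    rw [this, map_mul]; exact mul_le_mul_right h2 _
  have hL : ∀ z ∈ L, v z ≤ 1 → v (Δ z) ≤ δ := fun z hz h1 => by
    refine h.lip δ ?_ (hG.het hB hs hz h1)
    rintro _ ⟨h1, c, hc, k, rfl⟩ - -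
    exact (mono c hc k).trans (mul_le_of_le_one_left' h1)
  by_contra hne
  have hδ0 : 0 < δ := zero_lt_iff.2 (v.ne_zero_iff.2 (div_ne_zero hne hY0))
  have hlt : v (Δ u) < δ := by
    have hm := L.sub_mem hu L.one_mem
    have e2 : Δ u = Δ (u - 1) := by
      have := h.dadd _ hm _ L.one_mem
      rwa [sub_add_cancel, h.dS 1 S.one_mem, add_zero] at this
    by_cases h0 : u - 1 = 0
    · rw [e2, h0, h.dS 0 S.zero_mem, map_zero]; exact hδ0
    obtain ⟨_, ⟨c, hc, hc0, k, rfl⟩, e⟩ := hG.val hB hs hm h0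
    have hd0 : c * Y ^ k ≠ 0 := mul_ne_zero hc0 (zpow_ne_zero k hY0)
    have hdL : c * Y ^ k ∈ L := L.mul_mem (h.le hc) (L.zpow_mem hY k)
    have hq : v ((u - 1) / (c * Y ^ k)) = 1 := by
      rw [map_div₀, e, div_self]; exact v.ne_zero_iff.2 hd0
    have hvs : v (σ (c * Y ^ k)) = v (c * Y ^ k) := by
      rw [h.hom.mul _ (h.le hc) _ (L.zpow_mem hY k), h.hom.zpow hY, h.fixS c hc, map_mul, map_mul, map_zpow₀, map_zpow₀, vσY]
    have e3 : Δ (u - 1) = σ (c * Y ^ k) * Δ ((u - 1) / (c * Y ^ k)) + (u - 1) / (c * Y ^ k) * Δ (c * Y ^ k) := by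
      rw [← h.dmul _ hdL _ (L.div_mem hm hdL), mul_div_cancel₀ _ hd0]
    have h4 : v (Δ (u - 1)) ≤ v (c * Y ^ k) * δ := by
      rw [e3]
      refine v.map_add_le ?_ ?_
      · rw [map_mul, hvs]; exact mul_le_mul_right (hL _ (L.div_mem hm hdL) hq.le) _
      · rw [map_mul, hq, one_mul]; exact mono c hc k
    rw [e2]
    refine h4.trans_lt ?_
    rw [← e]
    exact mul_lt_of_lt_one_left hδ0 hu1
  rw [h.dmul _ hY _ hu] at hΔ
  have e5 : Δ Y = -(σ Y * Δ u / u) := by field_simp; linear_combination hΔ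
  have : δ = v (Δ u) := by
    rw [hδ, e5, neg_div, Valuation.map_neg, map_div₀, map_div₀, map_mul, vσY, vu, div_one, mul_comm, mul_div_assoc,
      div_self vY0, mul_one]
  exact absurd hlt (by rw [← this]; exact lt_irrefl _)

section
variable [IsAlgClosed Q]

lemma unit_root_uniq {e : ℕ} (he : v (e : Q) = 1) {x y : Q} (hx : x ^ e = 1) (hy : y ^ e = 1)
    (h : v (x - y) < 1) : x = y := by
  have he0 : e ≠ 0 := by rintro rfl; simp at he
  have hy0 : y ≠ 0 := by rintro rfl; simp [he0] at hy
  have vy : v y = 1 := by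
    have := congrArg v hy; rw [map_pow, map_one] at this
    exact (pow_eq_one_iff_of_nonneg zero_le he0).1 this
  have h1 : v (x / y - 1) < 1 := by
    have : x / y - 1 = (x - y) / y := by field_simp
    rw [this, map_div₀, vy, div_one]; exact h
  have h2 := Skew.lsum h1 e
  have h3 : (∑ i ∈ Finset.range e, (x / y) ^ i) ≠ 0 := by
    intro h0; rw [h0, zero_sub, Valuation.map_neg, he] at h2; exact lt_irrefl _ h2
  have h4 := geom_sum_mul (x / y) e
  rw [div_pow, hx, hy, div_one, sub_self] at h4
  have := (mul_eq_zero.1 h4).resolve_left h3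
  exact (div_eq_one_iff_eq hy0).1 (sub_eq_zero.1 this)

lemma Base.unit_root (hB : Base v S p) {e : ℕ} (he : (e : Q) ≠ 0) {r : Q} (h : v (r ^ e - 1) < 1) :
    ∃ w ∈ S, w ^ e = 1 ∧ v (w - r) < 1 := by
  have he0 : 0 < e := Nat.pos_of_ne_zero (by rintro rfl; simp at he)
  have hm : (X ^ e - 1 : Q[X]).Monic := monic_X_pow_sub_C (1 : Q) he0.ne'
  have e1 := (IsAlgClosed.splits (X ^ e - 1 : Q[X])).eq_prod_roots_of_monic hm
  have e2 := congrArg (eval r) e1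
  rw [eval_multiset_prod] at e2
  simp only [eval_sub, eval_pow, eval_X, eval_one, Multiset.map_map, Function.comp_def, eval_C] at e2
  rw [e2, map_multiset_prod, Multiset.map_map] at h
  obtain ⟨w, hw, hlt⟩ : ∃ w ∈ (X ^ e - 1 : Q[X]).roots, v (r - w) < 1 := by
    by_contra! hc
    refine not_lt.2 (Multiset.one_le_prod_of_one_le ?_) h
    intro x hx
    obtain ⟨w, hw, rfl⟩ := Multiset.mem_map.1 hx
    exact hc w hw
  have hwe : w ^ e = 1 := by
    have := (mem_roots'.1 hw).2
    simp only [IsRoot.def, eval_sub, eval_pow, eval_X, eval_one] at this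
    exact sub_eq_zero.1 this
  refine ⟨w, hB.sep w ?_, hwe, by rw [Valuation.map_sub_swap]; exact hlt⟩
  have hsep : (X ^ e - 1 : S[X]).Separable := X_pow_sub_one_separable_iff.2 fun h0 => he (by
    have := congrArg (algebraMap S Q) h0; simpa using this)
  exact hsep.of_dvd (minpoly.dvd S w (by simp [hwe]))
end
end

section
variable {v : Valuation Q Γ} {S L M N : Subfield Q} {Y θ : Q} {p : ℕ} {σ Δ : Q → Q} {C A : Set Q}
variable {G : Type*} [Group G] [Finite G] {a : G → Q → Q}

namespace Act

lemma hprod (h : Act G M N a) {ι : Type*} (s : Finset ι) (f : ι → Q) (hf : ∀ i ∈ s, f i ∈ N) (g : G) :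
    a g (∏ i ∈ s, f i) = ∏ i ∈ s, a g (f i) := by
  classical
  induction s using Finset.induction_on with
  | empty => simp [(h.hom g).one]
  | insert i s hi ih =>
    rw [Finset.prod_insert hi, Finset.prod_insert hi, (h.hom g).mul _ (hf i (by simp)) _
      (N.prod_mem fun j hj => hf j (Finset.mem_insert_of_mem hj)), ih fun j hj => hf j (Finset.mem_insert_of_mem hj)]

lemma nrm (h : Act G M N a) {D : Subgroup G} {H : Subgroup D} {z : Q} (hz : z ∈ h.Fx (H.map D.subtype))
    (hv : ∀ d ∈ D, v (a d z) = v z) : ∃ w ∈ h.Fx D, v w = v z ^ H.index := by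
  haveI := Fintype.ofFinite (D ⧸ H)
  refine ⟨∏ q : D ⧸ H, a (q.out : D) z, ⟨N.prod_mem fun q _ => h.mem _ z hz.1, fun d hd => ?_⟩, ?_⟩
  · rw [h.hprod _ _ (fun q _ => h.mem _ z hz.1)]
    refine Fintype.prod_equiv (MulAction.toPerm (⟨d, hd⟩ : D)) _ _ fun q => ?_
    obtain ⟨k, hk⟩ := QuotientGroup.mk_out_eq_mul H (⟨d, hd⟩ * q.out)
    have e2 : (MulAction.toPerm (⟨d, hd⟩ : D) q : D ⧸ H) = ((⟨d, hd⟩ * q.out : D) : D ⧸ H) := by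
      rw [MulAction.toPerm_apply]
      conv_lhs => rw [← QuotientGroup.out_eq' q]
      rfl
    rw [e2, hk, Subgroup.coe_mul _ (_ * _), h.mul (_ : G) ((k : D) : G) z hz.1, hz.2 (k : D) ⟨k, k.2, rfl⟩, Subgroup.coe_mul, h.mul _ _ z hz.1]
  · rw [map_prod, Finset.prod_congr rfl (fun q _ => hv _ (SetLike.coe_mem _)), Finset.prod_const, Finset.card_univ,
      Subgroup.index, Nat.card_eq_fintype_card]

lemma finS (h : Act G (adj S Y) N a) {L : Subfield Q} (h1 : adj S Y ≤ L) (h2 : L ≤ N) :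
    ∃ s : Set Q, s.Finite ∧ L = Subfield.closure (S ∪ s) := by
  obtain ⟨s, hs, e⟩ := h.fin _ h1 h2
  refine ⟨{Y} ∪ s, (Set.finite_singleton Y).union hs, ?_⟩
  rw [e]
  refine le_antisymm (Subfield.closure_le.2 (Set.union_subset ?_ ?_)) (Subfield.closure_le.2 ?_)
  · exact (Subfield.closure_mono (by rw [← Set.union_assoc]; exact Set.subset_union_left))
  · exact fun x hx => Subfield.subset_closure (.inr (.inr hx))
  · rintro x (hx | hx | hx)
    · exact Subfield.subset_closure (.inl (le_adj S Y hx))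
    · exact Subfield.subset_closure (.inl (hx ▸ mem_adj S Y))
    · exact Subfield.subset_closure (.inr hx)

lemma dec_val (h : Act G (adj S Y) N a) (hs : Sys v S Y C A) {d : G} (hd : d ∈ h.Dec v) {z : Q} (hz : z ∈ N) :
    v (a d z) = v z :=
  hom_val hs h.le (fun z hz => (h.sep z hz).isIntegral.isAlgebraic) (h.hom d) (fun z hz => h.fixM d z (le_adj S Y hz))
    (h.fixM d Y (mem_adj S Y)) hd hz

lemma dec_cong (h : Act G (adj S Y) N a) (hs : Sys v S Y C A) (hB : Base v S p) {d : G} (hd : d ∈ h.Dec v) {z : Q}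
    (hz : z ∈ N) (h1 : v z ≤ 1) : v (a d z - z) < 1 :=
  hom_cong hB ((le_adj S Y).trans h.le) (h.hom d) (fun z hz => h.fixM d z (le_adj S Y hz))
    (fun _ hz => h.dec_val hs hd hz) hz h1

lemma map_sub {H D : Subgroup G} (hle : H ≤ D) : (H.subgroupOf D).map D.subtype = H := by
  rw [Subgroup.subgroupOf_map_subtype, inf_of_le_left hle]

variable [IsAlgClosed Q]

lemma tame_im (h : Act G (adj S Y) N a) (hB : Base v S p) (hI : IM v S Y) {Hm : Subgroup G} (hle : Hm ≤ h.Dec v)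
    (hn : v ((Hm.relIndex (h.Dec v) : ℕ) : Q) = 1) : Good v S Y (h.Fx Hm) := by
  have hs := hI.sys hB
  have e := h.trace_trick (v := v) (D := h.Dec v) (H := Hm.subgroupOf (h.Dec v)) hn
    (fun d hd z hz h1 => h.dec_cong hs hB hd hz h1.le) (fun b hb h0 => by
      obtain ⟨n, hn, c, hc, e⟩ := hs.val (h.sep b hb.1).isIntegral.isAlgebraic h0
      obtain ⟨d, hd, e'⟩ := hB.tors hc.1 hn e
      exact ⟨d, h.le_Fx _ (le_adj S Y hd), e'⟩)
  rw [map_sub hle] at e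
  rw [e]; exact h.good_dec

lemma tame_vt (h : Act G (adj S Y) N a) (hB : Base v S p) (hV : VT v S Y) {Hm : Subgroup G} (hle : Hm ≤ h.Dec v)
    (hn : v ((Hm.relIndex (h.Dec v) : ℕ) : Q) = 1) : ∃ Y1, VT v S Y1 ∧ Good v S Y1 (h.Fx Hm) := by
  classical
  have hs := hV.sys
  have hGD := h.good_dec (v := v)
  obtain ⟨D, hD⟩ : ∃ D, D = h.Dec v := ⟨_, rfl⟩
  have hval : ∀ d ∈ D, ∀ z ∈ N, v (a d z) = v z := fun d hd z hz => h.dec_val hs (hD ▸ hd) hz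
  have hcong : ∀ d ∈ D, ∀ z ∈ N, v z ≤ 1 → v (a d z - z) < 1 := fun d hd z hz h1 => h.dec_cong hs hB (hD ▸ hd) hz h1
  rw [← hD] at hle hn hGD
  have hY0 := hV.1
  have vY0 : v Y ≠ 0 := v.ne_zero_iff.2 hY0
  have hSN : S ≤ N := (le_adj S Y).trans h.le
  have hYN : Y ∈ N := h.le (mem_adj S Y)
  obtain ⟨n, hnn⟩ : ∃ n, n = Hm.relIndex D := ⟨_, rfl⟩
  have hn0 : 0 < n := Nat.pos_of_ne_zero (by rintro rfl; rw [← hnn] at hn; simp at hn)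
  have hexp : ∀ b ∈ h.Fx Hm, b ≠ 0 → ∃ j : ℤ, ∃ c ∈ S, c ≠ 0 ∧ v b ^ n = v c * v Y ^ j := by
    intro b hb h0
    have hb' := hb
    rw [← map_sub hle] at hb'
    obtain ⟨w, hw, e⟩ := h.nrm hb' fun d hd => hval d hd b hb.1
    have hw0 : w ≠ 0 := by
      rintro rfl; rw [map_zero] at e; exact pow_ne_zero _ (v.ne_zero_iff.2 h0) e.symm
    obtain ⟨_, ⟨c, hc, hc0, k, rfl⟩, e2⟩ := hGD.val hB hs hw hw0
    refine ⟨k, c, hc, hc0, ?_⟩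
    rw [hnn]; rw [e2] at e; rw [map_mul, map_zpow₀] at e; exact e.symm
  have hYF : Y ∈ h.Fx Hm := h.le_Fx _ (mem_adj S Y)
  have hex : ∃ g : ℕ, 0 < g ∧ ∃ b ∈ h.Fx Hm, b ≠ 0 ∧ ∃ c ∈ S, c ≠ 0 ∧ v b ^ n = v c * v Y ^ (g : ℤ) :=
    ⟨n, hn0, Y, hYF, hY0, 1, S.one_mem, one_ne_zero, by simp⟩
  obtain ⟨g, hg⟩ : ∃ g, g = Nat.find hex := ⟨_, rfl⟩
  have hmin : ∀ g' < g, ¬ _ := fun g' hg' => Nat.find_min hex (hg ▸ hg')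
  obtain ⟨hg0, b0, hb0, hb00, c0, hc0, hc00, e0⟩ := hg ▸ Nat.find_spec hex
  clear hg
  have vb0 : v b0 ≠ 0 := v.ne_zero_iff.2 hb00
  have hdivi : ∀ b ∈ h.Fx Hm, b ≠ 0 → ∀ j : ℤ, ∀ c ∈ S, c ≠ 0 → v b ^ n = v c * v Y ^ j →
      ∃ m : ℤ, j = g * m ∧ ∃ c ∈ S, v b = v (c * b0 ^ m) := by
    intro b hb h0 j c hc hc0' e
    have hq : v (b / b0 ^ (j / g)) ^ n = v (c / c0 ^ (j / g)) * v Y ^ (j % g) := by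
      rw [map_div₀, map_zpow₀, div_pow, e, ← zpow_natCast (v b0 ^ (j / (g:ℤ))) n, ← zpow_mul, mul_comm _ (n : ℤ), zpow_mul,
        zpow_natCast, e0, mul_zpow, ← zpow_mul, Int.emod_def, zpow_sub₀ vY0, map_div₀, map_zpow₀]
      have : v c0 ^ (j / (g:ℤ)) ≠ 0 := zpow_ne_zero _ (v.ne_zero_iff.2 hc00)
      have : v Y ^ ((g:ℤ) * (j / (g:ℤ))) ≠ 0 := zpow_ne_zero _ vY0
      field_simp
    have hqF : b / b0 ^ (j / g) ∈ h.Fx Hm := (h.Fx Hm).div_mem hb ((h.Fx Hm).zpow_mem hb0 _)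
    have hb0z : b0 ^ (j / g) ≠ 0 := zpow_ne_zero _ hb00
    have hq0 : b / b0 ^ (j / g) ≠ 0 := div_ne_zero h0 hb0z
    have hcS : c / c0 ^ (j / g) ∈ S := S.div_mem hc (S.zpow_mem hc0 _)
    have hcS0 : c / c0 ^ (j / g) ≠ 0 := div_ne_zero hc0' (zpow_ne_zero _ hc00)
    have hr0 := Int.emod_nonneg j (Int.natCast_ne_zero.2 hg0.ne')
    have hrl := Int.emod_lt_of_pos j (Int.natCast_pos.2 hg0)
    have hz : j % g = 0 := by
      by_contra hne
      obtain ⟨r, hr⟩ := Int.eq_ofNat_of_zero_le hr0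
      rw [hr] at hq hrl hne
      exact hmin r (by omega) ⟨by omega, _, hqF, hq0, _, hcS, hcS0, hq⟩
    refine ⟨j / g, by rw [Int.mul_ediv_cancel' (Int.dvd_of_emod_eq_zero hz)], ?_⟩
    rw [hz, zpow_zero, mul_one] at hq
    obtain ⟨d, hd, e'⟩ := hB.tors hcS hn0 hq
    exact ⟨d, hd, by rw [map_mul, ← e', ← map_mul, div_mul_cancel₀ _ hb0z]⟩
  obtain ⟨e', he', cY, hcY, eY⟩ := hdivi Y hYF hY0 n 1 S.one_mem one_ne_zero (by simp)
  obtain ⟨e, rfl⟩ : ∃ e : ℕ, e' = e := Int.eq_ofNat_of_zero_le (by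
    by_contra hneg
    have : (g : ℤ) * e' ≤ 0 := mul_nonpos_of_nonneg_of_nonpos (by positivity) (by omega)
    omega)
  have hne : n = g * e := by exact_mod_cast he'
  rw [zpow_natCast] at eY
  have hcY0 : cY ≠ 0 := by rintro rfl; rw [zero_mul, map_zero] at eY; exact vY0 eY
  have hnQ : (n : Q) ≠ 0 := fun h0 => by rw [← hnn, h0] at hn; simp at hn
  have heQ : (e : Q) ≠ 0 := fun h0 => hnQ (by rw [hne]; push_cast; rw [h0, mul_zero])
  have hev := hB.nat e heQ
  have hb0N := hb0.1
  have hr : ∀ d : D, v ((a d b0 / b0) ^ e - 1) < 1 := by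
    intro d
    have hu : v (Y / (cY * b0 ^ e)) = 1 := by
      rw [map_div₀, eY, div_self]; rw [← eY]; exact vY0
    have huN : Y / (cY * b0 ^ e) ∈ N := N.div_mem hYN (N.mul_mem (hSN hcY) (N.pow_mem hb0N e))
    have h1 := hcong d d.2 _ huN hu.le
    have hab : a d b0 ≠ 0 := (h.hom d).ne hb0N hb00
    have h2 : v (a d (Y / (cY * b0 ^ e))) = 1 := by rw [hval d d.2 _ huN, hu]
    have h3 : a d (Y / (cY * b0 ^ e)) = Y / (cY * (a d b0) ^ e) := by
      rw [(h.hom d).div hYN (N.mul_mem (hSN hcY) (N.pow_mem hb0N e)), (h.hom d).mul _ (hSN hcY) _ (N.pow_mem hb0N e),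
        (h.hom d).pow hb0N, h.fixM d Y (mem_adj S Y), h.fixM d cY (le_adj S Y hcY)]
    have h4 : (a d b0 / b0) ^ e - 1 = -(a d (Y / (cY * b0 ^ e)) - Y / (cY * b0 ^ e)) / a d (Y / (cY * b0 ^ e)) := by
      rw [h3, div_pow]; field_simp; ring
    rw [h4, map_div₀, Valuation.map_neg, h2, div_one]; exact h1
  choose ω hωS hωe hω using fun d : D => hB.unit_root heQ (hr d)
  have hvr : ∀ d : D, v (a d b0 / b0) = 1 := fun d => by
    rw [map_div₀, hval d d.2 _ hb0N, div_self vb0]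
  have hvω : ∀ d : D, v (ω d) = 1 := fun d => cg_unit (hω d) (hvr d)
  have hω0 : ∀ d, ω d ≠ 0 := fun d h0 => by have := hvω d; rw [h0, map_zero] at this; exact zero_ne_one this
  have huniq : ∀ d : D, ∀ w, w ^ e = 1 → v (w - a d b0 / b0) < 1 → ω d = w := fun d w hw hw2 =>
    unit_root_uniq hev (hωe d) hw (by
      have : ω d - w = (ω d - a d b0 / b0) - (w - a d b0 / b0) := by ring
      rw [this]; exact v.map_sub_lt (hω d) hw2)
  have hωm : ∀ d d', ω (d * d') = ω d * ω d' := fun d d' => huniq _ _ (by rw [mul_pow, hωe, hωe, one_mul]) (by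
    have hrN : a d' b0 / b0 ∈ N := N.div_mem (h.mem _ _ hb0N) hb0N
    have e1 : a ((d * d' : D) : G) b0 / b0 = a d b0 / b0 * a d (a d' b0 / b0) := by
      have hab : a d b0 ≠ 0 := (h.hom d).ne hb0N hb00
      rw [Subgroup.coe_mul, h.mul _ _ _ hb0N, (h.hom d).div (h.mem _ _ hb0N) hb0N]
      field_simp
    have e2 : ω d * ω d' - a d b0 / b0 * a d (a d' b0 / b0) = (ω d - a d b0 / b0) * ω d' +
      a d b0 / b0 * ((ω d' - a d' b0 / b0) - (a d (a d' b0 / b0) - a d' b0 / b0)) := by ring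
    rw [e1, e2]
    refine v.map_add_lt ?_ ?_
    · rw [map_mul, hvω, mul_one]; exact hω d
    · rw [map_mul, hvr, one_mul]
      exact v.map_sub_lt (hω d') (hcong d d.2 _ hrN (hvr d').le))
  have hωH : ∀ d : D, (d : G) ∈ Hm → ω d = 1 := fun d hd => huniq _ _ (one_pow _) (by
    rw [hb0.2 _ hd, div_self hb00, sub_self, map_zero]; exact zero_lt_one)
  have hχM : ∀ d : D, (ω d)⁻¹ ∈ adj S Y := fun d => le_adj S Y (S.inv_mem (hωS d))
  have hb0' := hb0
  rw [← map_sub hle] at hb0'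
  obtain ⟨Y1, hY1⟩ : ∃ Y1, Y1 = h.Lag D (Hm.subgroupOf D) (fun d => (ω d)⁻¹) b0 := ⟨_, rfl⟩
  have hY1N : Y1 ∈ N := hY1 ▸ h.Lag_mem hχM hb0N
  have haY1 : ∀ d : D, a d Y1 = ω d * Y1 := by
    intro d
    have := h.Lag_act (H := Hm.subgroupOf D) (χ := fun d => (ω d)⁻¹) hχM (fun d d' => by rw [hωm, mul_inv])
      (fun d hd => by rw [hωH d (Subgroup.mem_subgroupOf.1 hd), inv_one]) hb0' d
    rw [← hY1] at this
    conv_rhs => rw [← this]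
    rw [mul_inv_cancel_left₀ (hω0 d)]
  have vY1 : v Y1 = v b0 := by
    rw [hY1]
    refine h.Lag_val hb00 hn fun d => ?_
    have : (ω d)⁻¹ * a d b0 / b0 - 1 = -(ω d - a d b0 / b0) / ω d := by have := hω0 d; field_simp; ring
    rw [this, map_div₀, Valuation.map_neg, hvω, div_one]; exact hω d
  have hY10 : Y1 ≠ 0 := by rintro rfl; rw [map_zero] at vY1; exact vb0 vY1.symm
  have hV1 : VT v S Y1 := ⟨hY10, fun k c hc ek => by
    have h1 : v Y ^ ((g : ℤ) * k) = v (c ^ n / c0 ^ k) := by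
      rw [map_div₀, map_pow, ← ek, vY1, ← zpow_natCast (v b0 ^ k), ← zpow_mul, mul_comm k, zpow_mul (v b0), zpow_natCast (v b0), e0, mul_zpow,
        ← zpow_mul, map_zpow₀, mul_div_cancel_left₀]
      exact zpow_ne_zero _ (v.ne_zero_iff.2 hc00)
    have := hV.2 _ _ (S.div_mem (S.pow_mem hc n) (S.zpow_mem hc0 k)) h1
    rcases mul_eq_zero.1 this with h2 | h2
    · omega
    · exact h2⟩
  let H1' : Subgroup D :=
    { carrier := {d | ω d = 1}
      mul_mem' := fun {x y} (hx : ω x = 1) (hy : ω y = 1) => show ω (x * y) = 1 by rw [hωm, hx, hy, one_mul]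
      one_mem' := hωH 1 (by rw [OneMemClass.coe_one]; exact Hm.one_mem)
      inv_mem' := fun {x} (hx : ω x = 1) => show ω x⁻¹ = 1 by
        have := hωm x⁻¹ x
        rw [inv_mul_cancel, hx, mul_one] at this
        rw [← this]; exact hωH 1 (by rw [OneMemClass.coe_one]; exact Hm.one_mem) }
  obtain ⟨H1, hH1⟩ : ∃ H1, H1 = H1'.map D.subtype := ⟨_, rfl⟩
  have mH1 : ∀ d, d ∈ H1 ↔ ∃ hd : d ∈ D, ω ⟨d, hd⟩ = 1 := fun d => by
    rw [hH1]; constructor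
    · rintro ⟨x, hx, rfl⟩; exact ⟨x.2, hx⟩
    · rintro ⟨hd, hx⟩; exact ⟨⟨d, hd⟩, hx, rfl⟩
  have hHH1 : Hm ≤ H1 := fun d hd => (mH1 d).2 ⟨hle hd, hωH _ hd⟩
  have hH1D : H1 ≤ D := fun d hd => ((mH1 d).1 hd).1
  have hY1F : Y1 ∈ h.Fx H1 := ⟨hY1N, fun d hd => by
    obtain ⟨hd', h1⟩ := (mH1 d).1 hd
    rw [haY1 ⟨d, hd'⟩, h1, one_mul]⟩
  have hn1 : v ((Hm.relIndex H1 : ℕ) : Q) = 1 := by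
    refine hB.nat _ fun h0 => hnQ ?_
    rw [hnn, ← Subgroup.relIndex_mul_relIndex Hm H1 D hHH1 hH1D]; push_cast; rw [h0, zero_mul]
  have eF := h.trace_trick (v := v) (D := H1) (H := Hm.subgroupOf H1) hn1
    (fun d hd z hz h1 => hcong d (hH1D hd) z hz h1.le) (fun b hb h0 => by
      rw [map_sub hHH1] at hb
      obtain ⟨j, c, hc, hc0', e1⟩ := hexp b hb h0
      obtain ⟨m, -, c', hc', e2⟩ := hdivi b hb h0 j c hc hc0' e1
      refine ⟨c' * Y1 ^ m, Subfield.mul_mem _ (h.le_Fx _ (le_adj S Y hc')) (Subfield.zpow_mem _ hY1F m), ?_⟩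
      rw [e2, map_mul, map_mul, map_zpow₀, map_zpow₀, vY1])
  rw [map_sub hHH1] at eF
  rw [eF]
  have hDF : h.Fx D ≤ h.Fx H1 := h.Fx_anti hH1D
  have hgen : h.Fx H1 ≤ adj (h.Fx D) Y1 := fun z hz =>
    h.cor1 _ ((h.le_Fx D).trans (le_adj _ _)) (adj_le (h.Fx_le D) hY1N) z hz.1 fun g' hg' => by
      have hgD : g' ∈ D := h.cor2 D g' fun w hw hw2 => hg' w (le_adj _ _ ⟨hw, hw2⟩)
      have h1 := hg' Y1 (mem_adj _ _)
      rw [haY1 ⟨g', hgD⟩] at h1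
      exact hz.2 _ ((mH1 g').2 ⟨hgD, mul_right_cancel₀ hY10 (h1.trans (one_mul _).symm)⟩)
  have hS1 : S ≤ h.Fx H1 := (le_adj S Y).trans (h.le_Fx _)
  have hle1 : adj S Y1 ≤ h.Fx H1 := adj_le hS1 hY1F
  refine ⟨Y1, hV1, hle1, h.finS (h.le_Fx _) (h.Fx_le _), fun σ Δ hsk hσ hΔ => ?_⟩
  have hqD : Y1 ^ e * cY / Y ∈ h.Fx D := by
    refine Subfield.div_mem _ (Subfield.mul_mem _ ⟨N.pow_mem hY1N e, fun d hd => ?_⟩ (h.le_Fx _ (le_adj S Y hcY)))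
      (h.le_Fx _ (mem_adj S Y))
    rw [(h.hom d).pow hY1N, haY1 ⟨d, hd⟩, mul_pow, hωe, one_mul]
  have hq1 : v (Y1 ^ e * cY / Y) = 1 := by
    rw [map_div₀, eY, map_mul, map_mul, map_pow, map_pow, vY1, mul_comm, div_self]
    exact mul_ne_zero (v.ne_zero_iff.2 hcY0) (pow_ne_zero _ vb0)
  obtain ⟨s, hsS, hs1⟩ := hB.res _ hq1.le
  have vs : v s = 1 := cg_unit (by rw [Valuation.map_sub_swap]; exact hs1) hq1
  have hs0 : s ≠ 0 := by rintro rfl; rw [map_zero] at vs; exact zero_ne_one vs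
  have hu1 : v (Y1 ^ e * cY / Y / s - 1) < 1 := by
    rw [div_sub_one hs0, map_div₀, vs, div_one]; exact hs1
  have huD : Y1 ^ e * cY / Y / s ∈ h.Fx D := Subfield.div_mem _ hqD (h.le_Fx _ (le_adj S Y hsS))
  have hYu : Y * (Y1 ^ e * cY / Y / s) ∈ adj S Y1 := by
    have : Y * (Y1 ^ e * cY / Y / s) = Y1 ^ e * cY / s := by field_simp
    rw [this]
    exact Subfield.div_mem _ (Subfield.mul_mem _ (Subfield.pow_mem _ (mem_adj _ _) e) (le_adj _ _ hcY)) (le_adj _ _ hsS)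
  have hσu := hsk.hom.fix (s := S ∪ {Y1}) hle1 (by
    rintro z (hz | rfl); exacts [hsk.fixS z hz, hσ]) _ hYu
  have hΔu := hsk.killed (s := S ∪ {Y1}) hle1 (by
    rintro z (hz | rfl); exacts [hsk.dS z hz, hΔ]) _ hYu
  have hsk' := hsk.mono hDF ((le_adj S Y).trans (h.le_Fx _))
  have hσY : σ Y = Y := sub_eq_zero.1 (vt_tame_core (Δ := fun z => σ z - z) hB hV hGD hsk'.sub1 huD hu1 hσu (sub_eq_zero.2 hσu))
  have hΔY : Δ Y = 0 := vt_tame_core hB hV hGD hsk' huD hu1 hσu hΔu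
  have hkD := hGD.skew σ Δ hsk' hσY hΔY
  intro z hz
  exact hsk.killed (s := h.Fx D ∪ {Y1}) (adj_le hDF hY1F) (by
    rintro z (hz | rfl); exacts [hkD z hz, hΔ]) z (hgen hz)
end Act
end

section
variable {v : Valuation Q Γ} {S L M N : Subfield Q} {Y θ : Q} {p : ℕ} {σ Δ : Q → Q} {C A : Set Q}
variable {G : Type*} [Group G] [Finite G] {a : G → Q → Q}

lemma prime_index_max {G : Type*} [Group G] [Finite G] (p : ℕ) [hp : Fact p.Prime] {K T : Subgroup G} (hK : K.index = p) (h : K ≤ T)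
    {τ : G} (hτ : τ ∉ K) (hT : τ ∈ T) : T = ⊤ := by
  have h1 : T.index ∣ p := hK ▸ Subgroup.index_dvd_of_le h
  rcases (Nat.dvd_prime hp.out).1 h1 with h2 | h2
  · exact Subgroup.index_eq_one.1 h2
  · exfalso
    have h3 := Subgroup.card_mul_index K
    have h4 := Subgroup.card_mul_index T
    rw [hK] at h3; rw [h2] at h4
    have h5 : Nat.card T = Nat.card K := Nat.eq_of_mul_eq_mul_right hp.out.pos (h4.trans h3.symm)
    have := Subgroup.eq_of_le_of_card_ge h h5.le
    exact hτ (this ▸ hT)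

namespace Act

def St (h : Act G M N a) (H : Subgroup G) (w : Q) (hw : w ∈ N) : Subgroup H where
  carrier := {g | a g w = w}
  mul_mem' := fun {x y} (hx : a x w = w) (hy : a y w = w) => by
    show a ((x * y : H) : G) w = w
    rw [Subgroup.coe_mul, h.mul _ _ w hw, hy, hx]
  one_mem' := h.one w hw
  inv_mem' := fun {x} (hx : a x w = w) => by
    show a ((x⁻¹ : H) : G) w = w
    conv_lhs => rw [← hx]
    rw [Subgroup.coe_inv, ← h.mul _ _ w hw, inv_mul_cancel, h.one w hw]

lemma as_exists [Fact p.Prime] [CharP Q p] (h : Act G M N a) {H : Subgroup G} (hH : H ≤ h.Dec v) (K : Subgroup H)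
    [K.Normal] (hK : K.index = p) : ∃ θ, ASx v p (h.Fx H) θ ∧ adj (h.Fx H) θ = h.Fx (K.map H.subtype) := by
  classical
  have hp : p.Prime := Fact.out
  obtain ⟨τ, hτ⟩ : ∃ τ : H, τ ∉ K := by
    by_contra! hc
    have : K = ⊤ := (Subgroup.eq_top_iff' K).2 hc
    rw [this, Subgroup.index_top] at hK
    exact hp.one_lt.ne hK
  have hτp : τ ^ p ∈ K := hK ▸ Subgroup.pow_index_mem K τ
  have hdist : ∀ m : ℕ, 0 < m → m < p → τ ^ m ∉ K := by
    intro m h0 h1 hm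
    have e1 : (τ : H ⧸ K) ^ m = 1 := by rw [← QuotientGroup.mk_pow]; exact (QuotientGroup.eq_one_iff _).2 hm
    have e2 : (τ : H ⧸ K) ^ p = 1 := by rw [← QuotientGroup.mk_pow]; exact (QuotientGroup.eq_one_iff _).2 hτp
    have e3 := pow_gcd_eq_one.2 ⟨e1, e2⟩
    have : m.gcd p = 1 := (Nat.Coprime.symm ((Nat.Prime.coprime_iff_not_dvd hp).2 fun hd => by
      have := Nat.le_of_dvd h0 hd; omega))
    rw [this, pow_one] at e3
    exact hτ ((QuotientGroup.eq_one_iff _).1 e3)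
  obtain ⟨F0, hF0⟩ : ∃ F0, F0 = h.Fx (K.map H.subtype) := ⟨_, rfl⟩
  have mF0 : ∀ z, z ∈ F0 ↔ z ∈ N ∧ ∀ k ∈ K, a (k : H) z = z := fun z => by
    rw [hF0]; constructor
    · exact fun hz => ⟨hz.1, fun k hk => hz.2 _ ⟨k, hk, rfl⟩⟩
    · refine fun hz => ⟨hz.1, ?_⟩
      rintro _ ⟨k, hk, rfl⟩; exact hz.2 k hk
  have hF0N : F0 ≤ N := fun z hz => ((mF0 z).1 hz).1
  have hst : ∀ z ∈ F0, ∀ t : H, a t z ∈ F0 := by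
    intro z hz t
    refine (mF0 _).2 ⟨h.mem _ z (hF0N hz), fun k hk => ?_⟩
    have h1 : t⁻¹ * k * t ∈ K := by
      have := (inferInstance : K.Normal).conj_mem k hk t⁻¹
      simpa using this
    have h2 := ((mF0 z).1 hz).2 _ h1
    conv_rhs => rw [← h2]
    rw [← h.mul _ _ z (hF0N hz), ← h.mul _ _ z (hF0N hz), ← Subgroup.coe_mul, ← Subgroup.coe_mul]
    congr 2; group
  have htop : ∀ w (hw : w ∈ N), (∀ k ∈ K, a (k : H) w = w) → a τ w = w → w ∈ h.Fx H := by
    intro w hw hk ht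
    have := prime_index_max p (T := h.St H w hw) hK (fun k hk' => hk k hk') hτ ht
    exact ⟨hw, fun g hg => by
      have : (⟨g, hg⟩ : H) ∈ h.St H w hw := this ▸ Subgroup.mem_top _
      exact this⟩
  have hap : ∀ z ∈ F0, a ((τ ^ p : H) : G) z = z := fun z hz => ((mF0 z).1 hz).2 _ hτp
  have hsucc : ∀ z ∈ F0, ∀ i : ℕ, a τ (a ((τ ^ i : H) : G) z) = a ((τ ^ (i + 1) : H) : G) z := fun z hz i => by
    rw [← h.mul _ _ z (hF0N hz), ← Subgroup.coe_mul, ← pow_succ']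
  have hsum0 : ∀ z ∈ F0, ∀ c : ℕ → Q, (∀ i, c i ∈ M) → a τ (∑ i ∈ Finset.range p, c i * a ((τ ^ i : H) : G) z) =
      ∑ i ∈ Finset.range p, c i * a ((τ ^ (i + 1) : H) : G) z := by
    intro z hz c hc
    rw [h.hsum _ _ fun i _ => N.mul_mem (h.le (hc i)) (h.mem _ z (hF0N hz))]
    refine Finset.sum_congr rfl fun i _ => ?_
    rw [(h.hom _).mul _ (h.le (hc i)) _ (h.mem _ z (hF0N hz)), h.fixM _ _ (hc i), hsucc z hz]
  obtain ⟨w, hw, hw0⟩ : ∃ w ∈ F0, (∑ i ∈ Finset.range p, a ((τ ^ i : H) : G) w) ≠ 0 := by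
    by_contra! hc
    let χ : ℕ → F0 →* Q := fun i => (((h.hom ((τ ^ i : H) : G)).mono hF0N).toHom : F0 →* Q)
    have hχ : ∀ i z, χ i z = a ((τ ^ i : H) : G) z := fun i z => rfl
    have hinj : ∀ i j : ℕ, i < j → j < p → χ i ≠ χ j := by
      intro i j hij hj he
      have h1 : (((τ ^ i)⁻¹ * τ ^ j : H) : G) ∈ K.map H.subtype := h.cor2 _ _ fun z hz hz2 => by
        have hzF : z ∈ F0 := hF0 ▸ ⟨hz, hz2⟩
        have h2 := DFunLike.congr_fun he ⟨z, hzF⟩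
        rw [hχ, hχ] at h2
        rw [Subgroup.coe_mul, h.mul _ _ z hz]
        have h2 : a ((τ ^ i : H) : G) z = a ((τ ^ j : H) : G) z := h2
        rw [← h2, ← h.mul _ _ z hz, Subgroup.coe_inv, inv_mul_cancel, h.one z hz]
      obtain ⟨k, hk, e⟩ := h1
      have e' : k = (τ ^ i)⁻¹ * τ ^ j := Subtype.ext e
      have : (τ ^ i)⁻¹ * τ ^ j = τ ^ (j - i) := by rw [inv_mul_eq_iff_eq_mul, ← pow_add]; congr 1; omega
      exact hdist (j - i) (by omega) (by omega) (by rw [← this, ← e']; exact hk)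
    have hli := (linearIndependent_monoidHom F0 Q).comp (fun i : Fin p => χ i) (by
      intro i j he
      by_contra hne
      rcases lt_or_gt_of_ne (fun e => hne (Fin.ext e) : (i : ℕ) ≠ j) with h1 | h1
      · exact hinj _ _ h1 j.2 he
      · exact hinj _ _ h1 i.2 he.symm)
    have := Fintype.linearIndependent_iff.1 hli (fun _ => 1) (by
      ext z
      simp only [Finset.sum_apply, Function.comp, one_smul, Pi.zero_apply]
      rw [Fin.sum_univ_eq_sum_range (fun i => χ i z) p]
      exact hc z z.2) ⟨0, hp.pos⟩
    exact one_ne_zero this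
  obtain ⟨t, ht⟩ : ∃ t, t = ∑ i ∈ Finset.range p, a ((τ ^ i : H) : G) w := ⟨_, rfl⟩
  rw [← ht] at hw0
  have hshift : ∀ f : ℕ → Q, f p = f 0 → ∑ i ∈ Finset.range p, f (i + 1) = ∑ i ∈ Finset.range p, f i := fun f hf => by
    have h1 := Finset.sum_range_succ f p
    have h2 := Finset.sum_range_succ' f p
    rw [hf] at h1; rw [h1] at h2
    exact (add_right_cancel h2).symm
  have htN : t ∈ N := ht ▸ N.sum_mem fun i _ => h.mem _ w (hF0N hw)
  have htF0 : t ∈ F0 := ht ▸ F0.sum_mem fun i _ => hst w hw _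
  have htH : t ∈ h.Fx H := htop t htN (fun k hk => ((mF0 t).1 htF0).2 k hk) (by
    have := hsum0 w hw (fun _ => 1) fun _ => M.one_mem
    simp only [one_mul] at this
    rw [ht, this]
    refine hshift (fun i => a ((τ ^ i : H) : G) w) ?_
    simp only [pow_zero]; rw [hap w hw]; exact (h.one w (hF0N hw)).symm)
  have hu : w / t ∈ F0 := F0.div_mem hw htF0
  have hu1 : ∑ i ∈ Finset.range p, a ((τ ^ i : H) : G) (w / t) = 1 := by
    have : ∀ i ∈ Finset.range p, a ((τ ^ i : H) : G) (w / t) = a ((τ ^ i : H) : G) w / t := fun i _ => by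
      rw [(h.hom _).div (hF0N hw) htN, htH.2 _ (SetLike.coe_mem _)]
    rw [Finset.sum_congr rfl this, ← Finset.sum_div, ← ht, div_self hw0]
  generalize w / t = u at hu hu1
  obtain ⟨θ, hθ⟩ : ∃ θ, θ = ∑ i ∈ Finset.range p, (-(i : Q)) * a ((τ ^ i : H) : G) u := ⟨_, rfl⟩
  have hcM : ∀ i : ℕ, -(i : Q) ∈ M := fun i => M.neg_mem (natCast_mem M i)
  have hθF : θ ∈ F0 := hθ ▸ F0.sum_mem fun i _ => F0.mul_mem (F0.neg_mem (natCast_mem F0 i)) (hst u hu _)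
  have hθN := hF0N hθF
  have hpQ : (p : Q) = 0 := CharP.cast_eq_zero Q p
  have hτθ : a τ θ = θ + 1 := by
    conv_lhs => rw [hθ, hsum0 u hu (fun i => -(i : Q)) hcM]
    have e1 : ∀ i ∈ Finset.range p, -(i : Q) * a ((τ ^ (i + 1) : H) : G) u =
      (-((i + 1 : ℕ) : Q)) * a ((τ ^ (i + 1) : H) : G) u + a ((τ ^ (i + 1) : H) : G) u := fun i _ => by push_cast; ring
    rw [Finset.sum_congr rfl e1, Finset.sum_add_distrib, hshift (fun i => (-(i : Q)) * a ((τ ^ i : H) : G) u) (by simp [hpQ]),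
      hshift (fun i => a ((τ ^ i : H) : G) u) (by
        simp only [pow_zero]; rw [hap u hu]; exact (h.one u (hF0N hu)).symm), ← hθ, hu1]
  have hHF : h.Fx H ≤ F0 := hF0 ▸ h.Fx_anti (by rintro _ ⟨x, -, rfl⟩; exact x.2)
  have hadj : adj (h.Fx H) θ ≤ F0 := adj_le hHF hθF
  refine ⟨θ, ⟨?_, a τ, (h.hom τ).mono (hadj.trans hF0N), fun z hz => hz.2 _ τ.2, hτθ, fun z hz => ?_⟩, ?_⟩
  · have hm : θ ^ p - θ ∈ F0 := F0.sub_mem (F0.pow_mem hθF p) hθF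
    refine htop _ (hF0N hm) (fun k hk => ((mF0 _).1 hm).2 k hk) ?_
    rw [(h.hom τ).sub (N.pow_mem hθN p) hθN, (h.hom τ).pow hθN, hτθ, add_pow_char, one_pow]; ring
  · exact hH τ.2 z (hF0N (hadj hz))
  · rw [← hF0]
    refine le_antisymm hadj fun z hz => h.cor1 _ ((h.le_Fx H).trans (le_adj _ _)) (hadj.trans hF0N) z (hF0N hz) fun g hg => ?_
    have hgH : g ∈ H := h.cor2 H g fun w hw hw2 => hg w (le_adj _ _ ⟨hw, hw2⟩)
    have hgK : (⟨g, hgH⟩ : H) ∈ K := by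
      by_contra hne
      have h1 := prime_index_max p (T := h.St H θ hθN) hK (fun k hk => ((mF0 θ).1 hθF).2 k hk) hne (hg θ (mem_adj _ _))
      have h2 : τ ∈ h.St H θ hθN := h1 ▸ Subgroup.mem_top _
      have h3 : a τ θ = θ := h2
      rw [hτθ] at h3
      exact one_ne_zero (add_eq_left.1 h3)
    exact ((mF0 z).1 hz).2 _ hgK

lemma climb [Fact p.Prime] [CharP Q p] (h : Act G M N a) (Pr : Q → Prop)
    (step : ∀ Y L θ, Pr Y → Good v S Y L → ASx v p L θ → ∃ Y', Pr Y' ∧ Good v S Y' (adj L θ)) (k : ℕ) :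
    ∀ H : Subgroup G, H ≤ h.Dec v → Nat.card H = p ^ k → (∃ Y1, Pr Y1 ∧ Good v S Y1 (h.Fx H)) →
    ∃ Y2, Pr Y2 ∧ Good v S Y2 N := by
  have hp : p.Prime := Fact.out
  induction k with
  | zero =>
    intro H _ hc hY
    rw [pow_zero, Subgroup.card_eq_one] at hc
    rwa [hc, h.Fx_bot] at hY
  | succ k ih =>
    rintro H hH hc ⟨Y1, hY1, hG⟩
    obtain ⟨K, hK⟩ := Sylow.exists_subgroup_card_pow_prime (G := H) p (n := k) (hc ▸ pow_dvd_pow p (Nat.le_succ k))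
    have hidx : K.index = p := by
      have := Subgroup.card_mul_index K
      rw [hK, hc, pow_succ] at this
      exact Nat.eq_of_mul_eq_mul_left (pow_pos hp.pos k) this
    haveI : K.Normal := Subgroup.normal_of_index_eq_minFac_card (by
      rw [hc, hidx, Nat.pow_minFac (Nat.succ_ne_zero k), hp.minFac_eq])
    obtain ⟨θ, h1, h2⟩ := h.as_exists hH K hidx
    obtain ⟨Y', h3, h4⟩ := step Y1 _ θ hY1 hG h1
    rw [h2] at h4
    refine ih (K.map H.subtype) ?_ ?_ ⟨Y', h3, h4⟩
    · rintro _ ⟨x, -, rfl⟩; exact hH x.2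
    · rw [Subgroup.card_map_of_injective H.subtype_injective, hK]

variable [IsAlgClosed Q]

lemma good_top [CharP Q p] (hp : p = 0 ∨ p.Prime) (h : Act G (adj S Y) N a) (hB : Base v S p) (hY : IM v S Y ∨ VT v S Y) :
    ∃ Y1, (IM v S Y1 ∨ VT v S Y1) ∧ Good v S Y1 N := by
  rcases hp with rfl | hp
  · haveI : CharZero Q := CharP.charP_to_charZero Q
    have hn : v (((⊥ : Subgroup G).relIndex (h.Dec v) : ℕ) : Q) = 1 := hB.nat _ (Nat.cast_ne_zero.2 (by
      rw [Subgroup.relIndex_bot_left]; exact Nat.card_pos.ne'))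
    rcases hY with hY | hY
    · have := h.tame_im hB hY bot_le hn
      rw [h.Fx_bot] at this
      exact ⟨Y, .inl hY, this⟩
    · obtain ⟨Y1, h1, h2⟩ := h.tame_vt hB hY bot_le hn
      rw [h.Fx_bot] at h2
      exact ⟨Y1, .inr h1, h2⟩
  · haveI : Fact p.Prime := ⟨hp⟩
    obtain ⟨P⟩ : Nonempty (Sylow p (h.Dec v)) := inferInstance
    obtain ⟨Hm, hHm⟩ : ∃ Hm, Hm = (P : Subgroup (h.Dec v)).map (h.Dec v).subtype := ⟨_, rfl⟩
    have hle : Hm ≤ h.Dec v := by rw [hHm]; rintro _ ⟨x, -, rfl⟩; exact x.2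
    have hsub : Hm.subgroupOf (h.Dec v) = P := by
      rw [hHm, Subgroup.subgroupOf, Subgroup.comap_map_eq_self_of_injective (h.Dec v).subtype_injective]
    have hn : v ((Hm.relIndex (h.Dec v) : ℕ) : Q) = 1 := hB.nat _ fun h0 => by
      rw [Subgroup.relIndex, hsub, CharP.cast_eq_zero_iff Q p] at h0
      exact P.not_dvd_index h0
    obtain ⟨k, hk⟩ := IsPGroup.iff_card.1 P.2
    have hk' : Nat.card Hm = p ^ k := by
      rw [hHm, Subgroup.card_map_of_injective (h.Dec v).subtype_injective]; exact hk
    rcases hY with hY | hY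
    · obtain ⟨Y1, h1, h2⟩ := h.climb (IM v S) (fun Y L θ h1 h2 h3 => im_step hB h1 h2 h3) k Hm hle hk'
        ⟨Y, hY, h.tame_im hB hY hle hn⟩
      exact ⟨Y1, .inl h1, h2⟩
    · obtain ⟨Y1, h1, h2⟩ := h.climb (VT v S) (fun Y L θ h1 h2 h3 => vt_step hB h1 h2 h3) k Hm hle hk'
        (h.tame_vt hB hY hle hn)
      exact ⟨Y1, .inr h1, h2⟩
end Act
end

section
variable {v : Valuation Q Γ} {S L M N κ : Subfield Q} {Y θ x : Q} {p : ℕ}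

lemma dicho [IsAlgClosed Q] (hB : Base v S p) (hx : ¬ IsAlgebraic S x) :
    ∃ Y, adj S Y = adj S x ∧ (IM v S Y ∨ VT v S Y) := by
  by_cases hc : ∀ a ∈ S, ∃ c ∈ S, v (x - a) = v c
  · refine ⟨x, rfl, .inl ⟨fun z hz h0 => ?_, fun z hz h => hx (h ▸ hz)⟩⟩
    have hr : ∀ r, IsAlgebraic S r → ∃ c ∈ S, v (x - r) = v c := by
      intro r hr
      obtain ⟨b, hb, hlt⟩ := hB.dense r hr (x - r) (sub_ne_zero.2 fun h => hx (h ▸ hr))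
      obtain ⟨c, hc', e⟩ := hc b hb
      refine ⟨c, hc', ?_⟩
      rw [← e, ← sub_add_sub_cancel x r b, Valuation.map_add_eq_of_lt_left _ hlt]
    have hpoly : ∀ G : Q[X], (∀ i, G.coeff i ∈ S) → G.eval x ≠ 0 → ∃ c ∈ S, v (G.eval x) = v c := by
      intro G hG h0
      have hG0 : G ≠ 0 := by rintro rfl; simp at h0
      have e := (IsAlgClosed.splits G).eq_prod_roots
      have key : ∀ s : Multiset Q, (∀ ρ ∈ s, IsAlgebraic S ρ) → ∃ c ∈ S, v ((s.map fun ρ => X - C ρ).prod.eval x) = v c := by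
        intro s
        induction s using Multiset.induction_on with
        | empty => intro _; exact ⟨1, S.one_mem, by simp⟩
        | cons a s ih =>
          intro hs
          obtain ⟨c, hc1, e1⟩ := ih fun ρ hρ => hs ρ (Multiset.mem_cons_of_mem hρ)
          obtain ⟨d, hd, e2⟩ := hr a (hs a (Multiset.mem_cons_self a s))
          exact ⟨d * c, S.mul_mem hd hc1, by
            rw [Multiset.map_cons, Multiset.prod_cons, eval_mul, map_mul, map_mul, e1, ← e2]; simp⟩
      obtain ⟨c, hc1, e1⟩ := key G.roots fun ρ hρ => root_alg hG hG0 (mem_roots'.1 hρ).2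
      refine ⟨G.leadingCoeff * c, S.mul_mem (hG _) hc1, ?_⟩
      rw [map_mul, ← e1, ← map_mul]
      conv_lhs => rw [e]
      simp
    obtain ⟨G, H, hG, hH, hH0, rfl⟩ := adj_frac hz
    have hG0 : G.eval x ≠ 0 := fun h => by simp [h] at h0
    obtain ⟨c, hc1, e1⟩ := hpoly G hG hG0
    obtain ⟨d, hd, e2⟩ := hpoly H hH hH0
    exact ⟨c / d, S.div_mem hc1 hd, by rw [map_div₀, map_div₀, e1, e2]⟩
  · push Not at hc
    obtain ⟨a, ha, hc⟩ := hc
    refine ⟨x - a, le_antisymm (adj_le (le_adj _ _) ((adj S x).sub_mem (mem_adj _ _) (le_adj _ _ ha)))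
      (adj_le (le_adj _ _) ?_), .inr ⟨?_, fun k c hcS e => ?_⟩⟩
    · have := (adj S (x - a)).add_mem (mem_adj S (x - a)) (le_adj S (x - a) ha)
      rwa [sub_add_cancel] at this
    · intro h0; exact hc 0 S.zero_mem (by rw [h0])
    · by_contra hk
      obtain ⟨n, hn⟩ := Int.eq_nat_or_neg k
      have hn0 : 0 < n := by rcases hn with rfl | rfl <;> omega
      have : ∃ c' ∈ S, v (x - a) ^ n = v c' := by
        rcases hn with rfl | rfl
        · exact ⟨c, hcS, by rwa [zpow_natCast] at e⟩
        · exact ⟨c⁻¹, S.inv_mem hcS, by rw [map_inv₀, ← e]; simp⟩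
      obtain ⟨c', hc', e'⟩ := this
      obtain ⟨d, hd, e2⟩ := hB.tors hc' hn0 e'
      exact hc d hd e2

lemma propG [IsAlgClosed Q] [CharP Q p] (hp : p = 0 ∨ p.Prime) (hκS : κ ≤ S) (hB : Base v S p)
    (hx : ¬ IsAlgebraic S x) (Z : Set Q) (hZ : Z.Finite) (hsep : ∀ z ∈ Z, IsSeparable (adj κ x) z) :
    ∃ R : Set Q, R.Finite ∧ Z ⊆ R ∧ x ∈ R ∧ (∀ r ∈ R, IsSeparable (adj κ x) r) ∧
      (∀ σ : Q ≃+* Q, (∀ z ∈ adj κ x, σ z = z) → ∀ r ∈ R, σ r ∈ R) ∧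
      ∃ Y, (IM v S Y ∨ VT v S Y) ∧ Good v S Y (Subfield.closure (S ∪ R)) := by
  classical
  obtain ⟨Y0, hY0, hc⟩ := dicho hB hx
  have hle : adj κ x ≤ adj S Y0 := hY0 ▸ adj_le (hκS.trans (le_adj _ _)) (mem_adj _ _)
  have hxs : IsSeparable (adj κ x) x := isSeparable_algebraMap (⟨x, mem_adj κ x⟩ : adj κ x)
  have hsep' : ∀ z ∈ insert x Z, IsSeparable (adj κ x) z := by
    rintro z (rfl | hz); exacts [hxs, hsep z hz]
  have hfin := hZ.insert x
  obtain ⟨f, hf⟩ : ∃ f, f = ∏ z ∈ hfin.toFinset, minpoly (adj κ x) z := ⟨_, rfl⟩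
  have hf0 : f ≠ 0 := hf ▸ Finset.prod_ne_zero_iff.2 fun z hz =>
    minpoly.ne_zero (hsep' z ((Set.Finite.mem_toFinset _).1 hz)).isIntegral
  have hmem : ∀ r, r ∈ f.rootSet Q ↔ aeval r f = 0 := fun r => by rw [mem_rootSet]; exact and_iff_right hf0
  have hsub : insert x Z ⊆ f.rootSet Q := fun z hz => (hmem z).2 (by
    rw [hf, map_prod]
    exact Finset.prod_eq_zero ((Set.Finite.mem_toFinset _).2 hz) (minpoly.aeval _ _))
  have hRsep : ∀ r ∈ f.rootSet Q, IsSeparable (adj κ x) r := by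
    intro r hr
    have := (hmem r).1 hr
    rw [hf, map_prod, Finset.prod_eq_zero_iff] at this
    obtain ⟨z, hz, h0⟩ := this
    exact (hsep' z ((Set.Finite.mem_toFinset _).1 hz)).of_dvd (minpoly.dvd _ _ h0)
  refine ⟨f.rootSet Q, Set.toFinite _, (Set.subset_insert _ _).trans hsub, hsub (.inl rfl), hRsep, ?_, ?_⟩
  · intro σ hσ r hr
    let σ' : Q →ₐ[adj κ x] Q := { (σ : Q →+* Q) with commutes' := fun z => hσ z z.2 }
    have h1 := (hmem r).1 hr
    refine (hmem _).2 ?_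
    have h2 : aeval (σ' r) f = σ' (aeval r f) := aeval_algHom_apply σ' r f
    rw [h1, map_zero] at h2; exact h2
  · let M := adj S Y0
    let I := IntermediateField.adjoin M (f.rootSet Q)
    let f' : M[X] := f.map (Subfield.inclusion hle)
    have hf' : f'.map (algebraMap M Q) = f.map (algebraMap (adj κ x) Q) := by rw [Polynomial.map_map]; rfl
    have hroot : f'.rootSet Q = f.rootSet Q := by
      rw [rootSet_def, rootSet_def, aroots_def, aroots_def, hf']
    have hMsep : ∀ r ∈ f.rootSet Q, IsSeparable M r := fun r hr => by
      letI : Algebra (adj κ x) M := (Subfield.inclusion hle).toAlgebra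
      haveI : IsScalarTower (adj κ x) M Q := .of_algebraMap_eq fun _ => rfl
      exact (hRsep r hr).tower_top M
    haveI : FiniteDimensional M I := IntermediateField.finiteDimensional_adjoin fun r hr => (hMsep r hr).isIntegral
    haveI : Algebra.IsSeparable M I := (IntermediateField.isSeparable_adjoin_iff_isSeparable M Q).2 hMsep
    haveI : IsSplittingField M (IntermediateField.adjoin M (f'.rootSet Q)) f' :=
      IntermediateField.adjoin_rootSet_isSplittingField (IsAlgClosed.splits _)
    haveI : Normal M I := by
      have := Normal.of_isSplittingField (F := M) (E := IntermediateField.adjoin M (f'.rootSet Q)) f'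
      rw [hroot] at this; exact this
    haveI : IsGalois M I := ⟨⟩
    have hMN : M ≤ I.toSubfield := fun z hz => I.algebraMap_mem ⟨z, hz⟩
    have eI : Subfield.extendScalars hMN = I := by ext; rfl
    haveI : FiniteDimensional M (Subfield.extendScalars hMN) := by rw [eI]; infer_instance
    haveI : IsGalois M (Subfield.extendScalars hMN) := by rw [eI]; infer_instance
    obtain ⟨a, ha⟩ := act_exists hMN
    obtain ⟨Y1, h1, h2⟩ := ha.good_top hp hB hc
    refine ⟨Y1, h1, ?_⟩
    have eN : I.toSubfield = Subfield.closure (S ∪ f.rootSet Q) := by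
      rw [IntermediateField.adjoin_toSubfield]
      refine le_antisymm (Subfield.closure_le.2 ?_) (Subfield.closure_le.2 ?_)
      · rintro z (⟨w, rfl⟩ | hz)
        · have : M ≤ Subfield.closure (S ∪ f.rootSet Q) := by
            show adj S Y0 ≤ _
            rw [hY0]
            exact adj_le (fun z hz => Subfield.subset_closure (.inl hz)) (Subfield.subset_closure (.inr (hsub (.inl rfl))))
          exact this w.2
        · exact Subfield.subset_closure (.inr hz)
      · rintro z (hz | hz)
        · exact Subfield.subset_closure (.inl ⟨⟨z, le_adj S Y0 hz⟩, rfl⟩)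
        · exact Subfield.subset_closure (.inr hz)
    rwa [eN] at h2
end

section
variable {v : Valuation Q Γ} {S L M N : Subfield Q} {Y θ : Q} {p : ℕ}
variable {ι ι' : Type} [Fintype ι] {a b : ι → Q} {z w : Q}

def mon (a : ι → Q) (α : ι → ℤ) : Q := ∏ i, a i ^ α i
def IsMon (a : ι → Q) (z : Q) : Prop := ∃ α, z = mon a α
def IsNMon (a : ι → Q) (z : Q) : Prop := ∃ α, 0 ≤ α ∧ z = mon a α

structure Par (v : Valuation Q Γ) (a : ι → Q) : Prop where
  ne : ∀ i, a i ≠ 0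
  lt : ∀ i, v (a i) < 1
  ind : ∀ α, v (mon a α) = 1 → α = 0

lemma mon_add (h : ∀ i, a i ≠ 0) (α β : ι → ℤ) : mon a (α + β) = mon a α * mon a β := by
  rw [mon, mon, mon, ← Finset.prod_mul_distrib]
  exact Finset.prod_congr rfl fun i _ => zpow_add₀ (h i) _ _

lemma mon_zero : mon a 0 = 1 := by simp [mon]
lemma mon_neg (α : ι → ℤ) : mon a (-α) = (mon a α)⁻¹ := by simp [mon]

lemma mon_single [DecidableEq ι] (i : ι) (n : ℤ) : mon a (Pi.single i n) = a i ^ n := by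
  rw [mon, Finset.prod_eq_single i (fun j _ h => by simp [h]) (by simp)]; simp

lemma IsNMon.mon (h : IsNMon a z) : IsMon a z := let ⟨α, _, e⟩ := h; ⟨α, e⟩
lemma IsMon.one : IsMon a 1 := ⟨0, mon_zero.symm⟩
lemma IsNMon.one : IsNMon a 1 := ⟨0, le_rfl, mon_zero.symm⟩
lemma IsMon.self (i : ι) : IsMon a (a i) := by classical exact ⟨Pi.single i 1, by simp [mon_single]⟩
lemma IsNMon.self (i : ι) : IsNMon a (a i) := by
  classical exact ⟨Pi.single i 1, Pi.single_nonneg.2 zero_le_one, by simp [mon_single]⟩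
lemma IsMon.mul (h : ∀ i, a i ≠ 0) (hz : IsMon a z) (hw : IsMon a w) : IsMon a (z * w) :=
  let ⟨α, e⟩ := hz; let ⟨β, e'⟩ := hw; ⟨α + β, by rw [mon_add h, e, e']⟩
lemma IsNMon.mul (h : ∀ i, a i ≠ 0) (hz : IsNMon a z) (hw : IsNMon a w) : IsNMon a (z * w) :=
  let ⟨α, h0, e⟩ := hz; let ⟨β, h1, e'⟩ := hw; ⟨α + β, add_nonneg h0 h1, by rw [mon_add h, e, e']⟩
lemma IsMon.inv (hz : IsMon a z) : IsMon a z⁻¹ := let ⟨α, e⟩ := hz; ⟨-α, by rw [mon_neg, e]⟩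
lemma IsNMon.pow (h : ∀ i, a i ≠ 0) (hz : IsNMon a z) (n : ℕ) : IsNMon a (z ^ n) := by
  induction n with
  | zero => rw [pow_zero]; exact .one
  | succ n ih => rw [pow_succ]; exact ih.mul h hz
lemma IsMon.zpow (h : ∀ i, a i ≠ 0) (hz : IsMon a z) (n : ℤ) : IsMon a (z ^ n) := by
  have key : ∀ n : ℕ, IsMon a (z ^ n) := fun n => by
    induction n with
    | zero => rw [pow_zero]; exact .one
    | succ n ih => rw [pow_succ]; exact ih.mul h hz
  obtain ⟨k, rfl | rfl⟩ := n.eq_nat_or_neg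
  · rw [zpow_natCast]; exact key k
  · rw [zpow_neg, zpow_natCast]; exact (key k).inv

lemma IsMon.trans [Fintype ι'] {b : ι' → Q} (hb : ∀ i, b i ≠ 0) (hab : ∀ i, IsMon b (a i)) (h : IsMon a z) : IsMon b z := by
  obtain ⟨α, rfl⟩ := h
  rw [LU.mon]
  exact Finset.prod_induction _ (IsMon b) (fun _ _ => IsMon.mul hb) .one fun i _ => (hab i).zpow hb _

lemma IsNMon.trans [Fintype ι'] {b : ι' → Q} (hb : ∀ i, b i ≠ 0) (hab : ∀ i, IsNMon b (a i)) (h : IsNMon a z) : IsNMon b z := by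
  obtain ⟨α, h0, rfl⟩ := h
  rw [LU.mon]
  refine Finset.prod_induction _ (IsNMon b) (fun _ _ => IsNMon.mul hb) .one fun i _ => ?_
  obtain ⟨n, hn⟩ := Int.eq_ofNat_of_zero_le (h0 i)
  rw [hn, zpow_natCast]; exact (hab i).pow hb n

lemma IsMon.ne (h : ∀ i, a i ≠ 0) (hz : IsMon a z) : z ≠ 0 := by
  obtain ⟨α, rfl⟩ := hz
  exact Finset.prod_ne_zero_iff.2 fun i _ => zpow_ne_zero _ (h i)

lemma IsMon.mem (h : ∀ i, a i ∈ L) (hz : IsMon a z) : z ∈ L := by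
  obtain ⟨α, rfl⟩ := hz
  exact prod_mem fun i _ => zpow_mem (h i) _

lemma mon_upd_left [DecidableEq ι] (i : ι) (c : Q) (β : ι → ℤ) :
    mon (Function.update a i (a i * c)) β = mon a β * c ^ β i := by
  have : ∀ k, Function.update a i (a i * c) k ^ β k = a k ^ β k * if k = i then c ^ β i else 1 := fun k => by
    by_cases h : k = i
    · subst h; simp [mul_zpow]
    · simp [h]
  simp only [mon, this, Finset.prod_mul_distrib, Finset.prod_ite_eq', Finset.mem_univ, if_true]

lemma mon_upd_right [DecidableEq ι] (h : ∀ i, a i ≠ 0) (j : ι) (n : ℤ) (β : ι → ℤ) :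
    mon a (Function.update β j (β j + n)) = mon a β * a j ^ n := by
  rw [← mon_single, ← mon_add h]
  congr 1; ext k
  by_cases hk : k = j
  · subst hk; simp
  · simp [hk]

lemma perron_step [DecidableEq ι] (ha : Par v a) {i j : ι} (hij : i ≠ j) (hlt : v (a i) < v (a j)) :
    Par v (Function.update a i (a i / a j)) ∧
    (∀ k, IsNMon (Function.update a i (a i / a j)) (a k)) ∧ (∀ k, IsMon a (Function.update a i (a i / a j) k)) ∧
    ∀ α : ι → ℤ, mon a α = mon (Function.update a i (a i / a j)) (Function.update α j (α j + α i)) := by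
  obtain ⟨b, hb⟩ : ∃ b, b = Function.update a i (a i / a j) := ⟨_, rfl⟩
  rw [← hb]
  have hbi : b i = a i / a j := by simp [hb]
  have hbk : ∀ k, k ≠ i → b k = a k := fun k hk => by simp [hb, hk]
  have hb0 : ∀ k, b k ≠ 0 := fun k => by
    by_cases hk : k = i
    · rw [hk, hbi]; exact div_ne_zero (ha.ne _) (ha.ne _)
    · rw [hbk k hk]; exact ha.ne k
  have key : ∀ β, mon b β = mon a (Function.update β j (β j + -β i)) := fun β => by
    rw [hb, div_eq_mul_inv, mon_upd_left, mon_upd_right ha.ne, zpow_neg, inv_zpow]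
  refine ⟨⟨hb0, fun k => ?_, fun β h => ?_⟩, fun k => ?_, fun k => ?_, fun α => ?_⟩
  · by_cases hk : k = i
    · rw [hk, hbi, map_div₀]; exact (div_lt_one₀ (zero_lt_iff.2 (v.ne_zero_iff.2 (ha.ne j)))).2 hlt
    · rw [hbk k hk]; exact ha.lt k
  · rw [key] at h
    have h0 := ha.ind _ h
    have hk : ∀ k, k ≠ j → β k = 0 := fun k hk => by simpa [hk] using congrFun h0 k
    ext k
    by_cases hkj : k = j
    · subst hkj; have := congrFun h0 k; simpa [hk i hij] using this
    · exact hk k hkj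
  · by_cases hk : k = i
    · have : a k = b i * b j := by rw [hk, hbi, hbk j hij.symm, div_mul_cancel₀ _ (ha.ne j)]
      rw [this]; exact (IsNMon.self i).mul hb0 (.self j)
    · rw [← hbk k hk]; exact .self k
  · by_cases hk : k = i
    · rw [hk, hbi, div_eq_mul_inv]; exact (IsMon.self i).mul ha.ne (IsMon.self j).inv
    · rw [hbk k hk]; exact .self k
  · rw [key]; congr 1
    ext k
    by_cases hk : k = j
    · subst hk; simp [hij]
    · simp [hk]

lemma mon_le (ha : Par v a) (α : ι → ℤ) (h : α ≤ 0) (h1 : v (mon a α) ≤ 1) : α = 0 := by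
  refine ha.ind α (le_antisymm h1 ?_)
  rw [mon, map_prod]
  refine Finset.prod_induction _ (1 ≤ ·) (fun _ _ h h' => one_le_mul_of_one_le_of_one_le h h') le_rfl fun i _ => ?_
  rw [map_zpow₀]
  exact one_le_zpow_of_nonpos₀ (zero_lt_iff.2 (v.ne_zero_iff.2 (ha.ne i))) (ha.lt i).le (h i)

lemma perron_one (n : ℕ) : ∀ (a : ι → Q) (α : ι → ℤ) (A B : ℕ), Par v a → v (mon a α) ≤ 1 → (∀ i, α i ≤ A) →
    (∀ i, -(B : ℤ) ≤ α i) →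
    (A + B) * (Fintype.card ι + 1) + (Finset.univ.filter fun i => α i = A ∨ α i = -(B : ℤ)).card ≤ n →
    ∃ b : ι → Q, Par v b ∧ (∀ k, IsNMon b (a k)) ∧ (∀ k, IsMon a (b k)) ∧ IsNMon b (mon a α) := by
  classical
  induction n with
  | zero =>
    intro a α A B ha h1 hA hB hn
    refine ⟨a, ha, .self, .self, α, ?_, rfl⟩
    have : B = 0 := by
      by_contra h
      have : 0 < (A + B) * (Fintype.card ι + 1) := by positivity
      omega
    subst this; exact fun i => by simpa using hB i
  | succ n ih =>
    intro a α A B ha h1 hA hB hn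
    have hcard : (Finset.univ.filter fun i => α i = A ∨ α i = -(B : ℤ)).card ≤ Fintype.card ι := Finset.card_le_univ _
    by_cases hB0 : B = 0
    · exact ⟨a, ha, .self, .self, α, fun i => by simpa [hB0] using hB i, rfl⟩
    by_cases hA0 : A = 0
    · have := mon_le ha α (fun i => by simpa [hA0] using hA i) h1
      exact ⟨a, ha, .self, .self, α, this.ge, rfl⟩
    by_cases hi : ∃ i, α i = A
    swap
    · push Not at hi
      obtain ⟨A, rfl⟩ := Nat.exists_eq_succ_of_ne_zero hA0
      have hc : (Finset.univ.filter fun i => α i = A ∨ α i = -(B : ℤ)).card ≤ Fintype.card ι := Finset.card_le_univ _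
      refine ih a α A B ha h1 (fun i => ?_) hB (by push_cast [Nat.succ_eq_add_one] at hn; nlinarith)
      have := hA i; have := hi i; push_cast at *; omega
    by_cases hj : ∃ j, α j = -(B : ℤ)
    swap
    · push Not at hj
      obtain ⟨B, rfl⟩ := Nat.exists_eq_succ_of_ne_zero hB0
      have hc : (Finset.univ.filter fun i => α i = A ∨ α i = -(B : ℤ)).card ≤ Fintype.card ι := Finset.card_le_univ _
      refine ih a α A B ha h1 hA (fun i => ?_) (by push_cast [Nat.succ_eq_add_one] at hn; nlinarith)
      have := hB i; have := hj i; push_cast at *; omega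
    obtain ⟨i, hi⟩ := hi
    obtain ⟨j, hj⟩ := hj
    have hij : i ≠ j := by rintro rfl; omega
    have fin : ∀ (k l : ι) (hkl : k ≠ l) (hlt : v (a k) < v (a l)) (hl : α l = A ∨ α l = -(B : ℤ))
        (h2 : α l + α k < A) (h3 : -(B : ℤ) < α l + α k),
        ∃ b : ι → Q, Par v b ∧ (∀ k, IsNMon b (a k)) ∧ (∀ k, IsMon a (b k)) ∧ IsNMon b (mon a α) := by
      intro k l hkl hlt hl h2 h3
      obtain ⟨q1, q2, q3, q4⟩ := perron_step ha hkl hlt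
      generalize Function.update a k (a k / a l) = a' at *
      have hup : ∀ m, m ≠ l → Function.update α l (α l + α k) m = α m := fun m hm => by simp [hm]
      obtain ⟨b, r1, r2, r3, r4⟩ := ih a' (Function.update α l (α l + α k)) A B q1 (by rwa [← q4])
        (fun m => by
          by_cases hm : m = l
          · subst hm; simpa using h2.le
          · rw [hup m hm]; exact hA m)
        (fun m => by
          by_cases hm : m = l
          · subst hm; simpa using h3.le
          · rw [hup m hm]; exact hB m) (by
          have : (Finset.univ.filter fun i => Function.update α l (α l + α k) i = A ∨ Function.update α l (α l + α k) i = -(B : ℤ)).card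
            < (Finset.univ.filter fun i => α i = A ∨ α i = -(B : ℤ)).card := by
            refine Finset.card_lt_card (Finset.ssubset_iff_of_subset (fun m hm => ?_) |>.2 ⟨l, by simpa using hl, by simp; omega⟩)
            by_cases hm' : m = l
            · subst hm'; simpa using hl
            · simpa [hm'] using hm
          omega)
      exact ⟨b, r1, fun m => (q2 m).trans r1.ne r2, fun m => (r3 m).trans ha.ne q3, by rwa [q4]⟩
    rcases lt_trichotomy (v (a i)) (v (a j)) with h | h | h
    · exact fin i j hij h (.inr hj) (by omega) (by omega)
    · exfalso
      have : v (mon a (Pi.single i 1 + -Pi.single j 1)) = 1 := by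
        rw [mon_add ha.ne, mon_neg, mon_single, mon_single, zpow_one, zpow_one, map_mul, map_inv₀, h,
          mul_inv_cancel₀ (v.ne_zero_iff.2 (ha.ne j))]
      have := congrFun (ha.ind _ this) i
      simp [hij] at this
    · exact fin j i hij.symm h (.inl hi) (by omega) (by omega)

lemma perron (ha : Par v a) (T : Set Q) (hT : T.Finite) (h : ∀ z ∈ T, IsMon a z ∧ v z ≤ 1) :
    ∃ b : ι → Q, Par v b ∧ (∀ k, IsNMon b (a k)) ∧ (∀ k, IsMon a (b k)) ∧ ∀ z ∈ T, IsNMon b z := by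
  induction T, hT using Set.Finite.induction_on with
  | empty => exact ⟨a, ha, .self, .self, by simp⟩
  | @insert z T _ _ ih =>
    obtain ⟨b, r1, r2, r3, r4⟩ := ih fun z hz => h z (.inr hz)
    obtain ⟨⟨α, hα⟩, hz⟩ := h z (.inl rfl)
    obtain ⟨β, hβ⟩ := IsMon.trans r1.ne (fun i => (r2 i).mon) ⟨α, hα⟩
    have hbd : ∀ i, |β i| ≤ ((∑ i, |β i|).toNat : ℤ) := fun i => by
      rw [Int.toNat_of_nonneg (Finset.sum_nonneg fun i _ => abs_nonneg _)]
      exact Finset.single_le_sum (f := fun i => |β i|) (fun i _ => abs_nonneg _) (Finset.mem_univ i)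
    obtain ⟨c, s1, s2, s3, s4⟩ := perron_one _ b β _ _ r1 (hβ ▸ hz) (fun i => (abs_le.1 (hbd i)).2) (fun i => (abs_le.1 (hbd i)).1) le_rfl
    refine ⟨c, s1, fun k => (r2 k).trans s1.ne s2, fun k => (s3 k).trans ha.ne r3, ?_⟩
    rintro w (rfl | hw)
    · rwa [hβ]
    · exact (r4 w hw).trans s1.ne s2
end

section
variable {v : Valuation Q Γ} {S L L' M N k κ : Subfield Q} {Y x : Q} {p : ℕ} {C A A' W : Set Q}
variable {ι ι₂ ι' ι₂' : Type} [Fintype ι] [Fintype ι₂] [Fintype ι'] {a : ι → Q} {a' : ι' → Q} {c : ι₂ → Q} {z w u : Q}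

def PA (k : Subfield Q) (a : ι → Q) (c : ι₂ → Q) : Set Q := k ∪ (Set.range a ∪ Set.range c)

def DD (v : Valuation Q Γ) (L : Subfield Q) (A : Set Q) (a : ι → Q) (w : Q) : Prop :=
  ∃ z u, w = z * u ∧ IsMon a z ∧ (v w ≤ 1 → IsNMon a z) ∧ Het v L A u ∧ Het v L A u⁻¹

structure UD (v : Valuation Q Γ) (k κ : Subfield Q) (W : Set Q) (a : ι → Q) (c : ι₂ → Q) : Prop where
  fin : W.Finite
  ne : ∀ w ∈ W, w ≠ 0
  sep : ∀ w ∈ W, IsSeparable κ w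
  le : κ ≤ Subfield.closure (k ∪ W)
  stab : ∀ σ : Q ≃+* Q, (∀ z ∈ κ, σ z = z) → ∀ w ∈ W, σ w ∈ Subfield.closure (k ∪ W)
  par : Par v a
  aF : ∀ i, a i ∈ Subfield.closure (k ∪ W)
  cF : ∀ i, c i ∈ Subfield.closure (k ∪ W)
  cl : ∀ i, v (c i) ≤ 1
  dec : ∀ w ∈ W, DD v (Subfield.closure (k ∪ W)) (PA k a c) a w

def UU (v : Valuation Q Γ) (k κ : Subfield Q) (i : ℕ) : Prop := ∀ Z : Set Q, Z.Finite → (∀ z ∈ Z, z ≠ 0) →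
  (∀ z ∈ Z, IsSeparable κ z) → ∃ (W : Set Q) (m n : ℕ) (a : Fin m → Q) (c : Fin n → Q),
    m + n = i ∧ Z ⊆ W ∧ UD v k κ W a c

lemma unit_val (h1 : Het v L A u) (h2 : Het v L A u⁻¹) (h0 : u ≠ 0) : v u = 1 := by
  refine le_antisymm h1.le_one ?_
  have := h2.le_one
  rw [map_inv₀] at this
  exact (inv_le_one₀ (zero_lt_iff.2 (v.ne_zero_iff.2 h0))).1 this

lemma IsNMon.het (ha : Par v a) (hL : ∀ i, a i ∈ L) (hA : ∀ i, a i ∈ A) (h : IsNMon a z) : Het v L A z := by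
  obtain ⟨α, h0, rfl⟩ := h
  rw [LU.mon]
  refine Finset.prod_induction _ (Het v L A) (fun _ _ => .mul _ _) .one fun i _ => ?_
  obtain ⟨n, hn⟩ := Int.eq_ofNat_of_zero_le (h0 i)
  rw [hn, zpow_natCast]
  exact Het.pow (.base _ (hA i) (hL i) (ha.lt i).le) n

lemma DD.het (ha : Par v a) (hL : ∀ i, a i ∈ L) (hA : ∀ i, a i ∈ A) (h : DD v L A a w) (hw : v w ≤ 1) : Het v L A w := by
  obtain ⟨z, u, rfl, h1, h2, h3, _⟩ := h
  exact .mul _ _ ((h2 hw).het ha hL hA) h3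

lemma DD.mul (h : DD v L A a w) (h0 : u ≠ 0) (h1 : Het v L A u) (h2 : Het v L A u⁻¹) : DD v L A a (w * u) := by
  obtain ⟨z, y, rfl, h3, h4, h5, h6⟩ := h
  refine ⟨z, y * u, by ring, h3, fun hw => h4 ?_, .mul _ _ h5 h1, by rw [mul_inv]; exact .mul _ _ h6 h2⟩
  rwa [map_mul, unit_val h1 h2 h0, mul_one] at hw

lemma DD.mono (ha' : Par v a') (hL : L ≤ L') (hA : ∀ z ∈ A, z ∈ L → v z ≤ 1 → Het v L' A' z)
    (hab : ∀ i, IsNMon a' (a i)) (h : DD v L A a w) : DD v L' A' a' w := by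
  obtain ⟨z, u, rfl, h3, h4, h5, h6⟩ := h
  exact ⟨z, u, rfl, h3.trans ha'.ne fun i => (hab i).mon, fun h => (h4 h).trans ha'.ne hab, h5.trans' hL hA, h6.trans' hL hA⟩

def Ext (v : Valuation Q Γ) (k κ S : Subfield Q) (Y : Q) (C A : Set Q) : Prop :=
  ∀ X l : Set Q, X.Finite → X ⊆ C → l.Finite → l ⊆ A → ∃ S1 : Set Q, S1.Finite ∧ S1 ⊆ S ∧
    ∀ (m n : ℕ) (W : Set Q) (a : Fin m → Q) (c : Fin n → Q) (L : Subfield Q), UD v k κ W a c → (∀ s ∈ S1, s ≠ 0 → s ∈ W) →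
    Subfield.closure (k ∪ W) ≤ L → Y ∈ L →
    ∃ (m' n' : ℕ) (a' : Fin m' → Q) (c' : Fin n' → Q), m' + n' = m + n + 1 ∧ Par v a' ∧
      (∀ i, a' i ∈ L) ∧ (∀ i, c' i ∈ L) ∧ (∀ i, v (c' i) ≤ 1) ∧ (∀ w ∈ W, DD v L (PA k a' c') a' w) ∧
      (∀ w ∈ X, DD v L (PA k a' c') a' w) ∧ ∀ e ∈ l, Het v L (PA k a' c') e

lemma IM.ext (h : IM v S Y) : Ext v k κ S Y (Cim S) (Aim v S Y) := by
  classical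
  intro X l hX hXC hl hlA
  have : ∀ e : Q, ∃ α β : Q, e ∈ l → α ∈ S ∧ β ∈ S ∧ v e ≤ 1 ∧ e = α + β * Y := fun e => by
    by_cases he : e ∈ l
    · obtain ⟨h1, α, h2, β, h3, h4⟩ := hlA he
      exact ⟨α, β, fun _ => ⟨h2, h3, h1, h4⟩⟩
    · exact ⟨0, 0, fun h => absurd h he⟩
  choose α β hαβ using this
  obtain ⟨a0, b0, hd, hab⟩ := (Ev.list h hl.toFinset (fun e a b => v (α e + β e * a) ≤ 1 ∧ v (β e * b) ≤ 1) fun e he => by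
    obtain ⟨h1, h2, h3, h4⟩ := hαβ e (by simpa using he)
    exact h.aff h1 h2 (h4 ▸ h3)).ex
  have hb0 := hd.2.2.1
  refine ⟨X ∪ {a0, b0} ∪ ((fun e => α e + β e * a0) '' l ∪ (fun e => β e * b0) '' l),
    (hX.union (by simp)).union ((hl.image _).union (hl.image _)), ?_, ?_⟩
  · rintro s ((hs | rfl | rfl) | ⟨e, he, rfl⟩ | ⟨e, he, rfl⟩)
    · exact (hXC hs).1
    · exact hd.1
    · exact hd.2.1
    · exact S.add_mem (hαβ e he).1 (S.mul_mem (hαβ e he).2.1 hd.1)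
    · exact S.mul_mem (hαβ e he).2.1 hd.2.1
  intro m n W a c L hU hW hL hY
  have hWL : ∀ w ∈ W, w ∈ L := fun w hw => hL (Subfield.subset_closure (.inr hw))
  have hmem : ∀ s ∈ X ∪ {a0, b0} ∪ ((fun e => α e + β e * a0) '' l ∪ (fun e => β e * b0) '' l), s ∈ L := fun s hs => by
    by_cases h0 : s = 0
    · rw [h0]; exact L.zero_mem
    · exact hWL _ (hW s hs h0)
  have hyL : (Y - a0) / b0 ∈ L := L.div_mem (L.sub_mem hY (hmem _ (by simp))) (hmem _ (by simp))
  have hsub : PA k a c ⊆ PA k a (Fin.cons ((Y - a0) / b0) c : Fin (n + 1) → Q) := by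
    rintro z (hz | hz | ⟨i, rfl⟩)
    exacts [.inl hz, .inr (.inl hz), .inr (.inr ⟨i.succ, by simp⟩)]
  have hD : ∀ w ∈ W, DD v L (PA k a (Fin.cons ((Y - a0) / b0) c : Fin (n + 1) → Q)) a w := fun w hw =>
    (hU.dec w hw).mono hU.par hL (fun z h1 h2 h3 => .base z (hsub h1) (hL h2) h3) .self
  have hH : ∀ s, s ∈ (fun e => α e + β e * a0) '' l ∪ (fun e => β e * b0) '' l → v s ≤ 1 →
      Het v L (PA k a (Fin.cons ((Y - a0) / b0) c : Fin (n + 1) → Q)) s := fun s hs h1 => by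
    by_cases h0 : s = 0
    · rw [h0]; exact .zero
    · exact (hD s (hW s (.inr hs) h0)).het hU.par (fun i => hL (hU.aF i)) (fun i => .inr (.inl ⟨i, rfl⟩)) h1
  refine ⟨m, n + 1, a, Fin.cons ((Y - a0) / b0) c, by omega, hU.par, fun i => hL (hU.aF i), fun i => ?_, fun i => ?_, hD,
    fun w hw => hD w (hW w (.inl (.inl hw)) (hXC hw).2), fun e he => ?_⟩
  · refine Fin.cases ?_ (fun i => ?_) i
    · simpa using hyL
    · simpa using hL (hU.cF i)
  · refine Fin.cases ?_ (fun i => ?_) i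
    · simpa using hd.le
    · simpa using hU.cl i
  · have : e = (α e + β e * a0) + (β e * b0) * ((Y - a0) / b0) := by
      rw [mul_assoc, mul_div_cancel₀ _ hb0]; nth_rw 1 [(hαβ e he).2.2.2]; ring
    rw [this]
    obtain ⟨h1, h2⟩ := hab e (by simpa using he)
    exact .add _ _ (hH _ (.inl ⟨e, he, rfl⟩) h1) (.mul _ _ (hH _ (.inr ⟨e, he, rfl⟩) h2)
      (.base _ (.inr (.inr ⟨0, by simp⟩)) hyL hd.le))

lemma VT.ext (h : VT v S Y) (hkS : k ≤ S) (hκ : ∀ w, IsSeparable κ w → w ∈ S) : Ext v k κ S Y (Cvt S Y) (Avt v S Y) := by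
  classical
  intro X l hX hXC hl hlA
  have : ∀ e : Q, ∃ (d : Q) (n : ℤ), e ∈ X ∪ l → d ∈ S ∧ e = d * Y ^ n ∧ (e ∈ X → d ≠ 0) := fun e => by
    by_cases he : e ∈ X
    · obtain ⟨d, h1, h0, n, h4⟩ := hXC he
      exact ⟨d, n, fun _ => ⟨h1, h4, fun _ => h0⟩⟩
    by_cases he' : e ∈ l
    · obtain ⟨_, d, h1, n, h4⟩ := hlA he'
      exact ⟨d, n, fun _ => ⟨h1, h4, fun h => absurd h he⟩⟩
    · exact ⟨0, 0, fun h => h.elim (fun h => absurd h he) fun h => absurd h he'⟩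
  choose d k' hdk using this
  refine ⟨d '' (X ∪ l), (hX.union hl).image _, ?_, ?_⟩
  · rintro _ ⟨e, he, rfl⟩; exact (hdk e he).1
  intro m n W a c L hU hW hL hY
  have hFS : Subfield.closure (k ∪ W) ≤ S := Subfield.closure_le.2 (Set.union_subset hkS fun w hw => hκ w (hU.sep w hw))
  have hY1 : v Y ≠ 1 := fun e => absurd (h.2 1 1 S.one_mem (by simpa using e)) one_ne_zero
  obtain ⟨y, hyY, hy⟩ : ∃ y, (y = Y ∨ y = Y⁻¹) ∧ v y < 1 := by
    rcases lt_or_gt_of_ne hY1 with e | e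
    · exact ⟨Y, .inl rfl, e⟩
    · exact ⟨Y⁻¹, .inr rfl, by rw [map_inv₀]; exact inv_lt_one_of_one_lt₀ e⟩
  have hyL : y ∈ L := by rcases hyY with rfl | rfl; exacts [hY, L.inv_mem hY]
  have hy0 : y ≠ 0 := by rcases hyY with rfl | rfl; exacts [h.1, inv_ne_zero h.1]
  have hyd : ∀ (n : ℤ), ∀ c ∈ S, v y ^ n = v c → n = 0 := fun n c hc e => by
    rcases hyY with rfl | rfl
    · exact h.2 n c hc e
    · rw [map_inv₀, inv_zpow, ← zpow_neg] at e; exact neg_eq_zero.1 (h.2 _ c hc e)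
  have hYn : ∀ n : ℤ, ∃ n' : ℤ, Y ^ n = y ^ n' := fun n => by
    rcases hyY with rfl | rfl
    · exact ⟨n, rfl⟩
    · exact ⟨-n, by simp⟩
  obtain ⟨a0, ha0⟩ : ∃ a0 : Fin (m + 1) → Q, a0 = Fin.cons y a := ⟨_, rfl⟩
  have e0 : a0 0 = y := by simp [ha0]
  have es : ∀ i : Fin m, a0 i.succ = a i := fun i => by simp [ha0]
  have hP0 : Par v a0 := by
    refine ⟨fun i => ?_, fun i => ?_, fun α hα => ?_⟩
    · refine Fin.cases (by rwa [e0]) (fun i => by rw [es]; exact hU.par.ne i) i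
    · refine Fin.cases (by rwa [e0]) (fun i => by rw [es]; exact hU.par.lt i) i
    · have hm : mon a0 α = y ^ α 0 * mon a (fun i => α i.succ) := by simp only [mon, Fin.prod_univ_succ, e0, es]
      have hne : mon a (fun i => α i.succ) ≠ 0 := IsMon.ne hU.par.ne ⟨_, rfl⟩
      rw [hm, map_mul, map_zpow₀] at hα
      have h0 : α 0 = 0 := hyd _ (mon a (fun i => α i.succ))⁻¹ (S.inv_mem (IsMon.mem (fun i => hFS (hU.aF i)) ⟨_, rfl⟩)) (by
        rw [map_inv₀]; exact eq_inv_of_mul_eq_one_left hα)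
      rw [h0, zpow_zero, one_mul] at hα
      have := hU.par.ind _ hα
      ext i
      exact Fin.cases h0 (fun i => congrFun this i) i
  have hdz : ∀ e : Q, ∃ z u : Q, e ∈ X ∪ l → d e ≠ 0 → e = z * u ∧ IsMon a0 z ∧
      Het v (Subfield.closure (k ∪ W)) (PA k a c) u ∧ Het v (Subfield.closure (k ∪ W)) (PA k a c) u⁻¹ ∧ v z = v e := fun e => by
    by_cases he : e ∈ X ∪ l ∧ d e ≠ 0
    · obtain ⟨z, u, h1, h2, _, h3, h4⟩ := hU.dec _ (hW (d e) ⟨e, he.1, rfl⟩ he.2)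
      obtain ⟨n', hn'⟩ := hYn (k' e)
      have hee : e = (z * y ^ n') * u := by rw [(hdk e he.1).2.1, h1, hn']; ring
      have hu0 : u ≠ 0 := fun h => he.2 (by rw [h1, h, mul_zero])
      refine ⟨z * y ^ n', u, fun _ _ => ⟨hee, (h2.trans hP0.ne fun i => ?_).mul hP0.ne ?_, h3, h4, ?_⟩⟩
      · rw [← es]; exact .self _
      · rw [← e0]; exact (IsMon.self 0).zpow hP0.ne _
      · rw [hee, map_mul _ _ u, unit_val h3 h4 hu0, mul_one]
    · exact ⟨0, 0, fun h1 h2 => absurd ⟨h1, h2⟩ he⟩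
  choose z u hzu using hdz
  obtain ⟨b, q1, q2, q3, q4⟩ := perron hP0 (z '' {e | e ∈ X ∪ l ∧ d e ≠ 0 ∧ v e ≤ 1})
    (((hX.union hl).subset fun e he => he.1).image z) (by
      rintro _ ⟨e, ⟨h1, h2, h3⟩, rfl⟩
      obtain ⟨_, h5, _, _, h6⟩ := hzu e h1 h2
      exact ⟨h5, h6 ▸ h3⟩)
  have ha0L : ∀ i, a0 i ∈ L := fun i => by
    refine Fin.cases (by rwa [e0]) (fun i => by rw [es]; exact hL (hU.aF i)) i
  have hbL : ∀ i, b i ∈ L := fun i => (q3 i).mem ha0L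
  have hab : ∀ i, IsNMon b (a i) := fun i => by rw [← es]; exact q2 _
  have hA : ∀ z ∈ PA k a c, z ∈ Subfield.closure (k ∪ W) → v z ≤ 1 → Het v L (PA k b c) z := by
    rintro z (hz | ⟨i, rfl⟩ | hz) h1 h2
    · exact .base _ (.inl hz) (hL h1) h2
    · exact (hab i).het q1 hbL fun i => .inr (.inl ⟨i, rfl⟩)
    · exact .base _ (.inr (.inr hz)) (hL h1) h2
  have hDX : ∀ e ∈ X ∪ l, d e ≠ 0 → DD v L (PA k b c) b e := fun e he h0 => by
    obtain ⟨r1, r2, r3, r4, r5⟩ := hzu e he h0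
    exact ⟨z e, u e, r1, r2.trans q1.ne fun i => (q2 i).mon, fun h1 => q4 _ ⟨e, ⟨he, h0, h1⟩, rfl⟩,
      r3.trans' hL hA, r4.trans' hL hA⟩
  refine ⟨m + 1, n, b, c, by omega, q1, hbL, fun i => hL (hU.cF i), hU.cl, fun w hw => (hU.dec w hw).mono q1 hL hA hab,
    fun w hw => hDX w (.inl hw) ((hdk w (.inl hw)).2.2 hw), fun e he => ?_⟩
  by_cases h0 : d e = 0
  · rw [(hdk e (.inr he)).2.1, h0, zero_mul]; exact .zero
  · exact (hDX e (.inr he) h0).het q1 hbL (fun i => .inr (.inl ⟨i, rfl⟩)) (hlA he).1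
end

section
variable {v : Valuation Q Γ} {S L L' M N k κ : Subfield Q} {Y x : Q} {p : ℕ} {C A A' W : Set Q}

lemma closure_fin1 {B R : Set Q} {z : Q} (hz : z ∈ Subfield.closure (B ∪ R)) :
    ∃ T : Set Q, T.Finite ∧ T ⊆ B ∧ z ∈ Subfield.closure (T ∪ R) := by
  have mon : ∀ {T T' : Set Q}, Subfield.closure (T ∪ R) ≤ Subfield.closure (T ∪ T' ∪ R) ∧
      Subfield.closure (T' ∪ R) ≤ Subfield.closure (T ∪ T' ∪ R) := fun {T T'} =>
    ⟨Subfield.closure_mono (Set.union_subset_union_left _ Set.subset_union_left),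
      Subfield.closure_mono (Set.union_subset_union_left _ Set.subset_union_right)⟩
  induction hz using Subfield.closure_induction with
  | mem z h =>
    rcases h with h | h
    · exact ⟨{z}, by simp, by simpa using h, Subfield.subset_closure (by simp)⟩
    · exact ⟨∅, by simp, by simp, Subfield.subset_closure (by simp [h])⟩
  | one => exact ⟨∅, by simp, by simp, Subfield.one_mem _⟩
  | add a b _ _ h1 h2 =>
    obtain ⟨T, t1, t2, t3⟩ := h1; obtain ⟨T', s1, s2, s3⟩ := h2
    exact ⟨T ∪ T', t1.union s1, Set.union_subset t2 s2, Subfield.add_mem _ (mon.1 t3) (mon.2 s3)⟩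
  | neg a _ h1 => obtain ⟨T, t1, t2, t3⟩ := h1; exact ⟨T, t1, t2, Subfield.neg_mem _ t3⟩
  | inv a _ h1 => obtain ⟨T, t1, t2, t3⟩ := h1; exact ⟨T, t1, t2, Subfield.inv_mem _ t3⟩
  | mul a b _ _ h1 h2 =>
    obtain ⟨T, t1, t2, t3⟩ := h1; obtain ⟨T', s1, s2, s3⟩ := h2
    exact ⟨T ∪ T', t1.union s1, Set.union_subset t2 s2, Subfield.mul_mem _ (mon.1 t3) (mon.2 s3)⟩

lemma closure_fin {B R l : Set Q} (hl : l.Finite) (h : l ⊆ Subfield.closure (B ∪ R)) :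
    ∃ T : Set Q, T.Finite ∧ T ⊆ B ∧ l ⊆ Subfield.closure (T ∪ R) := by
  induction l, hl using Set.Finite.induction_on with
  | empty => exact ⟨∅, by simp, by simp, by simp⟩
  | @insert z l _ _ ih =>
    obtain ⟨T, t1, t2, t3⟩ := ih ((Set.subset_insert _ _).trans h)
    obtain ⟨T', s1, s2, s3⟩ := closure_fin1 (h (.inl rfl))
    refine ⟨T ∪ T', t1.union s1, Set.union_subset t2 s2, Set.insert_subset ?_ (t3.trans ?_)⟩
    · exact Subfield.closure_mono (Set.union_subset_union_left _ Set.subset_union_right) s3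
    · exact Subfield.closure_mono (Set.union_subset_union_left _ Set.subset_union_left)

lemma sep_up (h : κ ≤ L) {z : Q} (hz : IsSeparable κ z) : IsSeparable L z := by
  letI : Algebra κ L := (Subfield.inclusion h).toAlgebra
  haveI : IsScalarTower κ L Q := .of_algebraMap_eq fun _ => rfl
  exact hz.tower_top L

lemma UU_step1 [IsAlgClosed Q] {R : Set Q} (hk : k ≤ κ) (hS : ∀ z, z ∈ S ↔ IsSeparable κ z) (hB : Base v S p)
    (hx : x ≠ 0) {i : ℕ} (hU : UU v k κ i) (hs : Sys v S Y C A) (hE : Ext v k κ S Y C A)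
    (hR : R.Finite) (hxR : x ∈ R) (hRs : ∀ r ∈ R, IsSeparable (adj κ x) r)
    (hst : ∀ σ : Q ≃+* Q, (∀ z ∈ adj κ x, σ z = z) → ∀ r ∈ R, σ r ∈ R)
    (hG : Good v S Y (Subfield.closure (S ∪ R))) :
    ∃ (W : Set Q) (m n : ℕ) (a : Fin m → Q) (c : Fin n → Q),
      m + n = i + 1 ∧ R \ {0} ⊆ W ∧ UD v k (adj κ x) W a c := by
  classical
  obtain ⟨N, hN⟩ : ∃ N, N = Subfield.closure (S ∪ R) := ⟨_, rfl⟩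
  have hRN : ∀ r ∈ R, r ∈ N := fun r hr => hN ▸ Subfield.subset_closure (.inr hr)
  rw [← hN] at hG
  have hCN : ∀ c ∈ C, c ∈ N := fun c hc => hG.le (hs.C_adj c hc)
  have : ∀ w : Q, ∃ c : Q, ∃ l : Set Q, l.Finite ∧ l ⊆ N ∧ (w ∈ R \ {0} → c ∈ C ∧
      ∀ L₁ : Subfield Q, l ⊆ L₁ → Het v L₁ (A ∩ l) (w / c) ∧ Het v L₁ (A ∩ l) (w / c)⁻¹) := by
    intro w
    by_cases hw : w ∈ R \ {0}
    · obtain ⟨c, hc, e⟩ := hG.val hB hs (hRN w hw.1) hw.2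
      have hc0 := hs.C0 c hc
      have h1 : v (w / c) = 1 := by rw [map_div₀, e, div_self (v.ne_zero_iff.2 hc0)]
      have hH := hG.het hB hs (N.div_mem (hRN w hw.1) (hCN c hc)) h1.le
      obtain ⟨l, l1, l2, l3⟩ := hH.finite
      exact ⟨c, l, l1, l2, fun _ => ⟨hc, fun L₁ h => ⟨l3 L₁ h, (l3 L₁ h).inv h1⟩⟩⟩
    · exact ⟨0, ∅, by simp, by simp, fun h => absurd h hw⟩
  choose cc l l1 l2 hcl using this
  have hR0 : (R \ {0}).Finite := hR.subset Set.diff_subset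
  obtain ⟨l', hl'⟩ : ∃ l', l' = insert Y (⋃ w ∈ R \ {0}, l w) := ⟨_, rfl⟩
  have hlf : l'.Finite := hl' ▸ (Set.Finite.biUnion hR0 fun i _ => l1 i).insert _
  have hlN : l' ⊆ N := hl' ▸ Set.insert_subset (hG.le (mem_adj _ _)) (Set.iUnion₂_subset fun i _ => l2 i)
  have hll : ∀ w ∈ R \ {0}, l w ⊆ l' := fun w hw => hl' ▸ (Set.subset_biUnion_of_mem (u := l) hw).trans (Set.subset_insert _ _)
  obtain ⟨S0, s1, s2, s3⟩ := closure_fin hlf (hN ▸ hlN)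
  obtain ⟨S1, t1, t2, hE⟩ := hE (cc '' (R \ {0})) (A ∩ l') (hR0.image _) (by
    rintro _ ⟨w, hw, rfl⟩; exact (hcl w hw).1) (hlf.subset Set.inter_subset_right) Set.inter_subset_left
  obtain ⟨W, m, n, a, c, hi, hZW, hW⟩ := hU ((S0 ∪ S1) \ {0}) ((s1.union t1).subset Set.diff_subset)
    (fun z hz => hz.2) (fun z hz => (hS z).1 (hz.1.elim (fun h => s2 h) fun h => t2 h))
  obtain ⟨F, hF⟩ : ∃ F, F = Subfield.closure (k ∪ (W ∪ R \ {0})) := ⟨_, rfl⟩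
  have hWF : Subfield.closure (k ∪ W) ≤ F := hF ▸ Subfield.closure_mono (Set.union_subset_union_right _ Set.subset_union_left)
  have hRF : ∀ r ∈ R, r ∈ F := fun r hr => by
    by_cases h : r = 0
    · rw [h]; exact F.zero_mem
    · rw [hF]; exact Subfield.subset_closure (.inr (.inr ⟨hr, h⟩))
  have hlF : l' ⊆ F := by
    refine s3.trans (Subfield.closure_le.2 (Set.union_subset (fun s hs => ?_) hRF))
    by_cases h : s = 0
    · rw [h]; exact F.zero_mem
    · exact hWF (Subfield.subset_closure (.inr (hZW ⟨.inl hs, h⟩)))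
  obtain ⟨m', n', a', c', q0, q1, q2, q3, q4, q5, q6, q7⟩ := hE m n W a c F hW (fun s hs h0 => hZW ⟨.inr hs, h0⟩) hWF
    (hlF (hl' ▸ .inl rfl))
  have hκF : adj κ x ≤ F := adj_le (hW.le.trans hWF) (hRF x hxR)
  refine ⟨W ∪ R \ {0}, m', n', a', c', by omega, Set.subset_union_right, ?_⟩
  constructor
  · exact hW.fin.union hR0
  · rintro w (hw | hw)
    exacts [hW.ne w hw, hw.2]
  · rintro w (hw | hw)
    exacts [sep_up (le_adj _ _) (hW.sep w hw), hRs w hw.1]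
  · rwa [← hF]
  · intro σ hσ
    rw [← hF]
    rintro w (hw | hw)
    · exact hWF (hW.stab σ (fun z hz => hσ z (le_adj _ _ hz)) w hw)
    · exact hRF _ (hst σ hσ w hw.1)
  · exact q1
  · rwa [← hF]
  · rwa [← hF]
  · exact q4
  · rw [← hF]
    rintro w (hw | hw)
    · exact q5 w hw
    · obtain ⟨r1, r2⟩ := hcl w hw
      have hc0 := hs.C0 _ r1
      obtain ⟨r3, r4⟩ := r2 F ((hll w hw).trans hlF)
      have key : ∀ z, Het v F (A ∩ l w) z → Het v F (PA k a' c') z := fun z hz =>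
        hz.trans' le_rfl fun e he _ _ => q7 e ⟨he.1, hll w hw he.2⟩
      have : w = cc w * (w / cc w) := (mul_div_cancel₀ _ hc0).symm
      rw [this]
      exact (q6 _ ⟨w, hw, rfl⟩).mul (div_ne_zero hw.2 hc0) (key _ r3) (key _ r4)

lemma UU_step [IsAlgClosed Q] [CharP Q p] (hp : p = 0 ∨ p.Prime) (hk : k ≤ κ) (hS : ∀ z, z ∈ S ↔ IsSeparable κ z)
    (hB : Base v S p) (hx : ¬ IsAlgebraic S x) {i : ℕ} (hU : UU v k κ i) : UU v k (adj κ x) (i + 1) := by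
  intro Z hZ h0 hsep
  have hκS : κ ≤ S := fun z hz => (hS z).2 (isSeparable_algebraMap (⟨z, hz⟩ : κ))
  obtain ⟨R, r1, r2, r3, r4, r5, Y, hc, hG⟩ := propG hp hκS hB hx Z hZ hsep
  have hx0 : x ≠ 0 := by rintro rfl; exact hx isAlgebraic_zero
  have fin : ∀ C A, Sys v S Y C A → Ext v k κ S Y C A → ∃ (W : Set Q) (m n : ℕ) (a : Fin m → Q) (c : Fin n → Q),
      m + n = i + 1 ∧ Z ⊆ W ∧ UD v k (adj κ x) W a c := fun C A hs hE => by
    obtain ⟨W, m, n, a, c, t1, t2, t3⟩ := UU_step1 hk hS hB hx0 hU hs hE r1 r3 r4 r5 hG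
    exact ⟨W, m, n, a, c, t1, fun z hz => t2 ⟨r2 hz, h0 z hz⟩, t3⟩
  rcases hc with h | h
  · exact fin _ _ (h.sys hB) h.ext
  · exact fin _ _ h.sys (h.ext (hk.trans hκS) fun w hw => (hS w).2 hw)
end

section
variable {v : Valuation Q Γ} {S L L' M N k κ : Subfield Q} {Y x : Q} {p : ℕ} {W : Set Q}

lemma UU_base (hk : ∀ z : Q, IsAlgebraic k z → z ≠ 0 → v z = 1) : UU v k k 0 := by
  intro Z hZ h0 hsep
  obtain ⟨W, hW⟩ : ∃ W : Set Q, W = ⋃ z ∈ Z, (minpoly k z).rootSet Q := ⟨_, rfl⟩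
  have hm : ∀ w, w ∈ W ↔ ∃ z ∈ Z, aeval w (minpoly k z) = 0 := fun w => by
    rw [hW]; simp only [Set.mem_iUnion₂, exists_prop]
    refine exists_congr fun z => and_congr_right fun hz => ?_
    rw [mem_rootSet]; exact and_iff_right (minpoly.ne_zero (hsep z hz).isIntegral)
  have hWs : ∀ w ∈ W, IsSeparable k w := fun w hw => by
    obtain ⟨z, hz, h⟩ := (hm w).1 hw
    exact (hsep z hz).of_dvd (minpoly.dvd _ _ h)
  have hW0 : ∀ w ∈ W, w ≠ 0 := by
    rintro w hw rfl
    obtain ⟨z, hz, h⟩ := (hm 0).1 hw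
    rw [← coeff_zero_eq_aeval_zero'] at h
    exact h0 z hz ((minpoly.coeff_zero_eq_zero (hsep z hz).isIntegral).1 ((algebraMap k Q).injective (h.trans (map_zero _).symm)))
  have hkW : k ≤ Subfield.closure (k ∪ W) := fun z hz => Subfield.subset_closure (.inl hz)
  have hWW : W ⊆ Subfield.closure (k ∪ W) := fun z hz => Subfield.subset_closure (.inr hz)
  refine ⟨W, 0, 0, Fin.elim0, Fin.elim0, rfl, fun z hz => (hm z).2 ⟨z, hz, minpoly.aeval _ _⟩, ?_, hW0, hWs, hkW, ?_, ⟨fun i => i.elim0,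
    fun i => i.elim0, fun α _ => Subsingleton.elim _ _⟩, fun i => i.elim0, fun i => i.elim0, fun i => i.elim0, fun w hw => ?_⟩
  · rw [hW]; exact hZ.biUnion fun z _ => rootSet_finite _ _
  · intro σ hσ w hw
    obtain ⟨z, hz, h⟩ := (hm w).1 hw
    let σ' : Q →ₐ[k] Q := { (σ : Q →+* Q) with commutes' := fun z => hσ z z.2 }
    refine hWW ((hm _).2 ⟨z, hz, ?_⟩)
    have h2 : aeval (σ' w) (minpoly k z) = σ' (aeval w (minpoly k z)) := aeval_algHom_apply σ' w _
    rw [h, map_zero] at h2; exact h2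
  · have hint := (hWs w hw).isIntegral
    have h1 : v w = 1 := hk w hint.isAlgebraic (hW0 w hw)
    have hH : Het v (Subfield.closure (k ∪ W)) (PA k (Fin.elim0 : Fin 0 → Q) (Fin.elim0 : Fin 0 → Q)) w := by
      refine .root ((minpoly k w).map (algebraMap k Q)) w (fun i => ?_) (hWW hw) h1.le ?_ ?_
      · rw [coeff_map]
        obtain ⟨c, hc⟩ := (minpoly k w).coeff i
        by_cases hc0 : c = 0
        · subst hc0; exact .zero
        · exact .base c (.inl hc) (hkW hc) (hk c (isAlg_mem hc) hc0).le
      · rw [eval_map_algebraMap]; exact minpoly.aeval _ _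
      · rw [derivative_map, eval_map_algebraMap]
        refine hk _ (IsIntegral.isAlgebraic ?_) ((hWs w hw).aeval_derivative_ne_zero (minpoly.aeval _ _))
        exact IsIntegral.of_mem_of_fg _ hint.fg_adjoin_singleton _ (aeval_mem_adjoin_singleton _ _)
    exact ⟨1, w, (one_mul w).symm, .one, fun _ => .one, hH, hH.inv h1⟩
end

section
variable {v : Valuation Q Γ} {S L L' M N k κ : Subfield Q} {Y x : Q} {p : ℕ} {W : Set Q}

structure Glob (v : Valuation Q Γ) (k : Subfield Q) : Prop where
  arch : ∀ a b, v a < 1 → b ≠ 0 → ∃ n : ℕ, v a ^ n ≤ v b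
  triv : ∀ z ∈ k, z ≠ 0 → v z = 1
  res : ∀ z, v z ≤ 1 → ∃ e, IsAlgebraic k e ∧ v (z - e) < 1
  perf : ∀ z : Q, IsAlgebraic k z → IsSeparable k z

lemma Glob.algt (h : Glob v k) (z : Q) (hz : IsAlgebraic k z) (h0 : z ≠ 0) : v z = 1 := by
  obtain ⟨n, hn, c, hc, hc0, e⟩ := torsion v k z hz h0
  rw [h.triv c hc hc0] at e
  exact val_pow_inj hn (by rw [e, one_pow])

lemma sepc_sep {z : Q} (hS : ∀ z, z ∈ S ↔ IsSeparable κ z) (hz : IsSeparable S z) : z ∈ S := by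
  have e : S = (separableClosure κ Q).toSubfield := by
    ext z; rw [hS]; exact (mem_separableClosure_iff (F := κ) (E := Q)).symm
  subst e
  exact (hS z).2 (IsSeparable.of_algebra_isSeparable_of_isSeparable (E := separableClosure κ Q) κ hz)

lemma Glob.base [IsAlgClosed Q] [CharP Q p] (hp : p = 0 ∨ p.Prime) (h : Glob v k) (hk : k ≤ κ)
    (hS : ∀ z, z ∈ S ↔ IsSeparable κ z) : Base v S p := by
  have hkS : ∀ z, IsAlgebraic k z → z ∈ S := fun z hz => (hS z).2 (sep_up hk (h.perf z hz))
  have key : ∀ f : S[X], f.Separable → ∀ z, aeval z f = 0 → z ∈ S := fun f hf z hz =>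
    sepc_sep hS (hf.of_dvd (minpoly.dvd _ _ hz))
  have nat : ∀ n : ℕ, (n : Q) ≠ 0 → v (n : Q) = 1 := fun n hn => h.triv _ (natCast_mem k n) hn
  have asroot : ∀ q : ℕ, 1 < q → (q : Q) = 0 → ∀ ε ∈ S, ε ≠ 0 → ∀ d ∈ S, ∃ a ∈ S, a ^ q - ε * a - d = 0 := by
    intro q hq1 hq0 ε hεS hε0 d hd
    have hq : ((q : ℕ) : S) = 0 := Subtype.ext (by simpa using hq0)
    have hf : (X ^ q - C (⟨ε, hεS⟩ : S) * X - C ⟨d, hd⟩ : S[X]).Separable := by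
      have : derivative (X ^ q - C (⟨ε, hεS⟩ : S) * X - C ⟨d, hd⟩ : S[X]) = C (-⟨ε, hεS⟩) := by
        simp [derivative_X_pow, hq]
      rw [separable_def, this]
      exact isCoprime_one_right.of_isCoprime_of_dvd_right (isUnit_iff_dvd_one.1
        (isUnit_C.2 (isUnit_iff_ne_zero.2 (neg_ne_zero.2 fun h => hε0 (congrArg Subtype.val h)))))
    have hdeg : (X ^ q - C (⟨ε, hεS⟩ : S) * X - C ⟨d, hd⟩ : S[X]).degree ≠ 0 := by
      have : (X ^ q - C (⟨ε, hεS⟩ : S) * X - C ⟨d, hd⟩ : S[X]).degree = q := by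
        rw [sub_sub]
        apply degree_sub_eq_left_of_degree_lt _ |>.trans (degree_X_pow q)
        rw [degree_X_pow]
        refine (degree_linear_le).trans_lt ?_
        exact_mod_cast hq1
      rw [this]; exact_mod_cast (by omega : q ≠ 0)
    obtain ⟨a, ha⟩ := IsAlgClosed.exists_aeval_eq_zero Q _ hdeg
    refine ⟨a, key _ hf a ha, ?_⟩
    simp only [map_sub, map_mul, map_pow, aeval_X, aeval_C] at ha
    exact ha
  haveI : CharP S p := (algebraMap S Q).charP_iff_charP p |>.2 inferInstance
  refine ⟨h.arch, fun z hz => ?_, fun z hz e he => ?_, fun hp c hc => ?_, nat, fun z hz => sepc_sep hS hz⟩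
  · obtain ⟨e, h1, h2⟩ := h.res z hz
    exact ⟨e, hkS e h1, h2⟩
  · suffices H : z ∈ S ∨ ∃ a ∈ S, v (z - a) < v e by
      rcases H with H | H
      · exact ⟨z, H, by simpa using zero_lt_iff.2 (v.ne_zero_iff.2 he)⟩
      · exact H
    rcases hp with rfl | hp
    · haveI : CharZero S := CharP.charP_to_charZero S
      exact .inl (sepc_sep hS (minpoly.irreducible hz.isIntegral).separable)
    by_cases ht : ∃ t ∈ S, t ≠ 0 ∧ v t < 1
    swap
    · left
      push Not at ht
      refine hkS z (alg_trans (N := S) (fun t htS => ?_) hz)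
      have h1 : v t ≤ 1 := by
        by_cases h0 : t = 0
        · simp [h0]
        have := ht t⁻¹ (S.inv_mem htS) (inv_ne_zero h0)
        rw [map_inv₀] at this
        exact (one_le_inv₀ (zero_lt_iff.2 (v.ne_zero_iff.2 h0))).1 this
      obtain ⟨e, h2, h3⟩ := h.res t h1
      have : t - e = 0 := by
        by_contra hne
        exact absurd h3 (not_lt.2 (ht _ (S.sub_mem htS (hkS e h2)) hne))
      rwa [sub_eq_zero.1 this]
    right
    obtain ⟨t, htS, ht0, ht1⟩ := ht
    obtain ⟨n, g, hg, hge⟩ := exists_separable_of_irreducible p (minpoly.irreducible hz.isIntegral) hp.ne_zero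
    have hzn : z ^ p ^ n ∈ S := key g hg _ (by
      have := minpoly.aeval S z; rw [← hge, expand_aeval] at this; exact this)
    have hpn : p ^ (n + 1) ≠ 0 := pow_ne_zero _ hp.ne_zero
    have hzq : z ^ p ^ (n + 1) ∈ S := by rw [pow_succ, pow_mul]; exact S.pow_mem hzn _
    have hq1 : 1 < p ^ (n + 1) := Nat.one_lt_pow (by omega) hp.one_lt
    have hcast : ((p ^ (n + 1) : ℕ) : Q) = 0 := by
      push_cast; rw [CharP.cast_eq_zero Q p]; exact zero_pow (by omega)
    obtain ⟨m, hm1, hmz, hm0⟩ : ∃ m : Q, 1 ≤ v m ∧ v z ≤ v m ∧ m ≠ 0 := by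
      rcases le_total (v z) 1 with h | h
      · exact ⟨1, by simp, by simpa using h, one_ne_zero⟩
      · exact ⟨z, h, le_rfl, by rintro rfl; simp at h⟩
    obtain ⟨j, hj⟩ := h.arch t (e ^ p ^ (n + 1) / m) ht1 (div_ne_zero (pow_ne_zero _ he) hm0)
    have hε0 : t ^ (j + 1) ≠ 0 := pow_ne_zero _ ht0
    have hvm : v m ≠ 0 := v.ne_zero_iff.2 hm0
    have hεs : v (t ^ (j + 1)) * v m < v e ^ p ^ (n + 1) := by
      rw [map_div₀, map_pow] at hj
      have h2 : v t ^ (j + 1) < v e ^ p ^ (n + 1) / v m := by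
        rw [pow_succ]
        exact (mul_lt_of_lt_one_right (zero_lt_iff.2 (pow_ne_zero _ (v.ne_zero_iff.2 ht0))) ht1).trans_le hj
      rw [map_pow]
      exact (lt_div_iff₀ (zero_lt_iff.2 hvm)).1 h2
    have hε1 : v (t ^ (j + 1)) ≤ 1 := by rw [map_pow]; exact pow_le_one₀ zero_le ht1.le
    have hεS : t ^ (j + 1) ∈ S := S.pow_mem htS _
    generalize t ^ (j + 1) = ε at *
    generalize hqq : p ^ (n + 1) = q at *
    obtain ⟨a, haS, ha'⟩ := asroot q hq1 hcast ε hεS hε0 (z ^ q) hzq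
    refine ⟨a, haS, ?_⟩
    have hfr : (a - z) ^ q = ε * a := by
      haveI : ExpChar Q p := .prime hp
      rw [← hqq, sub_pow_expChar_pow, hqq]; linear_combination ha'
    have hva : v a ≤ v m := by
      by_contra hlt
      push Not at hlt
      have h1 : v (ε * a + z ^ q) < v (a ^ q) := by
        rw [map_pow]
        refine v.map_add_lt ?_ ?_
        · rw [map_mul]
          exact (mul_le_of_le_one_left' hε1).trans_lt (lt_self_pow₀ (hm1.trans_lt hlt) hq1)
        · rw [map_pow]; exact pow_lt_pow_left₀ (hmz.trans_lt hlt) zero_le hpn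
      rw [show ε * a + z ^ q = a ^ q by linear_combination -ha'] at h1
      exact lt_irrefl _ h1
    rw [Valuation.map_sub_swap]
    refine lt_of_pow_lt_pow_left₀ q zero_le ?_
    rw [← map_pow, hfr, map_mul]
    exact (mul_le_mul_right hva _).trans_lt hεs
  · obtain ⟨a, haS, ha⟩ := asroot p hp.one_lt (CharP.cast_eq_zero Q p) 1 S.one_mem one_ne_zero c hc
    exact ⟨a, haS, by linear_combination ha⟩
end

section
variable {v : Valuation Q Γ} {S L L' M N k κ : Subfield Q} {Y x : Q} {p : ℕ} {W : Set Q}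

lemma adjoin_eq (k : Subfield Q) (R : Set Q) :
    (IntermediateField.adjoin k R).toSubfield = Subfield.closure (k ∪ R) := by
  rw [IntermediateField.adjoin_toSubfield]
  congr 2
  exact Subtype.range_coe

lemma alg_adj {R : Set Q} {z : Q} :
    IsAlgebraic (Subfield.closure (k ∪ R)) z ↔ IsAlgebraic (Algebra.adjoin k R) z := by
  rw [← IntermediateField.isAlgebraic_adjoin_iff, ← adjoin_eq]
  exact Iff.rfl

lemma UU_all [IsAlgClosed Q] [CharP Q p] (hp : p = 0 ∨ p.Prime) (h : Glob v k) (s : Finset Q)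
    (hs : AlgebraicIndependent k ((↑) : s → Q)) : UU v k (Subfield.closure (k ∪ (s : Set Q))) s.card := by
  classical
  induction s using Finset.induction_on with
  | empty =>
    have : Subfield.closure ((k : Set Q) ∪ ((∅ : Finset Q) : Set Q)) = k := by simp
    rw [this]; exact UU_base h.algt
  | insert x s hx ih =>
    have hs' : AlgebraicIndepOn k (id : Q → Q) (insert x (s : Set Q)) := by
      have := hs
      rw [← Finset.coe_insert]; exact this
    obtain ⟨h1, h2⟩ := (AlgebraicIndepOn.insert_iff (by simpa using hx)).1 hs'
    have h3 := ih h1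
    rw [Finset.card_insert_of_notMem hx]
    have e : Subfield.closure ((k : Set Q) ∪ ((insert x s : Finset Q) : Set Q)) =
        adj (Subfield.closure (k ∪ (s : Set Q))) x := by
      apply le_antisymm
      · rw [Subfield.closure_le]
        rintro z (hz | hz)
        · exact le_adj _ _ (Subfield.subset_closure (.inl hz))
        · rcases Finset.mem_insert.1 hz with rfl | hz
          · exact mem_adj _ _
          · exact le_adj _ _ (Subfield.subset_closure (.inr hz))
      · refine adj_le (Subfield.closure_mono (Set.union_subset_union_right _ (by simp))) ?_
        exact Subfield.subset_closure (.inr (by simp))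
    rw [e]
    generalize hκ : Subfield.closure (k ∪ (s : Set Q)) = κ at h3
    have hk : k ≤ κ := by rw [← hκ]; exact fun z hz => Subfield.subset_closure (.inl hz)
    have hS : ∀ z, z ∈ (separableClosure κ Q).toSubfield ↔ IsSeparable κ z := fun z => mem_separableClosure_iff
    refine UU_step hp hk hS (h.base hp hk hS) ?_ h3
    intro hxa
    have h4 := alg_trans (fun z hz => ((hS z).1 hz).isIntegral.isAlgebraic) hxa
    rw [← hκ, alg_adj] at h4
    rw [Set.image_id] at h2
    exact h2 h4
end

section
variable {v : Valuation Q Γ} {S L L' M N k κ : Subfield Q} {Y x : Q} {p : ℕ} {W : Set Q}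

def Evk (k : Subfield Q) (P : Subfield Q → Prop) : Prop :=
  ∃ C : Set Q, C.Finite ∧ C ⊆ k ∧ ∀ M : Subfield Q, C ⊆ M → P M

lemma Evk.and {P P' : Subfield Q → Prop} (h : Evk k P) (h' : Evk k P') : Evk k fun M => P M ∧ P' M := by
  obtain ⟨C, c1, c2, c3⟩ := h
  obtain ⟨D, d1, d2, d3⟩ := h'
  exact ⟨C ∪ D, c1.union d1, Set.union_subset c2 d2, fun M hM =>
    ⟨c3 M (Set.subset_union_left.trans hM), d3 M (Set.subset_union_right.trans hM)⟩⟩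

lemma Evk.all {α : Type*} {X : Set α} (hX : X.Finite) {P : α → Subfield Q → Prop} (h : ∀ x ∈ X, Evk k (P x)) :
    Evk k fun M => ∀ x ∈ X, P x M := by
  induction X, hX using Set.Finite.induction_on with
  | empty => exact ⟨∅, by simp, by simp, by simp⟩
  | @insert z l _ _ ih =>
    obtain ⟨C, c1, c2, c3⟩ := (h z (Set.mem_insert _ _)).and (ih fun x hx => h x (Set.mem_insert_of_mem _ hx))
    refine ⟨C, c1, c2, fun M hM x hx => ?_⟩
    rcases hx with rfl | hx
    exacts [(c3 M hM).1, (c3 M hM).2 x hx]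

lemma Evk.imp {P P' : Subfield Q → Prop} (h : Evk k P) (h' : ∀ M, P M → P' M) : Evk k P' := by
  obtain ⟨C, c1, c2, c3⟩ := h
  exact ⟨C, c1, c2, fun M hM => h' M (c3 M hM)⟩

lemma Evk.cl {R l : Set Q} (hl : l.Finite) (h : l ⊆ Subfield.closure (k ∪ R)) :
    Evk k fun M => l ⊆ Subfield.closure (M ∪ R) := by
  obtain ⟨T, t1, t2, t3⟩ := closure_fin hl h
  exact ⟨T, t1, t2, fun M hM => t3.trans (Subfield.closure_mono (Set.union_subset_union_left _ hM))⟩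

lemma sep_lift {z : Q} {f : Q[X]} (hf : f.Separable) (h0 : f.eval z = 0) (hN : ∀ i, f.coeff i ∈ N) :
    IsSeparable N z := by
  obtain ⟨g, rfl⟩ := lift_S f hN
  rw [separable_map] at hf
  refine hf.of_dvd (minpoly.dvd _ _ ?_)
  rwa [aeval_def, ← eval_map]

lemma Evk.sep {R : Set Q} {z : Q} (hz : IsSeparable κ z) (hκ : κ ≤ Subfield.closure (k ∪ R)) :
    Evk k fun M => IsSeparable (Subfield.closure (M ∪ R)) z := by
  obtain ⟨f, hf⟩ : ∃ f, f = (minpoly κ z).map (algebraMap κ Q) := ⟨_, rfl⟩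
  have h1 : Set.range f.coeff ⊆ Subfield.closure (k ∪ R) := by
    rintro _ ⟨i, rfl⟩; rw [hf, coeff_map]; exact hκ (SetLike.coe_mem _)
  have h2 : (Set.range f.coeff).Finite := by
    refine ((f.coeffs.finite_toSet).insert 0).subset ?_
    rintro _ ⟨i, rfl⟩
    by_cases h : f.coeff i = 0
    · exact .inl h
    · exact .inr (coeff_mem_coeffs h)
  refine (Evk.cl h2 h1).imp fun M hM => sep_lift (f := f) ?_ ?_ fun i => hM ⟨i, rfl⟩
  · rw [hf, separable_map]; exact hz
  · rw [hf, eval_map, ← aeval_def, minpoly.aeval]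

lemma Evk.het {m n : ℕ} {a : Fin m → Q} {c : Fin n → Q} {z : Q}
    (hz : Het v (Subfield.closure (k ∪ W)) (PA k a c) z) :
    Evk k fun M => Het v (Subfield.closure (M ∪ W)) (PA M a c) z := by
  obtain ⟨l, l1, l2, l3⟩ := hz.finite
  obtain ⟨C, c1, c2, c3⟩ := Evk.cl l1 l2
  refine ⟨C ∪ (l ∩ k), c1.union (l1.inter_of_left _), Set.union_subset c2 Set.inter_subset_right, fun M hM => ?_⟩
  refine (l3 _ (c3 M (Set.subset_union_left.trans hM))).mono le_rfl fun a ha _ _ => ?_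
  rcases ha with ⟨ha | ha, hl⟩
  · exact .inl (hM (.inr ⟨hl, ha⟩))
  · exact .inr ha

structure FD {m n : ℕ} (v : Valuation Q Γ) (E M : Subfield Q) (W : Set Q) (a : Fin m → Q) (c : Fin n → Q) : Prop where
  sep : ∀ w ∈ W, IsSeparable (Subfield.closure ((M : Set Q) ∪ E)) w
  stab : ∀ σ : Q ≃+* Q, (∀ z ∈ E, σ z = z) → ∀ w ∈ W, σ w ∈ Subfield.closure (M ∪ W)
  aF : ∀ i, a i ∈ Subfield.closure (M ∪ W)
  cF : ∀ i, c i ∈ Subfield.closure (M ∪ W)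
  dec : ∀ w ∈ W, DD v (Subfield.closure (M ∪ W)) (PA M a c) a w

lemma UD.descend {E : Subfield Q} {m n : ℕ} {a : Fin m → Q} {c : Fin n → Q} (h : UD v k κ W a c)
    (hfix : ∀ z ∈ k, ∀ σ : Q ≃+* Q, (∀ y ∈ E, σ y = y) → σ z = z) (hE : ∀ z : Q, IsAlgebraic E z)
    (hκ : κ ≤ Subfield.closure (k ∪ E)) : Evk k fun M => FD v E M W a c := by
  have h1 := Evk.all h.fin fun w hw => Evk.sep (h.sep w hw) hκ
  have h2 : Evk k fun M => ∀ w ∈ W, DD v (Subfield.closure (M ∪ W)) (PA M a c) a w := by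
    refine Evk.all h.fin fun w hw => ?_
    obtain ⟨z, u, e, d1, d2, d3, d4⟩ := h.dec w hw
    exact ((Evk.het d3).and (Evk.het d4)).imp fun M hM => ⟨z, u, e, d1, d2, hM.1, hM.2⟩
  have h3 := Evk.cl (Set.finite_range a) (by rintro _ ⟨i, rfl⟩; exact h.aF i)
  have h4 := Evk.cl (Set.finite_range c) (by rintro _ ⟨i, rfl⟩; exact h.cF i)
  have h5 : {y | ∃ w ∈ W, ∃ σ : Q ≃+* Q, (∀ z ∈ E, σ z = z) ∧ y = σ w}.Finite := by
    refine (h.fin.biUnion fun w _ => (minpoly E w).rootSet_finite Q).subset ?_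
    rintro y ⟨w, hw, σ, hσ, rfl⟩
    refine Set.mem_biUnion hw ?_
    rw [mem_rootSet]
    refine ⟨minpoly.ne_zero (hE w).isIntegral, ?_⟩
    let σ' : Q →ₐ[E] Q := { (σ : Q →+* Q) with commutes' := fun z => hσ z z.2 }
    have : aeval (σ' w) (minpoly E w) = 0 := by rw [aeval_algHom_apply, minpoly.aeval, map_zero]
    exact this
  have h6 := Evk.cl (k := k) (R := W) h5 (by
    rintro y ⟨w, hw, σ, hσ, rfl⟩
    refine h.stab σ (fun z hz => ?_) w hw
    have h7 : Subfield.closure ((k : Set Q) ∪ E) ≤ (σ : Q →+* Q).eqLocusField (RingHom.id Q) := by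
      rw [Subfield.closure_le]
      exact fun x hx => hx.elim (fun hx => hfix x hx σ hσ) (hσ x)
    exact h7 (hκ hz))
  refine ((h1.and h2).and ((h3.and h4).and h6)).imp fun M hM => ⟨hM.1.1, fun σ hσ w hw => ?_,
    fun i => hM.2.1.1 ⟨i, rfl⟩, fun i => hM.2.1.2 ⟨i, rfl⟩, hM.1.2⟩
  exact hM.2.2 ⟨w, hw, σ, hσ, rfl⟩
end

section
variable {v : Valuation Q Γ} {S L L' M N k κ : Subfield Q} {Y x : Q} {p : ℕ} {A W : Set Q}

def Ch (v : Valuation Q Γ) (B : Subring Q) {n : ℕ} (η : Fin n → Q) : Prop :=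
  (∀ i, v (η i) ≤ 1) ∧ ∃ f : Fin n → MvPolynomial (Fin n) B, (∀ i j, i < j → j ∉ (f i).vars) ∧
    (∀ i, MvPolynomial.aeval η (f i) = 0) ∧
    ∀ i, v (MvPolynomial.aeval η (MvPolynomial.pderiv i (f i))) = 1

variable {B : Subring Q}

lemma not_vars_last {n : ℕ} (h : MvPolynomial (Fin n) B) :
    Fin.last n ∉ (MvPolynomial.rename Fin.castSucc h).vars := fun hm => by
  obtain ⟨j, _, e⟩ := MvPolynomial.mem_vars_rename _ _ hm
  exact Fin.castSucc_ne_last j e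

lemma Ch.snoc {n : ℕ} {η : Fin n → Q} (h : Ch v B η) (f : Q[X]) {z : Q}
    (hf : ∀ i, f.coeff i ∈ Algebra.adjoin B (Set.range η)) (hz : v z ≤ 1) (h0 : f.eval z = 0)
    (h1 : v (f.derivative.eval z) = 1) : Ch v B (Fin.snoc η z : Fin (n + 1) → Q) := by
  obtain ⟨hO, g, g1, g2, g3⟩ := h
  have hf' : ∀ i, ∃ h : MvPolynomial (Fin n) B, MvPolynomial.aeval η h = f.coeff i := fun i => by
    have := hf i
    rw [Algebra.adjoin_range_eq_range_aeval] at this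
    exact this
  choose H hH using hf'
  have hc : (Fin.snoc η z : Fin (n + 1) → Q) ∘ Fin.castSucc = η := by
    ext i; simp
  have hren : ∀ q : MvPolynomial (Fin n) B, MvPolynomial.aeval (Fin.snoc η z : Fin (n + 1) → Q)
      (MvPolynomial.rename Fin.castSucc q) = MvPolynomial.aeval η q := fun q => by
    rw [MvPolynomial.aeval_rename, hc]
  refine ⟨fun i => ?_, Fin.snoc (fun i => MvPolynomial.rename Fin.castSucc (g i))
    (∑ i ∈ Finset.range (f.natDegree + 1), MvPolynomial.rename Fin.castSucc (H i) * MvPolynomial.X (Fin.last n) ^ i),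
    fun i j hij => ?_, fun i => ?_, fun i => ?_⟩
  · refine Fin.lastCases ?_ (fun i => ?_) i
    · simpa using hz
    · simpa using hO i
  · revert hij
    refine Fin.lastCases (fun hij => ?_) (fun i => ?_) i
    · exact absurd hij (Fin.le_last j).not_gt
    · rw [Fin.snoc_castSucc]
      refine Fin.lastCases (fun _ => not_vars_last _) (fun j hij hm => ?_) j
      obtain ⟨j', hj, e⟩ := MvPolynomial.mem_vars_rename _ _ hm
      obtain rfl := Fin.castSucc_injective n e
      exact g1 i j' (by simpa using hij) hj
  · refine Fin.lastCases ?_ (fun i => ?_) i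
    · rw [Fin.snoc_last, map_sum]
      simp_rw [map_mul, hren, hH, map_pow, MvPolynomial.aeval_X, Fin.snoc_last]
      rw [← eval_eq_sum_range, h0]
    · rw [Fin.snoc_castSucc, hren, g2]
  · refine Fin.lastCases ?_ (fun i => ?_) i
    · rw [Fin.snoc_last, map_sum, map_sum]
      have : ∀ i, MvPolynomial.aeval (Fin.snoc η z : Fin (n + 1) → Q) (MvPolynomial.pderiv (Fin.last n)
          (MvPolynomial.rename Fin.castSucc (H i) * MvPolynomial.X (Fin.last n) ^ i)) = f.coeff i * (i * z ^ (i - 1)) := by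
        intro i
        rw [MvPolynomial.pderiv_mul, MvPolynomial.pderiv_eq_zero_of_notMem_vars (not_vars_last _),
          MvPolynomial.pderiv_pow, MvPolynomial.pderiv_X_self]
        simp [hren, hH]
      simp_rw [this]
      rw [derivative_eval, Polynomial.sum_over_range _ (by simp)] at h1
      simpa [mul_assoc] using h1
    · rw [Fin.snoc_castSucc, MvPolynomial.pderiv_rename (Fin.castSucc_injective n), hren, g3]

lemma Ch.add {n : ℕ} {η : Fin n → Q} (h : Ch v B η) {z : Q} (hz : z ∈ Algebra.adjoin B (Set.range η)) (hv : v z ≤ 1) :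
    Ch v B (Fin.snoc η z : Fin (n + 1) → Q) := by
  refine h.snoc (X - C z) (fun i => ?_) hv (by simp) (by simp)
  rw [coeff_sub, coeff_X, coeff_C]
  refine sub_mem ?_ ?_ <;> split_ifs <;> simp [hz]

lemma snoc_range {n : ℕ} (η : Fin n → Q) (z : Q) : Set.range η ⊆ Set.range (Fin.snoc η z : Fin (n + 1) → Q) := by
  rintro _ ⟨i, rfl⟩; exact ⟨i.castSucc, by simp⟩

lemma Ch.het (hA : ∀ a ∈ A, v a ≤ 1 → a ∈ B) {z : Q} (hz : Het v L A z) : ∀ {n : ℕ} {η : Fin n → Q}, Ch v B η →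
    ∃ (n' : ℕ) (η' : Fin n' → Q), Ch v B η' ∧ Set.range η ⊆ Set.range η' ∧
      z ∈ Algebra.adjoin B (Set.range η') := by
  induction hz with
  | base a h1 h2 h3 =>
    intro n η h
    exact ⟨n, η, h, le_rfl, (Algebra.adjoin B (Set.range η)).algebraMap_mem ⟨a, hA a h1 h3⟩⟩
  | zero => intro n η h; exact ⟨n, η, h, le_rfl, zero_mem _⟩
  | one => intro n η h; exact ⟨n, η, h, le_rfl, one_mem _⟩
  | add a b _ _ ih1 ih2 =>
    intro n η h
    obtain ⟨n1, η1, h1, i1, j1⟩ := ih1 h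
    obtain ⟨n2, η2, h2, i2, j2⟩ := ih2 h1
    exact ⟨n2, η2, h2, i1.trans i2, add_mem (Algebra.adjoin_mono i2 j1) j2⟩
  | mul a b _ _ ih1 ih2 =>
    intro n η h
    obtain ⟨n1, η1, h1, i1, j1⟩ := ih1 h
    obtain ⟨n2, η2, h2, i2, j2⟩ := ih2 h1
    exact ⟨n2, η2, h2, i1.trans i2, mul_mem (Algebra.adjoin_mono i2 j1) j2⟩
  | neg a _ ih =>
    intro n η h
    obtain ⟨n1, η1, h1, i1, j1⟩ := ih h
    exact ⟨n1, η1, h1, i1, neg_mem j1⟩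
  | root f z _ _ hz h0 h1 ih =>
    intro n η h
    have key : ∀ N : ℕ, ∃ (n' : ℕ) (η' : Fin n' → Q), Ch v B η' ∧ Set.range η ⊆ Set.range η' ∧
        ∀ i < N, f.coeff i ∈ Algebra.adjoin B (Set.range η') := by
      intro N
      induction N with
      | zero => exact ⟨n, η, h, le_rfl, by simp⟩
      | succ N ihN =>
        obtain ⟨n1, η1, h1, i1, j1⟩ := ihN
        obtain ⟨n2, η2, h2, i2, j2⟩ := ih N h1
        refine ⟨n2, η2, h2, i1.trans i2, fun i hi => ?_⟩
        rcases Nat.lt_succ_iff_lt_or_eq.1 hi with hi | rfl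
        exacts [Algebra.adjoin_mono i2 (j1 i hi), j2]
    obtain ⟨n1, η1, h2, i1, j1⟩ := key (f.natDegree + 1)
    refine ⟨n1 + 1, Fin.snoc η1 z, h2.snoc f (fun i => ?_) hz h0 h1, i1.trans (snoc_range _ _),
      Algebra.subset_adjoin ⟨Fin.last n1, by simp⟩⟩
    by_cases hi : i < f.natDegree + 1
    · exact j1 i hi
    · rw [coeff_eq_zero_of_natDegree_lt (by omega)]; exact zero_mem _

lemma Ch.ex (hA : ∀ a ∈ A, v a ≤ 1 → a ∈ B) {X : Set Q} (hX : X.Finite) (h : ∀ z ∈ X, Het v L A z) :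
    ∃ (n : ℕ) (η : Fin n → Q), Ch v B η ∧ X ⊆ Set.range η := by
  induction X, hX using Set.Finite.induction_on with
  | empty => exact ⟨0, Fin.elim0, ⟨fun i => i.elim0, fun i => i.elim0, fun i => i.elim0, fun i => i.elim0,
      fun i => i.elim0⟩, by simp⟩
  | @insert z l _ _ ih =>
    obtain ⟨n, η, h1, h2⟩ := ih fun x hx => h x (Set.mem_insert_of_mem _ hx)
    have hz := h z (Set.mem_insert _ _)
    obtain ⟨n', η', h3, h4, h5⟩ := h1.het hA hz
    refine ⟨_, _, h3.add h5 hz.le_one, Set.insert_subset ⟨Fin.last n', by simp⟩ ?_⟩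
    exact h2.trans (h4.trans (snoc_range _ _))

open LocalUnif in
lemma Ch.unif {O : ValuationSubring Q} (hO : ∀ z, z ∈ O ↔ v z ≤ 1) {s n : ℕ} {t : Fin s → Q} {η : Fin n → Q}
    (h : Ch v (Subring.closure ((↑(M.toSubring ⊓ O.toSubring) : Set Q) ∪ Set.range t)) η)
    (ht : ∀ i, v (t i) ≤ 1) (hi : AlgebraicIndependent M t)
    (hal : ∀ z : Q, IsAlgebraic (Subfield.closure (M ∪ Set.range t)) z)
    (hg : Subfield.closure ((M : Set Q) ∪ Set.range t ∪ Set.range η) = ⊤) : UnifData ⊤ M O t η := by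
  obtain ⟨h1, f, f1, f2, f3⟩ := h
  refine ⟨fun i => ⟨trivial, (hO _).2 (ht i)⟩, fun i => ⟨trivial, (hO _).2 (h1 i)⟩, hi, fun z _ => ?_, hg,
    fun i => (f i).map (Subring.subtype _), fun i m => ?_, fun i j hij => ?_, fun i => ?_, ?_⟩
  · rw [IntermediateField.isAlgebraic_adjoin_iff]; exact alg_adj.1 (hal z)
  · rw [MvPolynomial.coeff_map]; exact SetLike.coe_mem _
  · have := f1 i j hij
    have h2 : j ∉ ((f i).map (Subring.subtype _)).vars := fun h => this (MvPolynomial.vars_map _ _ h)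
    by_contra h3
    refine h2 ?_
    rw [MvPolynomial.vars_def, Multiset.mem_toFinset]
    rw [MvPolynomial.degreeOf_def] at h3
    exact Multiset.count_ne_zero.1 h3
  · rw [MvPolynomial.eval_map]; exact f2 i
  · have e : ∀ q : MvPolynomial (Fin n) (Subring.closure ((↑(M.toSubring ⊓ O.toSubring) : Set Q) ∪ Set.range t)),
        MvPolynomial.eval η (q.map (Subring.subtype _)) = MvPolynomial.aeval η q := fun q => by
      rw [MvPolynomial.eval_map]; rfl
    have hd : v (Matrix.det (Matrix.of fun i j : Fin n =>
        MvPolynomial.eval η (MvPolynomial.pderiv j ((f i).map (Subring.subtype _))))) = 1 := by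
      rw [Matrix.det_of_lowerTriangular, map_prod]
      · refine Finset.prod_eq_one fun i _ => ?_
        rw [Matrix.of_apply, MvPolynomial.pderiv_map, e, f3]
      · intro i j hij
        rw [Matrix.of_apply, MvPolynomial.pderiv_map, e, MvPolynomial.pderiv_eq_zero_of_notMem_vars (f1 i j hij), map_zero]
    refine ⟨fun h => one_ne_zero (hd.symm.trans ((congrArg v h).trans v.map_zero)), (hO _).2 hd.le, (hO _).2 ?_⟩
    rw [map_inv₀, hd, inv_one]
end

section
variable {v : Valuation Q Γ} {S L L' M N k κ : Subfield Q} {Y x : Q} {p : ℕ} {A W : Set Q}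
variable {m n : ℕ} {a : Fin m → Q} {c : Fin n → Q}

lemma Het.alg {z : Q} (h : Het v L A z) : IsAlgebraic (Subfield.closure A) z := by
  have : z ∈ (algebraicClosure (Subfield.closure A) Q).toSubfield := by
    induction h with
    | base a h1 h2 h3 => exact mem_algebraicClosure_iff.2 (isAlg_mem (Subfield.subset_closure h1))
    | zero => exact zero_mem _
    | one => exact one_mem _
    | add a b _ _ h1 h2 => exact add_mem h1 h2
    | mul a b _ _ h1 h2 => exact mul_mem h1 h2
    | neg a _ h => exact neg_mem h
    | root f z _ _ _ h0 h1 ih =>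
      have hf : f ≠ 0 := by rintro rfl; simp at h1
      have := root_alg ih hf h0
      exact mem_algebraicClosure_iff.2 (alg_trans (fun z hz => mem_algebraicClosure_iff.1 hz) this)
  exact mem_algebraicClosure_iff.1 this

lemma PA_eq : Subfield.closure (PA M a c) = Subfield.closure (M ∪ Set.range (Fin.append a c)) := by
  rw [PA]; congr 2; ext z
  constructor
  · rintro (⟨i, rfl⟩ | ⟨i, rfl⟩)
    · exact ⟨Fin.castAdd n i, by simp⟩
    · exact ⟨Fin.natAdd m i, by simp⟩
  · rintro ⟨i, rfl⟩
    refine Fin.addCases (fun i => .inl ⟨i, by simp⟩) (fun i => .inr ⟨i, by simp⟩) i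

lemma span (hd : ∀ w ∈ W, DD v L (PA M a c) a w) :
    ∀ z ∈ Subfield.closure (M ∪ W), IsAlgebraic (Subfield.closure (M ∪ Set.range (Fin.append a c))) z := by
  rw [← PA_eq]
  refine alg_closure ?_
  rintro w (hw | hw)
  · exact isAlg_mem (Subfield.subset_closure (.inl hw))
  · obtain ⟨z, u, rfl, h1, _, h2, _⟩ := hd w hw
    exact (isAlg_mem (IsMon.mem (fun i => Subfield.subset_closure (.inr (.inl ⟨i, rfl⟩))) h1)).mul h2.alg

lemma indep (s : Finset Q) (hs : AlgebraicIndependent M ((↑) : s → Q))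
    (hsp : ∀ z : Q, IsAlgebraic (Subfield.closure (M ∪ (s : Set Q))) z) {d : ℕ} (hd : d = s.card) (t : Fin d → Q)
    (ht : ∀ z : Q, IsAlgebraic (Subfield.closure (M ∪ Set.range t)) z) : AlgebraicIndependent M t := by
  classical
  haveI : Algebra.IsAlgebraic (Algebra.adjoin M (Set.range t)) Q := ⟨fun z => alg_adj.1 (ht z)⟩
  obtain ⟨r, r1, r2⟩ := exists_isTranscendenceBasis_subset (R := M) (Set.range t)
  have hs' : IsTranscendenceBasis M ((↑) : s → Q) := by
    rw [hs.isTranscendenceBasis_iff_isAlgebraic]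
    refine ⟨fun z => ?_⟩
    rw [Subtype.range_coe_subtype]
    exact alg_adj.1 (hsp z)
  have hc := r2.cardinalMk_eq hs'
  have hrf : r.Finite := (Set.finite_range t).subset r1
  obtain ⟨r, rfl⟩ := hrf.exists_finset_coe
  have hc' : r.card = d := by
    rw [hd]
    simpa using hc
  have h1 : r ⊆ Finset.univ.image t := by
    intro z hz; obtain ⟨i, rfl⟩ := r1 hz; simp
  have h2 : (Finset.univ.image t).card ≤ d := by simpa using Finset.card_image_le (s := Finset.univ) (f := t)
  have h3 : r = Finset.univ.image t := Finset.eq_of_subset_of_card_le h1 (by omega)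
  have hinj : Function.Injective t := by
    have : (Finset.univ.image t).card = (Finset.univ : Finset (Fin d)).card := by rw [← h3, hc']; simp
    have := Finset.card_image_iff.1 this
    simpa using this
  have h4 := r2.1.comp (fun i : Fin d => (⟨t i, by rw [h3]; simp⟩ : (r : Set Q))) fun i j hij => hinj (by simpa using hij)
  exact h4

open LocalUnif in
lemma UNI {O : ValuationSubring Q} (hO : ∀ z, z ∈ O ↔ v z ≤ 1) (hM : ∀ z ∈ M, v z ≤ 1) (hW : W.Finite)
    (hg : Subfield.closure (M ∪ W) = ⊤) (ha : Par v a) (hc : ∀ i, v (c i) ≤ 1)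
    (hd : ∀ w ∈ W, DD v ⊤ (PA M a c) a w) (hi : AlgebraicIndependent M (Fin.append a c)) {r : ℕ} {ζ : Fin r → Q}
    (hζ : ∀ j, v (ζ j) ≤ 1 ∧ (ζ j = 0 ∨ ζ j ∈ W)) : UnifWrt ⊤ M O ζ := by
  choose z u h1 h2 h3 h4 h5 using hd
  obtain ⟨N, η, e1, e2⟩ := Ch.ex (v := v) (L := ⊤) (A := PA M a c)
    (B := Subring.closure ((↑(M.toSubring ⊓ O.toSubring) : Set Q) ∪ Set.range (Fin.append a c)))
    (X := (Set.range fun w : W => u w w.2) ∪ Set.range ζ) (by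
      rintro x (hx | hx) hv
      · exact Subring.subset_closure (.inl ⟨hx, (hO _).2 hv⟩)
      · refine Subring.subset_closure (.inr ?_)
        rcases hx with ⟨i, rfl⟩ | ⟨i, rfl⟩
        · exact ⟨Fin.castAdd n i, by simp⟩
        · exact ⟨Fin.natAdd m i, by simp⟩)
    ((haveI := hW.to_subtype; Set.finite_range _).union (Set.finite_range _)) (by
      rintro _ (⟨w, rfl⟩ | ⟨j, rfl⟩)
      · exact h4 w w.2
      · rcases (hζ j).2 with h | h
        · rw [h]; exact .zero
        · exact DD.het ha (fun _ => trivial) (fun i => .inr (.inl ⟨i, rfl⟩))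
            ⟨z _ h, u _ h, h1 _ h, h2 _ h, h3 _ h, h4 _ h, h5 _ h⟩ (hζ j).1)
  have hσ : ∀ j, ∃ i, η i = ζ j := fun j => e2 (.inr ⟨j, rfl⟩)
  choose σ hσ using hσ
  refine ⟨m + n, N, Fin.append a c, η, e1.unif hO (fun i => ?_) hi (fun x => ?_) ?_, σ, hσ⟩
  · refine Fin.addCases (fun i => ?_) (fun i => ?_) i
    · simpa using (ha.lt i).le
    · simpa using hc i
  · exact span (v := v) (L := ⊤) (W := W)
      (fun w h => ⟨z _ h, u _ h, h1 _ h, h2 _ h, h3 _ h, h4 _ h, h5 _ h⟩) x (by rw [hg]; trivial)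
  · rw [← top_le_iff, ← hg, Subfield.closure_le]
    rintro w (hw | hw)
    · exact Subfield.subset_closure (.inl (.inl hw))
    · rw [h1 w hw]
      refine mul_mem (IsMon.mem (fun i => Subfield.subset_closure (.inl (.inr ⟨Fin.castAdd n i, by simp⟩))) (h2 w hw)) ?_
      exact Subfield.subset_closure (.inr (e2 (.inl ⟨⟨w, hw⟩, rfl⟩)))
end

section
variable {v : Valuation Q Γ} {S L L' M N k κ : Subfield Q} {Y x : Q} {p : ℕ} {A W : Set Q}

section tr
variable {G : Type*} [Field G] (φ : G →+* Q)

lemma Het.tr (hφ : L ≤ φ.fieldRange) {z : Q} (h : Het v L A z) : ∀ y, φ y = z → Het (v.comap φ) ⊤ (φ ⁻¹' A) y := by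
  have lift : ∀ {z}, Het v L A z → ∃ y, φ y = z := fun h => hφ h.mem
  induction h with
  | base a h1 h2 h3 => rintro y rfl; exact .base y h1 trivial h3
  | zero => intro y hy; rw [(map_eq_zero φ).1 hy]; exact .zero
  | one => intro y hy; rw [φ.injective (hy.trans (map_one φ).symm)]; exact .one
  | add a b ha hb h1 h2 =>
    intro y hy
    obtain ⟨a, rfl⟩ := lift ha
    obtain ⟨b, rfl⟩ := lift hb
    rw [φ.injective (hy.trans (map_add φ a b).symm)]
    exact .add _ _ (h1 a rfl) (h2 b rfl)
  | mul a b ha hb h1 h2 =>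
    intro y hy
    obtain ⟨a, rfl⟩ := lift ha
    obtain ⟨b, rfl⟩ := lift hb
    rw [φ.injective (hy.trans (map_mul φ a b).symm)]
    exact .mul _ _ (h1 a rfl) (h2 b rfl)
  | neg a ha h1 =>
    intro y hy
    obtain ⟨a, rfl⟩ := lift ha
    rw [φ.injective (hy.trans (map_neg φ a).symm)]
    exact .neg _ (h1 a rfl)
  | root f z hf hz h1 h2 h3 ih =>
    rintro y rfl
    have : f ∈ Polynomial.lifts φ := by
      rw [lifts_iff_coeff_lifts]
      exact fun i => lift (hf i)
    obtain ⟨g, rfl⟩ := this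
    simp only [coe_mapRingHom] at *
    refine .root g y (fun i => ih i _ (by rw [coeff_map])) trivial h1 ?_ ?_
    · rw [eval_map, eval₂_at_apply] at h2; exact (map_eq_zero φ).1 h2
    · rw [derivative_map, eval_map, eval₂_at_apply] at h3; exact h3

variable {m n : ℕ} {a : Fin m → G} {c : Fin n → G}

lemma mon_tr (α : Fin m → ℤ) : φ (mon a α) = mon (φ ∘ a) α := by
  simp [mon, map_prod, map_zpow₀]

lemma Par.tr (h : Par v (φ ∘ a)) : Par (v.comap φ) a :=
  ⟨fun i hi => h.ne i (by simp [hi]), fun i => h.lt i, fun α hα => h.ind α (by rw [← mon_tr]; exact hα)⟩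

lemma DD.tr (hφ : L ≤ φ.fieldRange) {y : G} (h : DD v L (PA M (φ ∘ a) (φ ∘ c)) (φ ∘ a) (φ y)) :
    DD (v.comap φ) ⊤ (PA (M.comap φ) a c) a y := by
  obtain ⟨z, u, h1, ⟨α, h2⟩, h3, h4, h5⟩ := h
  obtain ⟨u, rfl⟩ := hφ h4.mem
  have e : φ ⁻¹' (PA M (φ ∘ a) (φ ∘ c)) = PA (M.comap φ) a c := by
    ext x; simp [PA, φ.injective.eq_iff]
  rw [← mon_tr] at h2
  subst h2
  refine ⟨mon a α, u, φ.injective (by rw [h1, map_mul]), ⟨α, rfl⟩, fun hv => ?_, ?_, ?_⟩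
  · obtain ⟨β, hβ⟩ := h3 hv
    rw [← mon_tr] at hβ
    exact ⟨β, hβ.1, φ.injective hβ.2⟩
  · rw [← e]; exact h4.tr φ hφ u rfl
  · rw [← e]; exact h5.tr φ hφ _ (map_inv₀ φ u)
end tr

lemma gal [IsAlgClosed Q] (h : N ≤ L) (halg : ∀ z : Q, IsAlgebraic N z) (hs : ∀ z ∈ L, IsSeparable N z)
    (hst : ∀ σ : Q ≃+* Q, (∀ z ∈ N, σ z = z) → ∀ z ∈ L, σ z ∈ L) : IsGalois N (Subfield.extendScalars h) := by
  haveI : Algebra.IsAlgebraic N Q := ⟨halg⟩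
  haveI : IsAlgClosure N Q := ⟨inferInstance, inferInstance⟩
  haveI : Normal N Q := IsAlgClosure.normal N Q
  haveI : Algebra.IsSeparable N (Subfield.extendScalars h) :=
    ⟨fun z => by
      have := hs z z.2
      rw [IsSeparable, ← minpoly.algHom_eq (Subfield.extendScalars h).val (Subfield.extendScalars h).val.injective z]
      exact this⟩
  haveI : Normal N (Subfield.extendScalars h) := by
    rw [IntermediateField.normal_iff_forall_map_le']
    rintro σ _ ⟨z, hz, rfl⟩
    exact hst σ.toRingEquiv (fun z hz => σ.commutes ⟨z, hz⟩) z hz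
  exact ⟨⟩

lemma gal_tr [IsAlgClosed Q] {F : Type*} [Field F] [Algebra F Q] (𝓕 : IntermediateField F Q) (N : Subfield 𝓕)
    (halg : ∀ z : Q, IsAlgebraic (N.map (algebraMap 𝓕 Q)) z)
    (hs : ∀ z ∈ 𝓕, IsSeparable (N.map (algebraMap 𝓕 Q)) z)
    (hst : ∀ σ : Q ≃+* Q, (∀ z ∈ N.map (algebraMap 𝓕 Q), σ z = z) → ∀ z ∈ 𝓕, σ z ∈ 𝓕) : IsGalois N 𝓕 := by
  have hN : N.map (algebraMap 𝓕 Q) ≤ 𝓕.toSubfield := by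
    rintro _ ⟨z, hz, rfl⟩; exact z.2
  haveI := gal hN halg hs hst
  let f : N.map (algebraMap 𝓕 Q) ≃+* N := (RingEquiv.ofBijective ((algebraMap 𝓕 Q).restrict N
    (N.map (algebraMap 𝓕 Q)) fun x hx => ⟨x, hx, rfl⟩) ⟨RingHom.injective _, fun ⟨_, x, hx, e⟩ => ⟨⟨x, hx⟩, Subtype.ext e⟩⟩).symm
  let g : Subfield.extendScalars hN ≃+* 𝓕 := RingEquiv.refl 𝓕
  refine IsGalois.of_equiv_equiv (f := f) (g := g) ?_
  have h1 : ∀ y : N, ((algebraMap N 𝓕).comp (f : _ →+* N)) (f.symm y) =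
      ((g : _ →+* 𝓕).comp (algebraMap _ (Subfield.extendScalars hN))) (f.symm y) := fun y => by
    rw [RingHom.comp_apply, RingHom.coe_coe, RingEquiv.apply_symm_apply]; rfl
  refine RingHom.ext fun z => ?_
  rw [← f.symm_apply_apply z]
  exact h1 _

lemma fin_dim (h : k ≤ M) {C : Set Q} (hC : C.Finite) (hCa : ∀ z ∈ C, IsAlgebraic k z)
    (e : M = Subfield.closure (k ∪ C)) :
    (letI : Algebra k M := (Subfield.inclusion h).toAlgebra; FiniteDimensional k M) := by
  have h1 : FiniteDimensional k (IntermediateField.adjoin k C) :=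
    haveI := hC.to_subtype
    IntermediateField.finiteDimensional_adjoin fun z hz => (hCa z hz).isIntegral
  have h2 : Subfield.extendScalars h = IntermediateField.adjoin k C := by
    apply IntermediateField.toSubfield_injective
    rw [adjoin_eq, ← e]; rfl
  rw [← h2] at h1
  exact h1
end

section
variable {v : Valuation Q Γ} {S L L' M N k κ : Subfield Q} {Y x : Q} {p : ℕ} {A W : Set Q}

lemma exists_ext {F : Type*} [Field F] (ι : F →+* Q) (O : ValuationSubring F) :
    ∃ A : ValuationSubring Q, A.comap ι = O := by
  obtain ⟨A, h, hl⟩ := IsLocalRing.exists_factor_valuationRing (ι.comp O.subtype)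
  have h1 : ∀ x ∈ O, ι x ∈ A := fun x hx => h ⟨x, hx⟩
  refine ⟨A, le_antisymm (fun x hx => ?_) fun x hx => h1 x hx⟩
  rw [ValuationSubring.mem_comap] at hx
  rcases O.mem_or_inv_mem x with hO | hO
  · exact hO
  by_cases h0 : x = 0
  · rw [h0]; exact O.zero_mem
  have hu : IsUnit (((ι.comp O.subtype).codRestrict A.toSubring h) ⟨x⁻¹, hO⟩) := by
    refine IsUnit.of_mul_eq_one (⟨ι x, hx⟩ : A.toSubring) (Subtype.ext ?_)
    change ι x⁻¹ * ι x = 1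
    rw [← map_mul, inv_mul_cancel₀ h0, map_one]
  obtain ⟨⟨u, w, h2, h3⟩, h4⟩ := hl.map_nonunit _ hu
  have h5 : x⁻¹ * (w : F) = 1 := by
    have := congrArg Subtype.val h2
    have h4' : u = ⟨x⁻¹, hO⟩ := h4
    rw [h4'] at this
    exact this
  have : x = w := by field_simp at h5; exact h5.symm
  rw [this]; exact w.2

lemma res_root [IsAlgClosed Q] (hv : ∀ z, IsAlgebraic k z → z ≠ 0 → v z = 1) {g : Q[X]} (hg : g ≠ 0)
    (hc : ∀ i, IsAlgebraic k (g.coeff i)) {z : Q} (hz : v (g.eval z) < 1) :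
    ∃ e, IsAlgebraic k e ∧ v (z - e) < 1 := by
  have hs := IsAlgClosed.splits g
  by_contra hcon
  push Not at hcon
  have hr : ∀ r ∈ g.roots, IsAlgebraic k r := fun r hr => by
    refine alg_trans (N := (algebraicClosure k Q).toSubfield) (fun z hz => mem_algebraicClosure_iff.1 hz) ?_
    exact root_alg (fun i => mem_algebraicClosure_iff.2 (hc i)) hg (isRoot_of_mem_roots hr)
  have e := hs.eval_eq_prod_roots z
  have hl : v g.leadingCoeff = 1 := hv _ (hc _) (leadingCoeff_ne_zero.2 hg)
  rw [e, map_mul, hl, one_mul] at hz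
  refine hz.not_ge ?_
  rw [map_multiset_prod, Multiset.map_map]
  refine Multiset.one_le_prod_of_one_le fun y hy => ?_
  obtain ⟨r, hr', rfl⟩ := Multiset.mem_map.1 hy
  exact hcon r (hr r hr')

lemma res_all [IsAlgClosed Q] (hv : ∀ z, IsAlgebraic k z → z ≠ 0 → v z = 1) (hM : ∀ z : Q, IsAlgebraic M z)
    (hr : ∀ z ∈ M, v z ≤ 1 → ∃ e, IsAlgebraic k e ∧ v (z - e) < 1) (z : Q) (hz : v z ≤ 1) :
    ∃ e, IsAlgebraic k e ∧ v (z - e) < 1 := by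
  obtain ⟨f, hf, h0⟩ := hM z
  obtain ⟨i, hi, hmax⟩ := Finset.exists_max_image f.support (fun i => v (f.coeff i : Q)) (support_nonempty.2 hf)
  have hi0 : (f.coeff i : Q) ≠ 0 := by
    have := mem_support_iff.1 hi
    simpa using this
  have hvi : v (f.coeff i : Q) ≠ 0 := v.ne_zero_iff.2 hi0
  have hb : ∀ j, v (f.coeff j / f.coeff i : Q) ≤ 1 := fun j => by
    rw [map_div₀]
    refine div_le_one_of_le₀ ?_ zero_le
    by_cases hj : j ∈ f.support
    · exact hmax j hj
    · rw [notMem_support_iff.1 hj]; simp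
  have hex : ∀ j, ∃ e, IsAlgebraic k e ∧ v ((f.coeff j / f.coeff i : Q) - e) < 1 := fun j =>
    hr _ (M.div_mem (SetLike.coe_mem _) (SetLike.coe_mem _)) (hb j)
  choose e he1 he2 using hex
  obtain ⟨g, hg⟩ : ∃ g : Q[X], g = ∑ j ∈ Finset.range (f.natDegree + 1), C (e j) * X ^ j := ⟨_, rfl⟩
  have hgc : ∀ j, g.coeff j = if j ∈ Finset.range (f.natDegree + 1) then e j else 0 := fun j => by
    rw [hg, finset_sum_coeff]; simp [coeff_C_mul, coeff_X_pow]
  refine res_root hv (g := g) (fun hg0 => ?_) (fun j => ?_) ?_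
  · have h1 := hgc i
    rw [hg0, if_pos (Finset.mem_range.2 (Nat.lt_succ_of_le (le_natDegree_of_mem_supp i hi)))] at h1
    have := he2 i
    rw [← h1, div_self hi0] at this
    simp at this
  · rw [hgc]; split_ifs
    · exact he1 j
    · exact isAlgebraic_zero
  · have h1 : ∑ j ∈ Finset.range (f.natDegree + 1), (f.coeff j / f.coeff i : Q) * z ^ j = 0 := by
      rw [aeval_eq_sum_range] at h0
      simp_rw [div_mul_eq_mul_div, ← Finset.sum_div]
      have : ∑ j ∈ Finset.range (f.natDegree + 1), (f.coeff j : Q) * z ^ j = 0 := h0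
      rw [this, zero_div]
    have h2 : g.eval z = - ∑ j ∈ Finset.range (f.natDegree + 1), ((f.coeff j / f.coeff i : Q) - e j) * z ^ j := by
      simp_rw [sub_mul, Finset.sum_sub_distrib]
      rw [h1, hg, eval_finset_sum]; simp
    rw [h2, Valuation.map_neg]
    refine Valuation.map_sum_lt v one_ne_zero fun j _ => ?_
    rw [map_mul, map_pow]
    exact (mul_le_of_le_one_right' (pow_le_one₀ zero_le hz)).trans_lt (he2 j)

lemma arch_all (hM : ∀ z : Q, IsAlgebraic M z)
    (h : ∀ a ∈ M, ∀ b ∈ M, a ≠ 0 → b ≠ 0 → v a < 1 → v b < 1 → ∃ n : ℕ, v a ^ n ≤ v b) (a b : Q) (ha : v a < 1)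
    (hb : b ≠ 0) : ∃ n : ℕ, v a ^ n ≤ v b := by
  rcases le_or_gt 1 (v b) with h1 | h1
  · exact ⟨0, by simpa using h1⟩
  by_cases ha0 : a = 0
  · exact ⟨1, by simp [ha0]⟩
  obtain ⟨n, hn, c, hc, hc0, ec⟩ := torsion v M a (hM a) ha0
  obtain ⟨m, hm, d, hd, hd0, ed⟩ := torsion v M b (hM b) hb
  obtain ⟨l, hl⟩ := h c hc d hd hc0 hd0 (by rw [← ec]; exact pow_lt_one₀ zero_le ha hn.ne')
    (by rw [← ed]; exact pow_lt_one₀ zero_le h1 hm.ne')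
  refine ⟨n * l, ?_⟩
  rw [pow_mul, ec]
  refine hl.trans ?_
  rw [← ed]
  exact pow_le_of_le_one zero_le h1.le hm.ne'

lemma sepbasis [PerfectField k] {E : Subfield Q} {Sg : Set Q} (hS : Sg.Finite) (hsep : ∀ g ∈ Sg, IsSeparable E g) :
    ∃ s : Finset Q, AlgebraicIndependent k ((↑) : s → Q) ∧ (∀ x ∈ s, x ∈ Subfield.closure ((k : Set Q) ∪ E)) ∧
      ∀ g ∈ Sg, IsSeparable (Subfield.closure (k ∪ (s : Set Q))) g := by
  classical
  obtain ⟨R, hR⟩ : ∃ R : Set Q, R = ⋃ g ∈ Sg, (((minpoly E g).map (algebraMap E Q)).coeffs : Set Q) := ⟨_, rfl⟩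
  have hRf : R.Finite := by rw [hR]; exact hS.biUnion fun g _ => Finset.finite_toSet _
  have hRE : R ⊆ E := by
    rw [hR]
    simp only [Set.iUnion_subset_iff]
    intro g _ x hx
    obtain ⟨n, _, rfl⟩ := mem_coeffs_iff.1 hx
    rw [coeff_map]; exact SetLike.coe_mem _
  obtain ⟨E1, hE1⟩ : ∃ E1, E1 = IntermediateField.adjoin k R := ⟨_, rfl⟩
  haveI : Algebra.EssFiniteType k E1 := by
    rw [IntermediateField.essFiniteType_iff, hE1]
    exact ⟨hRf.toFinset, by simp⟩
  obtain ⟨s, s1, s2⟩ := exists_isTranscendenceBasis_and_isSeparable_of_perfectField k E1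
  have hRE1 : ∀ x ∈ R, x ∈ E1.toSubfield := fun x hx => by
    rw [hE1]; exact IntermediateField.subset_adjoin _ _ hx
  have hκ : ∀ y ∈ IntermediateField.adjoin k (s : Set E1), (y : Q) ∈
      Subfield.closure (k ∪ ((s.image (algebraMap E1 Q) : Finset Q) : Set Q)) := fun y hy => by
    rw [← adjoin_eq]
    have h1 : IntermediateField.adjoin k (s : Set E1) ≤
        (IntermediateField.adjoin k ((s.image (algebraMap E1 Q) : Finset Q) : Set Q)).comap E1.val := by
      rw [IntermediateField.adjoin_le_iff]
      intro z hz
      exact IntermediateField.subset_adjoin _ _ (Finset.mem_coe.2 (Finset.mem_image_of_mem _ hz))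
    exact h1 hy
  have hE2 : ∀ y ∈ E1.toSubfield, y ∈ Subfield.closure (k ∪ R) := by rw [hE1, adjoin_eq]; exact fun _ h => h
  refine ⟨s.image (algebraMap E1 Q), ?_, fun x hx => ?_, fun g hg => ?_⟩
  · have h2 := (s1.1.map' (f := E1.val) E1.val.injective).coe_range
    have e : Set.range (E1.val ∘ ((↑) : s → E1)) = ((s.image (algebraMap E1 Q) : Finset Q) : Set Q) := by
      ext z; simp
    rw [e] at h2
    exact h2
  · obtain ⟨x, _, rfl⟩ := Finset.mem_image.1 hx
    exact Subfield.closure_mono (Set.union_subset_union_right _ hRE) (hE2 _ x.2)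
  · generalize (s.image (algebraMap E1 Q) : Finset Q) = s' at *
    have h3 : ∀ y ∈ E1.toSubfield, IsSeparable (Subfield.closure (k ∪ (s' : Set Q))) y := fun y hy => by
      have h4 : (minpoly (IntermediateField.adjoin k (s : Set E1)) (⟨y, hy⟩ : E1)).Separable :=
        s2.isSeparable' ⟨y, hy⟩
      refine sep_lift (f := (minpoly (IntermediateField.adjoin k (s : Set E1)) (⟨y, hy⟩ : E1)).map
        ((algebraMap E1 Q).comp (algebraMap _ E1))) h4.map ?_ fun i => ?_
      · have h5 := minpoly.aeval (IntermediateField.adjoin k (s : Set E1)) (⟨y, hy⟩ : E1)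
        have h6 := hom_eval₂ (minpoly (IntermediateField.adjoin k (s : Set E1)) (⟨y, hy⟩ : E1))
          (algebraMap _ E1) (algebraMap E1 Q) (⟨y, hy⟩ : E1)
        rw [aeval_def] at h5
        rw [h5, map_zero] at h6
        rw [eval_map]
        exact h6.symm
      · rw [coeff_map]
        exact hκ _ (SetLike.coe_mem _)
    refine (sepc_sep (S := (separableClosure (Subfield.closure (k ∪ (s' : Set Q))) Q).toSubfield)
      (fun z => mem_separableClosure_iff) ?_ : g ∈ _)
    have h4 : IsSeparable E1.toSubfield g := by
      refine sep_lift (f := (minpoly E g).map (algebraMap E Q)) (Separable.map (hsep g hg)) ?_ fun i => ?_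
      · rw [eval_map, ← aeval_def, minpoly.aeval]
      · by_cases h0 : ((minpoly E g).map (algebraMap E Q)).coeff i = 0
        · rw [h0]; exact zero_mem _
        · refine hRE1 _ ?_
          rw [hR]
          exact Set.mem_biUnion hg (coeff_mem_coeffs h0)
    exact sep_up (fun z hz => mem_separableClosure_iff.2 (h3 z hz)) h4
end

section
variable {v : Valuation Q Γ} {S L L' M N k κ : Subfield Q} {Y x : Q} {p : ℕ} {A W : Set Q}

lemma glob [IsAlgClosed Q] [PerfectField k] {K₀ : Subfield Q} (hk1 : K₀ ≤ k) (hk2 : ∀ z ∈ k, ∃ n > 0, z ^ n ∈ K₀)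
    (hM : ∀ z : Q, IsAlgebraic M z) (ht : ∀ z ∈ K₀, z ≠ 0 → v z = 1)
    (h : ∀ a ∈ M, ∀ b ∈ M, a ≠ 0 → b ≠ 0 → v a < 1 → v b < 1 → ∃ n : ℕ, v a ^ n ≤ v b)
    (hr : ∀ z ∈ M, v z ≤ 1 → ∃ g : Q[X], g ≠ 0 ∧ (∀ i, g.coeff i ∈ K₀) ∧ v (g.eval z) < 1) : Glob v k := by
  have h1 : ∀ z ∈ k, z ≠ 0 → v z = 1 := fun z hz h0 => by
    obtain ⟨n, hn, e⟩ := hk2 z hz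
    refine val_pow_inj hn ?_
    rw [← map_pow, ht _ e (pow_ne_zero _ h0), one_pow]
  have h2 : ∀ z, IsAlgebraic k z → z ≠ 0 → v z = 1 := fun z hz h0 => by
    obtain ⟨n, hn, c, hc, hc0, e⟩ := torsion v k z hz h0
    rw [h1 c hc hc0] at e
    exact val_pow_inj hn (by rw [e, one_pow])
  refine ⟨arch_all hM h, h1, res_all h2 hM fun z hz hz1 => ?_, fun z hz => ?_⟩
  · obtain ⟨g, g1, g2, g3⟩ := hr z hz hz1
    exact res_root h2 g1 (fun i => isAlg_mem (hk1 (g2 i))) g3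
  · exact PerfectField.separable_of_irreducible (minpoly.irreducible hz.isIntegral)

lemma core [IsAlgClosed Q] [PerfectField k] (hG : Glob v k) {K₀ E₀ F₀ : Subfield Q} (hKk : K₀ ≤ k) (hKE : K₀ ≤ E₀)
    {Sg Z : Set Q} (hSf : Sg.Finite) (hF₀ : F₀ = Subfield.closure (K₀ ∪ Sg))
    (hsep : ∀ g ∈ Sg, IsSeparable E₀ g) (hF : ∀ z : Q, IsAlgebraic F₀ z) (hk : ∀ z ∈ k, IsAlgebraic K₀ z)
    (hfix : ∀ z ∈ k, ∀ σ : Q ≃+* Q, (∀ y ∈ E₀, σ y = y) → σ z = z) (hZ : Z.Finite) (hZF : Z ⊆ F₀) :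
    ∃ (C W : Set Q) (m n : ℕ) (a : Fin m → Q) (c : Fin n → Q), C.Finite ∧ C ⊆ k ∧ W.Finite ∧
      F₀ ≤ Subfield.closure ((Subfield.closure (K₀ ∪ C) : Set Q) ∪ W) ∧ (∀ z ∈ Z, z = 0 ∨ z ∈ W) ∧
      Par v a ∧ (∀ i, v (c i) ≤ 1) ∧ FD v E₀ (Subfield.closure (K₀ ∪ C)) W a c ∧
      AlgebraicIndependent (Subfield.closure ((K₀ : Set Q) ∪ C)) (Fin.append a c) := by
  obtain ⟨p, hp⟩ := CharP.exists Q
  obtain ⟨s, s1, s2, s3⟩ := sepbasis (k := k) hSf hsep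
  obtain ⟨κ, hκ⟩ : ∃ κ, κ = Subfield.closure (k ∪ (s : Set Q)) := ⟨_, rfl⟩
  have hkκ : (k : Set Q) ⊆ κ := by rw [hκ]; exact Set.subset_union_left.trans Subfield.subset_closure
  have hκE : κ ≤ Subfield.closure (k ∪ (E₀ : Set Q)) := by
    rw [hκ, Subfield.closure_le]
    exact Set.union_subset (Set.subset_union_left.trans Subfield.subset_closure) s2
  have hFs : ∀ z ∈ F₀, IsSeparable κ z := by
    have : F₀ ≤ (separableClosure κ Q).toSubfield := by
      rw [hF₀, Subfield.closure_le]
      refine Set.union_subset (fun z hz => ?_) fun z hz => mem_separableClosure_iff.2 (by rw [hκ]; exact s3 z hz)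
      exact (separableClosure κ Q).algebraMap_mem ⟨z, hkκ (hKk hz)⟩
    exact fun z hz => mem_separableClosure_iff.1 (this hz)
  have hE : ∀ z : Q, IsAlgebraic E₀ z := fun z => by
    refine alg_trans (N := F₀) (fun y hy => ?_) (hF z)
    rw [hF₀] at hy
    refine alg_closure (fun z hz => ?_) y hy
    rcases hz with hz | hz
    · exact isAlg_mem (hKE hz)
    · exact (hsep z hz).isIntegral.isAlgebraic
  obtain ⟨W, m, n, a, c, hmn, hZW, hU⟩ := UU_all (p := p) ((CharP.char_is_prime_or_zero Q p).symm) hG s s1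
    ((Sg ∪ Z) \ {0}) ((hSf.union hZ).subset Set.diff_subset) (fun z hz => hz.2) (fun z hz => by
      rw [← hκ]
      refine hFs z ?_
      rcases hz.1 with h | h
      · rw [hF₀]; exact Subfield.subset_closure (Or.inr h)
      · exact hZF h)
  rw [← hκ] at hU
  obtain ⟨C, C1, C2, C3⟩ := hU.descend hfix hE hκE
  obtain ⟨M, hM⟩ : ∃ M, M = Subfield.closure ((K₀ : Set Q) ∪ C) := ⟨_, rfl⟩
  have hKM : K₀ ≤ M := by rw [hM]; exact fun z hz => Subfield.subset_closure (Or.inl hz)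
  have hMk : M ≤ k := by rw [hM, Subfield.closure_le]; exact Set.union_subset hKk C2
  have hFD := C3 M (by rw [hM]; exact Set.subset_union_right.trans Subfield.subset_closure)
  have hFW : F₀ ≤ Subfield.closure ((M : Set Q) ∪ W) := by
    rw [hF₀, Subfield.closure_le]
    refine Set.union_subset (fun z hz => Subfield.subset_closure (Or.inl (hKM hz))) fun z hz => ?_
    by_cases h0 : z = 0
    · rw [h0]; exact zero_mem _
    · exact Subfield.subset_closure (Or.inr (hZW ⟨Or.inl hz, h0⟩))
  refine ⟨C, W, m, n, a, c, C1, C2, hU.fin, ?_, fun z hz => ?_, hU.par, hU.cl, ?_, ?_⟩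
  · rw [← hM]; exact hFW
  · by_cases h0 : z = 0
    · exact Or.inl h0
    · exact Or.inr (hZW ⟨Or.inr hz, h0⟩)
  · rw [← hM]; exact hFD
  · rw [← hM]
    refine indep s ?_ (fun z => ?_) hmn _ (fun z => ?_)
    · exact AlgebraicIndependent.of_ringHom_of_comp_eq (f := Subfield.inclusion hMk) (g := RingHom.id Q) s1
        (Subfield.inclusion hMk).injective rfl
    · refine alg_trans (N := κ) (fun y hy => ?_) (alg_trans (N := F₀) (fun y hy => (hFs y hy).isIntegral.isAlgebraic) (hF z))
      rw [hκ] at hy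
      refine alg_closure (fun x hx => ?_) y hy
      rcases hx with hx | hx
      · exact alg_trans (N := K₀) (fun y hy => isAlg_mem (Subfield.subset_closure (Or.inl (hKM hy)))) (hk x hx)
      · exact isAlg_mem (Subfield.subset_closure (Or.inr hx))
    · exact alg_trans (N := Subfield.closure ((M : Set Q) ∪ W)) (span hFD.dec)
        (alg_trans (N := F₀) (fun y hy => isAlg_mem (hFW hy)) (hF z))
end

section
variable {v : Valuation Q Γ} {S L L' M N k κ : Subfield Q} {Y x : Q} {p : ℕ} {A W : Set Q}

lemma sep_cl {s : Set Q} (h : ∀ z ∈ s, z ∈ κ ∨ IsSeparable κ z) : ∀ z ∈ Subfield.closure s, IsSeparable κ z := by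
  have : Subfield.closure s ≤ (separableClosure κ Q).toSubfield := by
    rw [Subfield.closure_le]
    intro z hz
    rcases h z hz with hz | hz
    · exact (separableClosure κ Q).algebraMap_mem ⟨z, hz⟩
    · exact mem_separableClosure_iff.2 hz
  exact fun z hz => mem_separableClosure_iff.1 (this hz)

set_option maxHeartbeats 1000000 in
lemma final {F : Type*} [Field F] [Algebra F Q] [IsAlgClosed Q] [Algebra.IsAlgebraic F Q] {K E : Subfield F}
    {O : ValuationSubring F} {A : ValuationSubring Q} (hA : A.comap (algebraMap F Q) = O) {q : ℕ} (hq : 0 < q) {C W : Set Q}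
    {m n : ℕ} {a : Fin m → Q} {c : Fin n → Q} (hKE : K ≤ E) (hC : C.Finite) (hW : W.Finite)
    (hM : M = Subfield.closure (K.map (algebraMap F Q) ∪ C)) (hMq : ∀ z ∈ M, ∃ n : ℕ, z ^ q ^ n ∈ K.map (algebraMap F Q))
    (hMv : ∀ z ∈ M, A.valuation z ≤ 1) (hF : (algebraMap F Q).fieldRange ≤ Subfield.closure (M ∪ W))
    (ha : Par A.valuation a) (hc : ∀ i, A.valuation (c i) ≤ 1) (h : FD A.valuation (E.map (algebraMap F Q)) M W a c)
    (hi : AlgebraicIndependent M (Fin.append a c)) {r : ℕ} {ζ : Fin r → F} (hζ : ∀ k, ζ k ∈ O)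
    (hζW : ∀ k, algebraMap F Q (ζ k) = 0 ∨ algebraMap F Q (ζ k) ∈ W) :
    ∃ (𝓕 : IntermediateField F Q) (Q : ValuationSubring ↥𝓕)
      (𝓚 : Subfield ↥𝓕),
      FiniteDimensional F ↥𝓕 ∧
      Q.comap (algebraMap F ↥𝓕) = O ∧
      (∃ hle : K.map (algebraMap F ↥𝓕) ≤ 𝓚,
        (letI : Algebra ↥(K.map (algebraMap F ↥𝓕)) ↥𝓚 := (Subfield.inclusion hle).toAlgebra
         FiniteDimensional ↥(K.map (algebraMap F ↥𝓕)) ↥𝓚) ∧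
        ∀ x ∈ 𝓚, ∃ nn : ℕ, x ^ q ^ nn ∈ K.map (algebraMap F ↥𝓕)) ∧
      IsGalois ↥(E.map (algebraMap F ↥𝓕) ⊔ 𝓚) ↥𝓕 ∧
      IsGalois ↥((algebraMap F ↥𝓕).fieldRange ⊔ 𝓚) ↥𝓕 ∧
      LocalUnif.UnifWrt (F := ↥𝓕) ⊤ 𝓚 Q (fun k => algebraMap F ↥𝓕 (ζ k)) := by
  have hKM : K.map (algebraMap F Q) ≤ M := by rw [hM]; exact fun z hz => Subfield.subset_closure (Or.inl hz)
  have hCM : C ⊆ M := by rw [hM]; exact fun z hz => Subfield.subset_closure (Or.inr hz)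
  obtain ⟨𝓕, h𝓕⟩ : ∃ 𝓕, 𝓕 = IntermediateField.adjoin F (C ∪ W) := ⟨_, rfl⟩
  have hfd : FiniteDimensional F 𝓕 := by
    rw [h𝓕]
    haveI := (hC.union hW).to_subtype
    exact IntermediateField.finiteDimensional_adjoin fun x _ => (Algebra.IsAlgebraic.isAlgebraic x).isIntegral
  have h1 : 𝓕.toSubfield = Subfield.closure (M ∪ W) := by
    rw [h𝓕, IntermediateField.adjoin_toSubfield]
    apply le_antisymm
    · rw [Subfield.closure_le]
      refine Set.union_subset (fun z hz => hF hz) (Set.union_subset (fun z hz => ?_) fun z hz => ?_)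
      · exact Subfield.subset_closure (Or.inl (hCM hz))
      · exact Subfield.subset_closure (Or.inr hz)
    · rw [Subfield.closure_le]
      refine Set.union_subset (fun z hz => ?_) (fun z hz => Subfield.subset_closure (Or.inr (Or.inr hz)))
      rw [hM] at hz
      refine (Subfield.closure_le.2 ?_ : Subfield.closure _ ≤ _) hz
      refine Set.union_subset ?_ (fun z hz => Subfield.subset_closure (Or.inr (Or.inl hz)))
      rintro _ ⟨y, _, rfl⟩
      exact Subfield.subset_closure (Or.inl ⟨y, rfl⟩)
  clear h𝓕
  obtain ⟨φ, hφ⟩ : ∃ φ : 𝓕 →+* Q, φ = algebraMap 𝓕 Q := ⟨_, rfl⟩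
  have hφi := φ.injective
  have hφr : ∀ z ∈ Subfield.closure ((M : Set Q) ∪ W), ∃ y, φ y = z := fun z hz => by
    rw [← h1] at hz; exact ⟨⟨z, hz⟩, by rw [hφ]; rfl⟩
  have hφm : ∀ y, φ y ∈ Subfield.closure ((M : Set Q) ∪ W) := fun y => by
    rw [← h1, hφ]; exact y.2
  have hφF : ∀ y, φ (algebraMap F 𝓕 y) = algebraMap F Q y := fun y => by rw [hφ]; rfl
  have hMr : ∀ z ∈ M, ∃ y, φ y = z := fun z hz => hφr z (Subfield.subset_closure (Or.inl hz))
  have hle : K.map (algebraMap F 𝓕) ≤ M.comap φ := by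
    rintro _ ⟨y, hy, rfl⟩
    change φ (algebraMap F 𝓕 y) ∈ M
    rw [hφF]; exact hKM ⟨y, hy, rfl⟩
  have hKm : ∀ z ∈ K.map (algebraMap F Q), ∀ y, φ y = z → y ∈ K.map (algebraMap F 𝓕) := by
    rintro _ ⟨x, hx, rfl⟩ y hy
    refine ⟨x, hx, hφi ?_⟩
    rw [hφF, hy]
  have hpw : ∀ x ∈ M.comap φ, ∃ nn : ℕ, x ^ q ^ nn ∈ K.map (algebraMap F 𝓕) := fun x hx => by
    obtain ⟨nn, h⟩ := hMq _ hx
    exact ⟨nn, hKm _ h _ (map_pow _ _ _)⟩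
  have hgal : ∀ N : Subfield 𝓕, E.map (algebraMap F 𝓕) ≤ N → M.comap φ ≤ N → IsGalois N 𝓕 := by
    intro N hN1 hN2
    have hE' : E.map (algebraMap F Q) ≤ N.map (algebraMap 𝓕 Q) := by
      rintro _ ⟨y, hy, rfl⟩
      exact ⟨algebraMap F 𝓕 y, hN1 ⟨y, hy, rfl⟩, rfl⟩
    have hM' : M ≤ N.map (algebraMap 𝓕 Q) := fun z hz => by
      obtain ⟨y, rfl⟩ := hMr z hz
      exact ⟨y, hN2 hz, by rw [hφ]⟩
    have hs : ∀ z ∈ Subfield.closure (M ∪ W), IsSeparable (N.map (algebraMap 𝓕 Q)) z := by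
      refine sep_cl ?_
      rintro z (hz | hz)
      · exact Or.inl (hM' hz)
      · refine Or.inr (sep_up ?_ (h.sep z hz))
        rw [Subfield.closure_le]; exact Set.union_subset hM' hE'
    refine gal_tr 𝓕 N (fun z => ?_) (fun z hz => hs z ?_) fun σ hσ z hz => ?_
    · refine alg_trans (N := (algebraMap F Q).fieldRange) (fun y hy => (hs y (hF hy)).isIntegral.isAlgebraic) ?_
      obtain ⟨f, f0, f1⟩ := Algebra.IsAlgebraic.isAlgebraic (R := F) z
      refine root_alg (G := f.map (algebraMap F Q)) (fun i => ?_) ?_ ?_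
      · rw [coeff_map]; exact ⟨_, rfl⟩
      · exact (Polynomial.map_ne_zero_iff (algebraMap F Q).injective).2 f0
      · rw [eval_map]; exact f1
    · rw [← h1]; exact hz
    · have h2 : Subfield.closure (M ∪ W) ≤ (Subfield.closure (M ∪ W)).comap (σ : Q →+* Q) := by
        rw [Subfield.closure_le]
        refine Set.union_subset (fun z hz => ?_) fun z hz => h.stab σ (fun y hy => hσ y (hE' hy)) z hz
        change σ z ∈ Subfield.closure (M ∪ W)
        rw [hσ z (hM' hz)]
        exact Subfield.subset_closure (Or.inl hz)
      have h3 : z ∈ 𝓕.toSubfield := hz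
      rw [h1] at h3
      have h4 : σ z ∈ Subfield.closure (M ∪ W) := h2 h3
      rw [← h1] at h4
      exact h4
  obtain ⟨a', rfl⟩ : ∃ a', a = φ ∘ a' := by
    choose a' ha' using fun i => hφr _ (h.aF i)
    exact ⟨a', funext fun i => (ha' i).symm⟩
  obtain ⟨c', rfl⟩ : ∃ c', c = φ ∘ c' := by
    choose a' ha' using fun i => hφr _ (h.cF i)
    exact ⟨a', funext fun i => (ha' i).symm⟩
  refine ⟨𝓕, A.comap φ, M.comap φ, hfd, ?_, ⟨hle, ?_, hpw⟩, ?_, ?_, ?_⟩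
  · rw [← hA, ValuationSubring.comap_comap]
    congr 1
    exact RingHom.ext hφF
  · refine fin_dim hle (C := φ ⁻¹' C) (hC.preimage hφi.injOn) (fun z hz => ?_) ?_
    · obtain ⟨nn, h⟩ := hpw z (hCM hz)
      exact (isAlg_mem h).of_pow (pow_pos hq _)
    · apply le_antisymm
      · intro z hz
        have : M ≤ (Subfield.closure (K.map (algebraMap F 𝓕) ∪ φ ⁻¹' C)).map φ := by
          rw [hM, Subfield.closure_le]
          refine Set.union_subset ?_ fun z hz => ?_
          · rintro _ ⟨y, hy, rfl⟩
            exact ⟨_, Subfield.subset_closure (Or.inl ⟨y, hy, rfl⟩), hφF y⟩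
          · obtain ⟨y, rfl⟩ := hMr z (hCM hz)
            exact ⟨y, Subfield.subset_closure (Or.inr hz), rfl⟩
        obtain ⟨y, hy, e⟩ := this hz
        rw [← hφi e]; exact hy
      · rw [Subfield.closure_le]
        exact Set.union_subset hle fun z hz => hCM hz
  · exact hgal _ le_sup_left le_sup_right
  · refine hgal _ (le_trans ?_ le_sup_left) le_sup_right
    rintro _ ⟨y, _, rfl⟩
    exact ⟨y, rfl⟩
  · refine UNI (v := A.valuation.comap φ) (W := φ ⁻¹' W) (a := a') (c := c') (fun z => ?_) (fun z hz => hMv _ hz)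
      (hW.preimage hφi.injOn) ?_ (Par.tr φ ha) hc (fun w hw => ?_) ?_ fun j => ⟨?_, ?_⟩
    · rw [ValuationSubring.mem_comap, Valuation.comap_apply, ValuationSubring.valuation_le_one_iff]
    · rw [eq_top_iff]
      intro z _
      have : Subfield.closure (M ∪ W) ≤ (Subfield.closure (M.comap φ ∪ φ ⁻¹' W)).map φ := by
        rw [Subfield.closure_le]
        intro z hz
        obtain ⟨y, rfl⟩ := hφr z (Subfield.subset_closure hz)
        exact ⟨y, Subfield.subset_closure hz, rfl⟩
      obtain ⟨y, hy, e⟩ := this (hφm z)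
      rw [← hφi e]; exact hy
    · exact DD.tr φ (fun z hz => hφr z hz) (h.dec _ hw)
    · have e : Fin.append (φ ∘ a') (φ ∘ c') = φ ∘ Fin.append a' c' := by
        ext i
        refine Fin.addCases (fun i => ?_) (fun i => ?_) i <;> simp
      rw [e] at hi
      have hM2 : ∀ y : M.comap φ, φ y ∈ M := fun y => y.2
      refine AlgebraicIndependent.of_ringHom_of_comp_eq (f := (φ.comp (M.comap φ).subtype).codRestrict M hM2)
        (g := φ) hi (fun x y hxy => ?_) rfl
      exact Subtype.ext (hφi (congrArg Subtype.val hxy))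
    · rw [Valuation.comap_apply, hφF, ValuationSubring.valuation_le_one_iff]
      have := hζ j
      rw [← hA] at this
      exact this
    · rcases hζW j with h | h
      · left
        refine hφi ?_
        rw [hφF, h, map_zero]
      · right
        change φ _ ∈ W
        rw [hφF]; exact h
end

section
lemma inMax_iff {F Q : Type*} [Field F] [Field Q] {ι : F →+* Q} {O : ValuationSubring F} {A : ValuationSubring Q}
    (hA : A.comap ι = O) (x : F) : LocalUnif.InMax O x ↔ A.valuation (ι x) < 1 := by
  by_cases h0 : x = 0
  · simp [LocalUnif.InMax, h0]
  have h1 : A.valuation (ι x) ≠ 0 := (A.valuation.ne_zero_iff).2 (by simpa using h0)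
  have h2 : x⁻¹ ∈ O ↔ A.valuation (ι x⁻¹) ≤ 1 := by
    rw [← hA, ValuationSubring.mem_comap, ValuationSubring.valuation_le_one_iff]
  rw [LocalUnif.InMax, h2, map_inv₀, map_inv₀, inv_le_one₀ (zero_lt_iff.2 h1), not_le]
  simp [h0]

lemma main {F : Type*} (Q : Type*) [Field F] [Field Q] [Algebra F Q] [IsAlgClosed Q] [Algebra.IsAlgebraic F Q] {K E : Subfield F}
    {O : ValuationSubring F} {A : ValuationSubring Q} {Sg : Finset F} (hSg : IntermediateField.adjoin ↥K (Sg : Set F) = ⊤)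
    (htriv : LocalUnif.TrivialOn O K) (hrk1 : LocalUnif.RankOne O) (hzd : LocalUnif.ResidueAlgebraic O K)
    (hKE : K ≤ E) (hFEsep : Algebra.IsSeparable ↥E F) {m : ℕ} {ζ : Fin m → F} (hζ : ∀ k, ζ k ∈ O)
    (hA : A.comap (algebraMap F Q) = O) :
    ∃ (𝓕 : IntermediateField F Q) (Q : ValuationSubring ↥𝓕)
      (𝓚 : Subfield ↥𝓕),
      FiniteDimensional F ↥𝓕 ∧
      Q.comap (algebraMap F ↥𝓕) = O ∧
      (∃ hle : K.map (algebraMap F ↥𝓕) ≤ 𝓚,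
        (letI : Algebra ↥(K.map (algebraMap F ↥𝓕)) ↥𝓚 := (Subfield.inclusion hle).toAlgebra
         FiniteDimensional ↥(K.map (algebraMap F ↥𝓕)) ↥𝓚) ∧
        ∀ x ∈ 𝓚, ∃ nn : ℕ, x ^ ringExpChar F ^ nn ∈ K.map (algebraMap F ↥𝓕)) ∧
      IsGalois ↥(E.map (algebraMap F ↥𝓕) ⊔ 𝓚) ↥𝓕 ∧
      IsGalois ↥((algebraMap F ↥𝓕).fieldRange ⊔ 𝓚) ↥𝓕 ∧
      LocalUnif.UnifWrt (F := ↥𝓕) ⊤ 𝓚 Q (fun k => algebraMap F ↥𝓕 (ζ k)) := by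
  have hin := inMax_iff hA
  have hO : ∀ x, x ∈ O ↔ A.valuation (algebraMap F Q x) ≤ 1 := fun x => by
    rw [← hA, ValuationSubring.mem_comap, ValuationSubring.valuation_le_one_iff]
  have hιi := (algebraMap F Q).injective
  obtain ⟨q, hq⟩ : ∃ q, q = ringExpChar F := ⟨_, rfl⟩
  haveI hqF : ExpChar F q := by rw [hq]; infer_instance
  haveI hqQ : ExpChar Q q := expChar_of_injective_ringHom hιi q
  haveI hqK : ExpChar (K.map (algebraMap F Q)) q :=
    (RingHom.expChar_iff (K.map (algebraMap F Q)).subtype (RingHom.injective _) q).2 hqQ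
  have hq0 : 0 < q := expChar_pos F q
  obtain ⟨K₀, hK₀⟩ : ∃ K₀, K₀ = K.map (algebraMap F Q) := ⟨_, rfl⟩
  rw [← hK₀] at hqK
  obtain ⟨k, hk⟩ : ∃ k, k = (perfectClosure K₀ Q).toSubfield := ⟨_, rfl⟩
  have hkm : ∀ z, z ∈ k ↔ ∃ n : ℕ, z ^ q ^ n ∈ K₀ := fun z => by
    rw [hk]
    refine (mem_perfectClosure_iff_pow_mem (F := K₀) (E := Q) q).trans (exists_congr fun n => ?_)
    exact ⟨fun ⟨y, hy⟩ => hy ▸ y.2, fun h => ⟨⟨_, h⟩, rfl⟩⟩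
  haveI : PerfectField Q := inferInstance
  haveI hpf : PerfectField k := by rw [hk]; exact perfectClosure.perfectField K₀ Q
  have hKk : K₀ ≤ k := fun z hz => (hkm z).2 ⟨0, by simpa using hz⟩
  have hF : ∀ z : Q, IsAlgebraic (algebraMap F Q).fieldRange z := fun z => by
    obtain ⟨f, f0, f1⟩ := Algebra.IsAlgebraic.isAlgebraic (R := F) z
    refine root_alg (G := f.map (algebraMap F Q)) (fun i => ?_) ?_ ?_
    · rw [coeff_map]; exact ⟨_, rfl⟩
    · exact (Polynomial.map_ne_zero_iff hιi).2 f0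
    · rw [eval_map]; exact f1
  have hG : Glob A.valuation k := by
    refine glob (M := (algebraMap F Q).fieldRange) hKk (fun z hz => ?_) hF ?_ ?_ ?_
    · obtain ⟨n, h⟩ := (hkm z).1 hz
      exact ⟨q ^ n, pow_pos hq0 _, h⟩
    · rw [hK₀]
      rintro _ ⟨y, hy, rfl⟩ h0
      obtain ⟨h1, h2⟩ := htriv y hy
      rw [hO] at h1 h2
      refine le_antisymm h1 ?_
      rw [map_inv₀, map_inv₀] at h2
      exact (inv_le_one₀ (zero_lt_iff.2 ((A.valuation.ne_zero_iff).2 h0))).1 h2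
    · rintro _ ⟨a, rfl⟩ _ ⟨b, rfl⟩ ha hb h1 h2
      obtain ⟨n, hn⟩ := hrk1 a b (by rintro rfl; simp at ha) ((hin a).2 h1) (by rintro rfl; simp at hb) ((hin b).2 h2)
      refine ⟨n, ?_⟩
      rw [hO, map_div₀, map_div₀, map_pow, map_pow] at hn
      exact (div_le_one₀ (zero_lt_iff.2 ((A.valuation.ne_zero_iff).2 hb))).1 hn
    · rintro _ ⟨y, rfl⟩ hy
      obtain ⟨g, g0, g1, g2⟩ := hzd y ((hO y).2 hy)
      refine ⟨g.map (algebraMap F Q), (Polynomial.map_ne_zero_iff hιi).2 g0, fun i => ?_, ?_⟩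
      · rw [coeff_map, hK₀]; exact ⟨_, g1 i, rfl⟩
      · rw [eval_map, eval₂_at_apply]
        exact (hin _).1 g2
  have hF₀ : (algebraMap F Q).fieldRange = Subfield.closure (K₀ ∪ algebraMap F Q '' Sg) := by
    have h1 : Subfield.closure ((K : Set F) ∪ Sg) = ⊤ := by
      rw [← adjoin_eq, hSg]; rfl
    rw [RingHom.fieldRange_eq_map, ← h1, RingHom.map_field_closure, Set.image_union, hK₀]
    rfl
  obtain ⟨C, W, m', n, a, c, hC, hCk, hW, hFW, hZ, ha, hc, hFD, hi⟩ := core hG (E₀ := E.map (algebraMap F Q)) hKk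
    (by rw [hK₀]; rintro _ ⟨y, hy, rfl⟩; exact ⟨y, hKE hy, rfl⟩) (Sg := algebraMap F Q '' Sg)
    (Z := Set.range fun j => algebraMap F Q (ζ j)) (Sg.finite_toSet.image _) hF₀ (by
      rintro _ ⟨g, _, rfl⟩
      refine sep_lift (f := (minpoly E g).map ((algebraMap F Q).comp (algebraMap E F)))
        (Separable.map (hFEsep.isSeparable' g)) ?_ fun i => ?_
      · rw [eval_map, ← hom_eval₂, ← aeval_def, minpoly.aeval, map_zero]
      · rw [coeff_map]
        exact ⟨_, ((minpoly E g).coeff i).2, rfl⟩) hF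
    (fun z hz => by
      obtain ⟨n, h⟩ := (hkm z).1 hz
      exact (isAlg_mem h).of_pow (pow_pos hq0 _))
    (fun z hz σ hσ => by
      obtain ⟨n, h⟩ := (hkm z).1 hz
      refine iterateFrobenius_inj Q q n ?_
      rw [iterateFrobenius_def, iterateFrobenius_def, ← map_pow]
      rw [hK₀] at h
      obtain ⟨y, hy, e⟩ := h
      exact hσ _ ⟨y, hKE hy, e⟩)
    (Set.finite_range _) (by rintro _ ⟨j, rfl⟩; exact ⟨_, rfl⟩)
  have hMk : Subfield.closure ((K₀ : Set Q) ∪ C) ≤ k := by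
    rw [Subfield.closure_le]; exact Set.union_subset hKk hCk
  rw [← hq]
  refine final hA hq0 hKE hC hW (M := Subfield.closure ((K₀ : Set Q) ∪ C)) (by rw [hK₀]) (fun z hz => ?_) (fun z hz => ?_)
    hFW ha hc hFD hi hζ fun j => hZ _ ⟨j, rfl⟩
  · rw [← hK₀]; exact (hkm z).1 (hMk hz)
  · by_cases h0 : z = 0
    · rw [h0, map_zero]; exact zero_le
    · exact (hG.triv z (hMk hz) h0).le
end

end LU

set_option synthInstance.maxHeartbeats 400000 in
set_option maxHeartbeats 1000000 in
open LocalUnif in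

theorem statement_3
    (F : Type*) [Field F] (K : Subfield F) (O : ValuationSubring F)
    (hff : IsFunctionField K) (htriv : TrivialOn O K)
    (hrk1 : RankOne O) (hzd : ResidueAlgebraic O K)
    (E : Subfield F) (hKE : K ≤ E) (hFEsep : Algebra.IsSeparable ↥E F)
    (m : ℕ) (ζ : Fin m → F) (hζ : ∀ k, ζ k ∈ O) :
    ∃ (𝓕 : IntermediateField F (AlgebraicClosure F)) (Q : ValuationSubring ↥𝓕)
      (𝓚 : Subfield ↥𝓕),
      FiniteDimensional F ↥𝓕 ∧
      Q.comap (algebraMap F ↥𝓕) = O ∧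
      (∃ hle : K.map (algebraMap F ↥𝓕) ≤ 𝓚,
        (letI : Algebra ↥(K.map (algebraMap F ↥𝓕)) ↥𝓚 := (Subfield.inclusion hle).toAlgebra
         FiniteDimensional ↥(K.map (algebraMap F ↥𝓕)) ↥𝓚) ∧
        ∀ x ∈ 𝓚, ∃ nn : ℕ, x ^ ringExpChar F ^ nn ∈ K.map (algebraMap F ↥𝓕)) ∧
      IsGalois ↥(E.map (algebraMap F ↥𝓕) ⊔ 𝓚) ↥𝓕 ∧
      IsGalois ↥((algebraMap F ↥𝓕).fieldRange ⊔ 𝓚) ↥𝓕 ∧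
      UnifWrt (F := ↥𝓕) ⊤ 𝓚 Q (fun k => algebraMap F ↥𝓕 (ζ k)) := by
  obtain ⟨⟨Sg, hSg⟩, -⟩ := hff
  obtain ⟨A, hA⟩ := LU.exists_ext (algebraMap F (AlgebraicClosure F)) O
  exact LU.main (AlgebraicClosure F) hSg htriv hrk1 hzd hKE hFEsep hζ hA
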